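/- Suppose the set of all primes is partitioned into k color classes. Then there exist three pairwise distinct primes p_1, p_2, p_3 in the same color class with p_1 + p_2 = p_3 + 1. -/

import Mathlib

namespace SchurPrimes

open Finset

/-- The additive character `x ↦ exp (2πix)` of the reals. -/
noncomputable def e (x : ℝ) : ℂ := Complex.exp (Complex.I * ((2 * Real.pi * x : ℝ) : ℂ))

lemma e_zero : e 0 = 1 := by simp [e]

lemma e_add (x y : ℝ) : e (x + y) = e x * e y := by
  rw [e, e, e, ← Complex.exp_add]; congr 1; push_cast; ring

@[simp] lemma norm_e (x : ℝ) : ‖e x‖ = 1 := by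
  rw [e, mul_comm]; exact Complex.norm_exp_ofReal_mul_I _

lemma e_int (n : ℤ) : e n = 1 := by
  rw [e, Complex.exp_eq_one_iff]
  exact ⟨n, by push_cast; ring⟩

lemma e_nat (n : ℕ) : e n = 1 := by exact_mod_cast e_int n

lemma e_add_int (x : ℝ) (n : ℤ) : e (x + n) = e x := by rw [e_add, e_int, mul_one]

lemma e_neg (x : ℝ) : e (-x) = starRingEnd ℂ (e x) := by
  rw [e, e, ← Complex.exp_conj]; congr 1
  rw [map_mul, Complex.conj_I, Complex.conj_ofReal]; push_cast; ring

lemma e_sub (x y : ℝ) : e (x - y) = e x * starRingEnd ℂ (e y) := by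
  rw [sub_eq_add_neg, e_add, e_neg]

lemma e_nat_mul (n : ℕ) (x : ℝ) : e (n * x) = e x ^ n := by
  rw [e, e, ← Complex.exp_nat_mul]; congr 1; push_cast; ring

lemma e_sum {ι : Type*} (s : Finset ι) (f : ι → ℝ) : e (∑ i ∈ s, f i) = ∏ i ∈ s, e (f i) := by
  classical
  induction s using Finset.induction_on with
  | empty => simp [e_zero]
  | insert a s ha ih => rw [sum_insert ha, prod_insert ha, e_add, ih]

lemma norm_e_sub_one (x : ℝ) : ‖e x - 1‖ = 2 * |Real.sin (Real.pi * x)| := by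
  rw [e, Complex.norm_exp_I_mul_ofReal_sub_one, norm_mul, Real.norm_eq_abs, Real.norm_eq_abs,
    abs_of_pos (by norm_num : (0:ℝ) < 2)]
  congr 3; ring

lemma norm_e_sub_one_le (x : ℝ) : ‖e x - 1‖ ≤ 2 * Real.pi * |x| := by
  rw [e]
  refine (Real.norm_exp_I_mul_ofReal_sub_one_le).trans ?_
  rw [Real.norm_eq_abs, abs_mul, abs_of_pos Real.two_pi_pos]

lemma norm_e_sub_le (x y : ℝ) : ‖e x - e y‖ ≤ 2 * Real.pi * |x - y| := by
  have h : e x - e y = e y * (e (x - y) - 1) := by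
    rw [mul_sub, ← e_add]; simp
  rw [h, norm_mul, norm_e, one_mul]
  exact norm_e_sub_one_le _

lemma le_norm_e_sub_one {x δ : ℝ} (h : ∀ a : ℤ, δ ≤ |x - a|) : 4 * δ ≤ ‖e x - 1‖ := by
  have h1 : e x = e (x - round x) := by
    have := e_add_int (x - round x) (round x)
    rwa [sub_add_cancel] at this
  rw [h1, norm_e_sub_one]
  set y := x - round x with hy
  have hy2 : |y| ≤ 1 / 2 := abs_sub_round x
  have hd : δ ≤ |y| := h _
  have h2 : |Real.sin (Real.pi * y)| = |Real.sin (Real.pi * |y|)| := by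
    rcases abs_choice y with h | h <;> rw [h]
    rw [mul_neg, Real.sin_neg, abs_neg]
  have h3 := Real.mul_le_sin (x := Real.pi * |y|) (by positivity)
    (by nlinarith [Real.pi_pos])
  have h4 : 2 / Real.pi * (Real.pi * |y|) = 2 * |y| := by
    field_simp
  rw [h2]
  nlinarith [le_abs_self (Real.sin (Real.pi * |y|))]

lemma norm_geom_sum_le {θ δ : ℝ} (hδ : 0 < δ) (h : ∀ a : ℤ, δ ≤ |θ - a|) (y z : ℕ) :
    ‖∑ n ∈ Ioc y z, e (θ * n)‖ ≤ 1 / δ := by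
  have h1 := le_norm_e_sub_one h
  have hpos : 0 < ‖e θ - 1‖ := by linarith
  rcases le_total z y with hzy | hyz
  · rw [Ioc_eq_empty (by omega)]; simp; positivity
  have key : (∑ n ∈ Ioc y z, e (θ * n)) * (e θ - 1) = e (θ * (z + 1)) - e (θ * (y + 1)) := by
    induction z, hyz using Nat.le_induction with
    | base => simp
    | succ z hz ih =>
      rw [← Finset.sum_Ioc_consecutive _ hz (Nat.le_succ z), add_mul, ih]
      rw [Nat.Ioc_succ_singleton, sum_singleton]
      have : e (θ * ((z + 1 : ℕ) + 1)) = e (θ * (z + 1)) * e θ := by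
        rw [← e_add]; congr 1; push_cast; ring
      rw [this]; push_cast; ring
  have h2 : ‖∑ n ∈ Ioc y z, e (θ * n)‖ * ‖e θ - 1‖ ≤ 2 := by
    rw [← norm_mul, key]
    refine (norm_sub_le _ _).trans ?_
    simp; norm_num
  rw [le_div_iff₀ hδ]
  nlinarith [norm_nonneg (∑ n ∈ Ioc y z, e (θ * n))]

lemma abel_identity (g : ℕ → ℂ) (β : ℝ) (N : ℕ) :
    ∑ m ∈ Ioc 0 N, g m * e (β * m) = (∑ m ∈ Ioc 0 N, g m) * e (β * N)
      - ∑ m ∈ range N, (∑ i ∈ Ioc 0 m, g i) * (e (β * (m + 1)) - e (β * m)) := by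
  induction N with
  | zero => simp
  | succ N ih =>
    rw [Finset.sum_Ioc_succ_top (Nat.zero_le N), ih, Finset.sum_Ioc_succ_top (Nat.zero_le N),
      sum_range_succ]
    push_cast; ring

lemma norm_abel_le {g : ℕ → ℂ} {β B : ℝ} {N : ℕ}
    (h : ∀ m ≤ N, ‖∑ i ∈ Ioc 0 m, g i‖ ≤ B) :
    ‖∑ m ∈ Ioc 0 N, g m * e (β * m)‖ ≤ B * (1 + 2 * Real.pi * |β| * N) := by
  rw [abel_identity]
  refine (norm_sub_le _ _).trans ?_
  have hB : 0 ≤ B := (norm_nonneg _).trans (h N le_rfl)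
  have h1 : ‖(∑ m ∈ Ioc 0 N, g m) * e (β * N)‖ ≤ B := by
    rw [norm_mul, norm_e, mul_one]; exact h N le_rfl
  have h2 : ‖∑ m ∈ range N, (∑ i ∈ Ioc 0 m, g i) * (e (β * (m + 1)) - e (β * m))‖
      ≤ ∑ m ∈ range N, B * (2 * Real.pi * |β|) := by
    refine (norm_sum_le _ _).trans (sum_le_sum fun m hm => ?_)
    rw [norm_mul]
    refine mul_le_mul (h m (mem_range.1 hm).le) ?_ (norm_nonneg _) hB
    refine (norm_e_sub_le _ _).trans_eq ?_
    congr 2; ring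
  rw [sum_const, card_range, nsmul_eq_mul] at h2
  nlinarith

/-- If the frequencies `φ i` are separated modulo one, then an exponential sum with these
frequencies is dominated by a single one of them. -/
lemma separated_frequencies {ι : Type*} [DecidableEq ι] (s : Finset ι) (φ : ι → ℝ) (v : ι → ℂ)
    {B δ : ℝ} (hδ : 0 < δ) (hv : ∀ i ∈ s, ‖v i‖ ≤ B) (hB : 0 ≤ B)
    (hsep : ∀ i ∈ s, ∀ j ∈ s, i ≠ j → ∀ a : ℤ, 2 * δ ≤ |φ i - φ j - a|) (θ : ℝ) (y z : ℕ) :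
    ‖∑ i ∈ s, v i * ∑ n ∈ Ioc y z, e ((θ + φ i) * n)‖ ≤ s.card * (B / δ) ∨
    ∃ i ∈ s, ‖∑ i ∈ s, v i * ∑ n ∈ Ioc y z, e ((θ + φ i) * n)‖ ≤
      s.card * (B / δ) + ‖v i‖ * ‖∑ n ∈ Ioc y z, e ((θ + φ i) * n)‖ := by
  have hgood : ∀ i ∈ s, (∀ a : ℤ, δ ≤ |θ + φ i - a|) →
      ‖v i * ∑ n ∈ Ioc y z, e ((θ + φ i) * n)‖ ≤ B / δ := by
    intro i hi h
    rw [norm_mul, div_eq_mul_one_div]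
    exact mul_le_mul (hv i hi) (norm_geom_sum_le hδ h y z) (norm_nonneg _) hB
  by_cases hall : ∀ i ∈ s, ∀ a : ℤ, δ ≤ |θ + φ i - a|
  · left
    refine (norm_sum_le _ _).trans ?_
    rw [← nsmul_eq_mul]
    exact sum_le_card_nsmul _ _ _ fun i hi => hgood i hi (hall i hi)
  · right
    push Not at hall
    obtain ⟨i, hi, a, ha⟩ := hall
    refine ⟨i, hi, ?_⟩
    rw [← add_sum_erase _ _ hi, add_comm, ← norm_mul]
    refine (norm_add_le _ _).trans (add_le_add ?_ le_rfl)
    refine (norm_sum_le _ _).trans ?_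
    have h1 : ∑ j ∈ s.erase i, ‖v j * ∑ n ∈ Ioc y z, e ((θ + φ j) * n)‖
        ≤ (s.erase i).card • (B / δ) := by
      refine sum_le_card_nsmul _ _ _ fun j hj => hgood j (mem_of_mem_erase hj) fun b => ?_
      have h2 := hsep j (mem_of_mem_erase hj) i hi (ne_of_mem_erase hj) (b - a)
      have h3 : φ j - φ i - ((b - a : ℤ) : ℝ) = (θ + φ j - b) - (θ + φ i - a) := by
        push_cast; ring
      rw [h3] at h2
      have h4 := abs_sub (θ + φ j - b) (θ + φ i - a)
      linarith
    refine h1.trans ?_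
    rw [nsmul_eq_mul]
    refine mul_le_mul_of_nonneg_right ?_ (by positivity)
    exact_mod_cast card_le_card (erase_subset _ _)

/-- The product of the elements of `S`. -/
def nn (S : Finset ℕ) : ℕ := ∏ p ∈ S, p

/-- The product of `p - 1` over the elements `p` of `S`. -/
noncomputable def ph (S : Finset ℕ) : ℝ := ∏ p ∈ S, ((p : ℝ) - 1)

/-- The Ramanujan sum attached to a set of primes. -/
noncomputable def cc (S : Finset ℕ) (m : ℕ) : ℝ :=
  ∏ p ∈ S, if p ∣ m then (p : ℝ) - 1 else -1

lemma nn_pos {S : Finset ℕ} (hS : ∀ p ∈ S, p.Prime) : 0 < nn S :=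
  prod_pos fun p hp => (hS p hp).pos

lemma ph_pos {S : Finset ℕ} (hS : ∀ p ∈ S, p.Prime) : 0 < ph S :=
  prod_pos fun p hp => by
    have : (1 : ℝ) < p := by exact_mod_cast (hS p hp).one_lt
    linarith

lemma nn_le_two_pow_mul_ph {S : Finset ℕ} (hS : ∀ p ∈ S, p.Prime) :
    (nn S : ℝ) ≤ 2 ^ S.card * ph S := by
  rw [ph, nn, ← prod_const, ← prod_mul_distrib]; push_cast
  refine prod_le_prod (fun p hp => by positivity) (fun p hp => ?_)
  have : (2 : ℝ) ≤ p := by exact_mod_cast (hS p hp).two_le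
  linarith

lemma nn_mono {S T : Finset ℕ} (hT : ∀ p ∈ T, p.Prime) (h : S ⊆ T) : nn S ≤ nn T :=
  Nat.le_of_dvd (nn_pos hT) (prod_dvd_prod_of_subset _ _ _ h)

lemma nn_union_le {S T : Finset ℕ} (hS : ∀ p ∈ S, p.Prime) :
    nn (S ∪ T) ≤ nn S * nn T := by
  rw [nn, nn, nn, ← prod_union_inter]
  refine Nat.le_mul_of_pos_right _ (prod_pos fun p hp => ?_)
  exact (hS p (mem_inter.1 hp).1).pos

lemma nn_primeFactors {S : Finset ℕ} (hS : ∀ p ∈ S, p.Prime) : (nn S).primeFactors = S :=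
  Nat.primeFactors_prod hS

lemma nn_injOn : Set.InjOn nn {S : Finset ℕ | ∀ p ∈ S, p.Prime} := by
  intro S hS T hT h
  rw [← nn_primeFactors hS, ← nn_primeFactors hT, h]

lemma sum_e_prime {p : ℕ} (hp : p.Prime) (m : ℕ) :
    ∑ a ∈ Ico 1 p, e (m * ((a : ℝ) / p)) = ((if p ∣ m then (p : ℝ) - 1 else -1 : ℝ) : ℂ) := by
  have hp0 : (p : ℝ) ≠ 0 := by exact_mod_cast hp.ne_zero
  have h0 : ∑ a ∈ range p, e (m * ((a : ℝ) / p)) = if p ∣ m then (p : ℂ) else 0 := by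
    have h1 : ∀ a ∈ range p, e (m * ((a : ℝ) / p)) = e (m / p) ^ a := fun a _ => by
      rw [← e_nat_mul]; congr 1; ring
    rw [sum_congr rfl h1]
    split_ifs with hd
    · obtain ⟨c, rfl⟩ := hd
      have : e (((p * c : ℕ) : ℝ) / p) = 1 := by
        rw [← e_nat c]; congr 1; push_cast; field_simp
      rw [this]; simp
    · have hne : e ((m : ℝ) / p) ≠ 1 := by
        intro h
        rw [e, Complex.exp_eq_one_iff] at h
        obtain ⟨n, hn⟩ := h
        have h2 : ((2 * Real.pi * ((m : ℝ) / p) : ℝ) : ℂ) = ((n * (2 * Real.pi) : ℝ) : ℂ) := by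
          have : Complex.I * ((2 * Real.pi * ((m : ℝ) / p) : ℝ) : ℂ)
              = Complex.I * ((n * (2 * Real.pi) : ℝ) : ℂ) := by
            rw [hn]; push_cast; ring
          exact mul_left_cancel₀ Complex.I_ne_zero this
        have h3 : 2 * Real.pi * ((m : ℝ) / p) = n * (2 * Real.pi) := by exact_mod_cast h2
        have h4 : (m : ℝ) = n * p := by
          have := Real.pi_ne_zero
          field_simp at h3
          linarith
        have h5 : (m : ℤ) = n * p := by exact_mod_cast h4
        exact hd (by
          have : (p : ℤ) ∣ m := ⟨n, by rw [h5]; ring⟩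
          exact_mod_cast this)
      rw [geom_sum_eq hne, ← e_nat_mul]
      have : (p : ℝ) * (m / p) = m := by field_simp
      rw [this, e_nat]; simp
  rw [range_eq_Ico, sum_eq_sum_Ico_succ_bot hp.pos] at h0
  simp only [Nat.cast_zero, zero_div, mul_zero, e_zero, zero_add] at h0
  rw [eq_sub_of_add_eq' h0]
  split_ifs <;> push_cast <;> ring

/-- Extension by zero of a dependent function on `T`. -/
def ext (T : Finset ℕ) (f : (p : ℕ) → p ∈ T → ℕ) (p : ℕ) : ℕ := if h : p ∈ T then f p h else 0

/-- The frequency attached to a set of primes and a numerator for each of them. -/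
noncomputable def freq (T : Finset ℕ) (f : (p : ℕ) → p ∈ T → ℕ) : ℝ :=
  ∑ p ∈ T, (ext T f p : ℝ) / p

lemma cc_eq_sum {T : Finset ℕ} (hT : ∀ p ∈ T, p.Prime) (m : ℕ) :
    (cc T m : ℂ) = ∑ f ∈ T.pi (fun p => Ico 1 p), e (m * freq T f) := by
  rw [cc]; push_cast
  have h1 : ∀ p ∈ T, (if p ∣ m then (p : ℂ) - 1 else -1)
      = ∑ a ∈ Ico 1 p, e (m * ((a : ℝ) / p)) := fun p hp => by
    rw [sum_e_prime (hT p hp)]; split_ifs <;> simp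
  have h2 : ∏ p ∈ T, ((if p ∣ m then (p : ℝ) - 1 else -1 : ℝ) : ℂ)
      = ∏ p ∈ T, ∑ a ∈ Ico 1 p, e (m * ((a : ℝ) / p)) :=
    prod_congr rfl fun p hp => by rw [← h1 p hp]; split_ifs <;> simp
  rw [h2, prod_sum]
  refine sum_congr rfl fun f _ => ?_
  rw [freq, mul_sum, e_sum, ← prod_attach T]
  refine prod_congr rfl fun x _ => ?_
  rw [ext, dif_pos x.2]

lemma freq_spacing {V : Finset ℕ} {W : ℕ} (hV : ∀ p ∈ V, p.Prime ∧ p.Coprime W) (d : ℕ → ℤ)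
    {q : ℕ} (hq : q ∈ V) (hd : ¬ (q : ℤ) ∣ d q) (k : ℤ) :
    1 / (nn V : ℝ) ≤ |W * ∑ p ∈ V, (d p : ℝ) / p - k| := by
  have hpr : ∀ p ∈ V, p.Prime := fun p hp => (hV p hp).1
  have hpos : (0 : ℝ) < nn V := by exact_mod_cast nn_pos hpr
  set D : ℤ := ∑ p ∈ V, d p * ((∏ x ∈ V.erase p, x : ℕ) : ℤ) with hD
  have h1 : (nn V : ℝ) * ∑ p ∈ V, (d p : ℝ) / p = D := by
    rw [hD, mul_sum]; push_cast
    refine sum_congr rfl fun p hp => ?_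
    have hp0 : (p : ℝ) ≠ 0 := by exact_mod_cast (hpr p hp).ne_zero
    rw [nn, ← mul_prod_erase V _ hp]; push_cast; field_simp
  have h2 : ¬ (q : ℤ) ∣ W * D - k * nn V := by
    intro h
    have hqp : Prime (q : ℤ) := Nat.prime_iff_prime_int.1 (hpr q hq)
    have h3 : (q : ℤ) ∣ (nn V : ℤ) := by exact_mod_cast dvd_prod_of_mem (fun p => p) hq
    have h4 : (q : ℤ) ∣ W * D := by
      have := dvd_add h (dvd_mul_of_dvd_right h3 k)
      simpa using this
    have hcW : ¬ (q : ℤ) ∣ W := by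
      intro h
      have h' : q ∣ W := by exact_mod_cast h
      have := Nat.Coprime.eq_one_of_dvd (hV q hq).2 h'
      exact (hpr q hq).one_lt.ne' this
    have h5 : (q : ℤ) ∣ D := (hqp.dvd_or_dvd h4).resolve_left hcW
    rw [hD, ← add_sum_erase _ _ hq] at h5
    have h6 : (q : ℤ) ∣ ∑ p ∈ V.erase q, d p * ((∏ x ∈ V.erase p, x : ℕ) : ℤ) := by
      refine dvd_sum fun p hp => dvd_mul_of_dvd_right ?_ _
      have : q ∈ V.erase p := mem_erase.2 ⟨(ne_of_mem_erase hp).symm, hq⟩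
      exact_mod_cast dvd_prod_of_mem (fun p => p) this
    have h7 := (dvd_add_left h6).1 h5
    rcases hqp.dvd_or_dvd h7 with h8 | h8
    · exact hd h8
    · have h9 : q ∣ ∏ x ∈ V.erase q, x := by exact_mod_cast h8
      rw [Prime.dvd_finsetProd_iff (hpr q hq).prime] at h9
      obtain ⟨x, hx, hqx⟩ := h9
      have := (Nat.prime_dvd_prime_iff_eq (hpr q hq) (hpr x (mem_of_mem_erase hx))).1 hqx
      exact ne_of_mem_erase hx this.symm
  have h3 : (W * D - k * nn V : ℤ) ≠ 0 := fun h => h2 (by rw [h]; exact dvd_zero _)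
  have h4 : (1 : ℝ) ≤ |((W * D - k * nn V : ℤ) : ℝ)| := by
    rw [← Int.cast_abs]; exact_mod_cast Int.one_le_abs h3
  have h5 : ((W * D - k * nn V : ℤ) : ℝ) = nn V * (W * ∑ p ∈ V, (d p : ℝ) / p - k) := by
    push_cast; rw [← h1]; ring
  rw [h5, abs_mul, abs_of_pos hpos] at h4
  rw [div_le_iff₀ hpos]; linarith

lemma nn_mul_freq {T : Finset ℕ} (hT : ∀ p ∈ T, p.Prime) (f : (p : ℕ) → p ∈ T → ℕ) :
    ∃ k : ℤ, (nn T : ℝ) * freq T f = k := by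
  refine ⟨∑ p ∈ T, (ext T f p : ℤ) * ((∏ x ∈ T.erase p, x : ℕ) : ℤ), ?_⟩
  rw [freq, mul_sum]; push_cast
  refine sum_congr rfl fun p hp => ?_
  have hp0 : (p : ℝ) ≠ 0 := by exact_mod_cast (hT p hp).ne_zero
  rw [nn, ← mul_prod_erase T _ hp]; push_cast; field_simp

lemma freq_sub_spacing {T T' : Finset ℕ} {W R : ℕ} (hT : ∀ p ∈ T, p.Prime ∧ p.Coprime W)
    (hT' : ∀ p ∈ T', p.Prime ∧ p.Coprime W) (hR : nn T ≤ R ^ 2) (hR' : nn T' ≤ R ^ 2)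
    {f : (p : ℕ) → p ∈ T → ℕ} {f' : (p : ℕ) → p ∈ T' → ℕ}
    (hf : f ∈ T.pi fun p => Ico 1 p) (hf' : f' ∈ T'.pi fun p => Ico 1 p)
    (hne : (⟨T, f⟩ : (T : Finset ℕ) × ((p : ℕ) → p ∈ T → ℕ)) ≠ ⟨T', f'⟩) (k : ℤ) :
    1 / (R : ℝ) ^ 4 ≤ |W * freq T f - W * freq T' f' - k| := by
  have hV : ∀ p ∈ T ∪ T', p.Prime ∧ p.Coprime W := fun p hp =>
    (mem_union.1 hp).elim (hT p) (hT' p)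
  have hf1 : ∀ p (h : p ∈ T), 1 ≤ ext T f p ∧ ext T f p < p := fun p h => by
    rw [ext, dif_pos h]; exact mem_Ico.1 (mem_pi.1 hf p h)
  have hf1' : ∀ p (h : p ∈ T'), 1 ≤ ext T' f' p ∧ ext T' f' p < p := fun p h => by
    rw [ext, dif_pos h]; exact mem_Ico.1 (mem_pi.1 hf' p h)
  have hf0 : ∀ p, p ∉ T → ext T f p = 0 := fun p h => by rw [ext, dif_neg h]
  have hf0' : ∀ p, p ∉ T' → ext T' f' p = 0 := fun p h => by rw [ext, dif_neg h]
  set d : ℕ → ℤ := fun p => (ext T f p : ℤ) - ext T' f' p with hd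
  have hex : ∃ q ∈ T ∪ T', ¬ (q : ℤ) ∣ d q := by
    by_contra! hcon
    apply hne
    have hz : ∀ p, ext T f p = ext T' f' p := by
      intro p
      by_cases hp : p ∈ T ∪ T'
      · have h1 := hcon p hp
        have h2 : |d p| < p := by
          have : 0 < p := (hV p hp).1.pos
          have ha : ext T f p < p := by
            by_cases h : p ∈ T
            · exact (hf1 p h).2
            · rw [hf0 p h]; exact this
          have hb : ext T' f' p < p := by
            by_cases h : p ∈ T'
            · exact (hf1' p h).2
            · rw [hf0' p h]; exact this
          rw [abs_lt]; simp only [hd]; constructor <;> omega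
        have h3 := Int.eq_zero_of_abs_lt_dvd h1 h2
        simp only [hd] at h3; omega
      · rw [mem_union, not_or] at hp
        rw [hf0 p hp.1, hf0' p hp.2]
    have hTT : T = T' := by
      ext p
      constructor <;> intro h <;> by_contra h'
      · have := hf1 p h; have := hf0' p h'; have := hz p; omega
      · have := hf1' p h; have := hf0 p h'; have := hz p; omega
    subst hTT
    congr 1
    funext p hp
    have := hz p
    rwa [ext, ext, dif_pos hp, dif_pos hp] at this
  obtain ⟨q, hq, hqd⟩ := hex
  have h1 := freq_spacing hV d hq hqd k
  have h2 : (W : ℝ) * ∑ p ∈ T ∪ T', (d p : ℝ) / p = W * freq T f - W * freq T' f' := by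
    rw [← mul_sub]; congr 1
    have ha : freq T f = ∑ p ∈ T ∪ T', (ext T f p : ℝ) / p :=
      sum_subset subset_union_left fun p _ hp => by rw [hf0 p hp]; simp
    have hb : freq T' f' = ∑ p ∈ T ∪ T', (ext T' f' p : ℝ) / p :=
      sum_subset subset_union_right fun p _ hp => by rw [hf0' p hp]; simp
    rw [ha, hb, ← sum_sub_distrib]
    refine sum_congr rfl fun p _ => ?_
    simp only [hd]; push_cast; ring
  rw [h2] at h1
  refine le_trans ?_ h1
  have h3 : nn (T ∪ T') ≤ R ^ 4 := by
    refine (nn_union_le fun p hp => (hT p hp).1).trans ?_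
    calc nn T * nn T' ≤ R ^ 2 * R ^ 2 := Nat.mul_le_mul hR hR'
      _ = R ^ 4 := by ring
  have h4 : 0 < nn (T ∪ T') := nn_pos fun p hp => (hV p hp).1
  apply one_div_le_one_div_of_le
  · exact_mod_cast h4
  · exact_mod_cast h3

/-- A weighted sum of Ramanujan sums along the progression `W * n + b` has an exponential sum
which is small unless the frequency is close to a rational number with a denominator `nn T`. -/
theorem norm_ramanujan_sum_le {W R : ℕ} (b : ℕ) {𝒯 : Finset (Finset ℕ)}
    (h𝒯 : ∀ T ∈ 𝒯, (∀ p ∈ T, p.Prime ∧ p.Coprime W) ∧ nn T ≤ R ^ 2) (w : Finset ℕ → ℝ) {B : ℝ}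
    (hB : 0 ≤ B) (hw : ∀ T ∈ 𝒯, |w T| ≤ B) (hR : 1 ≤ R) (θ : ℝ) (y z : ℕ) {X : ℂ}
    (hX : X = ∑ n ∈ Ioc y z, ((∑ T ∈ 𝒯, w T * cc T (W * n + b) : ℝ) : ℂ) * e (θ * n)) :
    ‖X‖ ≤ 2 * B * R ^ 8 ∨ ∃ T ∈ 𝒯, ∃ k : ℤ, ‖X‖ ≤ 2 * B * R ^ 8 + |w T| * (z - y : ℕ) ∧
      (‖X‖ - 2 * B * R ^ 8) * |nn T * θ - k| ≤ |w T| * nn T := by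
  classical
  have hpr : ∀ T ∈ 𝒯, ∀ p ∈ T, p.Prime := fun T hT p hp => ((h𝒯 T hT).1 p hp).1
  set s : Finset ((T : Finset ℕ) × ((p : ℕ) → p ∈ T → ℕ)) :=
    𝒯.sigma fun T => T.pi fun p => Ico 1 p with hs
  have hR0 : (0 : ℝ) < R := by exact_mod_cast hR
  have hXs : X = ∑ i ∈ s, ((w i.1 : ℂ) * e (b * freq i.1 i.2)) *
      ∑ n ∈ Ioc y z, e ((θ + W * freq i.1 i.2) * n) := by
    rw [hX]
    have h1 : ∀ n ∈ Ioc y z, ((∑ T ∈ 𝒯, w T * cc T (W * n + b) : ℝ) : ℂ) * e (θ * n)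
        = ∑ i ∈ s, ((w i.1 : ℂ) * e (b * freq i.1 i.2)) * e ((θ + W * freq i.1 i.2) * n) := by
      intro n _
      rw [hs, sum_sigma]; push_cast
      rw [sum_mul]
      refine sum_congr rfl fun T hT => ?_
      rw [cc_eq_sum (hpr T hT), mul_sum, sum_mul]
      refine sum_congr rfl fun f _ => ?_
      rw [mul_assoc, mul_assoc, ← e_add, ← e_add]
      congr 2; push_cast; ring
    rw [sum_congr rfl h1, sum_comm]
    exact sum_congr rfl fun i _ => by rw [mul_sum]
  have hcard : (s.card : ℝ) ≤ R ^ 4 := by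
    have h1 : s.card ≤ R ^ 2 * R ^ 2 := by
      rw [hs, card_sigma]
      have h2 : 𝒯.card ≤ R ^ 2 := by
        have : 𝒯.card ≤ (Ioc 0 (R ^ 2)).card := by
          refine card_le_card_of_injOn nn (fun T hT => ?_) ?_
          · exact mem_coe.2 (mem_Ioc.2 ⟨nn_pos (hpr T hT), (h𝒯 T hT).2⟩)
          · exact nn_injOn.mono fun T hT => hpr T hT
        simpa using this
      refine le_trans (sum_le_card_nsmul _ _ (R ^ 2) fun T hT => ?_) ?_
      · rw [card_pi]
        refine le_trans (prod_le_prod' fun p _ => ?_) (h𝒯 T hT).2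
        simp
      · exact Nat.mul_le_mul_right _ h2
    calc (s.card : ℝ) ≤ ((R ^ 2 * R ^ 2 : ℕ) : ℝ) := by exact_mod_cast h1
      _ = R ^ 4 := by push_cast; ring
  have hδ : (0 : ℝ) < 1 / (2 * R ^ 4) := by positivity
  have hbound : (s.card : ℝ) * (B / (1 / (2 * R ^ 4))) ≤ 2 * B * R ^ 8 := by
    have : B / (1 / (2 * (R : ℝ) ^ 4)) = 2 * B * R ^ 4 := by field_simp
    rw [this]
    calc (s.card : ℝ) * (2 * B * R ^ 4) ≤ R ^ 4 * (2 * B * R ^ 4) := by gcongr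
      _ = _ := by ring
  have hnormv : ∀ i : (T : Finset ℕ) × ((p : ℕ) → p ∈ T → ℕ),
      ‖(w i.1 : ℂ) * e (b * freq i.1 i.2)‖ = |w i.1| := fun i => by
    rw [norm_mul, norm_e, mul_one, Complex.norm_real, Real.norm_eq_abs]
  have hmain := separated_frequencies s (fun i => (W : ℝ) * freq i.1 i.2)
    (fun i => (w i.1 : ℂ) * e (b * freq i.1 i.2)) hδ (B := B)
    (fun i hi => by
      rw [hnormv]; exact hw _ (mem_sigma.1 (hs ▸ hi)).1) hB
    (fun i hi j hj hij a => by
      rw [hs, mem_sigma] at hi hj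
      have := freq_sub_spacing (h𝒯 _ hi.1).1 (h𝒯 _ hj.1).1 (h𝒯 _ hi.1).2 (h𝒯 _ hj.1).2
        hi.2 hj.2 hij a
      refine le_trans (le_of_eq ?_) this
      field_simp) θ y z
  rw [← hXs] at hmain
  rcases hmain with h | ⟨i, hi, h⟩
  · left; exact h.trans hbound
  · right
    rw [hs, mem_sigma] at hi
    obtain ⟨m, hm⟩ := nn_mul_freq (hpr _ hi.1) i.2
    rw [hnormv] at h
    set a := round (θ + W * freq i.1 i.2) with ha
    refine ⟨i.1, hi.1, nn i.1 * a - W * m, ?_, ?_⟩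
    · refine h.trans (add_le_add hbound (mul_le_mul_of_nonneg_left ?_ (abs_nonneg _)))
      refine (norm_sum_le _ _).trans ?_
      simp
    · set G := ∑ n ∈ Ioc y z, e ((θ + W * freq i.1 i.2) * n) with hG
      have hT0 : (0 : ℝ) < nn i.1 := by exact_mod_cast nn_pos (hpr _ hi.1)
      have h1 : |nn i.1 * θ - ((nn i.1 * a - W * m : ℤ) : ℝ)|
          = nn i.1 * |θ + W * freq i.1 i.2 - a| := by
        rw [← abs_of_pos hT0, ← abs_mul, abs_of_pos hT0]
        congr 1; push_cast; rw [← hm]; ring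
      rw [h1]
      rcases (abs_nonneg (θ + W * freq i.1 i.2 - a)).eq_or_lt with h0 | h0
      · rw [← h0]; simp; positivity
      · have h2 : ‖G‖ ≤ 1 / |θ + W * freq i.1 i.2 - a| :=
          norm_geom_sum_le h0 (fun c => round_le _ c) y z
        have h3 : ‖G‖ * |θ + W * freq i.1 i.2 - a| ≤ 1 := by
          rwa [le_div_iff₀ h0] at h2
        have h4 : ‖X‖ - 2 * B * R ^ 8 ≤ |w i.1| * ‖G‖ := by linarith
        calc (‖X‖ - 2 * B * R ^ 8) * (nn i.1 * |θ + W * freq i.1 i.2 - a|)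
            ≤ (|w i.1| * ‖G‖) * (nn i.1 * |θ + W * freq i.1 i.2 - a|) := by gcongr
          _ = |w i.1| * nn i.1 * (‖G‖ * |θ + W * freq i.1 i.2 - a|) := by ring
          _ ≤ |w i.1| * nn i.1 * 1 := by gcongr
          _ = _ := by ring

section

lemma pow_card_le_nn_rpow {K ε : ℝ} (hK : 1 ≤ K) (hε : 0 < ε) :
    ∃ C : ℝ, 1 ≤ C ∧ ∀ T : Finset ℕ, (∀ p ∈ T, p.Prime) → K ^ T.card ≤ C * (nn T : ℝ) ^ ε := by
  set P : ℕ := ⌈K ^ (1 / ε)⌉₊ with hP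
  refine ⟨K ^ P, one_le_pow₀ hK, fun T hT => ?_⟩
  have h1 : (nn T : ℝ) ^ ε = ∏ p ∈ T, (p : ℝ) ^ ε := by
    rw [nn]; push_cast
    exact (Real.finsetProd_rpow _ _ (fun p _ => by positivity) ε).symm
  have h2 : K ^ T.card = K ^ (T.filter (· < P)).card * K ^ (T.filter (fun p => ¬ p < P)).card := by
    rw [← pow_add, card_filter_add_card_filter_not]
  rw [h1, h2]
  refine mul_le_mul ?_ ?_ (by positivity) (by positivity)
  · refine pow_le_pow_right₀ hK ?_
    calc (T.filter (· < P)).card ≤ (range P).card :=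
          card_le_card fun p hp => mem_range.2 (mem_filter.1 hp).2
      _ = P := card_range P
  · have hge : ∀ p : ℕ, P ≤ p → K ≤ (p : ℝ) ^ ε := fun p hp => by
      have h3 : K ^ (1 / ε) ≤ p := (Nat.le_ceil _).trans (by exact_mod_cast hp)
      calc K = (K ^ (1 / ε)) ^ ε := by
            rw [← Real.rpow_mul (by linarith), one_div_mul_cancel hε.ne', Real.rpow_one]
        _ ≤ _ := Real.rpow_le_rpow (by positivity) h3 hε.le
    calc K ^ (T.filter (fun p => ¬ p < P)).card
        = ∏ p ∈ T.filter (fun p => ¬ p < P), K := (prod_const _).symm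
      _ ≤ ∏ p ∈ T.filter (fun p => ¬ p < P), (p : ℝ) ^ ε :=
          prod_le_prod (fun _ _ => by linarith) fun p hp =>
            hge p (not_lt.1 (mem_filter.1 hp).2)
      _ ≤ ∏ p ∈ T, (p : ℝ) ^ ε := by
          rw [← prod_filter_mul_prod_filter_not T (· < P)]
          refine le_mul_of_one_le_left (prod_nonneg fun p _ => by positivity) ?_
          have : ∀ p ∈ T.filter (· < P), (1 : ℝ) ≤ (p : ℝ) ^ ε := fun p hp =>
            Real.one_le_rpow (by exact_mod_cast (hT p (mem_filter.1 hp).1).one_lt.le) hε.le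
          calc (1 : ℝ) = ∏ p ∈ T.filter (· < P), 1 := by simp
            _ ≤ _ := prod_le_prod (fun _ _ => zero_le_one) this

/-- A downward closed family of sets of primes not dividing `W`, with product at most `R`. -/
structure SieveFamily (𝒮 : Finset (Finset ℕ)) (W R : ℕ) : Prop where
  prime : ∀ S ∈ 𝒮, ∀ p ∈ S, p.Prime
  coprime : ∀ S ∈ 𝒮, ∀ p ∈ S, p.Coprime W
  down : ∀ S ∈ 𝒮, ∀ T ⊆ S, T ∈ 𝒮
  le : ∀ S ∈ 𝒮, nn S ≤ R
  empty : ∅ ∈ 𝒮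

/-- The normalizing factor of the Selberg sieve. -/
noncomputable def hh (𝒮 : Finset (Finset ℕ)) : ℝ := ∑ S ∈ 𝒮, 1 / ph S

/-- The Selberg sieve majorant of the integers free of prime factors in the members of `𝒮`,
normalized to have mean value one. -/
noncomputable def nu (𝒮 : Finset (Finset ℕ)) (m : ℕ) : ℝ :=
  (1 / hh 𝒮) * (∑ S ∈ 𝒮, (-1) ^ S.card / ph S * cc S m) ^ 2

variable {𝒮 : Finset (Finset ℕ)} {W R : ℕ}

lemma SieveFamily.one_le_hh (h : SieveFamily 𝒮 W R) : 1 ≤ hh 𝒮 := by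
  have h1 : 1 / ph ∅ ≤ hh 𝒮 := single_le_sum (f := fun S => 1 / ph S)
    (fun S hS => (one_div_pos.2 (ph_pos (h.prime S hS))).le) h.empty
  simpa [ph] using h1

lemma SieveFamily.nu_nonneg (h : SieveFamily 𝒮 W R) (m : ℕ) : 0 ≤ nu 𝒮 m := by
  have := h.one_le_hh
  rw [nu]; positivity

lemma SieveFamily.nu_eq_hh (h : SieveFamily 𝒮 W R) {m : ℕ}
    (hm : ∀ S ∈ 𝒮, ∀ p ∈ S, ¬ p ∣ m) : nu 𝒮 m = hh 𝒮 := by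
  have h0 := h.one_le_hh
  have h1 : ∑ S ∈ 𝒮, (-1) ^ S.card / ph S * cc S m = hh 𝒮 := by
    refine sum_congr rfl fun S hS => ?_
    have : cc S m = (-1) ^ S.card := by
      rw [cc, ← prod_const]
      exact prod_congr rfl fun p hp => if_neg (hm S hS p hp)
    rw [this, div_mul_eq_mul_div, ← mul_pow]; simp
  rw [nu, h1]; field_simp

lemma cc_mul_cc (S S' : Finset ℕ) (m : ℕ) :
    cc S m * cc S' m = ∑ U ∈ (S ∩ S').powerset,
      ph ((S ∩ S') \ U) * (∏ p ∈ U, ((p : ℝ) - 2)) * cc (U ∪ (S \ S' ∪ S' \ S)) m := by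
  have h1 : ∀ A B : Finset ℕ, Disjoint A B → cc (A ∪ B) m = cc A m * cc B m := fun A B hAB => by
    rw [cc, prod_union hAB]; rfl
  have h2 : cc S m = cc (S ∩ S') m * cc (S \ S') m := by
    rw [← h1 _ _ (disjoint_sdiff_inter S S').symm]
    congr 1; rw [union_comm, sdiff_union_inter]
  have h3 : cc S' m = cc (S ∩ S') m * cc (S' \ S) m := by
    rw [inter_comm, ← h1 _ _ (disjoint_sdiff_inter S' S).symm]
    congr 1; rw [union_comm, sdiff_union_inter]
  have hd : Disjoint (S \ S') (S' \ S) := disjoint_sdiff_sdiff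
  have h4 : cc (S ∩ S') m * cc (S ∩ S') m = ∑ U ∈ (S ∩ S').powerset,
      ph ((S ∩ S') \ U) * (∏ p ∈ U, ((p : ℝ) - 2)) * cc U m := by
    rw [cc, ← prod_mul_distrib]
    have : ∀ p ∈ S ∩ S', ((if p ∣ m then (p : ℝ) - 1 else -1) * if p ∣ m then (p : ℝ) - 1 else -1)
        = ((p : ℝ) - 2) * (if p ∣ m then (p : ℝ) - 1 else -1) + ((p : ℝ) - 1) := fun p _ => by
      split_ifs <;> ring
    rw [prod_congr rfl this, prod_add]
    refine sum_congr rfl fun U _ => ?_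
    rw [prod_mul_distrib, cc, ph]; ring
  have h5 : cc S m * cc S' m = (cc (S ∩ S') m * cc (S ∩ S') m) * cc (S \ S' ∪ S' \ S) m := by
    rw [h1 _ _ hd, h2, h3]; ring
  rw [h5, h4, sum_mul]
  refine sum_congr rfl fun U hU => ?_
  rw [h1 U _ ?_, mul_assoc]
  rw [disjoint_left]
  intro p hp hp'
  have := mem_inter.1 (mem_powerset.1 hU hp)
  simp only [mem_union, mem_sdiff] at hp'
  tauto

lemma recover_sets {S S' U : Finset ℕ} (hU : U ⊆ S ∩ S') :
    U = (U ∪ (S \ S' ∪ S' \ S)) \ (S \ S' ∪ S' \ S) ∧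
    S = S \ S' ∪ ((S ∩ S') \ U ∪ U) ∧ S' = S' \ S ∪ ((S ∩ S') \ U ∪ U) := by
  refine ⟨?_, ?_, ?_⟩
  · rw [union_sdiff_right, sdiff_eq_self_of_disjoint]
    rw [disjoint_left]
    intro p hp hp'
    have := mem_inter.1 (hU hp)
    simp only [mem_union, mem_sdiff] at hp'
    tauto
  · rw [sdiff_union_of_subset hU, sdiff_union_inter]
  · rw [sdiff_union_of_subset hU, inter_comm, sdiff_union_inter]

/-- The Selberg majorant is a combination of Ramanujan sums with small coefficients. -/
theorem SieveFamily.nu_expand (h : SieveFamily 𝒮 W R) :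
    ∃ (𝒯 : Finset (Finset ℕ)) (w : Finset ℕ → ℝ),
      (∀ T ∈ 𝒯, (∀ p ∈ T, p.Prime ∧ p.Coprime W) ∧ nn T ≤ R ^ 2) ∧ ∅ ∈ 𝒯 ∧ w ∅ = 1 ∧
      (∀ T ∈ 𝒯, |w T| ≤ 4 ^ T.card / ph T) ∧ ∀ m, nu 𝒮 m = ∑ T ∈ 𝒯, w T * cc T m := by
  classical
  have hH := h.one_le_hh
  set I : Finset (Finset ℕ × Finset ℕ × Finset ℕ) :=
    (𝒮 ×ˢ 𝒮 ×ˢ 𝒮).filter fun t => t.2.2 ⊆ t.1 ∩ t.2.1 with hI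
  have hmemI : ∀ t, t ∈ I ↔ t.1 ∈ 𝒮 ∧ t.2.1 ∈ 𝒮 ∧ t.2.2 ⊆ t.1 ∩ t.2.1 := by
    intro t
    rw [hI, mem_filter, mem_product, mem_product]
    refine ⟨fun ht => ⟨ht.1.1, ht.1.2.1, ht.2⟩, fun ht => ⟨⟨ht.1, ht.2.1, ?_⟩, ht.2.2⟩⟩
    exact h.down _ ht.1 _ (ht.2.2.trans inter_subset_left)
  set τ : Finset ℕ × Finset ℕ × Finset ℕ → Finset ℕ :=
    fun t => t.2.2 ∪ (t.1 \ t.2.1 ∪ t.2.1 \ t.1) with hτ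
  set g : Finset ℕ × Finset ℕ × Finset ℕ → ℝ := fun t =>
    (1 / hh 𝒮) * ((-1) ^ t.1.card / ph t.1 * ((-1) ^ t.2.1.card / ph t.2.1) *
      (ph ((t.1 ∩ t.2.1) \ t.2.2) * ∏ p ∈ t.2.2, ((p : ℝ) - 2))) with hg
  have hnu : ∀ m, nu 𝒮 m = ∑ t ∈ I, g t * cc (τ t) m := by
    intro m
    rw [nu, sq, sum_mul_sum, mul_sum, hI, sum_filter, sum_product]
    refine sum_congr rfl fun S hS => ?_
    rw [mul_sum, sum_product]
    refine sum_congr rfl fun S' hS' => ?_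
    have h1 : (-1) ^ S.card / ph S * cc S m * ((-1) ^ S'.card / ph S' * cc S' m)
        = (-1) ^ S.card / ph S * ((-1) ^ S'.card / ph S') * (cc S m * cc S' m) := by ring
    have h2 : (S ∩ S').powerset = 𝒮.filter fun U => U ⊆ S ∩ S' := by
      ext U
      rw [mem_powerset, mem_filter]
      exact ⟨fun hU => ⟨h.down _ hS _ (hU.trans inter_subset_left), hU⟩, fun hU => hU.2⟩
    rw [h1, cc_mul_cc, h2, sum_filter, mul_sum, mul_sum]
    refine sum_congr rfl fun U _ => ?_
    simp only [hg, hτ]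
    split_ifs
    · ring
    · simp
  set w : Finset ℕ → ℝ := fun T => ∑ t ∈ I.filter (fun t => τ t = T), g t with hw
  have hτsub : ∀ t ∈ I, τ t ⊆ t.1 ∪ t.2.1 := by
    intro t ht p hp
    have h3 := (hmemI t).1 ht
    simp only [hτ, mem_union, mem_sdiff] at hp ⊢
    rcases hp with hp | hp | hp
    · exact Or.inl (mem_inter.1 (h3.2.2 hp)).1
    · exact Or.inl hp.1
    · exact Or.inr hp.1
  have hunion : ∀ t ∈ I, ∀ p ∈ t.1 ∪ t.2.1, p.Prime ∧ p.Coprime W := fun t ht p hp => by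
    have h3 := (hmemI t).1 ht
    rcases mem_union.1 hp with hp | hp
    · exact ⟨h.prime _ h3.1 p hp, h.coprime _ h3.1 p hp⟩
    · exact ⟨h.prime _ h3.2.1 p hp, h.coprime _ h3.2.1 p hp⟩
  refine ⟨I.image τ, w, ?_, ?_, ?_, ?_, ?_⟩
  · intro T hT
    obtain ⟨t, ht, rfl⟩ := mem_image.1 hT
    have h3 := (hmemI t).1 ht
    refine ⟨fun p hp => hunion t ht p (hτsub t ht hp), ?_⟩
    calc nn (τ t) ≤ nn (t.1 ∪ t.2.1) := nn_mono (fun p hp => (hunion t ht p hp).1) (hτsub t ht)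
      _ ≤ nn t.1 * nn t.2.1 := nn_union_le (h.prime _ h3.1)
      _ ≤ R * R := Nat.mul_le_mul (h.le _ h3.1) (h.le _ h3.2.1)
      _ = R ^ 2 := by ring
  · refine mem_image.2 ⟨(∅, ∅, ∅), (hmemI _).2 ⟨h.empty, h.empty, by simp⟩, by simp [hτ]⟩
  · have h1 : I.filter (fun t => τ t = ∅) = 𝒮.image fun S => (S, S, ∅) := by
      ext ⟨S, S', U⟩
      rw [mem_filter, hmemI, mem_image]
      simp only [hτ, union_eq_empty, sdiff_eq_empty_iff_subset, Prod.mk.injEq]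
      constructor
      · rintro ⟨⟨h1, -, -⟩, h2, h3, h4⟩
        exact ⟨S, h1, rfl, h3.antisymm h4, h2.symm⟩
      · rintro ⟨S, h1, rfl, rfl, rfl⟩
        exact ⟨⟨h1, h1, empty_subset _⟩, rfl, subset_rfl, subset_rfl⟩
    simp only [hw]
    rw [h1, sum_image (fun a _ b _ hab => (Prod.mk.injEq .. ▸ hab).1)]
    have h2 : ∀ S ∈ 𝒮, g (S, S, ∅) = (1 / hh 𝒮) * (1 / ph S) := fun S hS => by
      have := (ph_pos (h.prime S hS)).ne'
      simp only [hg, inter_self, sdiff_empty, prod_empty, mul_one]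
      have h3 : ((-1 : ℝ) ^ S.card) * (-1) ^ S.card = 1 := by rw [← mul_pow]; simp
      field_simp
      rw [sq, h3]
    rw [sum_congr rfl h2, ← mul_sum]
    change 1 / hh 𝒮 * hh 𝒮 = 1
    field_simp
  · intro T _
    set F := I.filter (fun t => τ t = T) with hF
    by_cases hTp : ∀ p ∈ T, p.Prime
    swap
    · have : F = ∅ := by
        rw [eq_empty_iff_forall_notMem]
        intro t ht
        rw [hF, mem_filter] at ht
        apply hTp
        rw [← ht.2]
        exact fun p hp => (hunion t ht.1 p (hτsub t ht.1 hp)).1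
      rename_i hT
      obtain ⟨t, ht, rfl⟩ := mem_image.1 hT
      exact absurd (fun p hp => (hunion t ht p (hτsub t ht hp)).1) hTp
    have hTpos := ph_pos hTp
    have hgb : ∀ t ∈ F, |g t| ≤ (1 / hh 𝒮) * (1 / ph T) * (1 / ph ((t.1 ∩ t.2.1) \ t.2.2)) := by
      rintro ⟨S, S', U⟩ ht
      rw [hF, mem_filter, hmemI] at ht
      obtain ⟨⟨hS, hS', hU⟩, hT⟩ := ht
      simp only [hτ] at hS hS' hU hT
      have hSp := h.prime S hS
      have hSp' := h.prime S' hS'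
      have hsplit : ∀ A B : Finset ℕ, Disjoint A B → ph (A ∪ B) = ph A * ph B :=
        fun A B hAB => by rw [ph, prod_union hAB]; rfl
      have hUp : ∀ p ∈ U, p.Prime := fun p hp => hSp p (mem_inter.1 (hU hp)).1
      have hK : ∀ p ∈ (S ∩ S') \ U, p.Prime := fun p hp =>
        hSp p (mem_inter.1 (mem_sdiff.1 hp).1).1
      have hA : ∀ p ∈ S \ S', p.Prime := fun p hp => hSp p (mem_sdiff.1 hp).1
      have hB : ∀ p ∈ S' \ S, p.Prime := fun p hp => hSp' p (mem_sdiff.1 hp).1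
      have hI1 : ph (S ∩ S') = ph ((S ∩ S') \ U) * ph U := by
        rw [← hsplit _ _ sdiff_disjoint, sdiff_union_of_subset hU]
      have e1 : ph S = ph (S \ S') * (ph ((S ∩ S') \ U) * ph U) := by
        rw [← hI1, ← hsplit _ _ (disjoint_sdiff_inter S S'), sdiff_union_inter]
      have e2 : ph S' = ph (S' \ S) * (ph ((S ∩ S') \ U) * ph U) := by
        rw [← hI1, inter_comm, ← hsplit _ _ (disjoint_sdiff_inter S' S), sdiff_union_inter]
      have e3 : ph T = ph U * (ph (S \ S') * ph (S' \ S)) := by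
        rw [← hT, hsplit _ _ ?_, hsplit _ _ disjoint_sdiff_sdiff]
        rw [disjoint_left]
        intro p hp hp'
        have := mem_inter.1 (hU hp)
        simp only [mem_union, mem_sdiff] at hp'
        tauto
      have hprod : |∏ p ∈ U, ((p : ℝ) - 2)| ≤ ph U := by
        rw [abs_prod, ph]
        refine prod_le_prod (fun _ _ => abs_nonneg _) fun p hp => ?_
        have : (2 : ℝ) ≤ p := by exact_mod_cast (hUp p hp).two_le
        rw [abs_of_nonneg (by linarith)]; linarith
      have p1 := ph_pos hUp
      have p2 := ph_pos hK
      have p3 := ph_pos hA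
      have p4 := ph_pos hB
      simp only [hg]
      rw [e1, e2, e3]
      simp only [abs_mul, abs_div, abs_pow, abs_neg, abs_one, one_pow, abs_of_pos p1,
        abs_of_pos p2, abs_of_pos p3, abs_of_pos p4, abs_of_pos (show 0 < hh 𝒮 by linarith)]
      calc _ ≤ 1 / hh 𝒮 * (1 / (ph (S \ S') * (ph ((S ∩ S') \ U) * ph U)) *
              (1 / (ph (S' \ S) * (ph ((S ∩ S') \ U) * ph U))) *
              (ph ((S ∩ S') \ U) * ph U)) := by gcongr
        _ = _ := by field_simp
    have hinj : Set.InjOn (fun t : Finset ℕ × Finset ℕ × Finset ℕ =>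
        ((t.1 ∩ t.2.1) \ t.2.2, t.1 \ t.2.1, t.2.1 \ t.1)) F := by
      rintro ⟨S, S', U⟩ ht ⟨S₁, S₁', U₁⟩ ht₁ heq
      rw [mem_coe, hF, mem_filter, hmemI] at ht ht₁
      simp only [hτ, Prod.mk.injEq] at ht ht₁ heq ⊢
      obtain ⟨⟨-, -, hU⟩, hT⟩ := ht
      obtain ⟨⟨-, -, hU₁⟩, hT₁⟩ := ht₁
      obtain ⟨q1, q2, q3⟩ := heq
      obtain ⟨r1, r2, r3⟩ := recover_sets hU
      obtain ⟨s1, s2, s3⟩ := recover_sets hU₁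
      rw [hT, q2, q3] at r1
      rw [hT₁] at s1
      have hUU : U = U₁ := r1.trans s1.symm
      subst hUU
      rw [q1, q2] at r2
      rw [q1, q3] at r3
      exact ⟨r2.trans s2.symm, r3.trans s3.symm, rfl⟩
    calc |w T| ≤ ∑ t ∈ F, |g t| := abs_sum_le_sum_abs _ _
      _ ≤ ∑ t ∈ F, (1 / hh 𝒮) * (1 / ph T) * (1 / ph ((t.1 ∩ t.2.1) \ t.2.2)) :=
          sum_le_sum hgb
      _ = ∑ s ∈ F.image (fun t : Finset ℕ × Finset ℕ × Finset ℕ =>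
            ((t.1 ∩ t.2.1) \ t.2.2, t.1 \ t.2.1, t.2.1 \ t.1)),
            (1 / hh 𝒮) * (1 / ph T) * (1 / ph s.1) := by rw [sum_image hinj]
      _ ≤ ∑ s ∈ 𝒮 ×ˢ T.powerset ×ˢ T.powerset, (1 / hh 𝒮) * (1 / ph T) * (1 / ph s.1) := by
          refine sum_le_sum_of_subset_of_nonneg ?_ ?_
          · intro s hs
            obtain ⟨⟨S, S', U⟩, ht, rfl⟩ := mem_image.1 hs
            rw [hF, mem_filter, hmemI] at ht
            simp only [hτ] at ht
            rw [mem_product, mem_product, mem_powerset, mem_powerset]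
            refine ⟨h.down _ ht.1.1 _ (sdiff_subset.trans inter_subset_left), ?_, ?_⟩
            · rw [← ht.2]; exact subset_union_left.trans subset_union_right
            · rw [← ht.2]; exact subset_union_right.trans subset_union_right
          · intro s hs _
            have := ph_pos (h.prime _ (mem_product.1 hs).1)
            positivity
      _ = 4 ^ T.card / ph T := by
          rw [sum_product]
          simp only [sum_const, nsmul_eq_mul, card_product, card_powerset]
          rw [← mul_sum, ← mul_sum]
          change _ * (1 / hh 𝒮 * (1 / ph T) * hh 𝒮) = _
          have : (4 : ℝ) ^ T.card = 2 ^ T.card * 2 ^ T.card := by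
            rw [← mul_pow]; norm_num
          rw [this]
          push_cast
          field_simp
  · intro m
    rw [hnu, ← sum_fiberwise_of_maps_to (fun t ht => mem_image_of_mem τ ht)]
    refine sum_congr rfl fun T _ => ?_
    rw [hw, sum_mul]
    refine sum_congr rfl fun t ht => ?_
    rw [(mem_filter.1 ht).2]

end

lemma exists_coeff_bound {ε : ℝ} (hε : 0 < ε) : ∃ C : ℝ, 1 ≤ C ∧ ∀ T : Finset ℕ,
    (∀ p ∈ T, p.Prime) → (4 : ℝ) ^ T.card / ph T ≤ C * (nn T : ℝ) ^ ε / nn T := by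
  obtain ⟨C, hC, h⟩ := pow_card_le_nn_rpow (K := 8) (by norm_num) hε
  refine ⟨C, hC, fun T hT => ?_⟩
  have h1 := ph_pos hT
  have h2 : (0 : ℝ) < nn T := by exact_mod_cast nn_pos hT
  rw [div_le_div_iff₀ h1 h2]
  calc (4 : ℝ) ^ T.card * nn T ≤ 4 ^ T.card * (2 ^ T.card * ph T) := by
        gcongr; exact nn_le_two_pow_mul_ph hT
    _ = 8 ^ T.card * ph T := by rw [← mul_assoc, ← mul_pow]; norm_num
    _ ≤ C * (nn T : ℝ) ^ ε * ph T := by gcongr; exact h T hT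

lemma abs_cc_le_gcd {T : Finset ℕ} (hT : ∀ p ∈ T, p.Prime) (m : ℕ) :
    |cc T m| ≤ Nat.gcd (nn T) m := by
  classical
  have h1 : (∏ p ∈ T, if p ∣ m then p else 1) ∣ Nat.gcd (nn T) m := by
    rw [← prod_filter]
    refine Nat.dvd_gcd (prod_dvd_prod_of_subset _ _ _ (filter_subset _ _)) ?_
    exact prod_primes_dvd m (fun p hp => (hT p (mem_filter.1 hp).1).prime)
      (fun p hp => (mem_filter.1 hp).2)
  have h2 : |cc T m| ≤ ∏ p ∈ T, ((if p ∣ m then p else 1 : ℕ) : ℝ) := by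
    rw [cc, abs_prod]
    refine prod_le_prod (fun _ _ => abs_nonneg _) fun p hp => ?_
    have : (1 : ℝ) ≤ p := by exact_mod_cast (hT p hp).one_lt.le
    split_ifs
    · rw [abs_of_nonneg (by linarith)]; linarith
    · simp
  refine h2.trans ?_
  rw [← Nat.cast_prod]
  exact_mod_cast Nat.le_of_dvd (Nat.gcd_pos_of_pos_left _ (nn_pos hT)) h1

lemma sum_nu_le_and_fourier : ∃ C : ℝ, 1 ≤ C ∧ ∀ {𝒮 : Finset (Finset ℕ)} {W R : ℕ},
    SieveFamily 𝒮 W R → 1 ≤ R → ∀ b y z : ℕ,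
    (∑ n ∈ Ioc y z, nu 𝒮 (W * n + b) ≤ (z - y : ℕ) + C * R ^ 8) ∧
    ∀ θ κ P : ℝ, 0 < κ → ((z - y : ℕ) : ℝ) ≤ P → 0 < P → C * R ^ 8 ≤ κ * P / 2 →
      κ * P ≤ ‖∑ n ∈ Ioc y z, (nu 𝒮 (W * n + b) : ℂ) * e (θ * n)‖ →
      ∃ q : ℕ, 1 ≤ q ∧ (q : ℝ) ≤ C / κ ^ 2 ∧ ∃ k : ℤ, |q * θ - k| ≤ C / (κ ^ 2 * P) := by
  obtain ⟨C, hC, hcoef⟩ := exists_coeff_bound (ε := 1 / 2) (by norm_num)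
  have hcoef' : ∀ T : Finset ℕ, (∀ p ∈ T, p.Prime) →
      (4 : ℝ) ^ T.card / ph T ≤ C / Real.sqrt (nn T) := fun T hT => by
    refine (hcoef T hT).trans_eq ?_
    have h2 : (0 : ℝ) < nn T := by exact_mod_cast nn_pos hT
    rw [← Real.sqrt_eq_rpow, mul_div_assoc, Real.sqrt_div_self, div_eq_mul_inv]
  refine ⟨4 * C ^ 2, by nlinarith, fun {𝒮 W R} h hR b y z => ?_⟩
  obtain ⟨𝒯, w, h𝒯, hemp, hw0, hw, hnu⟩ := h.nu_expand
  have hpr : ∀ T ∈ 𝒯, ∀ p ∈ T, p.Prime := fun T hT p hp => ((h𝒯 T hT).1 p hp).1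
  have hwC : ∀ T ∈ 𝒯, |w T| ≤ C / Real.sqrt (nn T) := fun T hT =>
    (hw T hT).trans (hcoef' T (hpr T hT))
  have hwB : ∀ T ∈ 𝒯, |w T| ≤ C := fun T hT => by
    refine (hwC T hT).trans (div_le_self (by linarith) ?_)
    rw [Real.one_le_sqrt]
    exact_mod_cast nn_pos (hpr T hT)
  have hR8 : (0 : ℝ) ≤ (R : ℝ) ^ 8 := by positivity
  have hconst : 2 * C * (R : ℝ) ^ 8 ≤ 4 * C ^ 2 * R ^ 8 := by
    apply mul_le_mul_of_nonneg_right _ hR8; nlinarith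
  constructor
  · have hsub : ∀ T ∈ 𝒯.erase ∅, (∀ p ∈ T, p.Prime ∧ p.Coprime W) ∧ nn T ≤ R ^ 2 :=
      fun T hT => h𝒯 T (mem_of_mem_erase hT)
    -- every nontrivial frequency has a bounded exponential sum
    have key : ‖∑ n ∈ Ioc y z, ((∑ T ∈ 𝒯.erase ∅, w T * cc T (W * n + b) : ℝ) : ℂ)‖
        ≤ 2 * C * R ^ 8 := by
      have hR0 : (0 : ℝ) < R := by exact_mod_cast hR
      have hsum : ∑ n ∈ Ioc y z, ((∑ T ∈ 𝒯.erase ∅, w T * cc T (W * n + b) : ℝ) : ℂ)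
          = ∑ i ∈ (𝒯.erase ∅).sigma fun T => T.pi fun p => Ico 1 p,
            ((w i.1 : ℂ) * e (b * freq i.1 i.2)) *
              ∑ n ∈ Ioc y z, e ((W * freq i.1 i.2) * n) := by
        have h1 : ∀ n ∈ Ioc y z, ((∑ T ∈ 𝒯.erase ∅, w T * cc T (W * n + b) : ℝ) : ℂ)
            = ∑ i ∈ (𝒯.erase ∅).sigma fun T => T.pi fun p => Ico 1 p,
              ((w i.1 : ℂ) * e (b * freq i.1 i.2)) * e ((W * freq i.1 i.2) * n) := by
          intro n _
          rw [sum_sigma]; push_cast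
          refine sum_congr rfl fun T hT => ?_
          rw [cc_eq_sum (hpr T (mem_of_mem_erase hT)), mul_sum]
          refine sum_congr rfl fun f _ => ?_
          rw [mul_assoc, ← e_add]
          congr 2; push_cast; ring
        rw [sum_congr rfl h1, sum_comm]
        exact sum_congr rfl fun i _ => by rw [mul_sum]
      rw [hsum]
      have hterm : ∀ i ∈ (𝒯.erase ∅).sigma fun T => T.pi fun p => Ico 1 p,
          ‖((w i.1 : ℂ) * e (b * freq i.1 i.2)) * ∑ n ∈ Ioc y z, e ((W * freq i.1 i.2) * n)‖
            ≤ C * R ^ 4 := by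
        rintro ⟨T, f⟩ hi
        rw [mem_sigma] at hi
        simp only at hi ⊢
        have hT := mem_of_mem_erase hi.1
        rw [norm_mul, norm_mul, norm_e, mul_one, Complex.norm_real, Real.norm_eq_abs]
        refine mul_le_mul (hwB T hT) ?_ (norm_nonneg _) (by linarith)
        refine (norm_geom_sum_le (δ := 1 / (R : ℝ) ^ 4) (by positivity) (fun a => ?_) y z).trans
          (by rw [one_div_one_div])
        have hne : (⟨T, f⟩ : (T : Finset ℕ) × ((p : ℕ) → p ∈ T → ℕ)) ≠
            ⟨∅, fun p hp => absurd hp (notMem_empty p)⟩ := by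
          intro heq
          exact ne_of_mem_erase hi.1 (congrArg Sigma.fst heq)
        have := freq_sub_spacing (h𝒯 T hT).1 (h𝒯 ∅ hemp).1 (h𝒯 T hT).2 (h𝒯 ∅ hemp).2
          hi.2 (mem_pi.2 fun p hp => absurd hp (notMem_empty p)) hne a
        simpa [freq] using this
      refine (norm_sum_le _ _).trans ((sum_le_card_nsmul _ _ _ hterm).trans ?_)
      have hcard : (((𝒯.erase ∅).sigma fun T => T.pi fun p => Ico 1 p).card : ℝ) ≤ R ^ 4 := by
        have h1 : ((𝒯.erase ∅).sigma fun T => T.pi fun p => Ico 1 p).card ≤ R ^ 2 * R ^ 2 := by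
          rw [card_sigma]
          have h2 : (𝒯.erase ∅).card ≤ R ^ 2 := by
            have : (𝒯.erase ∅).card ≤ (Ioc 0 (R ^ 2)).card := by
              refine card_le_card_of_injOn nn (fun T hT => ?_) ?_
              · exact mem_coe.2 (mem_Ioc.2 ⟨nn_pos (hpr T (mem_of_mem_erase hT)),
                  (hsub T hT).2⟩)
              · exact nn_injOn.mono fun T hT => hpr T (mem_of_mem_erase hT)
            simpa using this
          refine le_trans (sum_le_card_nsmul _ _ (R ^ 2) fun T hT => ?_) ?_
          · rw [card_pi]
            refine le_trans (prod_le_prod' fun p _ => ?_) (hsub T hT).2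
            simp
          · exact Nat.mul_le_mul_right _ h2
        calc _ ≤ ((R ^ 2 * R ^ 2 : ℕ) : ℝ) := by exact_mod_cast h1
          _ = R ^ 4 := by push_cast; ring
      rw [nsmul_eq_mul]
      calc _ ≤ (R : ℝ) ^ 4 * (C * R ^ 4) := by gcongr
        _ ≤ _ := by nlinarith
    have h1 : ∑ n ∈ Ioc y z, nu 𝒮 (W * n + b) = (z - y : ℕ) +
        ∑ n ∈ Ioc y z, ∑ T ∈ 𝒯.erase ∅, w T * cc T (W * n + b) := by
      have : ∀ n ∈ Ioc y z, nu 𝒮 (W * n + b)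
          = 1 + ∑ T ∈ 𝒯.erase ∅, w T * cc T (W * n + b) := fun n _ => by
        rw [hnu, ← add_sum_erase _ _ hemp, hw0]; simp [cc]
      rw [sum_congr rfl this, sum_add_distrib]; simp
    rw [h1]
    rw [← Complex.ofReal_sum, Complex.norm_real, Real.norm_eq_abs] at key
    have := le_abs_self (∑ n ∈ Ioc y z, ∑ T ∈ 𝒯.erase ∅, w T * cc T (W * n + b))
    linarith
  · intro θ κ P hκ hzP hP hRP hX
    have hmain := norm_ramanujan_sum_le b h𝒯 w (by linarith : 0 ≤ C) hwB hR θ y z rfl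
    simp only [← hnu] at hmain
    set X := ∑ n ∈ Ioc y z, (nu 𝒮 (W * n + b) : ℂ) * e (θ * n) with hXdef
    have hκP : 0 < κ * P := by positivity
    rcases hmain with hb | ⟨T, hT, k, hb1, hb2⟩
    · linarith
    · have hn : (0 : ℝ) < nn T := by exact_mod_cast nn_pos (hpr T hT)
      have hs : 0 < Real.sqrt (nn T) := Real.sqrt_pos.2 hn
      have hss : Real.sqrt (nn T) * Real.sqrt (nn T) = nn T := Real.mul_self_sqrt hn.le
      have h1 : κ / 2 ≤ |w T| := by
        have : κ * P / 2 ≤ |w T| * P := by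
          have := mul_le_mul_of_nonneg_left hzP (abs_nonneg (w T))
          linarith
        have : κ / 2 * P ≤ |w T| * P := by linarith
        exact le_of_mul_le_mul_right this hP
      have h2 : κ * Real.sqrt (nn T) ≤ 2 * C := by
        have := h1.trans (hwC T hT)
        rw [le_div_iff₀ hs] at this; linarith
      refine ⟨nn T, nn_pos (hpr T hT), ?_, k, ?_⟩
      · rw [le_div_iff₀ (by positivity)]
        calc (nn T : ℝ) * κ ^ 2 = (κ * Real.sqrt (nn T)) ^ 2 := by rw [mul_pow, sq (√_), hss]; ring
          _ ≤ (2 * C) ^ 2 := by gcongr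
          _ = _ := by ring
      · rw [le_div_iff₀ (by positivity)]
        have h3 : κ * P / 2 * |nn T * θ - k| ≤ C * Real.sqrt (nn T) := by
          calc κ * P / 2 * |nn T * θ - k| ≤ (‖X‖ - 2 * C * R ^ 8) * |nn T * θ - k| := by
                gcongr; linarith
            _ ≤ |w T| * nn T := hb2
            _ ≤ C / Real.sqrt (nn T) * nn T := by gcongr; exact hwC T hT
            _ = _ := by rw [← hss]; field_simp; rw [Real.sqrt_sq hs.le]
        calc |nn T * θ - k| * (κ ^ 2 * P) = 2 * κ * (κ * P / 2 * |nn T * θ - k|) := by ring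
          _ ≤ 2 * κ * (C * Real.sqrt (nn T)) := by gcongr
          _ = 2 * C * (κ * Real.sqrt (nn T)) := by ring
          _ ≤ 2 * C * (2 * C) := by gcongr
          _ = _ := by ring

/-- The majorant splits into a combination of few Ramanujan sums and a part with small
exponential sums. -/
lemma nu_split {ε : ℝ} (hε : 0 < ε) : ∃ C : ℝ, 1 ≤ C ∧ ∀ {𝒮 : Finset (Finset ℕ)} {W R : ℕ},
    SieveFamily 𝒮 W R → 1 ≤ R → ∀ Q : ℕ, 1 ≤ Q → ∃ lo hi : ℕ → ℝ,
    (∀ m, nu 𝒮 m = lo m + hi m) ∧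
    (∀ m, |lo m| ≤ C * (Q : ℝ) ^ ε *
      ∑ q ∈ (Icc 1 Q).filter (fun q => q.Coprime W), (Nat.gcd q m : ℝ) / q) ∧
    ∀ (b y z : ℕ) (θ : ℝ), ‖∑ n ∈ Ioc y z, (hi (W * n + b) : ℂ) * e (θ * n)‖ ≤
      C * R ^ 8 + C / Real.sqrt Q * (z - y : ℕ) := by
  classical
  obtain ⟨C, hC, hcoef⟩ := exists_coeff_bound (ε := 1 / 2) (by norm_num)
  obtain ⟨C', hC', hcoef'⟩ := exists_coeff_bound hε
  refine ⟨2 * C + C', by linarith, fun {𝒮 W R} h hR Q hQ => ?_⟩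
  obtain ⟨𝒯, w, h𝒯, -, -, hw, hnu⟩ := h.nu_expand
  have hpr : ∀ T ∈ 𝒯, ∀ p ∈ T, p.Prime := fun T hT p hp => ((h𝒯 T hT).1 p hp).1
  have hQ0 : (0 : ℝ) < Q := by exact_mod_cast hQ
  refine ⟨fun m => ∑ T ∈ 𝒯.filter (fun T => nn T ≤ Q), w T * cc T m,
    fun m => ∑ T ∈ 𝒯.filter (fun T => ¬ nn T ≤ Q), w T * cc T m, fun m => ?_, fun m => ?_,
    fun b y z θ => ?_⟩
  · rw [hnu, sum_filter_add_sum_filter_not]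
  · have h1 : ∀ T ∈ 𝒯.filter (fun T => nn T ≤ Q),
        |w T * cc T m| ≤ C' * (Q : ℝ) ^ ε * ((Nat.gcd (nn T) m : ℝ) / nn T) := fun T hT => by
      rw [mem_filter] at hT
      rw [abs_mul]
      have hn : (0 : ℝ) < nn T := by exact_mod_cast nn_pos (hpr T hT.1)
      calc |w T| * |cc T m| ≤ (C' * (nn T : ℝ) ^ ε / nn T) * Nat.gcd (nn T) m := by
            refine mul_le_mul ((hw T hT.1).trans (hcoef' T (hpr T hT.1)))
              (abs_cc_le_gcd (hpr T hT.1) m) (abs_nonneg _) (by positivity)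
        _ ≤ (C' * (Q : ℝ) ^ ε / nn T) * Nat.gcd (nn T) m := by
            gcongr; exact_mod_cast hT.2
        _ = _ := by ring
    calc |∑ T ∈ 𝒯.filter (fun T => nn T ≤ Q), w T * cc T m|
        ≤ ∑ T ∈ 𝒯.filter (fun T => nn T ≤ Q), |w T * cc T m| := abs_sum_le_sum_abs _ _
      _ ≤ ∑ T ∈ 𝒯.filter (fun T => nn T ≤ Q),
            C' * (Q : ℝ) ^ ε * ((Nat.gcd (nn T) m : ℝ) / nn T) := sum_le_sum h1
      _ = C' * (Q : ℝ) ^ ε * ∑ q ∈ (𝒯.filter (fun T => nn T ≤ Q)).image nn,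
            ((Nat.gcd q m : ℝ) / q) := by
          rw [← mul_sum, sum_image]
          exact nn_injOn.mono fun T hT => hpr T (mem_filter.1 hT).1
      _ ≤ C' * (Q : ℝ) ^ ε *
          ∑ q ∈ (Icc 1 Q).filter (fun q => q.Coprime W), (Nat.gcd q m : ℝ) / q := by
          refine mul_le_mul_of_nonneg_left ?_ (by positivity)
          refine sum_le_sum_of_subset_of_nonneg ?_ fun _ _ _ => by positivity
          intro q hq
          obtain ⟨T, hT, rfl⟩ := mem_image.1 hq
          rw [mem_filter] at hT
          rw [mem_filter, mem_Icc]
          refine ⟨⟨nn_pos (hpr T hT.1), hT.2⟩, ?_⟩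
          exact Nat.Coprime.prod_left fun p hp => ((h𝒯 T hT.1).1 p hp).2
      _ ≤ _ := by
          refine mul_le_mul_of_nonneg_right ?_ (sum_nonneg fun _ _ => by positivity)
          gcongr; linarith
  · have hwC : ∀ T ∈ 𝒯.filter (fun T => ¬ nn T ≤ Q), |w T| ≤ C / Real.sqrt Q := by
      intro T hT
      rw [mem_filter] at hT
      refine (hw T hT.1).trans ((hcoef T (hpr T hT.1)).trans ?_)
      rw [← Real.sqrt_eq_rpow, mul_div_assoc, Real.sqrt_div_self, ← div_eq_mul_inv]
      have : (Q : ℝ) ≤ nn T := by exact_mod_cast (not_le.1 hT.2).le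
      gcongr
    have hB : C / Real.sqrt Q ≤ C := div_le_self (by linarith) (by
      rw [Real.one_le_sqrt]; exact_mod_cast hQ)
    have hB0 : 0 ≤ C / Real.sqrt Q := by positivity
    have hR8 : (0 : ℝ) ≤ (R : ℝ) ^ 8 := by positivity
    have hle : 2 * (C / Real.sqrt Q) * (R : ℝ) ^ 8 ≤ (2 * C + C') * R ^ 8 := by
      apply mul_le_mul_of_nonneg_right _ hR8; linarith
    have hle2 : C / Real.sqrt Q ≤ (2 * C + C') / Real.sqrt Q := by gcongr; linarith
    have hz : (0 : ℝ) ≤ (z - y : ℕ) := by positivity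
    rcases norm_ramanujan_sum_le b (fun T hT => h𝒯 T (mem_filter.1 hT).1) w hB0 hwC hR θ y z
      rfl with hb | ⟨T, hT, k, hb, -⟩
    · refine hb.trans (hle.trans (le_add_of_nonneg_right (by positivity)))
    · refine hb.trans (add_le_add hle (mul_le_mul_of_nonneg_right ?_ hz))
      exact (hwC T hT).trans hle2

/-- The monoid homomorphism `n ↦ 1 / n`. -/
noncomputable def invHom : ℕ →* ℝ where
  toFun n := (n : ℝ)⁻¹
  map_one' := by simp
  map_mul' a b := by push_cast; rw [mul_inv]

lemma sum_inv_le_of_primeFactors_eq {S A : Finset ℕ} (hS : ∀ p ∈ S, p.Prime)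
    (hA : ∀ a ∈ A, a ≠ 0 ∧ a.primeFactors = S) : ∑ a ∈ A, (a : ℝ)⁻¹ ≤ 1 / ph S := by
  have h1 := (EulerProduct.summable_and_hasSum_factoredNumbers_prod_filter_prime_geometric
    (f := invHom) (fun {p} hp => by
      have : (1 : ℝ) < p := by exact_mod_cast hp.one_lt
      change ‖(p : ℝ)⁻¹‖ < 1
      rw [norm_inv, Real.norm_natCast]; exact inv_lt_one_of_one_lt₀ this) S).2
  rw [filter_true_of_mem hS] at h1
  have h2 := hasSum_subtype_iff_indicator.1 h1
  have hn : (0 : ℝ) < nn S := by exact_mod_cast nn_pos hS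
  have hdvd : ∀ a ∈ A, nn S ∣ a := fun a ha => by
    rw [← (hA a ha).2]; exact Nat.prod_primeFactors_dvd a
  have hinj : Set.InjOn (fun a => a / nn S) A := fun a ha b hb hab => by
    rw [← Nat.div_mul_cancel (hdvd a ha), ← Nat.div_mul_cancel (hdvd b hb)]
    simp only at hab
    rw [hab]
  have h3 : ∑ a ∈ A, ((a / nn S : ℕ) : ℝ)⁻¹ ≤ ∏ p ∈ S, (1 - (p : ℝ)⁻¹)⁻¹ := by
    have h4 := sum_le_hasSum (A.image fun a => a / nn S)
      (fun i _ => Set.indicator_nonneg (fun n _ => by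
        change 0 ≤ (n : ℝ)⁻¹; positivity) i) h2
    rw [sum_image hinj] at h4
    refine le_trans (le_of_eq ?_) h4
    refine sum_congr rfl fun a ha => ?_
    rw [Set.indicator_of_mem]
    · rfl
    · have ha0 : a / nn S ≠ 0 := by
        have := Nat.div_mul_cancel (hdvd a ha)
        intro h0
        rw [h0, zero_mul] at this
        exact (hA a ha).1 this.symm
      rw [Nat.mem_factoredNumbers_iff_primeFactors_subset]
      refine ⟨ha0, ?_⟩
      exact (Nat.primeFactors_mono (Nat.div_dvd_of_dvd (hdvd a ha)) (hA a ha).1).trans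
        (hA a ha).2.subset
  have h5 : ∑ a ∈ A, (a : ℝ)⁻¹ = (nn S : ℝ)⁻¹ * ∑ a ∈ A, ((a / nn S : ℕ) : ℝ)⁻¹ := by
    rw [mul_sum]
    refine sum_congr rfl fun a ha => ?_
    rw [← mul_inv]
    congr 1
    rw [← Nat.cast_mul, Nat.mul_div_cancel' (hdvd a ha)]
  rw [h5]
  refine (mul_le_mul_of_nonneg_left h3 (by positivity)).trans_eq ?_
  rw [nn, ph, Nat.cast_prod, ← prod_inv_distrib, ← prod_mul_distrib, one_div, ← prod_inv_distrib]
  refine prod_congr rfl fun p hp => ?_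
  have h6 : (1 : ℝ) < p := by exact_mod_cast (hS p hp).one_lt
  rw [← mul_inv]; congr 1; field_simp

lemma log_le_sum_inv_ph (R : ℕ) : Real.log (R + 1) ≤
    ∑ S ∈ ((R + 1).primesBelow).powerset.filter (fun S => nn S ≤ R), 1 / ph S := by
  have h0 := log_add_one_le_harmonic R
  have h1 : ((harmonic R : ℚ) : ℝ) = ∑ n ∈ Icc 1 R, (n : ℝ)⁻¹ := by
    rw [harmonic_eq_sum_Icc]; push_cast; rfl
  rw [h1] at h0
  push_cast at h0
  refine h0.trans ?_
  rw [← sum_fiberwise_of_maps_to (g := Nat.primeFactors)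
    (t := ((R + 1).primesBelow).powerset.filter (fun S => nn S ≤ R))]
  · refine sum_le_sum fun S hS => sum_inv_le_of_primeFactors_eq ?_ ?_
    · intro p hp
      exact Nat.prime_of_mem_primesBelow (mem_powerset.1 (mem_filter.1 hS).1 hp)
    · intro a ha
      rw [mem_filter, mem_Icc] at ha
      exact ⟨by omega, ha.2⟩
  · intro n hn
    rw [mem_Icc] at hn
    rw [mem_filter, mem_powerset]
    constructor
    · intro p hp
      rw [Nat.mem_primesBelow]
      have := Nat.le_of_mem_primeFactors hp
      exact ⟨by omega, Nat.prime_of_mem_primeFactors hp⟩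
    · exact (Nat.le_of_dvd (by omega) (Nat.prod_primeFactors_dvd n)).trans hn.2

/-- The sets of primes not dividing `W` with product at most `R`. -/
def famW (W R : ℕ) : Finset (Finset ℕ) :=
  ((R + 1).primesBelow.filter (fun p => p.Coprime W)).powerset.filter (fun S => nn S ≤ R)

lemma famW_sieveFamily {W R : ℕ} (hR : 1 ≤ R) : SieveFamily (famW W R) W R where
  prime S hS p hp := by
    rw [famW, mem_filter, mem_powerset] at hS
    exact Nat.prime_of_mem_primesBelow (mem_filter.1 (hS.1 hp)).1
  coprime S hS p hp := by
    rw [famW, mem_filter, mem_powerset] at hS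
    exact (mem_filter.1 (hS.1 hp)).2
  down S hS T hT := by
    rw [famW, mem_filter, mem_powerset] at hS ⊢
    refine ⟨hT.trans hS.1, (nn_mono (fun p hp => ?_) hT).trans hS.2⟩
    exact Nat.prime_of_mem_primesBelow (mem_filter.1 (hS.1 hp)).1
  le S hS := (mem_filter.1 hS).2
  empty := by
    rw [famW, mem_filter]
    exact ⟨empty_mem_powerset _, by simpa [nn] using hR⟩

lemma famW_sieveFamily_prime {W R : ℕ} (S : Finset ℕ) (hS : S ∈ famW W R) : ∀ p ∈ S, p.Prime := by
  intro p hp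
  rw [famW, mem_filter, mem_powerset] at hS
  exact Nat.prime_of_mem_primesBelow (mem_filter.1 (hS.1 hp)).1

lemma totient_div (W : ℕ) (hW : 1 ≤ W) :
    ∑ A ∈ W.primeFactors.powerset, 1 / ph A = (W : ℝ) / W.totient := by
  have h1 : ∑ A ∈ W.primeFactors.powerset, 1 / ph A
      = ∏ p ∈ W.primeFactors, (1 + 1 / ((p : ℝ) - 1)) := by
    rw [prod_one_add]
    refine sum_congr rfl fun A _ => ?_
    rw [ph, prod_div_distrib]; simp
  have hpos : (0 : ℝ) < W.totient := by exact_mod_cast Nat.totient_pos.2 hW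
  have hne : ∏ p ∈ W.primeFactors, ((p : ℝ) - 1) ≠ 0 := by
    have := ph_pos (S := W.primeFactors) fun p hp => Nat.prime_of_mem_primeFactors hp
    exact this.ne'
  have h2 : (W.totient : ℝ) * ∏ p ∈ W.primeFactors, (p : ℝ)
      = W * ∏ p ∈ W.primeFactors, ((p : ℝ) - 1) := by
    have := Nat.totient_mul_prod_primeFactors W
    have h3 : ∏ p ∈ W.primeFactors, ((p : ℝ) - 1)
        = ((∏ p ∈ W.primeFactors, (p - 1) : ℕ) : ℝ) := by
      push_cast
      refine prod_congr rfl fun p hp => ?_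
      rw [Nat.cast_sub (Nat.prime_of_mem_primeFactors hp).one_lt.le]; simp
    rw [h3, ← Nat.cast_prod, ← Nat.cast_mul, this, Nat.cast_mul]
  have h4 : ∏ p ∈ W.primeFactors, (1 + 1 / ((p : ℝ) - 1))
      = (∏ p ∈ W.primeFactors, (p : ℝ)) / ∏ p ∈ W.primeFactors, ((p : ℝ) - 1) := by
    rw [← prod_div_distrib]
    refine prod_congr rfl fun p hp => ?_
    have : (1 : ℝ) < p := by exact_mod_cast (Nat.prime_of_mem_primeFactors hp).one_lt
    have : (p : ℝ) - 1 ≠ 0 := by linarith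
    field_simp; ring
  rw [h1, h4, div_eq_div_iff hne hpos.ne', mul_comm, h2]

lemma le_hh_famW {W : ℕ} (hW : 1 ≤ W) (R : ℕ) :
    (W.totient : ℝ) / W * Real.log (R + 1) ≤ hh (famW W R) := by
  classical
  have hpos : (0 : ℝ) < W.totient := by exact_mod_cast Nat.totient_pos.2 hW
  have hW0 : (0 : ℝ) < W := by exact_mod_cast hW
  suffices h : Real.log (R + 1) ≤ (W : ℝ) / W.totient * hh (famW W R) by
    calc (W.totient : ℝ) / W * Real.log (R + 1)
        ≤ (W.totient : ℝ) / W * ((W : ℝ) / W.totient * hh (famW W R)) := by gcongr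
      _ = _ := by field_simp
  refine (log_le_sum_inv_ph R).trans ?_
  rw [← totient_div W hW, hh, sum_mul_sum, ← sum_product']
  set F := ((R + 1).primesBelow).powerset.filter (fun S => nn S ≤ R) with hF
  have hpr : ∀ S ∈ F, ∀ p ∈ S, p.Prime := fun S hS p hp =>
    Nat.prime_of_mem_primesBelow (mem_powerset.1 (mem_filter.1 hS).1 hp)
  set g : Finset ℕ → Finset ℕ × Finset ℕ := fun S =>
    (S.filter (fun p => ¬ p.Coprime W), S.filter (fun p => p.Coprime W)) with hg
  have hinj : Set.InjOn g F := fun S _ T _ h => by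
    simp only [hg, Prod.mk.injEq] at h
    have := congrArg₂ (· ∪ ·) h.1 h.2
    rwa [union_comm, filter_union_filter_not_eq, union_comm, filter_union_filter_not_eq] at this
  have h1 : ∀ S ∈ F, 1 / ph S = 1 / ph (g S).1 * (1 / ph (g S).2) := fun S _ => by
    rw [ph, ph, ph]
    rw [← prod_filter_mul_prod_filter_not S (fun p => p.Coprime W)]
    simp only [hg, one_div, mul_inv]
    ring
  rw [sum_congr rfl h1, ← sum_image (f := fun t : Finset ℕ × Finset ℕ =>
    1 / ph t.1 * (1 / ph t.2)) hinj]
  refine sum_le_sum_of_subset_of_nonneg ?_ ?_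
  · intro t ht
    obtain ⟨S, hS, rfl⟩ := mem_image.1 ht
    have hS' := mem_filter.1 hS
    rw [mem_product, mem_powerset, famW, mem_filter, mem_powerset]
    refine ⟨fun p hp => ?_, fun p hp => ?_, ?_⟩
    · have hp' := mem_filter.1 hp
      have hpp := hpr S hS p hp'.1
      rw [Nat.mem_primeFactors]
      refine ⟨hpp, ?_, by omega⟩
      by_contra hnd
      exact hp'.2 ((Nat.Prime.coprime_iff_not_dvd hpp).2 hnd)
    · have hp' := mem_filter.1 hp
      exact mem_filter.2 ⟨mem_powerset.1 hS'.1 hp'.1, hp'.2⟩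
    · exact (nn_mono (hpr S hS) (filter_subset _ _)).trans hS'.2
  · intro t ht _
    rw [mem_product] at ht
    have h2 := ph_pos ((famW_sieveFamily_prime t.2 ht.2))
    have h3 : 0 < ph t.1 := ph_pos fun p hp =>
      Nat.prime_of_mem_primeFactors (mem_powerset.1 ht.1 hp)
    positivity

lemma sum_log_div_le (z : ℕ) (hz : 1 ≤ z) :
    ∑ p ∈ z.primesBelow, Real.log p / p ≤ Real.log z + Real.log 4 := by
  rcases hz.eq_or_lt with rfl | hz
  · have : Nat.primesBelow 1 = ∅ := by decide
    rw [this]; simp; exact Real.log_nonneg (by norm_num)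
  obtain ⟨n, rfl⟩ : ∃ n, z = n + 1 := ⟨z - 1, by omega⟩
  have hn : 1 ≤ n := by omega
  have hn0 : (0 : ℝ) < n := by exact_mod_cast hn
  have hlogp : ∀ p : ℕ, 0 ≤ Real.log p := fun p => Real.log_natCast_nonneg p
  have h1 : ∑ p ∈ (n + 1).primesBelow, ((n / p : ℕ) : ℝ) * Real.log p ≤ n * Real.log n := by
    calc ∑ p ∈ (n + 1).primesBelow, ((n / p : ℕ) : ℝ) * Real.log p
        = ∑ p ∈ (n + 1).primesBelow, ∑ m ∈ Ioc 0 n, if p ∣ m then Real.log p else 0 := by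
          refine sum_congr rfl fun p _ => ?_
          rw [← sum_filter, sum_const, Nat.Ioc_filter_dvd_card_eq_div, nsmul_eq_mul]
      _ = ∑ m ∈ Ioc 0 n, ∑ p ∈ (n + 1).primesBelow, if p ∣ m then Real.log p else 0 := sum_comm
      _ ≤ ∑ m ∈ Ioc 0 n, Real.log n := by
          refine sum_le_sum fun m hm => ?_
          rw [mem_Ioc] at hm
          have hm0 : (0 : ℝ) < m := by exact_mod_cast hm.1
          rw [← sum_filter]
          have : ((n + 1).primesBelow.filter fun p => p ∣ m) ⊆ m.primeFactors := fun p hp => by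
            rw [mem_filter] at hp
            exact Nat.mem_primeFactors.2 ⟨Nat.prime_of_mem_primesBelow hp.1, hp.2, by omega⟩
          refine (sum_le_sum_of_subset_of_nonneg this fun p _ _ => hlogp p).trans ?_
          rw [← Real.log_prod fun p hp => by
            exact_mod_cast (Nat.prime_of_mem_primeFactors hp).ne_zero, ← Nat.cast_prod]
          have h2 : ∏ p ∈ m.primeFactors, p ≤ m := Nat.le_of_dvd hm.1 (Nat.prod_primeFactors_dvd m)
          have h3 : 0 < ∏ p ∈ m.primeFactors, p :=
            prod_pos fun p hp => (Nat.prime_of_mem_primeFactors hp).pos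
          refine Real.log_le_log (by exact_mod_cast h3) ?_
          exact_mod_cast h2.trans hm.2
      _ = n * Real.log n := by simp
  have hθ : ∑ p ∈ (n + 1).primesBelow, Real.log p ≤ Real.log 4 * n := by
    have := Chebyshev.theta_le_log4_mul_x hn0.le
    rwa [Chebyshev.theta_eq_sum_primesLE_log] at this
  have h4 : n * ∑ p ∈ (n + 1).primesBelow, Real.log p / p
      ≤ n * (Real.log n + Real.log 4) := by
    calc n * ∑ p ∈ (n + 1).primesBelow, Real.log p / p
        = ∑ p ∈ (n + 1).primesBelow, ((n : ℝ) / p) * Real.log p := by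
          rw [mul_sum]; exact sum_congr rfl fun p _ => by ring
      _ ≤ ∑ p ∈ (n + 1).primesBelow, (((n / p : ℕ) : ℝ) * Real.log p + Real.log p) := by
          refine sum_le_sum fun p hp => ?_
          have hp := (Nat.prime_of_mem_primesBelow hp)
          have h5 : (n : ℝ) / p ≤ (n / p : ℕ) + 1 := by
            have := Nat.lt_floor_add_one ((n : ℝ) / p)
            rw [Nat.floor_div_eq_div] at this
            exact this.le
          have := mul_le_mul_of_nonneg_right h5 (hlogp p)
          linarith
      _ ≤ n * Real.log n + Real.log 4 * n := by
          rw [sum_add_distrib]; exact add_le_add h1 hθ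
      _ = _ := by ring
  have h5 := le_of_mul_le_mul_left h4 hn0
  refine h5.trans ?_
  gcongr
  linarith

/-- The density of the integers free of prime factors below `z`. -/
noncomputable def vv (z : ℕ) : ℝ := ∏ p ∈ z.primesBelow, (1 - 1 / (p : ℝ))

lemma one_sub_inv_pos {z p : ℕ} (hp : p ∈ z.primesBelow) : 0 < 1 - 1 / (p : ℝ) := by
  have : (1 : ℝ) < p := by exact_mod_cast (Nat.prime_of_mem_primesBelow hp).one_lt
  have := (div_lt_one (by linarith : (0:ℝ) < p)).2 this
  linarith

lemma vv_pos (z : ℕ) : 0 < vv z := prod_pos fun _ hp => one_sub_inv_pos hp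

lemma sum_powerset_inv_ph (z : ℕ) : ∑ S ∈ z.primesBelow.powerset, 1 / ph S = 1 / vv z := by
  have h1 : ∑ S ∈ z.primesBelow.powerset, 1 / ph S
      = ∏ p ∈ z.primesBelow, (1 + 1 / ((p : ℝ) - 1)) := by
    rw [prod_one_add]
    refine sum_congr rfl fun A _ => ?_
    rw [ph, prod_div_distrib]; simp
  rw [h1, vv, one_div, ← prod_inv_distrib]
  refine prod_congr rfl fun p hp => ?_
  have : (1 : ℝ) < p := by exact_mod_cast (Nat.prime_of_mem_primesBelow hp).one_lt
  have h2 : (p : ℝ) - 1 ≠ 0 := by linarith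
  have h3 : (p : ℝ) ≠ 0 := by linarith
  field_simp
  ring

lemma vv_mul_log_le (z : ℕ) : vv z * Real.log z ≤ 1 := by
  rcases Nat.eq_zero_or_pos z with rfl | hz
  · simp
  obtain ⟨n, rfl⟩ : ∃ n, z = n + 1 := ⟨z - 1, by omega⟩
  have h1 := log_le_sum_inv_ph n
  have h2 : ∑ S ∈ ((n + 1).primesBelow).powerset.filter (fun S => nn S ≤ n), 1 / ph S
      ≤ ∑ S ∈ ((n + 1).primesBelow).powerset, 1 / ph S :=
    sum_le_sum_of_subset_of_nonneg (filter_subset _ _) fun S hS _ => by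
      have := ph_pos (S := S) fun p hp => Nat.prime_of_mem_primesBelow (mem_powerset.1 hS hp)
      positivity
  rw [sum_powerset_inv_ph] at h2
  have h3 := h1.trans h2
  have := vv_pos (n + 1)
  rw [le_div_iff₀ this] at h3
  push_cast
  linarith

lemma sum_vv_div (z : ℕ) : ∑ p ∈ z.primesBelow, vv p / p = 1 - vv z := by
  induction z with
  | zero => simp [vv]
  | succ n ih =>
    have h1 : (n + 1).primesBelow = if n.Prime then insert n n.primesBelow else n.primesBelow := by
      rw [Nat.primesBelow, range_add_one, filter_insert]; rfl
    have hn : n ∉ n.primesBelow := fun h => (Nat.lt_of_mem_primesBelow h).false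
    rw [vv, h1]
    split_ifs with hp
    · rw [sum_insert hn, ih, prod_insert hn]
      change _ = 1 - (1 - 1 / (n : ℝ)) * vv n
      ring
    · exact ih

/-- The sets of primes below `z` with product at most `D`. -/
def famz (z D : ℕ) : Finset (Finset ℕ) := z.primesBelow.powerset.filter (fun S => nn S ≤ D)

lemma famz_sieveFamily {z D : ℕ} (hD : 1 ≤ D) : SieveFamily (famz z D) 1 D where
  prime S hS p hp := Nat.prime_of_mem_primesBelow (mem_powerset.1 (mem_filter.1 hS).1 hp)
  coprime S hS p hp := Nat.coprime_one_right p
  down S hS T hT := by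
    rw [famz, mem_filter, mem_powerset] at hS ⊢
    refine ⟨hT.trans hS.1, (nn_mono (fun p hp => ?_) hT).trans hS.2⟩
    exact Nat.prime_of_mem_primesBelow (hS.1 hp)
  le S hS := (mem_filter.1 hS).2
  empty := by
    rw [famz, mem_filter]
    exact ⟨empty_mem_powerset _, by simpa [nn] using hD⟩

lemma le_hh_famz {z D : ℕ} (hz : 2 ≤ z) (hD : 1 ≤ D) :
    1 / vv z * (1 - Real.exp 6 * Real.exp (-(Real.log D / Real.log z))) ≤ hh (famz z D) := by
  have hz1 : (1 : ℝ) < z := by exact_mod_cast hz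
  have hlz : 0 < Real.log z := Real.log_pos hz1
  have hD0 : (0 : ℝ) < D := by exact_mod_cast hD
  set σ : ℝ := 1 / Real.log z with hσ
  have hσ0 : 0 < σ := by positivity
  have hprS : ∀ S ∈ z.primesBelow.powerset, ∀ p ∈ S, p.Prime := fun S hS p hp =>
    Nat.prime_of_mem_primesBelow (mem_powerset.1 hS hp)
  have hsplit := sum_filter_add_sum_filter_not z.primesBelow.powerset (fun S => nn S ≤ D)
    (fun S => 1 / ph S)
  rw [sum_powerset_inv_ph] at hsplit
  change hh (famz z D) + _ = _ at hsplit
  have htail : ∑ S ∈ z.primesBelow.powerset.filter (fun S => ¬ nn S ≤ D), 1 / ph S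
      ≤ 1 / vv z * (Real.exp 6 * Real.exp (-(Real.log D / Real.log z))) := by
    have hDσ : (D : ℝ) ^ σ = Real.exp (Real.log D / Real.log z) := by
      rw [Real.rpow_def_of_pos hD0, hσ]; congr 1; ring
    have hDσ0 : 0 < (D : ℝ) ^ σ := Real.rpow_pos_of_pos hD0 _
    calc ∑ S ∈ z.primesBelow.powerset.filter (fun S => ¬ nn S ≤ D), 1 / ph S
        ≤ ∑ S ∈ z.primesBelow.powerset.filter (fun S => ¬ nn S ≤ D),
            ((nn S : ℝ) ^ σ / (D : ℝ) ^ σ) * (1 / ph S) := by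
          refine sum_le_sum fun S hS => ?_
          rw [mem_filter] at hS
          have := ph_pos (hprS S hS.1)
          refine le_mul_of_one_le_left (by positivity) ?_
          rw [one_le_div hDσ0]
          exact Real.rpow_le_rpow hD0.le (by exact_mod_cast (not_le.1 hS.2).le) hσ0.le
      _ ≤ ∑ S ∈ z.primesBelow.powerset, ((nn S : ℝ) ^ σ / (D : ℝ) ^ σ) * (1 / ph S) := by
          refine sum_le_sum_of_subset_of_nonneg (filter_subset _ _) fun S hS _ => ?_
          have := ph_pos (hprS S hS)
          positivity
      _ = (D : ℝ) ^ (-σ) * ∏ p ∈ z.primesBelow, (1 + (p : ℝ) ^ σ / ((p : ℝ) - 1)) := by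
          rw [prod_one_add, mul_sum]
          refine sum_congr rfl fun S _ => ?_
          rw [prod_div_distrib, Real.rpow_neg hD0.le, nn, Nat.cast_prod,
            ← Real.finsetProd_rpow _ _ (fun p _ => by positivity) σ, ph]
          ring
      _ = (D : ℝ) ^ (-σ) * (1 / vv z * ∏ p ∈ z.primesBelow, (1 + ((p : ℝ) ^ σ - 1) / p)) := by
          congr 1
          rw [vv, one_div, ← prod_inv_distrib, ← prod_mul_distrib]
          refine prod_congr rfl fun p hp => ?_
          have : (1 : ℝ) < p := by exact_mod_cast (Nat.prime_of_mem_primesBelow hp).one_lt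
          have h2 : (p : ℝ) - 1 ≠ 0 := by linarith
          have h3 : (p : ℝ) ≠ 0 := by linarith
          field_simp
          ring
      _ ≤ (D : ℝ) ^ (-σ) * (1 / vv z * Real.exp 6) := by
          have := vv_pos z
          gcongr
          calc ∏ p ∈ z.primesBelow, (1 + ((p : ℝ) ^ σ - 1) / p)
              ≤ ∏ p ∈ z.primesBelow, Real.exp (2 * σ * (Real.log p / p)) := by
                refine prod_le_prod (fun p hp => ?_) fun p hp => ?_
                · have : (1 : ℝ) < p := by exact_mod_cast (Nat.prime_of_mem_primesBelow hp).one_lt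
                  have h4 := Real.one_le_rpow this.le hσ0.le
                  have : 0 ≤ ((p : ℝ) ^ σ - 1) / p := div_nonneg (by linarith) (by linarith)
                  linarith
                · have h3 : (1 : ℝ) < p := by
                    exact_mod_cast (Nat.prime_of_mem_primesBelow hp).one_lt
                  have h5 : (p : ℝ) ≤ z := by exact_mod_cast (Nat.lt_of_mem_primesBelow hp).le
                  have hlp : 0 ≤ Real.log p := Real.log_nonneg h3.le
                  have h4 : σ * Real.log p ≤ 1 := by
                    rw [hσ, div_mul_eq_mul_div, one_mul, div_le_one hlz]
                    exact Real.log_le_log (by linarith) h5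
                  have h6 := Real.abs_exp_sub_one_le (x := σ * Real.log p)
                    (by rwa [abs_of_nonneg (by positivity)])
                  rw [abs_of_nonneg (a := σ * Real.log p) (by positivity)] at h6
                  have h7 : (p : ℝ) ^ σ = Real.exp (σ * Real.log p) := by
                    rw [Real.rpow_def_of_pos (by linarith)]; congr 1; ring
                  have h8 : ((p : ℝ) ^ σ - 1) / p ≤ 2 * σ * (Real.log p / p) := by
                    rw [← mul_div_assoc, h7]
                    gcongr
                    linarith [le_abs_self (Real.exp (σ * Real.log p) - 1)]
                  have := Real.add_one_le_exp (2 * σ * (Real.log p / p))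
                  linarith
            _ = Real.exp (2 * σ * ∑ p ∈ z.primesBelow, Real.log p / p) := by
                rw [mul_sum, Real.exp_sum]
            _ ≤ Real.exp 6 := by
                rw [Real.exp_le_exp]
                have h1 := sum_log_div_le z (by omega)
                have h2 : Real.log 4 = 2 * Real.log 2 := by
                  rw [← Real.log_rpow (by norm_num)]; norm_num
                have h3 : Real.log 2 ≤ Real.log z :=
                  Real.log_le_log (by norm_num) (by exact_mod_cast hz)
                calc 2 * σ * ∑ p ∈ z.primesBelow, Real.log p / p
                    ≤ 2 * σ * (3 * Real.log z) := by gcongr; linarith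
                  _ = 6 := by rw [hσ]; field_simp; norm_num
      _ = _ := by
          rw [Real.rpow_neg hD0.le, hDσ, ← Real.exp_neg]; ring
  have : 1 / vv z * (1 - Real.exp 6 * Real.exp (-(Real.log D / Real.log z)))
    = 1 / vv z - 1 / vv z * (Real.exp 6 * Real.exp (-(Real.log D / Real.log z))) := by ring
  linarith

/-- `k` has no prime factor below `z`. -/
def Rough (z k : ℕ) : Prop := ∀ p : ℕ, p.Prime → p ∣ k → z ≤ p

lemma nu_famz_of_rough {z D k : ℕ} (hD : 1 ≤ D) (hk : Rough z k) :
    nu (famz z D) k = hh (famz z D) := by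
  refine (famz_sieveFamily hD).nu_eq_hh fun S hS p hp hpk => ?_
  have h := mem_powerset.1 (mem_filter.1 hS).1 hp
  exact absurd (Nat.lt_of_mem_primesBelow h) (not_lt.2 (hk p (Nat.prime_of_mem_primesBelow h) hpk))

open Classical in
/-- The rough numbers up to `x`. -/
noncomputable def roughs (x z : ℕ) : Finset ℕ := (Ioc 0 x).filter (Rough z)

lemma mem_roughs {x z k : ℕ} : k ∈ roughs x z ↔ (0 < k ∧ k ≤ x) ∧ Rough z k := by
  simp [roughs]

lemma sum_nu_famz_div_le : ∃ C : ℝ, 1 ≤ C ∧ ∀ z D x : ℕ, 1 ≤ D →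
    ∑ k ∈ Ioc 0 x, nu (famz z D) k / hh (famz z D) ≤ x / hh (famz z D) + C * D ^ 8 := by
  obtain ⟨C, hC, h⟩ := sum_nu_le_and_fourier
  refine ⟨C, hC, fun z D x hD => ?_⟩
  have h1 := (h (famz_sieveFamily (z := z) hD) hD 0 0 x).1
  have h2 := (famz_sieveFamily (z := z) hD).one_le_hh
  simp only [one_mul, add_zero, tsub_zero] at h1
  rw [← sum_div]
  have h3 : 0 ≤ C * (D : ℝ) ^ 8 := by positivity
  calc _ ≤ (x + C * (D : ℝ) ^ 8) / hh (famz z D) := by gcongr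
    _ ≤ _ := by rw [add_div]; gcongr; exact div_le_self h3 h2

lemma card_roughs_eq (x z : ℕ) :
    ((roughs x z).card : ℝ) = ∑ k ∈ Ioc 0 x, open Classical in if Rough z k then 1 else 0 := by
  classical
  rw [roughs, card_filter]; push_cast; congr!

lemma indicator_rough_le {z D k : ℕ} (hD : 1 ≤ D) :
    (open Classical in if Rough z k then (1 : ℝ) else 0) ≤ nu (famz z D) k / hh (famz z D) := by
  have h2 := (famz_sieveFamily (z := z) hD).one_le_hh
  split_ifs with h
  · rw [nu_famz_of_rough hD h, div_self (by linarith)]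
  · exact div_nonneg ((famz_sieveFamily hD).nu_nonneg _) (by linarith)

lemma card_roughs_le : ∃ C : ℝ, 1 ≤ C ∧ ∀ z D x : ℕ, 1 ≤ D →
    ((roughs x z).card : ℝ) ≤ x / hh (famz z D) + C * D ^ 8 := by
  obtain ⟨C, hC, h⟩ := sum_nu_famz_div_le
  refine ⟨C, hC, fun z D x hD => le_trans ?_ (h z D x hD)⟩
  rw [card_roughs_eq]
  exact sum_le_sum fun k _ => indicator_rough_le hD

/-- Buchstab's inequality. -/
lemma le_card_roughs_add (N z : ℕ) :
    N ≤ (roughs N z).card + ∑ p ∈ z.primesBelow, (roughs (N / p) p).card := by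
  classical
  have h1 : Ioc 0 N ⊆ roughs N z ∪
      z.primesBelow.biUnion fun p => (roughs (N / p) p).image fun m => p * m := by
    intro k hk
    rw [mem_Ioc] at hk
    rw [mem_union, mem_roughs, mem_biUnion]
    by_cases hr : Rough z k
    · exact Or.inl ⟨hk, hr⟩
    · right
      unfold Rough at hr
      push Not at hr
      obtain ⟨p, hp, hpk, hpz⟩ := hr
      have hk1 : k ≠ 1 := by rintro rfl; exact hp.one_lt.ne' (Nat.dvd_one.1 hpk)
      have hq := Nat.minFac_prime hk1
      refine ⟨k.minFac, Nat.mem_primesBelow.2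
        ⟨(Nat.minFac_le_of_dvd hp.two_le hpk).trans_lt hpz, hq⟩, mem_image.2
        ⟨k / k.minFac, mem_roughs.2 ⟨⟨Nat.div_pos (Nat.minFac_le hk.1) hq.pos,
          Nat.div_le_div_right hk.2⟩, fun r hr hrk => ?_⟩, Nat.mul_div_cancel' k.minFac_dvd⟩⟩
      exact Nat.minFac_le_of_dvd hr.two_le (hrk.trans (Nat.div_dvd_of_dvd k.minFac_dvd))
  have h2 := card_le_card h1
  rw [Nat.card_Ioc, tsub_zero] at h2
  refine h2.trans ((card_union_le _ _).trans (Nat.add_le_add_left (card_biUnion_le.trans ?_) _))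
  exact sum_le_sum fun p _ => card_image_le

lemma inv_hh_famz_le {z D : ℕ} (hz : 2 ≤ z) (hD : 1 ≤ D) (hu : 8 ≤ Real.log D / Real.log z) :
    1 / hh (famz z D) ≤
      vv z * (1 + 2 * (Real.exp 6 * Real.exp (-(Real.log D / Real.log z)))) ∧
    Real.exp 6 * Real.exp (-(Real.log D / Real.log z)) ≤ 1 / 2 := by
  set τ := Real.exp 6 * Real.exp (-(Real.log D / Real.log z)) with hτ
  have h0 : 0 ≤ τ := by positivity
  have h1 : τ ≤ 1 / 2 := by
    rw [hτ, ← Real.exp_add]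
    have h3 : Real.exp (6 + -(Real.log D / Real.log z)) ≤ Real.exp (-1) :=
      Real.exp_le_exp.2 (by linarith)
    have h4 := Real.exp_one_gt_d9
    have h5 : Real.exp (-1) ≤ 1 / 2 := by
      rw [Real.exp_neg, inv_le_comm₀ (Real.exp_pos _) (by norm_num)]; linarith
    linarith
  refine ⟨?_, h1⟩
  have h2 := le_hh_famz hz hD
  rw [← hτ] at h2
  have hv := vv_pos z
  have h3 := (famz_sieveFamily (z := z) hD).one_le_hh
  rw [div_le_iff₀ (by linarith)]
  have h4 : 0 ≤ vv z * (1 + 2 * τ) := by positivity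
  calc (1:ℝ) ≤ (1 + 2 * τ) * (1 - τ) := by nlinarith
    _ = vv z * (1 + 2 * τ) * (1 / vv z * (1 - τ)) := by field_simp
    _ ≤ _ := by gcongr

lemma inv_hh_famz_le_log {z D : ℕ} (hz : 2 ≤ z) (hD : 1 ≤ D)
    (hu : 8 ≤ Real.log D / Real.log z) : 1 / hh (famz z D) ≤ 2 / Real.log z := by
  obtain ⟨h1, h2⟩ := inv_hh_famz_le hz hD hu
  have h3 := vv_mul_log_le z
  have hv := vv_pos z
  have hl : 0 < Real.log z := Real.log_pos (by exact_mod_cast hz)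
  calc _ ≤ vv z * 2 := h1.trans (by gcongr; linarith)
    _ ≤ _ := by rw [le_div_iff₀ hl]; linarith

lemma sum_vv_mul_exp_le {z D : ℕ} (hz : 2 ≤ z) (hu : 8 ≤ Real.log D / Real.log z) :
    ∑ p ∈ z.primesBelow, vv p / p * Real.exp (-(Real.log D / Real.log p)) ≤
      3 * Real.exp (-(Real.log D / Real.log z / 2)) / Real.log z := by
  set u := Real.log D / Real.log z with hu'
  have hl : 0 < Real.log z := Real.log_pos (by exact_mod_cast hz)
  have hD : Real.log D = u * Real.log z := by rw [hu']; field_simp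
  have h1 : ∀ p ∈ z.primesBelow, vv p / p * Real.exp (-(Real.log D / Real.log p)) ≤
      Real.exp (-(u / 2)) / Real.log z ^ 2 * (Real.log p / p) := by
    intro p hp
    have hpp := Nat.prime_of_mem_primesBelow hp
    have hpz := Nat.lt_of_mem_primesBelow hp
    have hp0 : (0:ℝ) < p := by exact_mod_cast hpp.pos
    have hlp : 0 < Real.log p := Real.log_pos (by exact_mod_cast hpp.one_lt)
    have hle : Real.log p ≤ Real.log z := Real.log_le_log hp0 (by exact_mod_cast hpz.le)
    set s := Real.log z / Real.log p with hs
    have hs1 : 1 ≤ s := by rw [hs, le_div_iff₀ hlp]; linarith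
    have h2 : Real.log D / Real.log p = u * s := by rw [hD, hs]; ring
    rw [h2]
    have h3 : Real.exp (-(u * s)) ≤ Real.exp (-(u / 2)) * (1 / s ^ 2) := by
      have h4 : Real.exp (-(u * s)) ≤ Real.exp (-(u / 2)) * Real.exp (-(2 * s)) := by
        rw [← Real.exp_add]; apply Real.exp_le_exp.2; nlinarith
      refine h4.trans ?_
      gcongr
      rw [Real.exp_neg, ← one_div]
      have h5 : s ≤ Real.exp s := by linarith [Real.add_one_le_exp s]
      have h6 : Real.exp (2 * s) = Real.exp s ^ 2 := by rw [← Real.exp_nat_mul]; norm_num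
      rw [h6]
      gcongr
    have h7 := vv_mul_log_le p
    have h8 : vv p ≤ 1 / Real.log p := by rw [le_div_iff₀ hlp]; exact h7
    calc vv p / p * Real.exp (-(u * s))
        ≤ 1 / Real.log p / p * (Real.exp (-(u / 2)) * (1 / s ^ 2)) := by gcongr
      _ = _ := by rw [hs]; field_simp
  refine (sum_le_sum h1).trans ?_
  rw [← mul_sum]
  have h2 := sum_log_div_le z (by omega)
  have h3 : Real.log 4 ≤ 2 * Real.log z := by
    have : Real.log 4 = 2 * Real.log 2 := by
      rw [show (4:ℝ) = 2 ^ 2 by norm_num, Real.log_pow]; norm_num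
    rw [this]
    have : Real.log 2 ≤ Real.log z := Real.log_le_log (by norm_num) (by exact_mod_cast hz)
    linarith
  calc _ ≤ Real.exp (-(u / 2)) / Real.log z ^ 2 * (3 * Real.log z) := by gcongr; linarith
    _ = _ := by field_simp

/-- The fundamental lemma of the sieve: the Selberg majorant is close to the rough numbers. -/
lemma sum_famz_sub_rough_le : ∃ C : ℝ, 1 ≤ C ∧ ∀ z D N : ℕ, 2 ≤ z → 1 ≤ D →
    8 ≤ Real.log D / Real.log z →
    ∑ k ∈ Ioc 0 N, (nu (famz z D) k / hh (famz z D) -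
      open Classical in if Rough z k then 1 else 0) ≤
      C * N * Real.exp (-(Real.log D / Real.log z / 2)) / Real.log z + C * z * D ^ 8 := by
  obtain ⟨C, hC, hsum⟩ := sum_nu_famz_div_le
  obtain ⟨C', hC', hcard⟩ := card_roughs_le
  refine ⟨8 * Real.exp 6 + C + C', by linarith [Real.exp_pos 6], fun z D N hz hD hu => ?_⟩
  set u := Real.log D / Real.log z with hu'
  set X := Real.exp (-(u / 2)) with hX
  have hl : 0 < Real.log z := Real.log_pos (by exact_mod_cast hz)
  have hv := vv_pos z
  rw [sum_sub_distrib, ← card_roughs_eq]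
  have h1 := hsum z D N hD
  have h2 := (inv_hh_famz_le hz hD hu).1
  have h3 : (N : ℝ) ≤ (roughs N z).card + ∑ p ∈ z.primesBelow, ((roughs (N / p) p).card : ℝ) := by
    exact_mod_cast le_card_roughs_add N z
  have h4 : ∑ p ∈ z.primesBelow, ((roughs (N / p) p).card : ℝ) ≤
      ∑ p ∈ z.primesBelow, (N * (vv p / p) + 2 * Real.exp 6 * N *
        (vv p / p * Real.exp (-(Real.log D / Real.log p))) + C' * D ^ 8) := by
    refine sum_le_sum fun p hp => ?_
    have hpp := Nat.prime_of_mem_primesBelow hp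
    have hpz := Nat.lt_of_mem_primesBelow hp
    have hp0 : (0:ℝ) < p := by exact_mod_cast hpp.pos
    have hlp : 0 < Real.log p := Real.log_pos (by exact_mod_cast hpp.one_lt)
    have hle : Real.log p ≤ Real.log z := Real.log_le_log hp0 (by exact_mod_cast hpz.le)
    have hD0 : 0 ≤ Real.log D := Real.log_natCast_nonneg D
    have hup : 8 ≤ Real.log D / Real.log p := hu.trans (div_le_div_of_nonneg_left hD0 hlp hle)
    have h5 := hcard p D (N / p) hD
    have h6 := (inv_hh_famz_le hpp.two_le hD hup).1
    have h7 : ((N / p : ℕ) : ℝ) ≤ N / p := Nat.cast_div_le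
    have h8 := (famz_sieveFamily (z := p) hD).one_le_hh
    calc _ ≤ _ := h5
      _ = ((N / p : ℕ) : ℝ) * (1 / hh (famz p D)) + C' * D ^ 8 := by ring
      _ ≤ (N / p) * (vv p *
          (1 + 2 * (Real.exp 6 * Real.exp (-(Real.log D / Real.log p))))) + C' * D ^ 8 := by
        gcongr
      _ = _ := by ring
  rw [sum_add_distrib, sum_add_distrib, ← mul_sum, ← mul_sum, sum_vv_div, sum_const,
    nsmul_eq_mul] at h4
  have h5 := sum_vv_mul_exp_le hz hu
  rw [← hu', ← hX] at h5
  have h6 : ((z.primesBelow).card : ℝ) * (C' * D ^ 8) ≤ C' * z * D ^ 8 := by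
    have : (z.primesBelow).card ≤ z := by
      have := card_filter_le (range z) Nat.Prime
      rw [card_range] at this; exact this
    have : ((z.primesBelow).card : ℝ) ≤ z := by exact_mod_cast this
    calc _ ≤ (z : ℝ) * (C' * D ^ 8) := by gcongr
      _ = _ := by ring
  have h7 : (N : ℝ) / hh (famz z D) ≤ N * vv z + 2 * Real.exp 6 * N * (X / Real.log z) := by
    have h8 : Real.exp (-u) ≤ X := Real.exp_le_exp.2 (by linarith)
    have h9 : vv z ≤ 1 / Real.log z := by rw [le_div_iff₀ hl]; exact vv_mul_log_le z
    calc (N : ℝ) / hh (famz z D) = N * (1 / hh (famz z D)) := by ring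
      _ ≤ N * (vv z * (1 + 2 * (Real.exp 6 * Real.exp (-u)))) := by gcongr
      _ = N * vv z + 2 * Real.exp 6 * N * (Real.exp (-u) * vv z) := by ring
      _ ≤ N * vv z + 2 * Real.exp 6 * N * (X * (1 / Real.log z)) := by gcongr
      _ = _ := by ring
  have h10 : 2 * Real.exp 6 * N * ∑ p ∈ z.primesBelow,
      vv p / p * Real.exp (-(Real.log D / Real.log p)) ≤
      2 * Real.exp 6 * N * (3 * X / Real.log z) := by gcongr
  have h11 : C * (D : ℝ) ^ 8 ≤ C * z * D ^ 8 := by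
    have : (1:ℝ) ≤ z := by exact_mod_cast (by omega : 1 ≤ z)
    have : C ≤ C * (z : ℝ) := le_mul_of_one_le_right (by linarith) this
    gcongr
  have h12 : 0 ≤ (C + C') * N * X / Real.log z := by positivity
  have h13 : 0 ≤ (8 * Real.exp 6) * z * (D:ℝ) ^ 8 := by positivity
  have h14 : (8 * Real.exp 6 + C + C') * N * X / Real.log z =
    2 * Real.exp 6 * N * (X / Real.log z) + 2 * Real.exp 6 * N * (3 * X / Real.log z) +
    (C + C') * N * X / Real.log z := by ring
  rw [h14]
  linarith

lemma exists_norm_eq_mul (w : ℂ) : ∃ c : ℂ, ‖c‖ ≤ 1 ∧ c * w = ‖w‖ := by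
  by_cases h : w = 0
  · exact ⟨0, by simp, by simp [h]⟩
  · have h0 : ((‖w‖ : ℝ) : ℂ) ≠ 0 := by exact_mod_cast norm_ne_zero_iff.2 h
    refine ⟨starRingEnd ℂ w / ‖w‖, ?_, ?_⟩
    · rw [norm_div, RCLike.norm_conj, Complex.norm_real, norm_norm,
        div_self (norm_ne_zero_iff.2 h)]
    · rw [div_mul_eq_mul_div, mul_comm, Complex.mul_conj, Complex.normSq_eq_norm_sq]
      field_simp
      push_cast; ring

/-- The dispersion estimate for bilinear sums with a sieve majorant. -/
lemma dispersion (𝒥 : Finset ℕ) (M : ℕ → ℕ) (y P : ℕ) (hM : ∀ j ∈ 𝒥, M j ≤ P) (b ν : ℕ → ℝ)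
    {H : ℝ} (hH : 0 < H) (hb : ∀ m, 0 ≤ b m) (hbν : ∀ m, H * b m ≤ ν m) (α : ℝ) :
    (∑ j ∈ 𝒥, ‖∑ m ∈ Ioc y (M j), (b m : ℂ) * e (α * j * m)‖) ^ 2 ≤
      (∑ m ∈ Ioc y P, ν m) / H ^ 2 * ∑ j ∈ 𝒥, ∑ j' ∈ 𝒥,
        ‖∑ m ∈ Ioc y (min (M j) (M j')), (ν m : ℂ) * e (α * ((j : ℝ) - j') * m)‖ := by
  have hν : ∀ m, 0 ≤ ν m := fun m => (mul_nonneg hH.le (hb m)).trans (hbν m)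
  choose c hc1 hc2 using fun j : ℕ =>
    exists_norm_eq_mul (∑ m ∈ Ioc y (M j), (b m : ℂ) * e (α * j * m))
  have hfilter : ∀ M' ≤ P, (Ioc y P).filter (fun m => m ≤ M') = Ioc y M' := by
    intro M' hM'
    ext m; simp only [mem_filter, mem_Ioc]; omega
  set G : ℕ → ℂ := fun m => ∑ j ∈ 𝒥, if m ≤ M j then c j * e (α * j * m) else 0 with hG
  have h1 : ((∑ j ∈ 𝒥, ‖∑ m ∈ Ioc y (M j), (b m : ℂ) * e (α * j * m)‖ : ℝ) : ℂ) =
      ∑ m ∈ Ioc y P, b m * G m := by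
    push_cast
    simp_rw [hG, mul_sum]
    rw [sum_comm]
    refine sum_congr rfl fun j hj => ?_
    rw [← hc2 j, mul_sum, ← hfilter _ (hM j hj), sum_filter]
    refine sum_congr rfl fun m _ => ?_
    split_ifs <;> ring
  have h2 : (∑ j ∈ 𝒥, ‖∑ m ∈ Ioc y (M j), (b m : ℂ) * e (α * j * m)‖) ≤
      (1 / H) * ∑ m ∈ Ioc y P, ν m * ‖G m‖ := by
    have h0 : 0 ≤ ∑ j ∈ 𝒥, ‖∑ m ∈ Ioc y (M j), (b m : ℂ) * e (α * j * m)‖ :=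
      sum_nonneg fun _ _ => norm_nonneg _
    rw [← Real.norm_of_nonneg h0, ← Complex.norm_real, h1, mul_sum]
    refine (norm_sum_le _ _).trans (sum_le_sum fun m _ => ?_)
    rw [norm_mul, Complex.norm_real, Real.norm_of_nonneg (hb m), ← mul_assoc]
    gcongr
    rw [one_div, ← div_eq_inv_mul, le_div_iff₀ hH, mul_comm]
    exact hbν m
  have h3 : (∑ m ∈ Ioc y P, ν m * ‖G m‖) ^ 2 ≤
      (∑ m ∈ Ioc y P, ν m) * ∑ m ∈ Ioc y P, ν m * ‖G m‖ ^ 2 :=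
    sum_sq_le_sum_mul_sum_of_sq_le_mul _ (fun m _ => hν m)
      (fun m _ => mul_nonneg (hν m) (sq_nonneg _)) fun m _ => (by ring : _ = _).le
  have h4 : ∑ m ∈ Ioc y P, ν m * ‖G m‖ ^ 2 ≤ ∑ j ∈ 𝒥, ∑ j' ∈ 𝒥,
      ‖∑ m ∈ Ioc y (min (M j) (M j')), (ν m : ℂ) * e (α * ((j : ℝ) - j') * m)‖ := by
    have h5 : ((∑ m ∈ Ioc y P, ν m * ‖G m‖ ^ 2 : ℝ) : ℂ) = ∑ j ∈ 𝒥, ∑ j' ∈ 𝒥,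
        c j * starRingEnd ℂ (c j') *
        ∑ m ∈ Ioc y (min (M j) (M j')), (ν m : ℂ) * e (α * ((j : ℝ) - j') * m) := by
      push_cast
      have h6 : ∀ m, (ν m : ℂ) * (‖G m‖ : ℂ) ^ 2 = ∑ j ∈ 𝒥, ∑ j' ∈ 𝒥,
          if m ≤ min (M j) (M j') then c j * starRingEnd ℂ (c j') *
            ((ν m : ℂ) * e (α * ((j : ℝ) - j') * m)) else 0 := by
        intro m
        have : (‖G m‖ : ℂ) ^ 2 = G m * starRingEnd ℂ (G m) := by
          rw [Complex.mul_conj, Complex.normSq_eq_norm_sq]; push_cast; rfl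
        rw [this, hG, map_sum, sum_mul_sum, mul_sum]
        refine sum_congr rfl fun j _ => ?_
        rw [mul_sum]
        refine sum_congr rfl fun j' _ => ?_
        by_cases ha : m ≤ M j <;> by_cases hb : m ≤ M j' <;> simp [ha, hb]
        rw [show α * ((j : ℝ) - j') * m = α * j * m - α * j' * m by ring, e_sub]
        ring
      simp_rw [h6]
      rw [sum_comm]
      refine sum_congr rfl fun j hj => ?_
      rw [sum_comm]
      refine sum_congr rfl fun j' hj' => ?_
      rw [mul_sum, ← hfilter (min (M j) (M j')) ((min_le_left _ _).trans (hM j hj)), sum_filter]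
    have h0 : 0 ≤ ∑ m ∈ Ioc y P, ν m * ‖G m‖ ^ 2 :=
      sum_nonneg fun m _ => mul_nonneg (hν m) (sq_nonneg _)
    rw [← Real.norm_of_nonneg h0, ← Complex.norm_real, h5]
    refine (norm_sum_le _ _).trans (sum_le_sum fun j _ => (norm_sum_le _ _).trans
      (sum_le_sum fun j' _ => ?_))
    rw [norm_mul, norm_mul, RCLike.norm_conj]
    refine mul_le_of_le_one_left (norm_nonneg _) ?_
    exact mul_le_one₀ (hc1 j) (norm_nonneg _) (hc1 j')
  have h0 : 0 ≤ ∑ m ∈ Ioc y P, ν m := sum_nonneg fun m _ => hν m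
  calc _ ≤ ((1 / H) * ∑ m ∈ Ioc y P, ν m * ‖G m‖) ^ 2 := by
        gcongr
    _ = 1 / H ^ 2 * (∑ m ∈ Ioc y P, ν m * ‖G m‖) ^ 2 := by rw [mul_pow]; ring
    _ ≤ 1 / H ^ 2 * ((∑ m ∈ Ioc y P, ν m) * ∑ m ∈ Ioc y P, ν m * ‖G m‖ ^ 2) := by gcongr
    _ = (∑ m ∈ Ioc y P, ν m) / H ^ 2 * ∑ m ∈ Ioc y P, ν m * ‖G m‖ ^ 2 := by ring
    _ ≤ _ := mul_le_mul_of_nonneg_left h4 (by positivity)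

/-- If many differences `j - j₁` from a short interval make `(j - j₁) θ` nearly integral, then they
are all multiples of the denominator of a good rational approximation to `θ`. -/
lemma common_denominator {𝒥 : Finset ℕ} {j₁ : ℕ} {θ X δ : ℝ} (hX : 0 ≤ X) (hδ : 0 ≤ δ)
    (hcard : 2 ≤ 𝒥.card)
    (hInt : ∃ x₀ : ℝ, ∀ j ∈ 𝒥, x₀ ≤ j ∧ (j : ℝ) ≤ x₀ + X)
    (hdist : ∀ j ∈ 𝒥, |(j : ℝ) - j₁| ≤ X)
    (happ : ∀ j ∈ 𝒥, ∃ k : ℤ, |((j : ℝ) - j₁) * θ - k| ≤ δ)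
    (hsmall : 2 * X / (𝒥.card - 1) * δ + 2 * X * δ < 1) :
    ∃ r : ℕ, 1 ≤ r ∧ ∃ a : ℤ, (r : ℝ) ≤ 2 * X / (𝒥.card - 1) ∧
      ∀ j ∈ 𝒥, (r : ℤ) ∣ (j : ℤ) - j₁ ∧ |(j : ℝ) - j₁| * |r * θ - a| ≤ r * δ := by
  set w := 2 * X / ((𝒥.card : ℝ) - 1) with hw
  have hc1 : (1 : ℝ) ≤ (𝒥.card : ℝ) - 1 := by
    have : (2 : ℝ) ≤ 𝒥.card := by exact_mod_cast hcard
    linarith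
  have hpair : ∃ i ∈ 𝒥, ∃ j ∈ 𝒥, i < j ∧ ((j : ℝ) - i) ≤ w := by
    obtain ⟨x₀, hx₀⟩ := hInt
    have hXpos : 0 < X := by
      obtain ⟨i, hi, j, hj, hij⟩ := one_lt_card.1 (by omega : 1 < 𝒥.card)
      refine hX.lt_of_ne fun h0 => hij ?_
      have h1 := hx₀ i hi
      have h2 := hx₀ j hj
      rw [← h0] at h1 h2
      have : (i : ℝ) = j := by linarith
      exact_mod_cast this
    have hwpos : 0 < w := by positivity
    have hmap : ∀ j ∈ 𝒥, ⌊((j : ℝ) - x₀) / w⌋₊ ∈ range (𝒥.card - 1) := by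
      intro j hj
      have h1 := hx₀ j hj
      rw [mem_range, Nat.floor_lt (div_nonneg (by linarith) hwpos.le), div_lt_iff₀ hwpos]
      have h2 : ((𝒥.card - 1 : ℕ) : ℝ) = (𝒥.card : ℝ) - 1 := by
        rw [Nat.cast_sub (by omega)]; simp
      rw [h2, hw]
      field_simp
      linarith
    obtain ⟨i, hi, j, hj, hij, hf⟩ :=
      exists_ne_map_eq_of_card_lt_of_maps_to (by rw [card_range]; omega) hmap
    have key : ∀ i ∈ 𝒥, ∀ j : ℕ, ⌊((i : ℝ) - x₀) / w⌋₊ = ⌊((j : ℝ) - x₀) / w⌋₊ →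
        (j : ℝ) - i ≤ w := by
      intro i hi j hf
      have h1 := hx₀ i hi
      have h3 := Nat.floor_le (div_nonneg (sub_nonneg.2 h1.1) hwpos.le)
      have h4 := Nat.lt_floor_add_one (((j : ℝ) - x₀) / w)
      rw [← hf] at h4
      have h5 : ((j : ℝ) - x₀) / w < ((i : ℝ) - x₀) / w + 1 := by linarith
      rw [div_add_one hwpos.ne', div_lt_div_iff_of_pos_right hwpos] at h5
      linarith
    rcases lt_or_gt_of_ne hij with h | h
    · exact ⟨i, hi, j, hj, h, key i hi j hf⟩
    · exact ⟨j, hj, i, hi, h, key j hj i hf.symm⟩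
  have hex : ∃ r : ℕ, 1 ≤ r ∧ ∃ a : ℤ, |(r : ℝ) * θ - a| ≤ 2 * δ := by
    obtain ⟨i, hi, j, hj, hij, -⟩ := hpair
    obtain ⟨k, hk⟩ := happ i hi
    obtain ⟨l, hl⟩ := happ j hj
    refine ⟨j - i, by omega, l - k, ?_⟩
    rw [Nat.cast_sub hij.le]
    push_cast
    rw [show ((j : ℝ) - i) * θ - (l - k) = (((j : ℝ) - j₁) * θ - l) - (((i : ℝ) - j₁) * θ - k) by
      ring]
    exact (abs_sub _ _).trans (by linarith)
  classical
  obtain ⟨hr1, a, ha⟩ := Nat.find_spec hex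
  set r := Nat.find hex with hr
  have hrw : (r : ℝ) ≤ w := by
    obtain ⟨i, hi, j, hj, hij, hle⟩ := hpair
    obtain ⟨k, hk⟩ := happ i hi
    obtain ⟨l, hl⟩ := happ j hj
    have : r ≤ j - i := by
      refine Nat.find_min' hex ⟨by omega, l - k, ?_⟩
      rw [Nat.cast_sub hij.le]
      push_cast
      rw [show ((j : ℝ) - i) * θ - (l - k) =
        (((j : ℝ) - j₁) * θ - l) - (((i : ℝ) - j₁) * θ - k) by ring]
      exact (abs_sub _ _).trans (by linarith)
    have h2 : (r : ℝ) ≤ ((j - i : ℕ) : ℝ) := by exact_mod_cast this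
    rw [Nat.cast_sub hij.le] at h2
    linarith
  have hcop : IsCoprime (r : ℤ) a := by
    rw [Int.isCoprime_iff_gcd_eq_one]
    set g := Int.gcd r a with hg
    have hg0 : 0 < g := Int.gcd_pos_of_ne_zero_left _ (by omega)
    obtain ⟨r', hr'⟩ : (g : ℤ) ∣ r := Int.gcd_dvd_left ..
    obtain ⟨a', ha'⟩ : (g : ℤ) ∣ a := Int.gcd_dvd_right ..
    have hr'0 : 0 < r' := by
      by_contra hn
      have : (g : ℤ) * r' ≤ 0 := mul_nonpos_of_nonneg_of_nonpos (by omega) (by omega)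
      omega
    lift r' to ℕ using hr'0.le
    have hle : r ≤ r' := by
      refine Nat.find_min' hex ⟨by omega, a', ?_⟩
      have e1 : (r : ℝ) = g * r' := by exact_mod_cast hr'
      have e2 : (a : ℝ) = g * a' := by exact_mod_cast ha'
      rw [e1, e2, mul_assoc, ← mul_sub, abs_mul] at ha
      have h3 : (1 : ℝ) ≤ |(g : ℝ)| := by
        rw [abs_of_nonneg (Nat.cast_nonneg g)]; exact_mod_cast hg0
      nlinarith [abs_nonneg ((r' : ℝ) * θ - a')]
    have h4 : r = g * r' := by exact_mod_cast hr'
    nlinarith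
  refine ⟨r, hr1, a, hrw, fun j hj => ?_⟩
  obtain ⟨k, hk⟩ := happ j hj
  have hr0 : (0 : ℝ) ≤ r := Nat.cast_nonneg r
  have hlt : |(r : ℝ) * k - ((j : ℝ) - j₁) * a| < 1 := by
    rw [show (r : ℝ) * k - ((j : ℝ) - j₁) * a = ((j : ℝ) - j₁) * (r * θ - a) -
      r * (((j : ℝ) - j₁) * θ - k) by ring]
    refine (abs_sub _ _).trans_lt ?_
    rw [abs_mul, abs_mul, abs_of_nonneg hr0]
    have h1 : |(j : ℝ) - j₁| * |r * θ - a| ≤ X * (2 * δ) :=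
      mul_le_mul (hdist j hj) ha (abs_nonneg _) hX
    have h2 : r * |((j : ℝ) - j₁) * θ - k| ≤ w * δ :=
      mul_le_mul hrw hk (abs_nonneg _) (hr0.trans hrw)
    linarith
  have heq : (r : ℤ) * k = ((j : ℤ) - j₁) * a := by
    have : |(r : ℤ) * k - ((j : ℤ) - j₁) * a| < 1 := by exact_mod_cast hlt
    have := Int.abs_lt_one_iff.1 this
    omega
  refine ⟨hcop.dvd_of_dvd_mul_right ⟨k, heq.symm⟩, ?_⟩
  have heq' : (r : ℝ) * k = ((j : ℝ) - j₁) * a := by exact_mod_cast heq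
  rw [← abs_mul, show ((j : ℝ) - j₁) * (r * θ - a) = r * (((j : ℝ) - j₁) * θ - k) by
    linear_combination heq', abs_mul, abs_of_nonneg hr0]
  gcongr

lemma le_of_totient_le (B : ℝ) : ∃ B' : ℕ, 1 ≤ B' ∧ ∀ r : ℕ, 1 ≤ r → (r.totient : ℝ) ≤ B → r ≤ B' := by
  obtain ⟨C, hC, h⟩ := exists_coeff_bound (ε := 1 / 2) (by norm_num)
  refine ⟨⌊(B * C) ^ 2⌋₊ + 1, by omega, fun r hr hB => ?_⟩
  have hp : ∀ p ∈ r.primeFactors, p.Prime := fun p hp => Nat.prime_of_mem_primeFactors hp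
  have h1 := h r.primeFactors hp
  have hph := ph_pos hp
  have hr0 : (0:ℝ) < r := by exact_mod_cast hr
  have hphi0 : (0:ℝ) < r.totient := by exact_mod_cast Nat.totient_pos.2 hr
  have hB0 : 0 < B := hphi0.trans_le hB
  have hnn : (0:ℝ) < nn r.primeFactors := by exact_mod_cast nn_pos hp
  have hnr : (nn r.primeFactors : ℝ) ≤ r := by
    exact_mod_cast Nat.le_of_dvd hr (Nat.prod_primeFactors_dvd r)
  have h2 : (nn r.primeFactors : ℝ) / ph r.primeFactors = r / r.totient := by
    have h3 : (r.totient : ℝ) * nn r.primeFactors = r * ph r.primeFactors := by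
      have h4 := Nat.totient_mul_prod_primeFactors r
      have h5 : (r.totient : ℝ) * ((∏ p ∈ r.primeFactors, p : ℕ) : ℝ) =
        r * ((∏ p ∈ r.primeFactors, (p - 1) : ℕ) : ℝ) := by exact_mod_cast h4
      rw [nn, ph, h5, Nat.cast_prod]
      congr 1
      refine prod_congr rfl fun p hp' => ?_
      rw [Nat.cast_sub (hp p hp').one_le, Nat.cast_one]
    rw [div_eq_div_iff hph.ne' hphi0.ne']; linarith
  have h6 : (1 : ℝ) / ph r.primeFactors ≤
      C * (nn r.primeFactors : ℝ) ^ (1 / 2 : ℝ) / nn r.primeFactors := by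
    refine le_trans ?_ h1
    gcongr
    exact one_le_pow₀ (by norm_num)
  rw [div_le_div_iff₀ hph hnn] at h6
  have h7 : (r : ℝ) / r.totient ≤ C * Real.sqrt r := by
    rw [← h2, div_le_iff₀ hph, Real.sqrt_eq_rpow]
    rw [one_mul] at h6
    refine h6.trans ?_
    gcongr
  have h8 : (r : ℝ) ≤ B * C * Real.sqrt r := by
    rw [div_le_iff₀ hphi0] at h7
    calc (r : ℝ) ≤ C * Real.sqrt r * r.totient := h7
      _ ≤ C * Real.sqrt r * B := by gcongr
      _ = _ := by ring
  have h9 : Real.sqrt r ≤ B * C := by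
    have hs : 0 < Real.sqrt r := Real.sqrt_pos.2 hr0
    have : Real.sqrt r * Real.sqrt r = r := Real.mul_self_sqrt hr0.le
    nlinarith
  have h10 : (r : ℝ) ≤ (B * C) ^ 2 := by
    rw [← Real.sq_sqrt hr0.le]; gcongr
  exact (Nat.le_floor h10).trans (by omega)

/-- Brun–Titchmarsh for rough numbers in a progression. -/
lemma card_rough_progression_le : ∃ C : ℝ, 1 ≤ C ∧ ∀ (R r j₁ : ℕ) (X : ℝ) (𝒥 : Finset ℕ),
    2 ≤ R → 1 ≤ r → 0 ≤ X →
    (∀ j ∈ 𝒥, Rough (R + 1) j ∧ |(j : ℝ) - j₁| ≤ X ∧ (r : ℤ) ∣ (j : ℤ) - j₁) →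
    (𝒥.card : ℝ) ≤ 2 * X / (r.totient * Real.log R) + C * R ^ 8 := by
  obtain ⟨C, hC, h⟩ := sum_nu_le_and_fourier
  refine ⟨C + 1, by linarith, fun R r j₁ X 𝒥 hR hr hX h𝒥 => ?_⟩
  have hl : 0 < Real.log R := Real.log_pos (by exact_mod_cast hR)
  have hR1 : (1:ℝ) ≤ R := by exact_mod_cast (by omega : 1 ≤ R)
  have hphi0 : (0:ℝ) < r.totient := by exact_mod_cast Nat.totient_pos.2 hr
  have hr0 : (0:ℝ) < r := by exact_mod_cast hr
  rcases 𝒥.eq_empty_or_nonempty with rfl | hne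
  · simp only [card_empty, Nat.cast_zero]; positivity
  set m := 𝒥.min' hne with hm
  have hmem : m ∈ 𝒥 := 𝒥.min'_mem hne
  set z := ⌊2 * X / r⌋₊ with hz
  have hfam := famW_sieveFamily (W := r) (R := R) (by omega)
  have h1 := (h hfam (by omega) m 0 z).1
  have hH := hfam.one_le_hh
  have hle := le_hh_famW hr R
  have hcard : ((𝒥.card : ℝ) - 1) * hh (famW r R) ≤ ∑ n ∈ Ioc 0 z, nu (famW r R) (r * n + m) := by
    have hsub : 𝒥.erase m ⊆ ((Ioc 0 z).filter
        (fun n => nu (famW r R) (r * n + m) = hh (famW r R))).image fun n => r * n + m := by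
      intro j hj
      rw [mem_erase] at hj
      have hmj : m < j := lt_of_le_of_ne (𝒥.min'_le j hj.2) (Ne.symm hj.1)
      obtain ⟨k, hk⟩ : (r : ℤ) ∣ (j : ℤ) - m := by
        have := dvd_sub (h𝒥 j hj.2).2.2 (h𝒥 m hmem).2.2
        rwa [sub_sub_sub_cancel_right] at this
      have hk0 : 0 < k := by
        by_contra hn
        have : (r : ℤ) * k ≤ 0 := mul_nonpos_of_nonneg_of_nonpos (by omega) (by omega)
        omega
      lift k to ℕ using hk0.le
      have hjk : r * k + m = j := by
        have : ((r * k + m : ℕ) : ℤ) = j := by push_cast; linarith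
        exact_mod_cast this
      rw [mem_image]
      refine ⟨k, mem_filter.2 ⟨mem_Ioc.2 ⟨by omega, Nat.le_floor ?_⟩, ?_⟩, hjk⟩
      · rw [le_div_iff₀ hr0]
        have h2 := (h𝒥 j hj.2).2.1
        have h3 := (h𝒥 m hmem).2.1
        rw [abs_le] at h2 h3
        have : (r : ℝ) * k + m = j := by exact_mod_cast hjk
        linarith
      · refine hfam.nu_eq_hh fun T hT p hp hpd => ?_
        rw [hjk] at hpd
        have hpp := famW_sieveFamily_prime T hT p hp
        have h2 := (h𝒥 j hj.2).1 p hpp hpd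
        have h3 : p ≤ nn T := by
          refine Nat.le_of_dvd (nn_pos (famW_sieveFamily_prime T hT)) (dvd_prod_of_mem _ hp)
        have := hfam.le T hT
        omega
    have hc := (card_le_card hsub).trans card_image_le
    rw [card_erase_of_mem hmem] at hc
    have hc' : (𝒥.card : ℝ) - 1 ≤ ((Ioc 0 z).filter
        (fun n => nu (famW r R) (r * n + m) = hh (famW r R))).card := by
      have : ((𝒥.card - 1 : ℕ) : ℝ) = (𝒥.card : ℝ) - 1 := by
        rw [Nat.cast_sub (card_pos.2 hne), Nat.cast_one]
      rw [← this]; exact_mod_cast hc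
    calc _ ≤ (((Ioc 0 z).filter
        (fun n => nu (famW r R) (r * n + m) = hh (famW r R))).card : ℝ) * hh (famW r R) := by
          gcongr
      _ = ∑ n ∈ (Ioc 0 z).filter (fun n => nu (famW r R) (r * n + m) = hh (famW r R)),
          nu (famW r R) (r * n + m) := by
        rw [← nsmul_eq_mul, ← sum_const]
        exact sum_congr rfl fun n hn => (mem_filter.1 hn).2.symm
      _ ≤ _ := sum_le_sum_of_subset_of_nonneg (filter_subset _ _)
          fun n _ _ => hfam.nu_nonneg _
  have hz' : (z : ℝ) ≤ 2 * X / r := Nat.floor_le (by positivity)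
  rw [tsub_zero] at h1
  have h2 : (r.totient : ℝ) / r * Real.log R ≤ hh (famW r R) := by
    refine le_trans ?_ hle
    gcongr
    linarith
  have h3 : (𝒥.card : ℝ) - 1 ≤ (2 * X / r + C * R ^ 8) / hh (famW r R) := by
    rw [le_div_iff₀ (by linarith)]; linarith
  have h4 : 2 * X / r / hh (famW r R) ≤ 2 * X / (r.totient * Real.log R) := by
    calc _ ≤ 2 * X / r / ((r.totient : ℝ) / r * Real.log R) := by gcongr
      _ = _ := by field_simp
  have h5 : C * (R:ℝ) ^ 8 / hh (famW r R) ≤ C * R ^ 8 := div_le_self (by positivity) hH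
  rw [add_div] at h3
  have h6 : (1:ℝ) ≤ R ^ 8 := one_le_pow₀ hR1
  linarith

/-- `α` lies within `K / (r N)` of a rational with denominator `r ≤ Q`. -/
def NearRational (Q K : ℝ) (N : ℕ) (α : ℝ) : Prop :=
  ∃ r : ℕ, 1 ≤ r ∧ (r : ℝ) ≤ Q ∧ ∃ a : ℤ, |r * α - a| ≤ K / N

lemma NearRational.mono {Q K Q' K' : ℝ} {N : ℕ} {α : ℝ} (h : NearRational Q K N α) (hQ : Q ≤ Q')
    (hK : K ≤ K') : NearRational Q' K' N α := by
  obtain ⟨r, h1, h2, a, h3⟩ := h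
  exact ⟨r, h1, h2.trans hQ, a, h3.trans (by gcongr)⟩

/-- If the correlations of the majorant are large on a short block, then they are large for many
differences from a common element. -/
lemma exists_popular {𝒥 : Finset ℕ} {V : ℕ → ℕ → ℝ} {κ P U : ℝ} (hU : (𝒥.card : ℝ) ≤ U)
    (hV : ∀ i ∈ 𝒥, ∀ j ∈ 𝒥, V i j ≤ 2 * P) (hP : 0 < P) (hκ : 0 < κ) (hUpos : 0 < U)
    (hsum : 2 * κ * P * U ^ 2 < ∑ i ∈ 𝒥, ∑ j ∈ 𝒥, V i j) :
    ∃ i ∈ 𝒥, κ / 2 * U ≤ (𝒥.filter fun j => κ * P ≤ V i j).card := by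
  by_contra! hcon
  have h1 : ∀ i ∈ 𝒥, ∑ j ∈ 𝒥, V i j ≤ 2 * κ * P * U := by
    intro i hi
    rw [← sum_filter_add_sum_filter_not 𝒥 (fun j => κ * P ≤ V i j)]
    have h2 : ∑ j ∈ 𝒥.filter (fun j => κ * P ≤ V i j), V i j ≤ κ / 2 * U * (2 * P) := by
      refine (sum_le_card_nsmul _ _ (2 * P) fun j hj => hV i hi j (mem_filter.1 hj).1).trans ?_
      rw [nsmul_eq_mul]
      exact mul_le_mul_of_nonneg_right (hcon i hi).le (by positivity)
    have h3 : ∑ j ∈ 𝒥.filter (fun j => ¬ κ * P ≤ V i j), V i j ≤ U * (κ * P) := by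
      refine (sum_le_card_nsmul _ _ (κ * P) fun j hj => (not_le.1 (mem_filter.1 hj).2).le).trans ?_
      rw [nsmul_eq_mul]
      refine mul_le_mul_of_nonneg_right (le_trans ?_ hU) (by positivity)
      exact_mod_cast card_filter_le _ _
    linarith
  have h2 := sum_le_card_nsmul 𝒥 _ _ h1
  rw [nsmul_eq_mul] at h2
  have h3 : (𝒥.card : ℝ) * (2 * κ * P * U) ≤ U * (2 * κ * P * U) := by gcongr
  linarith

set_option maxHeartbeats 2000000 in
/-- Bilinear sums over a short block of rough numbers. -/
lemma type_two_block {ε : ℝ} (hε : 0 < ε) : ∃ L Q K : ℝ, ∃ R₀ : ℕ, 1 ≤ L ∧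
    ∀ (R N : ℕ) (J α : ℝ) (𝒥 : Finset ℕ) (b : ℕ → ℝ) (y : ℕ), R₀ ≤ R → 1 ≤ J → J ^ 2 ≤ N →
    ¬ NearRational Q K N α →
    (∀ j ∈ 𝒥, J ≤ j ∧ (j : ℝ) ≤ J + J / L ∧ 2 ≤ j ∧ Rough (R ^ 16) j) →
    (∀ m, 0 ≤ b m ∧ b m ≤ 1 ∧ (b m ≠ 0 → Rough (R ^ 16) m)) →
    ∑ j ∈ 𝒥, ‖∑ m ∈ Ioc y (N / j), (b m : ℂ) * e (α * j * m)‖ ≤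
      ε * N / (L * Real.log R ^ 2) := by
  obtain ⟨C₁, hC₁, hsieve⟩ := sum_nu_le_and_fourier
  obtain ⟨C₂, hC₂, hcount⟩ := card_rough_progression_le
  set κ := ε ^ 2 / 36 with hκ
  have hκ0 : 0 < κ := by positivity
  obtain ⟨B, hB1, hB⟩ := le_of_totient_le (2 / κ)
  set Q₁ := (⌊C₁ / κ ^ 2⌋₊).factorial with hQ₁
  have hQ₁0 : 1 ≤ Q₁ := Nat.factorial_pos _
  have hQ₁R : (1:ℝ) ≤ Q₁ := by exact_mod_cast hQ₁0
  set K' := Q₁ * (C₁ / κ ^ 2) with hK'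
  have hK'0 : 0 < K' := by positivity
  set L := 8 * K' + 1 with hL
  have hL1 : 1 ≤ L := by linarith
  set T := 2 * C₁ + 2 * C₁ / κ + C₂ * L + 2 * C₂ * L / κ + 12 * K' / κ + 2 * L / κ with hT
  have hT0 : 0 < T := by positivity
  refine ⟨L, B * Q₁, 2 * B * K' * L / κ, ⌈2 * T⌉₊ + 3, hL1,
    fun R N J α 𝒥 b y hR hJ1 hJN hα h𝒥 hb => ?_⟩
  have hRT : 2 * T ≤ R := (Nat.le_ceil _).trans (by exact_mod_cast (by omega : ⌈2 * T⌉₊ ≤ R))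
  have hR3 : 3 ≤ R := by omega
  have hR3' : (3:ℝ) ≤ R := by exact_mod_cast hR3
  set l := Real.log R with hl
  have hl1 : 1 ≤ l := by
    rw [hl, Real.le_log_iff_exp_le (by linarith)]
    linarith [Real.exp_one_lt_d9]
  have hlR : l ≤ R := (Real.log_le_sub_one_of_pos (by linarith)).trans (by linarith)
  clear_value T L K' Q₁ κ l
  rcases 𝒥.eq_empty_or_nonempty with rfl | ⟨j₀, hj₀⟩
  · simp only [sum_empty]; positivity
  by_contra! hcon
  -- size of the block
  have hJ0 : 0 < J := by linarith
  have hJR : (R : ℝ) ^ 16 / 2 ≤ J := by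
    obtain ⟨h1, h2, h3, h4⟩ := h𝒥 j₀ hj₀
    have h5 : R ^ 16 ≤ j₀ := (h4 _ (Nat.minFac_prime (by omega)) (Nat.minFac_dvd _)).trans
      (Nat.minFac_le (by omega))
    have h6 : (R : ℝ) ^ 16 ≤ j₀ := by exact_mod_cast h5
    have : J / L ≤ J := div_le_self hJ0.le hL1
    linarith
  have hJT : T * R ^ 8 * l ≤ J := by
    have h1 : (R : ℝ) ≤ R ^ 7 := le_self_pow₀ (by linarith) (by norm_num)
    have h2 : 2 * T * l ≤ R ^ 7 * R := mul_le_mul (hRT.trans h1) hlR (by linarith) (by positivity)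
    have h3 : 2 * T * l * R ^ 8 ≤ R ^ 7 * R * R ^ 8 := by gcongr
    have h4 : (R : ℝ) ^ 7 * R * R ^ 8 = R ^ 16 := by ring
    linarith
  set P : ℝ := N / J with hP
  have hPJ : P * J = N := by rw [hP]; field_simp
  have hJP : J ≤ P := by rw [hP, le_div_iff₀ hJ0, ← sq]; exact hJN
  have hP0 : 0 < P := by linarith
  have hTle : ∀ t, 0 ≤ t → t ≤ T → t * R ^ 8 * l ≤ J ∧ t * R ^ 8 ≤ J ∧ t * l ≤ J ∧ t ≤ J := by
    intro t ht htT
    have h8 : (1:ℝ) ≤ R ^ 8 := one_le_pow₀ (by linarith)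
    have h1 : t * R ^ 8 * l ≤ T * R ^ 8 * l := by gcongr
    have h2 : t * R ^ 8 * 1 ≤ t * R ^ 8 * l := by gcongr
    have h3 : t * 1 * l ≤ t * R ^ 8 * l := by gcongr
    have h4 : t * 1 ≤ t * l := by gcongr
    refine ⟨?_, ?_, ?_, ?_⟩ <;> linarith
  have p1 : 0 < C₁ / κ := by positivity
  have p2 : 0 < C₂ * L := by positivity
  have p3 : 0 < C₂ * L / κ := by positivity
  have p4 : 0 < K' / κ := by positivity
  have p5 : 0 < L / κ := by positivity
  have hT' : T = 2 * C₁ + 2 * (C₁ / κ) + C₂ * L + 2 * (C₂ * L / κ) + 12 * (K' / κ) +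
    2 * (L / κ) := by rw [hT]; ring
  have t1 := (hTle (2 * C₁) (by linarith) (by linarith)).2.1
  have t2 := (hTle (2 * (C₁ / κ)) (by linarith) (by linarith)).2.1
  have t3 := (hTle (C₂ * L) (by linarith) (by linarith)).1
  have t4 := (hTle (2 * (C₂ * L / κ)) (by linarith) (by linarith)).1
  have t5 := (hTle (12 * (K' / κ)) (by linarith) (by linarith)).2.2.1
  have t6 := (hTle (2 * (L / κ)) (by linarith) (by linarith)).2.2.1
  -- the majorant
  have hfam := famW_sieveFamily (W := 1) (R := R) (by omega)
  have hH : l ≤ hh (famW 1 R) := by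
    have h1 := le_hh_famW (W := 1) le_rfl R
    simp only [Nat.totient_one, Nat.cast_one, div_one, one_mul] at h1
    refine le_trans ?_ h1
    rw [hl]; gcongr; linarith
  have hrough : ∀ m, Rough (R ^ 16) m → Rough (R + 1) m := fun m h p hp hpm => by
    have := h p hp hpm
    have h2 : R ^ 2 ≤ R ^ 16 := Nat.pow_le_pow_right (by omega) (by norm_num)
    have h3 : R + 1 ≤ R ^ 2 := by clear * - hR3; nlinarith
    omega
  have hbν : ∀ m, l * b m ≤ nu (famW 1 R) m := by
    intro m
    obtain ⟨h1, h2, h3⟩ := hb m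
    by_cases h0 : b m = 0
    · rw [h0, mul_zero]; exact hfam.nu_nonneg m
    · rw [hfam.nu_eq_hh]
      · exact (mul_le_of_le_one_right (by linarith) h2).trans hH
      · intro S hS p hp hpm
        have h4 := hrough m (h3 h0) p (hfam.prime S hS p hp) hpm
        have h5 : p ≤ nn S := Nat.le_of_dvd (nn_pos (hfam.prime S hS)) (dvd_prod_of_mem _ hp)
        have := hfam.le S hS
        omega
  -- cardinality of the block
  set U := 3 * J / (L * l) with hU
  have hU0 : 0 < U := by positivity
  clear_value U P
  have hcard : (𝒥.card : ℝ) ≤ U := by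
    have h1 := hcount R 1 j₀ (J / L) 𝒥 (by omega) le_rfl (by positivity) fun j hj =>
      ⟨hrough j (h𝒥 j hj).2.2.2, by
        rw [abs_le]; constructor <;> linarith [(h𝒥 j hj).1, (h𝒥 j hj).2.1, (h𝒥 j₀ hj₀).1,
          (h𝒥 j₀ hj₀).2.1], by simp⟩
    rw [Nat.totient_one, Nat.cast_one, one_mul, ← hl] at h1
    have h2 : C₂ * R ^ 8 ≤ J / (L * l) := by
      rw [le_div_iff₀ (by positivity)]; linarith
    calc _ ≤ _ := h1
      _ ≤ 2 * (J / L) / l + J / (L * l) := by gcongr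
      _ = U := by rw [hU]; field_simp; norm_num
  -- dispersion
  set V : ℕ → ℕ → ℝ := fun i j => ‖∑ m ∈ Ioc y (min (N / j) (N / i)),
    (nu (famW 1 R) m : ℂ) * e (α * ((j : ℝ) - i) * m)‖ with hV
  have hM : ∀ j ∈ 𝒥, N / j ≤ ⌊P⌋₊ := by
    intro j hj
    refine Nat.le_floor (Nat.cast_div_le.trans ?_)
    rw [hP]
    gcongr
    exact (h𝒥 j hj).1
  have hνsum : ∀ z ≤ ⌊P⌋₊, ∑ m ∈ Ioc y z, nu (famW 1 R) m ≤ 2 * P := by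
    intro z hz
    have h1 := (hsieve hfam (by omega) 0 y z).1
    simp only [one_mul, add_zero] at h1
    have h2 : ((z - y : ℕ) : ℝ) ≤ P :=
      (by exact_mod_cast (by omega : z - y ≤ ⌊P⌋₊) : ((z - y : ℕ) : ℝ) ≤ (⌊P⌋₊ : ℕ)).trans
        (Nat.floor_le hP0.le)
    linarith
  have hdisp := dispersion 𝒥 (fun j => N / j) y ⌊P⌋₊ hM b (nu (famW 1 R)) (by linarith : 0 < l)
    (fun m => (hb m).1) hbν α
  have hsum : 2 * κ * P * U ^ 2 < ∑ i ∈ 𝒥, ∑ j ∈ 𝒥, V i j := by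
    have h1 : (ε * N / (L * l ^ 2)) ^ 2 < 2 * P / l ^ 2 * ∑ i ∈ 𝒥, ∑ j ∈ 𝒥, V i j := by
      refine lt_of_lt_of_le ?_ (hdisp.trans (mul_le_mul (div_le_div_of_nonneg_right
        (hνsum _ le_rfl) (by positivity)) (le_of_eq sum_comm)
        (sum_nonneg fun _ _ => sum_nonneg fun _ _ => norm_nonneg _) (by positivity)))
      gcongr
    have h2 : (ε * N / (L * l ^ 2)) ^ 2 = 2 * P / l ^ 2 * (2 * κ * P * U ^ 2) := by
      rw [hκ, hU, ← hPJ]; field_simp; ring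
    rw [h2] at h1
    exact lt_of_mul_lt_mul_left h1 (by positivity)
  have hVle : ∀ i ∈ 𝒥, ∀ j ∈ 𝒥, V i j ≤ 2 * P := by
    intro i hi j hj
    refine le_trans ((norm_sum_le _ _).trans (le_of_eq ?_))
      (hνsum (min (N / j) (N / i)) ((min_le_left _ _).trans (hM j hj)))
    refine sum_congr rfl fun m _ => ?_
    rw [norm_mul, norm_e, mul_one, Complex.norm_real, Real.norm_of_nonneg (hfam.nu_nonneg m)]
  obtain ⟨j₁, hj₁, hpop⟩ := exists_popular hcard hVle hP0 hκ0 hU0 hsum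
  set 𝒥₁ := 𝒥.filter fun j => κ * P ≤ V j₁ j with h𝒥₁
  have hsub : ∀ j ∈ 𝒥₁, j ∈ 𝒥 := fun j hj => (mem_filter.1 hj).1
  have hUJ : κ / 2 * U = 3 * κ / 2 * (J / (L * l)) := by rw [hU]; ring
  rw [hUJ] at hpop
  have hLl : 2 ≤ κ * (J / (L * l)) := by
    rw [mul_div_assoc', le_div_iff₀ (by positivity)]
    have := mul_le_mul_of_nonneg_left t6 hκ0.le
    have h2 : κ * (2 * (L / κ) * l) = 2 * (L * l) := by field_simp
    linarith
  have hcard2 : 2 ≤ 𝒥₁.card := by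
    have : (2:ℝ) ≤ 𝒥₁.card := by linarith
    exact_mod_cast this
  have hcard2' : (2:ℝ) ≤ 𝒥₁.card := by exact_mod_cast hcard2
  set δ := K' / P with hδ
  have happ : ∀ j ∈ 𝒥₁, ∃ k : ℤ, |((j : ℝ) - j₁) * (Q₁ * α) - k| ≤ δ := by
    intro j hj
    have h1 := (mem_filter.1 hj).2
    have h2 : ((min (N / j) (N / j₁) - y : ℕ) : ℝ) ≤ P := by
      have h3 : min (N / j) (N / j₁) - y ≤ ⌊P⌋₊ :=
        (Nat.sub_le _ _).trans ((min_le_left _ _).trans (hM j (hsub j hj)))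
      exact (by exact_mod_cast h3 : ((min (N / j) (N / j₁) - y : ℕ) : ℝ) ≤ (⌊P⌋₊ : ℕ)).trans
        (Nat.floor_le hP0.le)
    have h3 : C₁ * R ^ 8 ≤ κ * P / 2 := by
      have := mul_le_mul_of_nonneg_left t2 hκ0.le
      have h2 : κ * (2 * (C₁ / κ) * R ^ 8) = 2 * (C₁ * R ^ 8) := by field_simp
      have h4 : κ * J ≤ κ * P := mul_le_mul_of_nonneg_left hJP hκ0.le
      linarith
    obtain ⟨q, hq1, hq2, k, hk⟩ := (hsieve hfam (by omega) 0 y (min (N / j) (N / j₁))).2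
      (α * ((j : ℝ) - j₁)) κ P hκ0 h2 hP0 h3 (by simpa [hV] using h1)
    obtain ⟨t, ht⟩ : q ∣ Q₁ := hQ₁ ▸ Nat.dvd_factorial hq1 (Nat.le_floor hq2)
    have ht' : (Q₁ : ℝ) = q * t := by exact_mod_cast ht
    have htQ : (t : ℝ) ≤ Q₁ := by
      have : t ≤ Q₁ := by rw [ht]; exact Nat.le_mul_of_pos_left t hq1
      exact_mod_cast this
    refine ⟨t * k, ?_⟩
    push_cast
    rw [show ((j : ℝ) - j₁) * (Q₁ * α) - t * k = t * (q * (α * ((j : ℝ) - j₁)) - k) by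
      rw [ht']; ring, abs_mul, Nat.abs_cast]
    calc (t : ℝ) * |q * (α * ((j : ℝ) - j₁)) - k| ≤ Q₁ * (C₁ / (κ ^ 2 * P)) := by gcongr
      _ = δ := by rw [hδ, hK']; field_simp
  have hX : 2 * (J / L) / ((𝒥₁.card : ℝ) - 1) ≤ 3 * l / κ := by
    have h1 : 3 * κ / 4 * (J / (L * l)) ≤ (𝒥₁.card : ℝ) - 1 := by linarith
    calc _ ≤ 2 * (J / L) / (3 * κ / 4 * (J / (L * l))) := by gcongr
      _ = 8 / 3 * l / κ := by field_simp; norm_num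
      _ ≤ _ := by gcongr; norm_num
  have hδ0 : 0 < δ := by positivity
  clear_value δ
  have hdist : ∀ j ∈ 𝒥₁, |(j : ℝ) - j₁| ≤ J / L := by
    intro j hj
    have h1 := h𝒥 j (hsub j hj)
    have h2 := h𝒥 j₁ hj₁
    rw [abs_le]; constructor <;> linarith [h1.1, h1.2.1, h2.1, h2.2.1]
  obtain ⟨r, hr1, a, -, hr⟩ := common_denominator (𝒥 := 𝒥₁) (j₁ := j₁) (θ := Q₁ * α)
    (X := J / L) (δ := δ) (by positivity) hδ0.le hcard2
    ⟨J, fun j hj => ⟨(h𝒥 j (hsub j hj)).1, (h𝒥 j (hsub j hj)).2.1⟩⟩ hdist happ (by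
      have h1 : 3 * l / κ * δ ≤ 1 / 4 := by
        rw [hδ, mul_div_assoc', div_le_iff₀ hP0]
        have : 3 * l / κ * K' = 12 * (K' / κ) * l / 4 := by ring
        linarith
      have h2 : 2 * (J / L) * δ ≤ 1 / 4 := by
        have h3 : 2 * (J / L) * δ = J * (2 * K') / (L * P) := by rw [hδ]; field_simp
        rw [h3, div_le_iff₀ (by positivity)]
        have : J * (2 * K') ≤ P * (L / 4) := mul_le_mul hJP (by linarith) (by linarith) hP0.le
        linarith
      have h4 := mul_le_mul_of_nonneg_right hX hδ0.le
      linarith)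
  have hphi0 : (0:ℝ) < r.totient := by exact_mod_cast Nat.totient_pos.2 hr1
  have hsm : C₂ * R ^ 8 ≤ κ / 2 * (J / (L * l)) := by
    rw [mul_div_assoc', le_div_iff₀ (by positivity)]
    have := mul_le_mul_of_nonneg_left t4 hκ0.le
    have h2 : κ * (2 * (C₂ * L / κ) * R ^ 8 * l) = 2 * (C₂ * R ^ 8 * (L * l)) := by
      field_simp
    linarith
  have hcnt : ∀ X, 0 ≤ X → (∀ j ∈ 𝒥₁, |(j : ℝ) - j₁| ≤ X) →
      κ * (J / (L * l)) ≤ 2 * X / (r.totient * l) := by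
    intro X hX0 hXle
    have h1 := hcount R r j₁ X 𝒥₁ (by omega) hr1 hX0 fun j hj =>
      ⟨hrough j (h𝒥 j (hsub j hj)).2.2.2, hXle j hj, (hr j hj).1⟩
    rw [← hl] at h1
    linarith
  have hrB : r ≤ B := by
    refine hB r hr1 ?_
    have h1 := hcnt (J / L) (by positivity) hdist
    rw [le_div_iff₀ (by positivity)] at h1 ⊢
    have h2 : κ * (J / (L * l)) * (r.totient * l) = r.totient * κ * (J / L) := by field_simp
    rw [h2] at h1
    exact le_of_mul_le_mul_right h1 (by positivity)
  have hrB' : (r : ℝ) ≤ B := by exact_mod_cast hrB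
  refine hα ⟨r * Q₁, Nat.mul_pos hr1 hQ₁0, by push_cast; gcongr, a, ?_⟩
  push_cast
  rw [mul_assoc]
  set β := |r * (Q₁ * α) - a| with hβ
  have hN0 : (0:ℝ) < N := by rw [← hPJ]; positivity
  rcases (abs_nonneg (r * (Q₁ * α) - a)).eq_or_lt with h0 | hpos
  · rw [hβ, ← h0]; positivity
  rw [← hβ] at hpos
  have h1 := hcnt (r * δ / β) (by positivity) fun j hj => by
    rw [le_div_iff₀ hpos]; exact (hr j hj).2
  have hphi1 : (1:ℝ) ≤ r.totient := by exact_mod_cast Nat.totient_pos.2 hr1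
  have h2 : κ * (J / (L * l)) ≤ 2 * (B * δ / β) / (1 * l) := h1.trans (by gcongr)
  rw [hδ] at h2
  rw [le_div_iff₀ hN0, ← hPJ]
  have h3 : κ * (J / (L * l)) * (β * P * L * l / κ) = β * (P * J) := by field_simp
  have h4 : 2 * (B * (K' / P) / β) / (1 * l) * (β * P * L * l / κ) = 2 * B * K' * L / κ := by
    field_simp
  rw [← h3, ← h4]
  gcongr

open Classical in
/-- Bilinear sums over rough variables are small off the major arcs. -/
lemma type_two (S : ℕ) (hS : 1 ≤ S) {ε : ℝ} (hε : 0 < ε) : ∃ Q K : ℝ, ∃ R₀ : ℕ,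
    ∀ (R N : ℕ) (α : ℝ) (b : ℕ → ℝ) (y : ℕ), R₀ ≤ R → N ≤ R ^ S → ¬ NearRational Q K N α →
    (∀ m, 0 ≤ b m ∧ b m ≤ 1 ∧ (b m ≠ 0 → Rough (R ^ 16) m)) →
    ∑ j ∈ (Ioc 1 (Nat.sqrt N)).filter (Rough (R ^ 16)),
      ‖∑ m ∈ Ioc y (N / j), (b m : ℂ) * e (α * j * m)‖ ≤ ε * N / Real.log R := by
  obtain ⟨L, Q, K, R₀, hL, h⟩ := type_two_block (ε := ε / (3 * S)) (by positivity)
  refine ⟨Q, K, R₀ + 3, fun R N α b y hR hN hα hb => ?_⟩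
  have hR3 : (3:ℝ) ≤ R := by exact_mod_cast (by omega : 3 ≤ R)
  set l := Real.log R with hl
  have hl1 : 1 ≤ l := by
    rw [hl, Real.le_log_iff_exp_le (by linarith)]
    linarith [Real.exp_one_lt_d9]
  have hL0 : 0 < L := by linarith
  set ρ := 1 + 1 / L with hρ
  have hρ1 : 1 < ρ := by rw [hρ]; linarith [show 0 < 1 / L by positivity]
  have hlogρ : 1 / (2 * L) ≤ Real.log ρ := by
    refine le_trans ?_ (Real.one_sub_inv_le_log_of_pos (by linarith))
    rw [hρ, show 1 + 1 / L = (L + 1) / L by field_simp, inv_div, one_sub_div (by linarith)]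
    rw [div_le_div_iff₀ (by linarith) (by linarith)]
    linarith
  have hlogρ0 : 0 < Real.log ρ := lt_of_lt_of_le (by positivity) hlogρ
  set 𝒥 := (Ioc 1 (Nat.sqrt N)).filter (Rough (R ^ 16)) with h𝒥
  set t : ℕ → ℕ := fun j => ⌊Real.log j / Real.log ρ⌋₊ with ht
  have hS1 : (1:ℝ) ≤ S := by exact_mod_cast hS
  set I := ⌊2 * L * S * l⌋₊ with hI
  have hcard : ((range (I + 1)).card : ℝ) ≤ 3 * S * L * l := by
    rw [card_range]; push_cast
    have := Nat.floor_le (show 0 ≤ 2 * L * S * l by positivity)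
    have h1 : 1 ≤ L * S * l := by
      have := mul_le_mul (mul_le_mul hL hS1 (by norm_num) (by linarith)) hl1 (by norm_num)
        (by positivity)
      linarith
    rw [hI]; linarith
  have hmaps : ∀ j ∈ 𝒥, t j ∈ range (I + 1) := by
    intro j hj
    rw [h𝒥, mem_filter, mem_Ioc] at hj
    rw [mem_range, Nat.lt_succ_iff]
    refine Nat.floor_le_floor ?_
    have hj1 : (1:ℝ) ≤ j := by exact_mod_cast hj.1.1.le
    have hjN : (j:ℝ) ≤ (R:ℝ) ^ S := by
      exact_mod_cast (hj.1.2.trans (Nat.sqrt_le_self N)).trans hN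
    have h1 : Real.log j ≤ S * l := by
      rw [hl, ← Real.log_pow]
      exact Real.log_le_log (by linarith) hjN
    rw [div_le_iff₀ hlogρ0]
    calc Real.log j ≤ S * l := h1
      _ = 2 * L * S * l * (1 / (2 * L)) := by field_simp
      _ ≤ _ := by gcongr
  rw [← sum_fiberwise_of_maps_to hmaps]
  have hblock : ∀ i ∈ range (I + 1), ∑ j ∈ 𝒥 with t j = i,
      ‖∑ m ∈ Ioc y (N / j), (b m : ℂ) * e (α * j * m)‖ ≤ ε / (3 * S) * N / (L * l ^ 2) := by
    intro i _
    rcases (𝒥.filter fun j => t j = i).eq_empty_or_nonempty with h0 | ⟨j₀, hj₀⟩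
    · rw [h0, sum_empty]; positivity
    have key : ∀ j ∈ 𝒥.filter fun j => t j = i, ρ ^ i ≤ j ∧ (j:ℝ) ≤ ρ ^ i + ρ ^ i / L ∧ 2 ≤ j ∧
        Rough (R ^ 16) j := by
      intro j hj
      rw [mem_filter, h𝒥, mem_filter, mem_Ioc] at hj
      obtain ⟨⟨⟨hj1, hj2⟩, hj3⟩, hj4⟩ := hj
      have hj0 : (1:ℝ) ≤ j := by exact_mod_cast hj1.le
      have h5 : 0 ≤ Real.log j / Real.log ρ := div_nonneg (Real.log_nonneg hj0) hlogρ0.le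
      rw [ht] at hj4
      rw [Nat.floor_eq_iff h5, le_div_iff₀ hlogρ0, div_lt_iff₀ hlogρ0] at hj4
      refine ⟨?_, ?_, hj1, hj3⟩
      · rw [← Real.log_le_log_iff (by positivity) (by linarith), Real.log_pow]; exact hj4.1
      · rw [show ρ ^ i + ρ ^ i / L = ρ ^ (i + 1) by rw [pow_succ, hρ]; field_simp]
        rw [← Real.log_le_log_iff (by linarith) (by positivity), Real.log_pow]
        push_cast; exact hj4.2.le
    refine h R N (ρ ^ i) α _ b y (by omega) (one_le_pow₀ hρ1.le) ?_ hα key hb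
    have h1 := (key j₀ hj₀).1
    rw [mem_filter, h𝒥, mem_filter, mem_Ioc] at hj₀
    have h2 : (j₀:ℝ) ^ 2 ≤ N := by exact_mod_cast Nat.le_sqrt'.1 hj₀.1.1.2
    exact le_trans (by gcongr) h2
  refine (sum_le_card_nsmul _ _ _ hblock).trans ?_
  rw [nsmul_eq_mul]
  calc _ ≤ 3 * S * L * l * (ε / (3 * S) * N / (L * l ^ 2)) := by gcongr
    _ = _ := by field_simp

section

lemma sum_divisorsAntidiagonal_eq (F : ℕ → ℕ → ℂ) (N : ℕ) :
    ∑ n ∈ Ioc 0 N, ∑ x ∈ n.divisorsAntidiagonal, F x.1 x.2 =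
      ∑ x ∈ (Ioc 0 N ×ˢ Ioc 0 N).filter (fun x => x.1 * x.2 ≤ N), F x.1 x.2 := by
  trans ∑ n ∈ Ioc 0 N, ∑ x ∈ Ioc 0 N ×ˢ Ioc 0 N with x.1 * x.2 = n, F x.1 x.2
  · refine sum_congr rfl fun n hn => ?_
    rw [mem_Ioc] at hn
    rw [Nat.divisorsAntidiagonal_eq_prod_filter_of_le hn.1.ne' hn.2]
  · simp_rw [sum_filter]
    rw [sum_comm]
    exact sum_congr rfl fun _ _ => by simp_all

/-- The hyperbola method. -/
lemma sum_hyperbola (F : ℕ → ℕ → ℂ) (N : ℕ) :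
    ∑ x ∈ (Ioc 0 N ×ˢ Ioc 0 N).filter (fun x => x.1 * x.2 ≤ N), F x.1 x.2 =
      ∑ j ∈ Ioc 0 (Nat.sqrt N), ∑ m ∈ Ioc 0 (N / j), F j m +
        ∑ m ∈ Ioc 0 (Nat.sqrt N), ∑ j ∈ Ioc (Nat.sqrt N) (N / m), F j m := by
  rw [← sum_filter_add_sum_filter_not _ (fun x => x.1 ≤ Nat.sqrt N)]
  congr 1
  · rw [sum_sigma']
    refine sum_bij' (fun x _ => ⟨x.1, x.2⟩) (fun x _ => (x.1, x.2)) ?_ ?_ ?_ ?_ ?_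
    · rintro ⟨a, b⟩ h
      simp only [mem_filter, mem_product, mem_Ioc, mem_sigma] at h ⊢
      refine ⟨⟨h.1.1.1.1, h.2⟩, h.1.1.2.1, ?_⟩
      rw [Nat.le_div_iff_mul_le h.1.1.1.1, mul_comm]; exact h.1.2
    · rintro ⟨a, b⟩ h
      simp only [mem_filter, mem_product, mem_Ioc, mem_sigma] at h ⊢
      have h1 := h.2.2
      rw [Nat.le_div_iff_mul_le h.1.1, mul_comm] at h1
      exact ⟨⟨⟨⟨h.1.1, h.1.2.trans (Nat.sqrt_le_self N)⟩, h.2.1,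
        h.2.2.trans (Nat.div_le_self _ _)⟩, h1⟩, h.1.2⟩
    all_goals simp
  · rw [sum_sigma']
    refine sum_bij' (fun x _ => ⟨x.2, x.1⟩) (fun x _ => (x.2, x.1)) ?_ ?_ ?_ ?_ ?_
    · rintro ⟨a, b⟩ h
      simp only [mem_filter, mem_product, mem_Ioc, mem_sigma, not_le] at h ⊢
      refine ⟨⟨h.1.1.2.1, ?_⟩, h.2, ?_⟩
      · by_contra hb
        have h2 : (Nat.sqrt N + 1) * (Nat.sqrt N + 1) ≤ N :=
          (Nat.mul_le_mul h.2 (by omega)).trans h.1.2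
        exact absurd (Nat.lt_succ_sqrt N) (not_lt.2 h2)
      · rw [Nat.le_div_iff_mul_le h.1.1.2.1]; exact h.1.2
    · rintro ⟨a, b⟩ h
      simp only [mem_filter, mem_product, mem_Ioc, mem_sigma, not_le] at h ⊢
      have h1 := h.2.2
      rw [Nat.le_div_iff_mul_le h.1.1] at h1
      exact ⟨⟨⟨⟨by omega, h.2.2.trans (Nat.div_le_self _ _)⟩, h.1.1,
        h.1.2.trans (Nat.sqrt_le_self N)⟩, h1⟩, h.2.1⟩
    all_goals simp

open Classical in
/-- The indicator function of the rough numbers. -/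
noncomputable def rr (z k : ℕ) : ℝ := if Rough z k then 1 else 0

lemma rr_nonneg (z k : ℕ) : 0 ≤ rr z k := by unfold rr; split_ifs <;> norm_num

lemma rr_le_one (z k : ℕ) : rr z k ≤ 1 := by unfold rr; split_ifs <;> norm_num

lemma rr_ne_zero {z k : ℕ} (h : rr z k ≠ 0) : Rough z k := by
  unfold rr at h; by_contra h1; simp [h1] at h

lemma rr_mul (z j m : ℕ) : rr z (j * m) = rr z j * rr z m := by
  have : Rough z (j * m) ↔ Rough z j ∧ Rough z m := by
    refine ⟨fun h => ⟨fun p hp h1 => h p hp (h1.mul_right m), fun p hp h1 => h p hp (h1.mul_left j)⟩,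
      fun h p hp h1 => ?_⟩
    rcases hp.dvd_mul.1 h1 with h1 | h1
    exacts [h.1 p hp h1, h.2 p hp h1]
  unfold rr
  by_cases h1 : Rough z j <;> by_cases h2 : Rough z m <;> simp [this, h1, h2]

lemma rr_one (z : ℕ) : rr z 1 = 1 := by
  have : Rough z 1 := fun p hp h => absurd (Nat.dvd_one.1 h) hp.one_lt.ne'
  simp [rr, this]

open scoped ArithmeticFunction.vonMangoldt

lemma sum_rr_log_eq (z N : ℕ) (α : ℝ) :
    ∑ k ∈ Ioc 0 N, (rr z k * Real.log k : ℝ) * e (α * k) =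
      ∑ j ∈ Ioc 0 (Nat.sqrt N), ∑ m ∈ Ioc 0 (N / j),
        ((rr z j * rr z m * Λ m : ℝ) : ℂ) * e (α * j * m) +
      ∑ m ∈ Ioc 0 (Nat.sqrt N), ∑ j ∈ Ioc (Nat.sqrt N) (N / m),
        ((rr z j * rr z m * Λ m : ℝ) : ℂ) * e (α * j * m) := by
  rw [← sum_hyperbola (fun j m => ((rr z j * rr z m * Λ m : ℝ) : ℂ) * e (α * j * m)),
    ← sum_divisorsAntidiagonal_eq (fun j m => ((rr z j * rr z m * Λ m : ℝ) : ℂ) * e (α * j * m))]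
  refine sum_congr rfl fun k _ => ?_
  rw [← ArithmeticFunction.vonMangoldt_sum, ← Nat.sum_divisorsAntidiagonal' (fun _ i => Λ i),
    mul_sum, Complex.ofReal_sum, sum_mul]
  refine sum_congr rfl fun x hx => ?_
  rw [Nat.mem_divisorsAntidiagonal] at hx
  rw [← hx.1, rr_mul]
  push_cast
  rw [show α * ((x.1:ℝ) * x.2) = α * x.1 * x.2 by ring]

/-- The sum over prime powers of rough type is controlled by bilinear sums. -/
lemma norm_sum_rr_vonMangoldt_le {z N : ℕ} {α B : ℝ} (hN : 2 ≤ N)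
    (hB : ∀ (b : ℕ → ℝ) (y : ℕ), (∀ m, 0 ≤ b m ∧ b m ≤ 1 ∧ (b m ≠ 0 → Rough z m)) →
      ∑ j ∈ (Ioc 1 (Nat.sqrt N)).filter (fun j => rr z j ≠ 0),
        ‖∑ m ∈ Ioc y (N / j), (b m : ℂ) * e (α * j * m)‖ ≤ B) :
    ‖∑ m ∈ Ioc 0 N, (rr z m * Λ m : ℝ) * e (α * m)‖ ≤
      ‖∑ k ∈ Ioc 0 N, (rr z k * Real.log k : ℝ) * e (α * k)‖ + 2 * Real.log N * B := by
  have hs : 1 ≤ Nat.sqrt N := Nat.le_sqrt.2 (by omega)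
  have hlog : 0 < Real.log N := Real.log_pos (by exact_mod_cast hN)
  have hins : Ioc 0 (Nat.sqrt N) = insert 1 (Ioc 1 (Nat.sqrt N)) := by
    ext x; simp only [mem_Ioc, mem_insert]; omega
  have key := sum_rr_log_eq z N α
  have hΛlog : ∀ m ≤ N, 1 ≤ m → Λ m ≤ Real.log N := fun m hm h1 =>
    ArithmeticFunction.vonMangoldt_le_log.trans
      (Real.log_le_log (by exact_mod_cast h1) (by exact_mod_cast hm))
  have hT2 : ‖∑ j ∈ Ioc 1 (Nat.sqrt N), ∑ m ∈ Ioc 0 (N / j),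
      ((rr z j * rr z m * Λ m : ℝ) : ℂ) * e (α * j * m)‖ ≤ Real.log N * B := by
    set b : ℕ → ℝ := fun m => if m ∈ Ioc 0 N then rr z m * Λ m / Real.log N else 0 with hb
    have h1 := hB b 0 (fun m => by
      rw [hb]; dsimp only
      split_ifs with h
      · rw [mem_Ioc] at h
        refine ⟨div_nonneg (mul_nonneg (rr_nonneg _ _) ArithmeticFunction.vonMangoldt_nonneg) hlog.le,
          (div_le_one hlog).2 ?_, fun h2 => rr_ne_zero (z := z) fun h3 => h2 (by simp [h3])⟩
        calc _ ≤ 1 * Real.log N := mul_le_mul (rr_le_one _ _) (hΛlog m h.2 h.1)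
              ArithmeticFunction.vonMangoldt_nonneg zero_le_one
          _ = _ := one_mul _
      · simp)
    rw [sum_filter] at h1
    calc _ ≤ ∑ j ∈ Ioc 1 (Nat.sqrt N), ‖∑ m ∈ Ioc 0 (N / j),
        ((rr z j * rr z m * Λ m : ℝ) : ℂ) * e (α * j * m)‖ := norm_sum_le _ _
      _ ≤ ∑ j ∈ Ioc 1 (Nat.sqrt N), Real.log N * (if rr z j ≠ 0 then
          ‖∑ m ∈ Ioc 0 (N / j), (b m : ℂ) * e (α * j * m)‖ else 0) := by
        refine sum_le_sum fun j hj => ?_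
        split_ifs with h
        · have h2 : ∑ m ∈ Ioc 0 (N / j), ((rr z j * rr z m * Λ m : ℝ) : ℂ) * e (α * j * m) =
            (rr z j * Real.log N : ℝ) * ∑ m ∈ Ioc 0 (N / j), (b m : ℂ) * e (α * j * m) := by
            rw [mul_sum]
            refine sum_congr rfl fun m hm => ?_
            rw [mem_Ioc] at hm
            have h3 : m ∈ Ioc 0 N := mem_Ioc.2 ⟨hm.1, hm.2.trans (Nat.div_le_self _ _)⟩
            rw [hb]; simp only [h3, if_true]
            rw [← mul_assoc, ← Complex.ofReal_mul]
            congr 2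
            field_simp
          rw [h2, norm_mul, Complex.norm_real, Real.norm_of_nonneg
            (mul_nonneg (rr_nonneg _ _) hlog.le)]
          gcongr
          calc _ ≤ 1 * Real.log N := mul_le_mul_of_nonneg_right (rr_le_one _ _) hlog.le
            _ = _ := one_mul _
        · push Not at h
          simp [h]
      _ ≤ _ := by rw [← mul_sum]; gcongr
  have hT3 : ‖∑ m ∈ Ioc 0 (Nat.sqrt N), ∑ j ∈ Ioc (Nat.sqrt N) (N / m),
        ((rr z j * rr z m * Λ m : ℝ) : ℂ) * e (α * j * m)‖ ≤ Real.log N * B := by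
    have h1 := hB (rr z) (Nat.sqrt N) (fun m => ⟨rr_nonneg _ _, rr_le_one _ _, rr_ne_zero⟩)
    rw [sum_filter] at h1
    rw [hins, sum_insert (by simp), ArithmeticFunction.vonMangoldt_apply_one]
    simp only [mul_zero, Complex.ofReal_zero, zero_mul, sum_const_zero, zero_add]
    calc _ ≤ ∑ m ∈ Ioc 1 (Nat.sqrt N), ‖∑ j ∈ Ioc (Nat.sqrt N) (N / m),
        ((rr z j * rr z m * Λ m : ℝ) : ℂ) * e (α * j * m)‖ := norm_sum_le _ _
      _ ≤ ∑ m ∈ Ioc 1 (Nat.sqrt N), Real.log N * (if rr z m ≠ 0 then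
          ‖∑ j ∈ Ioc (Nat.sqrt N) (N / m), (rr z j : ℂ) * e (α * m * j)‖ else 0) := by
        refine sum_le_sum fun m hm => ?_
        rw [mem_Ioc] at hm
        split_ifs with h
        · have h2 : ∑ j ∈ Ioc (Nat.sqrt N) (N / m),
              ((rr z j * rr z m * Λ m : ℝ) : ℂ) * e (α * j * m) =
            (rr z m * Λ m : ℝ) * ∑ j ∈ Ioc (Nat.sqrt N) (N / m), (rr z j : ℂ) * e (α * m * j) := by
            rw [mul_sum]
            refine sum_congr rfl fun j _ => ?_
            rw [show α * j * m = α * m * j by ring]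
            push_cast; ring
          rw [h2, norm_mul, Complex.norm_real, Real.norm_of_nonneg
            (mul_nonneg (rr_nonneg _ _) ArithmeticFunction.vonMangoldt_nonneg)]
          gcongr
          calc _ ≤ 1 * Real.log N := mul_le_mul (rr_le_one _ _)
                (hΛlog m (hm.2.trans (Nat.sqrt_le_self N)) hm.1.le)
                ArithmeticFunction.vonMangoldt_nonneg zero_le_one
            _ = _ := one_mul _
        · push Not at h
          simp [h]
      _ ≤ _ := by rw [← mul_sum]; gcongr
  have hfirst : ∑ m ∈ Ioc 0 N, ((rr z m * Λ m : ℝ) : ℂ) * e (α * m) =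
      ∑ k ∈ Ioc 0 N, (rr z k * Real.log k : ℝ) * e (α * k)
      - ∑ j ∈ Ioc 1 (Nat.sqrt N), ∑ m ∈ Ioc 0 (N / j),
      ((rr z j * rr z m * Λ m : ℝ) : ℂ) * e (α * j * m)
      - ∑ m ∈ Ioc 0 (Nat.sqrt N), ∑ j ∈ Ioc (Nat.sqrt N) (N / m),
        ((rr z j * rr z m * Λ m : ℝ) : ℂ) * e (α * j * m) := by
    have h4 : ∑ j ∈ Ioc 0 (Nat.sqrt N), ∑ m ∈ Ioc 0 (N / j),
        ((rr z j * rr z m * Λ m : ℝ) : ℂ) * e (α * j * m) =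
        ∑ m ∈ Ioc 0 N, ((rr z m * Λ m : ℝ) : ℂ) * e (α * m) +
          ∑ j ∈ Ioc 1 (Nat.sqrt N), ∑ m ∈ Ioc 0 (N / j),
            ((rr z j * rr z m * Λ m : ℝ) : ℂ) * e (α * j * m) := by
      rw [hins, sum_insert (by simp)]
      simp only [rr_one, one_mul, Nat.div_one, Nat.cast_one, mul_one]
    rw [key, h4]
    ring
  rw [hfirst]
  refine (norm_sub_le _ _).trans ?_
  have := norm_sub_le (∑ k ∈ Ioc 0 N, ((rr z k * Real.log k : ℝ) : ℂ) * e (α * k))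
    (∑ j ∈ Ioc 1 (Nat.sqrt N), ∑ m ∈ Ioc 0 (N / j),
      ((rr z j * rr z m * Λ m : ℝ) : ℂ) * e (α * j * m))
  linarith

lemma log_sub_log_le {k N : ℕ} (hk : 1 ≤ k) (hN : k ≤ N) :
    Real.log N - Real.log k ≤ ∑ i ∈ Ico k N, (1:ℝ) / i := by
  induction N, hN using Nat.le_induction with
  | base => simp
  | succ n hn ih =>
    rw [sum_Ico_succ_top hn]
    have hn0 : (0:ℝ) < n := by exact_mod_cast (by omega : 0 < n)
    have h1 : Real.log (n + 1 : ℕ) - Real.log n ≤ 1 / n := by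
      rw [← Real.log_div (by positivity) (by positivity)]
      refine (Real.log_le_sub_one_of_pos (by positivity)).trans (le_of_eq ?_)
      push_cast; field_simp; ring
    linarith

lemma sum_mul_log_sub_le {r : ℕ → ℝ} (hr : ∀ k, 0 ≤ r k) (N : ℕ) :
    ∑ k ∈ Ioc 0 N, r k * (Real.log N - Real.log k) ≤
      ∑ i ∈ Ioc 0 N, (∑ k ∈ Ioc 0 i, r k) / i := by
  calc _ ≤ ∑ k ∈ Ioc 0 N, r k * ∑ i ∈ Icc k N, (1:ℝ) / i := by
        refine sum_le_sum fun k hk => mul_le_mul_of_nonneg_left ?_ (hr k)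
        rw [mem_Ioc] at hk
        refine (log_sub_log_le hk.1 hk.2).trans (sum_le_sum_of_subset_of_nonneg ?_ ?_)
        · exact Ico_subset_Icc_self
        · intros; positivity
    _ = _ := by
        simp_rw [mul_sum, sum_div]
        rw [sum_comm' (t' := Ioc 0 N) (s' := fun i => Ioc 0 i)]
        · simp [div_eq_mul_inv]
        · intro k i; simp only [mem_Ioc, mem_Icc]; omega

lemma norm_sum_log_le {r : ℕ → ℝ} (hr : ∀ k, 0 ≤ r k) {N : ℕ} (hN : 1 ≤ N) (α : ℝ) :
    ‖∑ k ∈ Ioc 0 N, (r k * Real.log k : ℝ) * e (α * k)‖ ≤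
      Real.log N * ‖∑ k ∈ Ioc 0 N, (r k : ℂ) * e (α * k)‖ +
      ∑ i ∈ Ioc 0 N, (∑ k ∈ Ioc 0 i, r k) / i := by
  have h1 : ∑ k ∈ Ioc 0 N, ((r k * Real.log k : ℝ) : ℂ) * e (α * k) =
      Real.log N * ∑ k ∈ Ioc 0 N, (r k : ℂ) * e (α * k) -
      ∑ k ∈ Ioc 0 N, ((r k * (Real.log N - Real.log k) : ℝ) : ℂ) * e (α * k) := by
    rw [mul_sum, ← sum_sub_distrib]
    refine sum_congr rfl fun k _ => ?_
    push_cast; ring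
  rw [h1]
  refine (norm_sub_le _ _).trans (add_le_add ?_ (le_trans ?_ (sum_mul_log_sub_le hr N)))
  · rw [norm_mul, Complex.norm_real, Real.norm_of_nonneg (Real.log_nonneg (by exact_mod_cast hN))]
  · refine (norm_sum_le _ _).trans (sum_le_sum fun k hk => ?_)
    rw [mem_Ioc] at hk
    rw [norm_mul, norm_e, mul_one, Complex.norm_real, Real.norm_of_nonneg]
    exact mul_nonneg (hr k) (sub_nonneg.2 (Real.log_le_log (by exact_mod_cast hk.1)
      (by exact_mod_cast hk.2)))

lemma sum_rr_le : ∃ C : ℝ, 1 ≤ C ∧ ∀ R i : ℕ, 2 ≤ R →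
    ∑ k ∈ Ioc 0 i, rr (R ^ 16) k ≤ 2 * i / Real.log R + C * R ^ 8 := by
  classical
  obtain ⟨C, hC, h⟩ := card_rough_progression_le
  refine ⟨C, hC, fun R i hR => ?_⟩
  have h1 := h R 1 0 i ((Ioc 0 i).filter (Rough (R ^ 16))) hR le_rfl (by positivity) (by
    intro j hj
    rw [mem_filter, mem_Ioc] at hj
    refine ⟨fun p hp hpj => le_trans ?_ (hj.2 p hp hpj), ?_, by simp⟩
    · calc R + 1 ≤ R ^ 2 := by nlinarith
        _ ≤ R ^ 16 := Nat.pow_le_pow_right (by omega) (by norm_num)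
    · simp only [Nat.cast_zero, sub_zero, Nat.abs_cast]; exact_mod_cast hj.1.2)
  rw [Nat.totient_one, Nat.cast_one, one_mul] at h1
  refine le_trans (le_of_eq ?_) h1
  rw [card_filter]; push_cast; rfl

lemma sum_sum_rr_div_le : ∃ C : ℝ, 1 ≤ C ∧ ∀ R N : ℕ, 2 ≤ R →
    ∑ i ∈ Ioc 0 N, (∑ k ∈ Ioc 0 i, rr (R ^ 16) k) / i ≤
      2 * N / Real.log R + C * R ^ 8 * (1 + Real.log N) := by
  obtain ⟨C, hC, h⟩ := sum_rr_le
  refine ⟨C, hC, fun R N hR => ?_⟩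
  have hl : 0 < Real.log R := Real.log_pos (by exact_mod_cast hR)
  calc _ ≤ ∑ i ∈ Ioc 0 N, (2 / Real.log R + C * R ^ 8 * (i:ℝ)⁻¹) := by
        refine sum_le_sum fun i hi => ?_
        rw [mem_Ioc] at hi
        have hi0 : (0:ℝ) < i := by exact_mod_cast hi.1
        rw [div_le_iff₀ hi0]
        refine (h R i hR).trans (le_of_eq ?_)
        field_simp
    _ = 2 * N / Real.log R + C * R ^ 8 * ∑ i ∈ Ioc 0 N, (i:ℝ)⁻¹ := by
        rw [sum_add_distrib, ← mul_sum]; simp; ring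
    _ ≤ _ := by
        gcongr
        have := harmonic_le_one_add_log N
        rw [harmonic_eq_sum_Icc] at this
        push_cast at this
        exact this

/-- Passing from rough prime powers to primes. -/
lemma norm_sum_prime_le {z N : ℕ} (hN : 1 ≤ N) (α : ℝ) :
    ‖∑ p ∈ (Ioc 0 N).filter Nat.Prime, (Real.log p : ℂ) * e (α * p)‖ ≤
      ‖∑ m ∈ Ioc 0 N, (rr z m * Λ m : ℝ) * e (α * m)‖ +
        2 * √N * Real.log N + 2 * z := by
  have h0 : ∑ p ∈ (Ioc 0 N).filter Nat.Prime, (Real.log p : ℂ) * e (α * p) =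
      ∑ m ∈ Ioc 0 N, ((rr z m * Λ m : ℝ) : ℂ) * e (α * m) -
      ∑ m ∈ Ioc 0 N, (((rr z m * Λ m : ℝ) : ℂ) - (if m.Prime then (Real.log m : ℂ) else 0)) *
        e (α * m) := by
    rw [← sum_sub_distrib, sum_filter]
    refine sum_congr rfl fun m _ => ?_
    split_ifs <;> ring
  rw [h0, add_assoc]
  refine (norm_sub_le _ _).trans ((add_le_add_iff_left _).2 ?_)
  have hψ := Chebyshev.psi_sub_theta_le (x := N) (by exact_mod_cast hN)
  have hθ := Chebyshev.theta_le_log4_mul_x (x := z) (by positivity)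
  have hlog4 : Real.log 4 ≤ 2 := by
    rw [show (4:ℝ) = 2 ^ 2 by norm_num, Real.log_pow]
    have := Real.log_two_lt_d9; push_cast; linarith
  have hψ' : ∑ m ∈ Ioc 0 N, (Λ m - if m.Prime then Real.log m else 0) ≤ 2 * √N * Real.log N := by
    refine le_trans (le_of_eq ?_) hψ
    rw [sum_sub_distrib, ← sum_filter, Chebyshev.psi, Chebyshev.theta, Nat.floor_natCast]
  have hθ' : ∑ m ∈ (Ioc 0 z).filter Nat.Prime, Real.log m ≤ 2 * z := by
    have : Chebyshev.theta (z:ℝ) = ∑ m ∈ (Ioc 0 z).filter Nat.Prime, Real.log m := by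
      rw [Chebyshev.theta, Nat.floor_natCast]
    rw [← this]
    exact hθ.trans (by gcongr)
  refine (norm_sum_le _ _).trans ?_
  calc _ ≤ ∑ m ∈ Ioc 0 N, ((Λ m - if m.Prime then Real.log m else 0) +
        if m.Prime ∧ m ≤ z then Real.log m else 0) := by
        refine sum_le_sum fun m hm => ?_
        rw [norm_mul, norm_e, mul_one]
        by_cases hp : m.Prime
        · have hlog : 0 ≤ Real.log m := Real.log_natCast_nonneg m
          rw [ArithmeticFunction.vonMangoldt_apply_prime hp]
          simp only [hp, if_true, sub_self, zero_add, true_and]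
          rw [← Complex.ofReal_sub, Complex.norm_real, Real.norm_eq_abs]
          by_cases hz : z ≤ m
          · have : Rough z m := fun q hq h => by
              rw [(Nat.prime_dvd_prime_iff_eq hq hp).1 h]; exact hz
            simp only [rr, this, if_true, one_mul, sub_self, abs_zero]
            split_ifs <;> simp [hlog]
          · simp only [(not_le.1 hz).le, if_true]
            have h1 := rr_nonneg z m
            have h2 := rr_le_one z m
            rw [abs_le]; constructor <;> nlinarith
        · simp only [hp, if_false, sub_zero, false_and, add_zero, Complex.norm_real]
          rw [Real.norm_of_nonneg (mul_nonneg (rr_nonneg _ _) ArithmeticFunction.vonMangoldt_nonneg)]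
          exact mul_le_of_le_one_left ArithmeticFunction.vonMangoldt_nonneg (rr_le_one _ _)
    _ ≤ 2 * √N * Real.log N + 2 * z := by
        rw [sum_add_distrib]
        refine add_le_add hψ' (le_trans ?_ hθ')
        rw [← sum_filter]
        refine sum_le_sum_of_subset_of_nonneg ?_ (fun i _ _ => Real.log_natCast_nonneg i)
        intro m hm
        simp only [mem_filter, mem_Ioc] at hm ⊢
        exact ⟨⟨hm.1.1, hm.2.2⟩, hm.2.1⟩

end

/-- Exponential sums over rough numbers are small off the major arcs. -/
lemma type_one : ∃ C : ℝ, 1 ≤ C ∧ ∀ (R t N : ℕ) (κ α : ℝ), 2 ≤ R → 128 ≤ t → 1 ≤ N → 0 < κ →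
    C * ((R:ℝ) ^ t) ^ 8 ≤ κ * N / 2 → ¬ NearRational (C / κ ^ 2) (C / κ ^ 2) N α →
    ‖∑ k ∈ Ioc 0 N, (rr (R ^ 16) k : ℂ) * e (α * k)‖ ≤
      κ * N / (8 * Real.log R) + C * N * Real.exp (-(t / 32)) / Real.log R +
        C * R ^ 16 * ((R:ℝ) ^ t) ^ 8 := by
  obtain ⟨C₁, hC₁, h1⟩ := sum_nu_le_and_fourier
  obtain ⟨C₂, hC₂, h2⟩ := sum_famz_sub_rough_le
  refine ⟨C₁ + C₂, by linarith, fun R t N κ α hR ht hN hκ hbig hα => ?_⟩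
  set z := R ^ 16 with hz
  set D := R ^ t with hD
  have hl : 0 < Real.log R := Real.log_pos (by exact_mod_cast hR)
  have hz2 : 2 ≤ z := hR.trans (Nat.le_self_pow (by norm_num) R)
  have hD1 : 1 ≤ D := Nat.one_le_pow _ _ (by omega)
  have hlz : Real.log z = 16 * Real.log R := by rw [hz]; push_cast; rw [Real.log_pow]; norm_num
  have hlD : Real.log D = t * Real.log R := by rw [hD]; push_cast; rw [Real.log_pow]
  have hu : Real.log D / Real.log z = t / 16 := by
    rw [hlz, hlD]; field_simp
  have ht' : (128:ℝ) ≤ t := by exact_mod_cast ht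
  have hu8 : 8 ≤ Real.log D / Real.log z := by rw [hu]; linarith
  have hh1 := (famz_sieveFamily (z := z) hD1).one_le_hh
  have hhinv := inv_hh_famz_le_log hz2 hD1 hu8
  have hrough := h2 z D N hz2 hD1 hu8
  have hDc : (D:ℝ) = (R:ℝ) ^ t := by rw [hD]; push_cast; rfl
  have hzc : (z:ℝ) = (R:ℝ) ^ 16 := by rw [hz]; push_cast; rfl
  have hN0 : (0:ℝ) < N := by exact_mod_cast hN
  have hν : ‖∑ n ∈ Ioc 0 N, (nu (famz z D) n : ℂ) * e (α * n)‖ < κ * N := by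
    by_contra hcon
    push Not at hcon
    obtain ⟨q, hq1, hq2, k, hk⟩ := (h1 (famz_sieveFamily (z := z) hD1) hD1 0 0 N).2 α κ N hκ
      (by simp) hN0 (by
        rw [hDc]
        refine le_trans ?_ hbig
        gcongr; linarith) (by simpa using hcon)
    refine hα ⟨q, hq1, hq2.trans (by gcongr; linarith), k, hk.trans ?_⟩
    rw [div_div]; gcongr; linarith
  have hsplit : ∑ k ∈ Ioc 0 N, (rr z k : ℂ) * e (α * k) =
      (1 / hh (famz z D) : ℝ) * ∑ n ∈ Ioc 0 N, (nu (famz z D) n : ℂ) * e (α * n) -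
      ∑ k ∈ Ioc 0 N, ((nu (famz z D) k / hh (famz z D) - rr z k : ℝ) : ℂ) * e (α * k) := by
    rw [mul_sum, ← sum_sub_distrib]
    refine sum_congr rfl fun k _ => ?_
    push_cast; ring
  rw [hsplit]
  have hfst : ‖((1 / hh (famz z D) : ℝ) : ℂ) *
      ∑ n ∈ Ioc 0 N, (nu (famz z D) n : ℂ) * e (α * n)‖ ≤ κ * N / (8 * Real.log R) := by
    rw [norm_mul, Complex.norm_real, Real.norm_of_nonneg (by positivity)]
    calc _ ≤ 2 / Real.log z * (κ * N) := by gcongr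
      _ = _ := by rw [hlz]; field_simp; norm_num
  have hsnd : ‖∑ k ∈ Ioc 0 N, ((nu (famz z D) k / hh (famz z D) - rr z k : ℝ) : ℂ) *
      e (α * k)‖ ≤ (C₁ + C₂) * N * Real.exp (-(t / 32)) / Real.log R +
        (C₁ + C₂) * R ^ 16 * ((R:ℝ) ^ t) ^ 8 := by
    refine (norm_sum_le _ _).trans (le_trans ?_ (hrough.trans ?_))
    · refine sum_le_sum fun k _ => ?_
      rw [norm_mul, norm_e, mul_one, Complex.norm_real, Real.norm_of_nonneg]
      · rfl
      · exact sub_nonneg.2 (indicator_rough_le hD1)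
    · rw [hu, hlz, hDc, hzc]
      refine add_le_add ?_ (by gcongr; linarith)
      rw [show -((t:ℝ) / 16 / 2) = -(t / 32) by ring]
      gcongr <;> linarith
  refine (norm_sub_le _ _).trans ?_
  linarith

lemma exists_mul_exp_le {A : ℝ} {η : ℝ} (hη : 0 < η) :
    ∃ t : ℕ, 128 ≤ t ∧ A * t * Real.exp (-(t / 32)) ≤ η := by
  have h1 := (Real.tendsto_pow_mul_exp_neg_atTop_nhds_zero 1).comp
    ((tendsto_natCast_atTop_atTop (R := ℝ)).atTop_div_const (show (0:ℝ) < 32 by norm_num))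
  have h2 := h1.const_mul (A * 32)
  rw [mul_zero] at h2
  obtain ⟨t, ht1, ht2⟩ := ((h2.eventually_le_const hη).and (Filter.eventually_ge_atTop 128)).exists
  refine ⟨t, ht2, le_trans (le_of_eq ?_) ht1⟩
  simp only [Function.comp, pow_one]
  ring

lemma exists_pow_le_lt {S N R₀ : ℕ} (hS : 1 ≤ S) (hN : R₀ ^ S ≤ N) :
    ∃ R, R₀ ≤ R ∧ R ^ S ≤ N ∧ N < (R + 1) ^ S := by
  have h : ∀ m, m ^ S ≤ N → m ≤ N := fun m hm => (Nat.le_self_pow (by omega) m).trans hm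
  refine ⟨Nat.findGreatest (fun m => m ^ S ≤ N) N, Nat.le_findGreatest (h _ hN) hN,
    Nat.findGreatest_spec (P := fun m => m ^ S ≤ N) (h _ hN) hN, ?_⟩
  by_contra hcon
  push Not at hcon
  have := Nat.le_findGreatest (P := fun m => m ^ S ≤ N) (h _ hcon) hcon
  omega

set_option maxHeartbeats 1000000 in
/-- Exponential sums over the primes are small off the major arcs. -/
theorem prime_exponential_sum {η : ℝ} (hη : 0 < η) : ∃ Q K : ℝ, ∃ N₀ : ℕ, ∀ (N : ℕ) (α : ℝ),
    N₀ ≤ N → ¬ NearRational Q K N α →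
    ‖∑ p ∈ (Ioc 0 N).filter Nat.Prime, (Real.log p : ℂ) * e (α * p)‖ ≤ η * N := by
  classical
  obtain ⟨C, hC, hone⟩ := type_one
  obtain ⟨C', hC', hdiv⟩ := sum_sum_rr_div_le
  obtain ⟨t, ht, htη⟩ := exists_mul_exp_le (A := 128 * C) (show 0 < η / 8 by positivity)
  set S := 64 * t with hS
  have hS1 : (1:ℝ) ≤ S := by exact_mod_cast (by omega : 1 ≤ S)
  set ε := η / (32 * S) with hε
  have hε0 : 0 < ε := by positivity
  set κ := η / (2 * S) with hκ
  have hκ0 : 0 < κ := by positivity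
  obtain ⟨Q, K, R₁, htwo⟩ := type_two (2 * S) (by omega) hε0
  set T := 16 * S * C / η + 2 * C / κ + 24 * S * C' / η + 32 * S / η + 16 / η with hT
  have hT0 : 0 < T := by positivity
  set R₂ := R₁ + 3 + ⌈T⌉₊ + ⌈Real.exp (16 / η)⌉₊ with hR₂
  refine ⟨max Q (C / κ ^ 2), max K (C / κ ^ 2), R₂ ^ S, fun N α hN hα => ?_⟩
  obtain ⟨R, hR0, hRN, hNR⟩ := exists_pow_le_lt (by omega) hN
  have hR3 : (3:ℝ) ≤ R := by exact_mod_cast (by omega : 3 ≤ R)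
  have hRT : T ≤ R := (Nat.le_ceil _).trans (by exact_mod_cast (by omega : ⌈T⌉₊ ≤ R))
  have hRexp : Real.exp (16 / η) ≤ R :=
    (Nat.le_ceil _).trans (by exact_mod_cast (by omega : ⌈Real.exp (16 / η)⌉₊ ≤ R))
  have hα1 : ¬ NearRational Q K N α := fun h => hα (h.mono (le_max_left _ _) (le_max_left _ _))
  have hα2 : ¬ NearRational (C / κ ^ 2) (C / κ ^ 2) N α :=
    fun h => hα (h.mono (le_max_right _ _) (le_max_right _ _))
  set l := Real.log R with hl
  have hl1 : 1 ≤ l := by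
    rw [hl, Real.le_log_iff_exp_le (by linarith)]
    linarith [Real.exp_one_lt_d9]
  have hlR : l ≤ R := (Real.log_le_sub_one_of_pos (by linarith)).trans (by linarith)
  have hlη : 16 / η ≤ l := by rwa [hl, Real.le_log_iff_exp_le (by linarith)]
  have hNR2 : N ≤ R ^ (2 * S) := by
    refine hNR.le.trans ?_
    rw [show R ^ (2 * S) = (R ^ 2) ^ S from pow_mul _ _ _]
    refine Nat.pow_le_pow_left ?_ S
    have : 3 ≤ R := by omega
    nlinarith
  have hN1 : 2 ≤ N := by
    have : R ≤ N := (Nat.le_self_pow (by omega) R).trans hRN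
    omega
  have hNR' : (R:ℝ) ^ (64 * t) ≤ N := by exact_mod_cast hRN
  have hN0 : (2:ℝ) ≤ N := by exact_mod_cast hN1
  set lN := Real.log N with hlN
  have hlN0 : 0 ≤ lN := Real.log_nonneg (by linarith)
  have hlogN : lN ≤ 2 * S * l := by
    rw [hlN, hl]
    have : (N:ℝ) ≤ (R:ℝ) ^ (2 * S) := by exact_mod_cast hNR2
    have := Real.log_le_log (by linarith) this
    rw [Real.log_pow] at this
    push_cast at this; exact this
  clear_value R₂ ε κ T l lN S
  have hpow : ∀ a : ℕ, a + 1 ≤ 64 * t → ∀ B, B ≤ T → B * (R:ℝ) ^ a ≤ N := by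
    intro a ha B hB
    calc B * (R:ℝ) ^ a ≤ R * (R:ℝ) ^ a := by gcongr; exact hB.trans hRT
      _ = (R:ℝ) ^ (a + 1) := by ring
      _ ≤ (R:ℝ) ^ (64 * t) := pow_le_pow_right₀ (by linarith) ha
      _ ≤ N := hNR'
  have hT1 : 16 * S * C / η ≤ T := by
    rw [hT]; linarith [show 0 ≤ 2 * C / κ by positivity, show 0 ≤ 24 * S * C' / η by positivity,
      show 0 ≤ 32 * S / η by positivity, show 0 ≤ 16 / η by positivity]
  have hT2 : 2 * C / κ ≤ T := by
    rw [hT]; linarith [show 0 ≤ 16 * S * C / η by positivity, show 0 ≤ 24 * S * C' / η by positivity,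
      show 0 ≤ 32 * S / η by positivity, show 0 ≤ 16 / η by positivity]
  have hT3 : 24 * S * C' / η ≤ T := by
    rw [hT]; linarith [show 0 ≤ 16 * S * C / η by positivity, show 0 ≤ 2 * C / κ by positivity,
      show 0 ≤ 32 * S / η by positivity, show 0 ≤ 16 / η by positivity]
  have hT4 : 32 * S / η ≤ T := by
    rw [hT]; linarith [show 0 ≤ 16 * S * C / η by positivity, show 0 ≤ 2 * C / κ by positivity,
      show 0 ≤ 24 * S * C' / η by positivity, show 0 ≤ 16 / η by positivity]
  have hT5 : 16 / η ≤ T := by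
    rw [hT]; linarith [show 0 ≤ 16 * S * C / η by positivity, show 0 ≤ 2 * C / κ by positivity,
      show 0 ≤ 24 * S * C' / η by positivity, show 0 ≤ 32 * S / η by positivity]
  -- the type I contribution
  have hA := hone R t N κ α (by omega) ht (by omega) hκ0 (by
    have := hpow (8 * t) (by omega) _ hT2
    rw [div_mul_eq_mul_div, div_le_iff₀ hκ0] at this
    rw [← pow_mul, mul_comm t 8]; linarith) hα2
  rw [← hl] at hA
  have hA' : lN * ‖∑ k ∈ Ioc 0 N, (rr (R ^ 16) k : ℂ) * e (α * k)‖ ≤ 3 * (η / 8) * N := by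
    have e1 : 2 * S * l * (κ * N / (8 * l)) = η / 8 * N := by rw [hκ]; field_simp
    have e2 : 2 * S * l * (C * N * Real.exp (-(t / 32)) / l) ≤ η / 8 * N := by
      have e3 : 2 * S * l * (C * N * Real.exp (-(t / 32)) / l) =
          (128 * C * t * Real.exp (-(t / 32))) * N := by
        rw [hS]; push_cast; field_simp; norm_num
      rw [e3]; gcongr
    have e4 : 2 * S * l * (C * R ^ 16 * ((R:ℝ) ^ t) ^ 8) ≤ η / 8 * N := by
      have := hpow (8 * t + 17) (by omega) _ hT1
      rw [div_mul_eq_mul_div, div_le_iff₀ hη] at this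
      calc _ ≤ 2 * S * R * (C * R ^ 16 * ((R:ℝ) ^ t) ^ 8) := by gcongr
        _ = (16 * S * C * (R:ℝ) ^ (8 * t + 17)) / 8 := by ring
        _ ≤ N * η / 8 := by gcongr
        _ = _ := by ring
    calc _ ≤ 2 * S * l * (κ * N / (8 * l) + C * N * Real.exp (-(t / 32)) / l +
        C * R ^ 16 * ((R:ℝ) ^ t) ^ 8) := by gcongr
      _ ≤ _ := by rw [mul_add, mul_add]; linarith
  have hB := hdiv R N (by omega)
  rw [← hl, ← hlN] at hB
  have hB' : 2 * N / l + C' * R ^ 8 * (1 + lN) ≤ 2 * (η / 8) * N := by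
    have e1 : 2 * N / l ≤ η / 8 * N := by
      rw [div_le_iff₀ (by linarith)]
      rw [div_le_iff₀ hη] at hlη
      nlinarith
    have e2 : C' * R ^ 8 * (1 + lN) ≤ η / 8 * N := by
      have := hpow 9 (by omega) _ hT3
      rw [div_mul_eq_mul_div, div_le_iff₀ hη] at this
      have e3 : 1 + lN ≤ 3 * S * R := by
        have : S * l ≤ S * R := by gcongr
        have : 1 ≤ S * (R:ℝ) := by nlinarith
        linarith
      calc _ ≤ C' * R ^ 8 * (3 * S * R) := by gcongr
        _ = (24 * S * C' * (R:ℝ) ^ 9) / 8 := by ring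
        _ ≤ N * η / 8 := by gcongr
        _ = _ := by ring
    linarith
  have hlog := norm_sum_log_le (r := rr (R ^ 16)) (fun k => rr_nonneg _ k) (by omega : 1 ≤ N) α
  rw [← hlN] at hlog
  -- the type II contribution
  have hII := norm_sum_rr_vonMangoldt_le (z := R ^ 16) (α := α) (B := ε * N / l) hN1 (by
    intro b y hb
    rw [hl]
    refine le_trans (le_of_eq ?_) (htwo R N α b y (by omega) hNR2 hα1 hb)
    refine sum_congr (filter_congr fun j _ => ?_) fun _ _ => rfl
    unfold rr; split_ifs with h <;> simp [h])
  rw [← hlN] at hII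
  have hII' : 2 * lN * (ε * N / l) ≤ η / 8 * N := by
    calc _ ≤ 2 * (2 * S * l) * (ε * N / l) := by gcongr
      _ = _ := by rw [hε]; field_simp; norm_num
  have hP := norm_sum_prime_le (z := R ^ 16) (by omega : 1 ≤ N) α
  rw [← hlN] at hP
  have hP' : 2 * √N * lN + 2 * ((R ^ 16 : ℕ) : ℝ) ≤ 2 * (η / 8) * N := by
    have e1 : 2 * √N * lN ≤ η / 8 * N := by
      have hsq : (R:ℝ) ^ 2 ≤ √N := by
        refine Real.le_sqrt_of_sq_le ?_
        rw [← pow_mul]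
        exact le_trans (pow_le_pow_right₀ (by linarith) (by omega)) hNR'
      have hR' : 32 * S / η ≤ R := hT4.trans hRT
      rw [div_le_iff₀ hη] at hR'
      calc 2 * √N * lN ≤ 2 * √N * (2 * S * l) := by gcongr
        _ ≤ 2 * √N * (2 * S * R) := by gcongr
        _ = √N * ((32 * S) * R) / 8 := by ring
        _ ≤ √N * ((R * η) * R) / 8 := by gcongr
        _ = √N * (R ^ 2 * η) / 8 := by ring
        _ ≤ √N * (√N * η) / 8 := by gcongr
        _ = (√N * √N) * η / 8 := by ring
        _ = _ := by rw [Real.mul_self_sqrt (by linarith)]; ring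
    have e2 : 2 * ((R ^ 16 : ℕ) : ℝ) ≤ η / 8 * N := by
      have := hpow 16 (by omega) _ hT5
      rw [div_mul_eq_mul_div, div_le_iff₀ hη] at this
      push_cast; linarith
    linarith
  linarith

section

open MeasureTheory Filter Topology

/-- The Fejér kernel on the real line. -/
noncomputable def fejer (T x : ℝ) : ℝ := ∫ t in (0:ℝ)..T, 2 * (1 - t / T) * Real.cos (t * x)

lemma fejer_eq {T x : ℝ} (hT : 0 < T) (hx : x ≠ 0) :
    fejer T x = 2 * (1 - Real.cos (T * x)) / (T * x ^ 2) := by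
  have h : ∀ t ∈ Set.uIcc 0 T, HasDerivAt
      (fun t => 2 * (1 - t / T) * (Real.sin (t * x) / x) - 2 * Real.cos (t * x) / (T * x ^ 2))
      (2 * (1 - t / T) * Real.cos (t * x)) t := by
    intro t _
    have h1 : HasDerivAt (fun t : ℝ => t * x) x t := by simpa using (hasDerivAt_id t).mul_const x
    have h2 : HasDerivAt (fun t : ℝ => 2 * (1 - t / T)) (2 * (-(1 / T))) t :=
      (((hasDerivAt_id t).div_const T).const_sub 1).const_mul 2
    have h3 := (h2.mul (h1.sin.div_const x)).sub ((h1.cos.const_mul 2).div_const (T * x ^ 2))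
    refine h3.congr_deriv ?_
    field_simp; ring
  rw [fejer, intervalIntegral.integral_eq_sub_of_hasDerivAt h
    (by apply Continuous.intervalIntegrable; fun_prop)]
  simp
  field_simp; ring

lemma continuous_fejer (T : ℝ) : Continuous (fejer T) := by
  unfold fejer
  apply intervalIntegral.continuous_parametric_intervalIntegral_of_continuous'
  fun_prop

lemma fejer_nonneg {T : ℝ} (hT : 0 < T) (x : ℝ) : 0 ≤ fejer T x := by
  rcases eq_or_ne x 0 with rfl | hx
  · refine intervalIntegral.integral_nonneg hT.le fun t ht => ?_
    have : t / T ≤ 1 := (div_le_one hT).2 ht.2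
    simp only [mul_zero, Real.cos_zero, mul_one]; linarith
  · rw [fejer_eq hT hx]
    have := Real.cos_le_one (T * x)
    apply div_nonneg <;> [linarith; positivity]

lemma fejer_le {T : ℝ} (hT : 0 < T) (x : ℝ) : fejer T x ≤ 2 * T := by
  unfold fejer
  calc _ ≤ ∫ _ in (0:ℝ)..T, (2:ℝ) := by
        refine intervalIntegral.integral_mono_on hT.le
          (by apply Continuous.intervalIntegrable; fun_prop) (by simp) fun t ht => ?_
        have h1 : t / T ≤ 1 := (div_le_one hT).2 ht.2
        have h2 : 0 ≤ t / T := div_nonneg ht.1 hT.le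
        have h3 := Real.cos_le_one (t * x)
        have h4 := Real.neg_one_le_cos (t * x)
        nlinarith
    _ = _ := by simp; ring

lemma fejer_le_div {T : ℝ} (hT : 0 < T) {x : ℝ} (hx : x ≠ 0) : fejer T x ≤ 4 / T * x⁻¹ ^ 2 := by
  rw [fejer_eq hT hx]
  have := Real.neg_one_le_cos (T * x)
  rw [show 4 / T * x⁻¹ ^ 2 = 4 / (T * x ^ 2) by field_simp]
  gcongr; linarith

lemma fejer_le_cauchy {T : ℝ} (hT : 0 < T) (x : ℝ) :
    fejer T x ≤ (2 * T + 4 / T) * (1 + x ^ 2)⁻¹ := by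
  rw [← div_eq_mul_inv, le_div_iff₀ (by positivity), mul_add, mul_one]
  refine add_le_add (fejer_le hT x) ?_
  rcases eq_or_ne x 0 with rfl | hx
  · simp; positivity
  · calc _ ≤ 4 / T * x⁻¹ ^ 2 * x ^ 2 := by gcongr; exact fejer_le_div hT hx
      _ = _ := by field_simp

lemma integrable_fejer {T : ℝ} (hT : 0 < T) : Integrable (fejer T) := by
  refine (integrable_inv_one_add_sq.const_mul (2 * T + 4 / T)).mono'
    (continuous_fejer T).aestronglyMeasurable (ae_of_all _ fun x => ?_)
  rw [Real.norm_of_nonneg (fejer_nonneg hT x)]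
  exact fejer_le_cauchy hT x

lemma fejer_neg (T x : ℝ) : fejer T (-x) = fejer T x := by
  unfold fejer; simp

lemma one_le_integral_fejer {T : ℝ} (hT : 0 < T) : 1 / 2 ≤ ∫ x, fejer T x := by
  have h1 : ∀ x ∈ Set.Ioc 0 (1 / T), T / 2 ≤ fejer T x := by
    intro x hx
    rw [fejer]
    calc T / 2 = ∫ t in (0:ℝ)..T, (1 - t / T) := by
          rw [intervalIntegral.integral_sub (by simp)
            (by apply Continuous.intervalIntegrable; fun_prop)]
          simp [intervalIntegral.integral_div]; field_simp; ring
      _ ≤ _ := by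
          refine intervalIntegral.integral_mono_on hT.le
            (by apply Continuous.intervalIntegrable; fun_prop)
            (by apply Continuous.intervalIntegrable; fun_prop) fun t ht => ?_
          have h1 : t / T ≤ 1 := (div_le_one hT).2 ht.2
          have h2 : t * x ≤ 1 := by
            calc t * x ≤ T * (1 / T) := mul_le_mul ht.2 hx.2 hx.1.le hT.le
              _ = 1 := by field_simp
          have h3 : 0 ≤ t * x := mul_nonneg ht.1 hx.1.le
          have h4 := Real.one_sub_sq_div_two_le_cos (x := t * x)
          have h5 : 1 / 2 ≤ Real.cos (t * x) := by nlinarith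
          nlinarith
  calc (1:ℝ) / 2 = ∫ _ in Set.Ioc 0 (1 / T), T / 2 := by
        rw [setIntegral_const]; simp [hT.le]; field_simp
    _ ≤ ∫ x in Set.Ioc 0 (1 / T), fejer T x :=
        setIntegral_mono_on (by simp) (integrable_fejer hT).integrableOn measurableSet_Ioc h1
    _ ≤ _ := setIntegral_le_integral (integrable_fejer hT) (ae_of_all _ (fejer_nonneg hT))

lemma integral_fejer_tail_le {T ε : ℝ} (hT : 0 < T) (hε : 0 < ε) :
    ∫ x in (Set.Ioc (-ε) ε)ᶜ, fejer T x ≤ 8 / (T * ε) := by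
  have h0 : ∫ x in Set.Ioi ε, fejer T x ≤ 4 / (T * ε) := by
    have hInt : IntegrableOn (fun x : ℝ => 4 / T * x ^ (-2 : ℝ)) (Set.Ioi ε) :=
      (integrableOn_Ioi_rpow_of_lt (by norm_num) hε).const_mul _
    calc _ ≤ ∫ x in Set.Ioi ε, 4 / T * x ^ (-2 : ℝ) := by
          refine setIntegral_mono_on (integrable_fejer hT).integrableOn hInt measurableSet_Ioi
            fun x hx => ?_
          have hx0 : 0 < x := hε.trans hx
          refine (fejer_le_div hT hx0.ne').trans (le_of_eq ?_)
          rw [Real.rpow_neg hx0.le, inv_pow]; norm_num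
      _ = _ := by
          rw [integral_const_mul, integral_Ioi_rpow_of_lt (by norm_num) hε]
          norm_num [Real.rpow_neg_one]
          field_simp
  have h1 : ∫ x in Set.Iic (-ε), fejer T x = ∫ x in Set.Ioi ε, fejer T x := by
    have := integral_comp_neg_Iic (-ε) (fejer T)
    simpa [fejer_neg] using this
  have h2 : (Set.Ioc (-ε) ε)ᶜ = Set.Iic (-ε) ∪ Set.Ioi ε := by
    ext x; simp only [Set.mem_compl_iff, Set.mem_Ioc, Set.mem_union, Set.mem_Iic, Set.mem_Ioi]
    constructor
    · intro h; by_contra hc; push Not at hc h; linarith [h hc.1]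
    · rintro (h | h) ⟨h3, h4⟩ <;> linarith
  rw [h2, setIntegral_union _ measurableSet_Ioi (integrable_fejer hT).integrableOn
    (integrable_fejer hT).integrableOn, h1]
  · calc _ ≤ 4 / (T * ε) + 4 / (T * ε) := add_le_add h0 h0
      _ = _ := by ring
  · rw [Set.disjoint_left]; intro x hx hx'
    simp only [Set.mem_Iic, Set.mem_Ioi] at hx hx'; linarith

lemma le_integral_fejer_Ioc {T ε : ℝ} (hT : 0 < T) (hε : 0 < ε) :
    (∫ x, fejer T x) - 8 / (T * ε) ≤ ∫ x in Set.Ioc (-ε) ε, fejer T x := by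
  have h := integral_add_compl (s := Set.Ioc (-ε) ε) measurableSet_Ioc (integrable_fejer hT)
  linarith [integral_fejer_tail_le hT hε]

/-- Tauberian step: a bounded function `B` with `exp u * B u` monotone converges to `c` as soon as
its Fejér averages do. -/
theorem tendsto_of_tendsto_fejer {B : ℝ → ℝ} {M c : ℝ} (hB : Measurable B) (h0 : ∀ u, 0 ≤ B u)
    (hM : ∀ u, B u ≤ M) (hmono : Monotone fun u => Real.exp u * B u)
    (hT : ∀ T, 0 < T → Tendsto (fun v => ∫ x, B (v - x) * fejer T x) atTop
      (𝓝 (c * ∫ x, fejer T x))) : Tendsto B atTop (𝓝 c) := by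
  have hM0 : 0 ≤ M := (h0 0).trans (hM 0)
  have hcmp : ∀ u v, u ≤ v → Real.exp (u - v) * B u ≤ B v := by
    intro u v huv
    have h1 := hmono huv
    simp only at h1
    rw [Real.exp_sub, div_mul_eq_mul_div, div_le_iff₀ (Real.exp_pos _)]
    linarith
  have hInt : ∀ T, 0 < T → ∀ v, Integrable fun x => B (v - x) * fejer T x := by
    intro T hT v
    refine (integrable_fejer hT).bdd_mul (c := M)
      (hB.comp (measurable_const.sub measurable_id)).aestronglyMeasurable (ae_of_all _ fun x => ?_)
    rw [Real.norm_eq_abs, abs_of_nonneg (h0 _)]; exact hM _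
  have hexp : ∀ ε : ℝ, 0 < ε → ε ≤ 1 / 2 → Real.exp (2 * ε) ≤ 1 + 4 * ε := by
    intro ε h1 h2
    have := Real.abs_exp_sub_one_le (x := 2 * ε) (by rw [abs_of_pos] <;> linarith)
    rw [abs_of_pos (by linarith : 0 < 2 * ε)] at this
    linarith [le_abs_self (Real.exp (2 * ε) - 1)]
  have key : ∀ ε : ℝ, 0 < ε → ε ≤ 1 / 2 →
      ∀ᶠ v in atTop, |B v - c| ≤ (2 + 5 * M) * ε := by
    intro ε hε hε2
    set T : ℝ := 16 / ε ^ 2 with hTdef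
    have hT0 : 0 < T := by positivity
    set κ := ∫ x, fejer T x with hκ
    have hκ2 : 1 / 2 ≤ κ := one_le_integral_fejer hT0
    have htail : 8 / (T * ε) = ε / 2 := by rw [hTdef]; field_simp; norm_num
    have hI1 : κ - ε / 2 ≤ ∫ x in Set.Ioc (-ε) ε, fejer T x := by
      rw [← htail]; exact le_integral_fejer_Ioc hT0 hε
    have hI3 : ∫ x in (Set.Ioc (-ε) ε)ᶜ, fejer T x ≤ ε / 2 := by
      rw [← htail]; exact integral_fejer_tail_le hT0 hε
    have hI2 : ∫ x in Set.Ioc (-ε) ε, fejer T x ≤ κ :=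
      setIntegral_le_integral (integrable_fejer hT0) (ae_of_all _ (fejer_nonneg hT0))
    have hlim := (Metric.tendsto_nhds.1 (hT T hT0)) ε hε
    have hl1 := (tendsto_atTop_add_const_right atTop ε tendsto_id).eventually hlim
    have hl2 := (tendsto_atTop_add_const_right atTop (-ε) tendsto_id).eventually hlim
    filter_upwards [hl1, hl2] with v hv1 hv2
    simp only [id, Real.dist_eq] at hv1 hv2
    rw [← hκ] at hv1 hv2
    have hu : Real.exp (-(2 * ε)) * B v * (κ - ε / 2) ≤ c * κ + ε := by
      calc _ ≤ Real.exp (-(2 * ε)) * B v * ∫ x in Set.Ioc (-ε) ε, fejer T x :=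
            mul_le_mul_of_nonneg_left hI1 (mul_nonneg (Real.exp_pos _).le (h0 _))
        _ = ∫ x in Set.Ioc (-ε) ε, Real.exp (-(2 * ε)) * B v * fejer T x :=
            (integral_const_mul _ _).symm
        _ ≤ ∫ x in Set.Ioc (-ε) ε, B (v + ε - x) * fejer T x := by
            refine setIntegral_mono_on ((integrable_fejer hT0).integrableOn.const_mul _)
              (hInt T hT0 _).integrableOn measurableSet_Ioc fun x hx => ?_
            refine mul_le_mul_of_nonneg_right ?_ (fejer_nonneg hT0 x)
            refine le_trans ?_ (hcmp v (v + ε - x) (by linarith [hx.2]))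
            refine mul_le_mul_of_nonneg_right (Real.exp_le_exp.2 (by linarith [hx.1])) (h0 _)
        _ ≤ ∫ x, B (v + ε - x) * fejer T x := setIntegral_le_integral (hInt T hT0 _)
            (ae_of_all _ fun x => mul_nonneg (h0 _) (fejer_nonneg hT0 x))
        _ ≤ _ := by linarith [(abs_lt.1 hv1).2]
    have hl : c * κ - ε ≤ Real.exp (2 * ε) * B v * κ + M * (ε / 2) := by
      calc c * κ - ε ≤ ∫ x, B (v + -ε - x) * fejer T x := by linarith [(abs_lt.1 hv2).1]
        _ = (∫ x in Set.Ioc (-ε) ε, B (v + -ε - x) * fejer T x)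
            + ∫ x in (Set.Ioc (-ε) ε)ᶜ, B (v + -ε - x) * fejer T x :=
            (integral_add_compl measurableSet_Ioc (hInt T hT0 _)).symm
        _ ≤ (∫ x in Set.Ioc (-ε) ε, Real.exp (2 * ε) * B v * fejer T x)
            + ∫ x in (Set.Ioc (-ε) ε)ᶜ, M * fejer T x := by
            refine add_le_add ?_ ?_
            · refine setIntegral_mono_on (hInt T hT0 _).integrableOn
                ((integrable_fejer hT0).integrableOn.const_mul _) measurableSet_Ioc fun x hx => ?_
              refine mul_le_mul_of_nonneg_right ?_ (fejer_nonneg hT0 x)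
              have h1 := hcmp (v + -ε - x) v (by linarith [hx.1])
              have h2 : B (v + -ε - x)
                  = Real.exp (ε + x) * (Real.exp (v + -ε - x - v) * B (v + -ε - x)) := by
                rw [← mul_assoc, ← Real.exp_add]; ring_nf; simp
              rw [h2]
              refine (mul_le_mul_of_nonneg_left h1 (Real.exp_pos _).le).trans ?_
              exact mul_le_mul_of_nonneg_right (Real.exp_le_exp.2 (by linarith [hx.2])) (h0 _)
            · refine setIntegral_mono_on (hInt T hT0 _).integrableOn
                ((integrable_fejer hT0).integrableOn.const_mul _) measurableSet_Ioc.compl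
                fun x _ => ?_
              exact mul_le_mul_of_nonneg_right (hM _) (fejer_nonneg hT0 x)
        _ ≤ _ := by
            rw [integral_const_mul, integral_const_mul]
            exact add_le_add (mul_le_mul_of_nonneg_left hI2
              (mul_nonneg (Real.exp_pos _).le (h0 _))) (mul_le_mul_of_nonneg_left hI3 hM0)
    have hB0 := h0 v
    have hBM := hM v
    have hexpε := hexp ε hε hε2
    have hexpn : 1 - 2 * ε ≤ Real.exp (-(2 * ε)) := by
      linarith [Real.add_one_le_exp (-(2 * ε))]
    clear_value T κ
    clear hInt hcmp hl1 hl2 hlim hT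
    have hBε : B v * ε ≤ M * ε := mul_le_mul_of_nonneg_right hBM hε.le
    rw [abs_le]
    constructor
    · have h1 : Real.exp (2 * ε) * B v * κ ≤ (B v + 4 * (M * ε)) * κ := by
        refine mul_le_mul_of_nonneg_right ?_ (by linarith)
        have := mul_le_mul_of_nonneg_right hexpε hB0
        nlinarith
      have h2 : c * κ ≤ (B v + 4 * (M * ε) + (2 + M) * ε) * κ := by
        have : ε + M * (ε / 2) ≤ (2 + M) * ε * κ := by
          have := mul_le_mul_of_nonneg_left hκ2 (by positivity : 0 ≤ (2 + M) * ε)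
          linarith
        linarith
      have := le_of_mul_le_mul_right h2 (by linarith)
      linarith
    · have h3 : (1 - 2 * ε) * B v * (κ * (1 - ε)) ≤ Real.exp (-(2 * ε)) * B v * (κ - ε / 2) := by
        have hk : κ * (1 - ε) ≤ κ - ε / 2 := by nlinarith
        have h5 : 0 ≤ κ * (1 - ε) := mul_nonneg (by linarith) (by linarith)
        exact mul_le_mul (mul_le_mul_of_nonneg_right hexpn hB0) hk h5
          (mul_nonneg (Real.exp_pos _).le hB0)
      have h4 : (B v - 3 * (M * ε)) * κ ≤ (c + 2 * ε) * κ := by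
        have h6 : (B v - 3 * (M * ε)) ≤ (1 - 2 * ε) * B v * (1 - ε) := by
          have : 0 ≤ 2 * ε ^ 2 * B v := by positivity
          nlinarith
        have h7 := mul_le_mul_of_nonneg_right h6 (by linarith : 0 ≤ κ)
        have h8 : ε ≤ 2 * ε * κ := by nlinarith
        linarith
      have := le_of_mul_le_mul_right h4 (by linarith)
      nlinarith
  rw [Metric.tendsto_nhds]
  intro η hη
  set ε := min (1 / 2) (η / (2 * (2 + 5 * M)))
  have hε : 0 < ε := lt_min (by norm_num) (by positivity)
  filter_upwards [key ε hε (min_le_left _ _)] with v hv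
  rw [Real.dist_eq]
  refine hv.trans_lt ?_
  calc (2 + 5 * M) * ε ≤ (2 + 5 * M) * (η / (2 * (2 + 5 * M))) :=
        mul_le_mul_of_nonneg_left (min_le_right _ _) (by positivity)
    _ = η / 2 := by field_simp
    _ < η := by linarith

lemma ofReal_fejer_eq_re (T x : ℝ) :
    fejer T x = (∫ t in (0:ℝ)..T, ((2 * (1 - t / T) : ℝ) : ℂ) * Complex.exp (Complex.I * (t * x))).re := by
  have h2 := Complex.reCLM.intervalIntegral_comp_comm (μ := volume) (a := 0) (b := T)
    (f := fun t : ℝ => ((2 * (1 - t / T) : ℝ) : ℂ) * Complex.exp (Complex.I * (t * x)))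
    (by apply Continuous.intervalIntegrable; fun_prop)
  simp only [Complex.reCLM_apply] at h2
  rw [← h2, fejer]
  congr 1; ext t
  rw [Complex.re_ofReal_mul, mul_comm Complex.I, ← Complex.ofReal_mul, Complex.exp_ofReal_mul_I_re]

lemma integral_damped_mul_fejer {E : ℝ → ℝ} {K : ℝ} (hE : Measurable E) (hK : ∀ u, |E u| ≤ K)
    {H : ℂ → ℂ} {δ : ℝ} (hδ : 0 < δ)
    (h : ∀ t : ℝ, ∫ u in Set.Ioi (0:ℝ), (E u : ℂ) * Complex.exp (-((δ + Complex.I * t) * u))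
      = H (δ + Complex.I * t)) {T : ℝ} (hT : 0 < T) (v : ℝ) :
    ∫ u in Set.Ioi (0:ℝ), Real.exp (-(δ * u)) * (E u * fejer T (v - u)) =
      (∫ t in Set.Ioc 0 T, ((2 * (1 - t / T) : ℝ) : ℂ) *
        (Complex.exp (Complex.I * (t * v)) * H (δ + Complex.I * t))).re := by
  set F : ℝ → ℝ → ℂ := fun u t => ((2 * (1 - t / T) : ℝ) : ℂ) *
    (Complex.exp (Complex.I * (t * v)) * ((E u : ℂ) * Complex.exp (-((δ + Complex.I * t) * u))))
    with hF
  have hexpint : IntegrableOn (fun u : ℝ => Real.exp (-(δ * u))) (Set.Ioi 0) := by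
    have := exp_neg_integrableOn_Ioi 0 hδ
    simpa [neg_mul] using this
  have hnorm : ∀ u t : ℝ, t ∈ Set.Ioc 0 T → ‖F u t‖ ≤ 2 * K * Real.exp (-(δ * u)) := by
    intro u t ht
    have h1 : ‖Complex.exp (Complex.I * (t * v))‖ = 1 := by
      rw [Complex.norm_exp]; simp
    have h2 : ‖Complex.exp (-((δ + Complex.I * t) * u))‖ = Real.exp (-(δ * u)) := by
      rw [Complex.norm_exp]; simp
    have h3 : |2 * (1 - t / T)| ≤ 2 := by
      have a1 : t / T ≤ 1 := (div_le_one hT).2 ht.2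
      have a2 : 0 ≤ t / T := div_nonneg ht.1.le hT.le
      rw [abs_le]; constructor <;> linarith
    rw [hF]
    rw [norm_mul, norm_mul, norm_mul, h1, h2, Complex.norm_real, Complex.norm_real, one_mul,
      Real.norm_eq_abs, Real.norm_eq_abs, ← mul_assoc]
    refine mul_le_mul_of_nonneg_right ?_ (Real.exp_pos _).le
    exact mul_le_mul h3 (hK u) (abs_nonneg _) zero_le_two
  have hmeas : Measurable (Function.uncurry F) := by
    rw [hF]; unfold Function.uncurry
    fun_prop
  have hFint : Integrable (Function.uncurry F)
      ((volume.restrict (Set.Ioi (0:ℝ))).prod (volume.restrict (Set.Ioc 0 T))) := by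
    have hb : Integrable (fun z : ℝ × ℝ => (2 * K * Real.exp (-(δ * z.1))) * (1:ℝ))
        ((volume.restrict (Set.Ioi (0:ℝ))).prod (volume.restrict (Set.Ioc 0 T))) := by
      refine Integrable.mul_prod (f := fun u => 2 * K * Real.exp (-(δ * u))) (g := fun _ => (1:ℝ))
        (hexpint.const_mul _) ?_
      exact integrable_const _
    refine hb.mono' hmeas.aestronglyMeasurable ?_
    rw [Measure.prod_restrict]
    refine (ae_restrict_iff' (measurableSet_Ioi.prod measurableSet_Ioc)).2 (ae_of_all _ ?_)
    rintro ⟨u, t⟩ ⟨_, ht⟩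
    simpa using hnorm u t ht
  have hswap := integral_integral_swap hFint
  have hR : ∀ t : ℝ, ∫ u in Set.Ioi (0:ℝ), F u t = ((2 * (1 - t / T) : ℝ) : ℂ) *
        (Complex.exp (Complex.I * (t * v)) * H (δ + Complex.I * t)) := by
    intro t
    rw [hF]; simp only
    rw [integral_const_mul, integral_const_mul, h]
  have hL : ∀ u : ℝ, Real.exp (-(δ * u)) * (E u * fejer T (v - u))
      = (∫ t in Set.Ioc 0 T, F u t).re := by
    intro u
    rw [ofReal_fejer_eq_re, intervalIntegral.integral_of_le hT.le]
    rw [← Complex.re_ofReal_mul, ← Complex.re_ofReal_mul, ← integral_const_mul, ← integral_const_mul]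
    congr 2; ext t
    rw [hF]
    simp only
    have : Complex.exp (Complex.I * (t * (v - u : ℝ))) * Complex.exp (-(δ * u) : ℝ)
      = Complex.exp (Complex.I * (t * v)) * Complex.exp (-((δ + Complex.I * t) * u)) := by
      rw [← Complex.exp_add, ← Complex.exp_add]; congr 1; push_cast; ring
    rw [Complex.ofReal_exp]
    linear_combination (((2 * (1 - t / T) : ℝ) : ℂ) * (E u : ℂ)) * this
  calc _ = ∫ u in Set.Ioi (0:ℝ), Complex.reCLM (∫ t in Set.Ioc 0 T, F u t) := by
        simp only [hL, Complex.reCLM_apply]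
    _ = (∫ u in Set.Ioi (0:ℝ), ∫ t in Set.Ioc 0 T, F u t).re := by
        rw [Complex.reCLM.integral_comp_comm (by simpa [Function.uncurry] using hFint.integral_prod_left),
          Complex.reCLM_apply]
    _ = _ := by rw [hswap]; simp only [hR]

lemma integral_mul_fejer_eq {E : ℝ → ℝ} {K : ℝ} (hE : Measurable E) (hK : ∀ u, |E u| ≤ K)
    {H : ℂ → ℂ} (hH : ContinuousOn H {s | 0 ≤ s.re})
    (h : ∀ δ : ℝ, 0 < δ → ∀ t : ℝ,
      ∫ u in Set.Ioi (0:ℝ), (E u : ℂ) * Complex.exp (-((δ + Complex.I * t) * u))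
      = H (δ + Complex.I * t)) {T : ℝ} (hT : 0 < T) (v : ℝ) :
    ∫ u in Set.Ioi (0:ℝ), E u * fejer T (v - u) =
      (∫ t in Set.Ioc 0 T, ((2 * (1 - t / T) : ℝ) : ℂ) *
        (Complex.exp (Complex.I * (t * v)) * H (Complex.I * t))).re := by
  have hK0 : 0 ≤ K := (abs_nonneg _).trans (hK 0)
  have hlim1 : Tendsto (fun δ : ℝ => ∫ u in Set.Ioi (0:ℝ),
      Real.exp (-(δ * u)) * (E u * fejer T (v - u))) (𝓝[>] 0)
      (𝓝 (∫ u in Set.Ioi (0:ℝ), E u * fejer T (v - u))) := by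
    refine tendsto_integral_filter_of_dominated_convergence (fun u => K * fejer T (v - u))
      (Eventually.of_forall fun δ => ?_) ?_ ?_ ?_
    · have := (continuous_fejer T).measurable
      have h2 : Measurable fun u => fejer T (v - u) := this.comp (measurable_const.sub measurable_id)
      exact Measurable.aestronglyMeasurable (by fun_prop)
    · filter_upwards [self_mem_nhdsWithin] with δ hδ
      refine (ae_restrict_iff' measurableSet_Ioi).2 (ae_of_all _ fun u hu => ?_)
      have h1 : Real.exp (-(δ * u)) ≤ 1 := Real.exp_le_one_iff.2 (by
        have := mul_pos (Set.mem_Ioi.1 hδ) (Set.mem_Ioi.1 hu); linarith)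
      have h2 := fejer_nonneg hT (v - u)
      rw [norm_mul, norm_mul, Real.norm_of_nonneg (Real.exp_pos _).le, Real.norm_of_nonneg h2,
        Real.norm_eq_abs]
      calc _ ≤ 1 * (K * fejer T (v - u)) := mul_le_mul h1
            (mul_le_mul_of_nonneg_right (hK u) h2) (by positivity) zero_le_one
        _ = _ := one_mul _
    · exact (((integrable_fejer hT).comp_sub_left v).const_mul K).integrableOn
    · refine ae_of_all _ fun u => ?_
      have : Continuous fun δ : ℝ => Real.exp (-(δ * u)) * (E u * fejer T (v - u)) := by fun_prop
      have h2 := this.tendsto 0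
      simp only [zero_mul, neg_zero, Real.exp_zero, one_mul] at h2
      exact h2.mono_left nhdsWithin_le_nhds
  obtain ⟨C, hC⟩ : ∃ C, ∀ δ ∈ Set.Icc (0:ℝ) 1, ∀ t ∈ Set.Icc 0 T,
      ‖H (δ + Complex.I * t)‖ ≤ C := by
    have hc : IsCompact ((fun z : ℝ × ℝ => (z.1 : ℂ) + Complex.I * z.2) ''
        (Set.Icc (0:ℝ) 1 ×ˢ Set.Icc 0 T)) :=
      (isCompact_Icc.prod isCompact_Icc).image (by fun_prop)
    obtain ⟨C, hC⟩ := hc.exists_bound_of_continuousOn (hH.mono (by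
      rintro _ ⟨⟨δ, t⟩, ⟨hδ, _⟩, rfl⟩; simpa using hδ.1))
    exact ⟨C, fun δ hδ t ht => hC _ ⟨(δ, t), ⟨hδ, ht⟩, rfl⟩⟩
  have hcont : ∀ δ : ℝ, 0 ≤ δ → ContinuousOn (fun t : ℝ => ((2 * (1 - t / T) : ℝ) : ℂ) *
        (Complex.exp (Complex.I * (t * v)) * H (δ + Complex.I * t))) (Set.Ioc 0 T) := by
    intro δ hδ
    refine ContinuousOn.mul (by fun_prop) (ContinuousOn.mul (by fun_prop) ?_)
    exact hH.comp (by fun_prop) (by intro t _; simpa using hδ)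
  have hlim2 : Tendsto (fun δ : ℝ => ∫ t in Set.Ioc 0 T, ((2 * (1 - t / T) : ℝ) : ℂ) *
        (Complex.exp (Complex.I * (t * v)) * H (δ + Complex.I * t))) (𝓝[>] 0)
      (𝓝 (∫ t in Set.Ioc 0 T, ((2 * (1 - t / T) : ℝ) : ℂ) *
        (Complex.exp (Complex.I * (t * v)) * H (Complex.I * t)))) := by
    refine tendsto_integral_filter_of_dominated_convergence (fun _ => 2 * C) ?_ ?_ ?_ ?_
    · filter_upwards [self_mem_nhdsWithin] with δ hδ
      exact (hcont δ (Set.mem_Ioi.1 hδ).le).aestronglyMeasurable measurableSet_Ioc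
    · filter_upwards [Ioo_mem_nhdsGT (zero_lt_one' ℝ)] with δ hδ
      refine (ae_restrict_iff' measurableSet_Ioc).2 (ae_of_all _ fun t ht => ?_)
      have h1 : ‖Complex.exp (Complex.I * (t * v))‖ = 1 := by rw [Complex.norm_exp]; simp
      have h3 : |2 * (1 - t / T)| ≤ 2 := by
        have a1 : t / T ≤ 1 := (div_le_one hT).2 ht.2
        have a2 : 0 ≤ t / T := div_nonneg ht.1.le hT.le
        rw [abs_le]; constructor <;> linarith
      rw [norm_mul, norm_mul, h1, one_mul, Complex.norm_real, Real.norm_eq_abs]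
      exact mul_le_mul h3 (hC δ ⟨hδ.1.le, hδ.2.le⟩ t ⟨ht.1.le, ht.2⟩) (norm_nonneg _) zero_le_two
    · exact integrable_const _
    · refine ae_of_all _ fun t => ?_
      refine Tendsto.const_mul _ (Tendsto.const_mul _ ?_)
      have h1 : Tendsto (fun δ : ℝ => (δ : ℂ) + Complex.I * t) (𝓝[>] 0)
          (𝓝[{s | 0 ≤ s.re}] (Complex.I * t)) := by
        refine tendsto_nhdsWithin_iff.2 ⟨?_, ?_⟩
        · have : Continuous fun δ : ℝ => (δ : ℂ) + Complex.I * t := by fun_prop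
          have h2 := this.tendsto 0
          simp only [Complex.ofReal_zero, zero_add] at h2
          exact h2.mono_left nhdsWithin_le_nhds
        · filter_upwards [self_mem_nhdsWithin] with δ hδ
          simpa using (Set.mem_Ioi.1 hδ).le
      exact (hH (Complex.I * t) (by simp)).tendsto.comp h1
  have hlim3 := (Complex.continuous_re.tendsto _).comp hlim2
  refine tendsto_nhds_unique hlim1 (hlim3.congr' ?_)
  filter_upwards [self_mem_nhdsWithin] with δ hδ
  exact (integral_damped_mul_fejer hE hK (Set.mem_Ioi.1 hδ) (h δ hδ) hT v).symm

lemma tendsto_integral_mul_fejer {E : ℝ → ℝ} {K : ℝ} (hE : Measurable E) (hK : ∀ u, |E u| ≤ K)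
    {H : ℂ → ℂ} (hH : ContinuousOn H {s | 0 ≤ s.re})
    (h : ∀ δ : ℝ, 0 < δ → ∀ t : ℝ,
      ∫ u in Set.Ioi (0:ℝ), (E u : ℂ) * Complex.exp (-((δ + Complex.I * t) * u))
      = H (δ + Complex.I * t)) {T : ℝ} (hT : 0 < T) :
    Tendsto (fun v => ∫ u in Set.Ioi (0:ℝ), E u * fejer T (v - u)) atTop (𝓝 0) := by
  set f : ℝ → ℂ := (Set.Ioc 0 T).indicator fun t => ((2 * (1 - t / T) : ℝ) : ℂ) * H (Complex.I * t)
  have h1 := Real.tendsto_integral_exp_smul_cocompact f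
  have h2 : Tendsto (fun v : ℝ => -(v / (2 * Real.pi))) atTop (cocompact ℝ) := by
    have : Tendsto (fun v : ℝ => -(v / (2 * Real.pi))) atTop atBot :=
      tendsto_neg_atTop_atBot.comp (tendsto_id.atTop_div_const (by positivity))
    exact this.mono_right atBot_le_cocompact
  have h3 := (Complex.continuous_re.tendsto _).comp (h1.comp h2)
  refine h3.congr fun v => ?_
  rw [integral_mul_fejer_eq hE hK hH h hT v, ← integral_indicator measurableSet_Ioc]
  simp only [Function.comp]
  congr 2; ext t
  simp only [f, Set.indicator_apply]
  split_ifs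
  · rw [Circle.smul_def, Real.fourierChar_apply, smul_eq_mul]
    have : (((2 * Real.pi * -(t * -(v / (2 * Real.pi))) : ℝ) : ℂ) * Complex.I)
        = Complex.I * (t * v) := by
      push_cast; field_simp
    rw [this]; ring
  · simp

lemma tendsto_integral_fejer_Ioi {T : ℝ} (hT : 0 < T) :
    Tendsto (fun v => ∫ u in Set.Ioi (0:ℝ), fejer T (v - u)) atTop (𝓝 (∫ x, fejer T x)) := by
  have h1 : Tendsto (fun v : ℝ => ∫ x in Set.Iio v, fejer T x) atTop (𝓝 (∫ x, fejer T x)) :=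
    (aecover_Iio tendsto_id).integral_tendsto_of_countably_generated (integrable_fejer hT)
  refine h1.congr fun v => ?_
  rw [← integral_indicator measurableSet_Iio, ← integral_indicator measurableSet_Ioi,
    ← integral_sub_left_eq_self _ _ v]
  congr 1; ext u
  simp only [Set.indicator_apply, Set.mem_Iio, Set.mem_Ioi]
  congr 1
  simp

/-- A form of the Wiener–Ikehara theorem. -/
theorem wiener_ikehara {a : ℕ → ℝ} (ha : ∀ n, 0 ≤ a n) {M : ℝ}
    (hM : ∀ n : ℕ, ∑ k ∈ Icc 1 n, a k ≤ M * n) {g : ℂ → ℂ} (hg : ContinuousOn g {s | 1 ≤ s.re})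
    {c : ℝ} (hL : ∀ s : ℂ, 1 < s.re → LSeries (fun n => (a n : ℂ)) s = g s + c / (s - 1)) :
    Tendsto (fun n : ℕ => (∑ k ∈ Icc 1 n, a k) / n) atTop (𝓝 c) := by
  set A : ℕ → ℝ := fun n => ∑ k ∈ Icc 1 n, a k with hA
  have hA0 : ∀ n, 0 ≤ A n := fun n => sum_nonneg fun k _ => ha k
  have hAmono : Monotone A := fun m n hmn =>
    sum_le_sum_of_subset_of_nonneg (Icc_subset_Icc_right hmn) fun k _ _ => ha k
  have hM0 : 0 ≤ M := by have := (hA0 1).trans (hM 1); simpa using this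
  set D : ℝ → ℝ := fun u => if 0 < u then A ⌊Real.exp u⌋₊ else 0 with hD
  have hDmono : Monotone D := by
    intro u v huv
    simp only [hD]
    split_ifs with h1 h2
    · exact hAmono (Nat.floor_mono (Real.exp_le_exp.2 huv))
    · exact absurd (h1.trans_le huv) h2
    · exact hA0 _
    · exact le_rfl
  set B : ℝ → ℝ := fun u => Real.exp (-u) * D u with hB
  have hBm : Measurable B := by
    have := hDmono.measurable
    fun_prop
  have hD0 : ∀ u, 0 ≤ D u := by
    intro u; simp only [hD]; split_ifs; exacts [hA0 _, le_rfl]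
  have hB0 : ∀ u, 0 ≤ B u := fun u => mul_nonneg (Real.exp_pos _).le (hD0 u)
  have hBM : ∀ u, B u ≤ M := by
    intro u
    simp only [hB, hD]
    split_ifs
    · rw [Real.exp_neg, inv_mul_le_iff₀ (Real.exp_pos _), mul_comm]
      refine (hM _).trans ?_
      exact mul_le_mul_of_nonneg_left (Nat.floor_le (Real.exp_pos _).le) hM0
    · simpa using hM0
  have hBneg : ∀ u, u ≤ 0 → B u = 0 := by
    intro u hu; simp [hB, hD, not_lt.2 hu]
  have hBmono : Monotone fun u => Real.exp u * B u := by
    have : (fun u => Real.exp u * B u) = D := by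
      ext u; simp only [hB]; rw [← mul_assoc, ← Real.exp_add]; simp
    rw [this]; exact hDmono
  set H : ℂ → ℂ := fun z => (g (1 + z) - c) / (1 + z) with hH
  have hHc : ContinuousOn H {s | 0 ≤ s.re} := by
    refine ContinuousOn.div ((hg.comp (by fun_prop) ?_).sub continuousOn_const) (by fun_prop) ?_
    · intro z hz; simpa using hz
    · intro z hz h0
      have := congrArg Complex.re h0
      simp only [Complex.add_re, Complex.one_re, Complex.zero_re] at this
      have hz' : 0 ≤ z.re := hz
      linarith
  have hBint : ∀ z : ℂ, 0 < z.re → IntegrableOn (fun u : ℝ => (B u : ℂ) * Complex.exp (-(z * u)))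
      (Set.Ioi 0) := by
    intro z hz
    have h1 : IntegrableOn (fun u : ℝ => Complex.exp (-(z * u))) (Set.Ioi 0) := by
      have := integrableOn_exp_mul_complex_Ioi (a := -z) (by simpa using hz) 0
      simpa only [neg_mul] using this
    refine Integrable.bdd_mul (c := M) h1
      (Complex.measurable_ofReal.comp hBm).aestronglyMeasurable (ae_of_all _ fun u => ?_)
    rw [Complex.norm_real, Real.norm_of_nonneg (hB0 u)]; exact hBM u
  have hBtr : ∀ z : ℂ, 0 < z.re → ∫ u in Set.Ioi (0:ℝ), (B u : ℂ) * Complex.exp (-(z * u))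
      = LSeries (fun n => (a n : ℂ)) (1 + z) / (1 + z) := by
    intro z hz
    have hz1 : (1 + z) ≠ 0 := by
      intro h0
      have := congrArg Complex.re h0
      simp only [Complex.add_re, Complex.one_re, Complex.zero_re] at this
      linarith
    have h1 := LSeries_eq_mul_integral_of_nonneg a (r := 1) zero_le_one (s := 1 + z)
      (by simpa using hz) (by
        refine Asymptotics.IsBigO.of_bound M (Eventually.of_forall fun n => ?_)
        rw [Real.norm_of_nonneg (hA0 n), Real.rpow_one, Real.norm_of_nonneg (Nat.cast_nonneg n)]
        exact hM n) ha
    rw [h1, mul_div_cancel_left₀ _ hz1]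
    have h2 := integral_comp_exp_Ioi (fun t : ℝ => (∑ k ∈ Icc 1 ⌊t⌋₊, (a k : ℂ))
      * (t : ℂ) ^ (-((1 + z) + 1))) 0
    rw [Real.exp_zero] at h2
    rw [← h2]
    refine setIntegral_congr_fun measurableSet_Ioi fun u hu => ?_
    simp only [hB, hD, if_pos (Set.mem_Ioi.1 hu), hA]
    have h3 : ((Real.exp u : ℝ) : ℂ) ^ (-((1 + z) + 1)) = Complex.exp (u * (-((1 + z) + 1))) := by
      rw [Complex.cpow_def_of_ne_zero (by exact_mod_cast (Real.exp_pos u).ne'),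
        ← Complex.ofReal_log (Real.exp_pos u).le, Real.log_exp]
    have h4 : Complex.exp u * Complex.exp (u * (-((1 + z) + 1)))
        = Complex.exp (-u) * Complex.exp (-(z * u)) := by
      rw [← Complex.exp_add, ← Complex.exp_add]; congr 1; ring
    rw [Complex.real_smul, h3]
    push_cast
    linear_combination -(∑ k ∈ Icc 1 ⌊Real.exp u⌋₊, (a k : ℂ)) * h4
  have hE : ∀ δ : ℝ, 0 < δ → ∀ t : ℝ,
      ∫ u in Set.Ioi (0:ℝ), ((B u - c : ℝ) : ℂ) * Complex.exp (-((δ + Complex.I * t) * u))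
      = H (δ + Complex.I * t) := by
    intro δ hδ t
    set z : ℂ := δ + Complex.I * t with hz
    have hzre : 0 < z.re := by simpa [hz] using hδ
    have hz0 : z ≠ 0 := by rintro h0; rw [h0] at hzre; simp at hzre
    have hz1 : (1 + z) ≠ 0 := by
      intro h0
      have := congrArg Complex.re h0
      simp only [Complex.add_re, Complex.one_re, Complex.zero_re] at this
      linarith
    clear_value z
    have h1 : IntegrableOn (fun u : ℝ => Complex.exp (-(z * u))) (Set.Ioi 0) := by
      have := integrableOn_exp_mul_complex_Ioi (a := -z) (by simpa using hzre) 0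
      simpa only [neg_mul] using this
    have h2 : ∫ u in Set.Ioi (0:ℝ), Complex.exp (-(z * u)) = 1 / z := by
      have := integral_exp_mul_complex_Ioi (a := -z) (by simpa using hzre) 0
      simp only [neg_mul] at this
      rw [this]; simp
    have h3 : ∀ u : ℝ, ((B u - c : ℝ) : ℂ) * Complex.exp (-(z * u))
        = (B u : ℂ) * Complex.exp (-(z * u)) - c * Complex.exp (-(z * u)) := by
      intro u; push_cast; ring
    simp only [h3]
    rw [integral_sub (hBint z hzre) (h1.const_mul _), integral_const_mul, h2, hBtr z hzre,
      hL _ (by simpa using hzre), hH]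
    simp only
    have : 1 + z - 1 = z := by ring
    rw [this]
    field_simp
    ring
  have hBE : ∀ u, |B u - c| ≤ M + |c| := fun u =>
    (abs_sub _ _).trans (add_le_add_left (by rw [abs_of_nonneg (hB0 u)]; exact hBM u) _)
  have hfin : ∀ T, 0 < T → Tendsto (fun v => ∫ x, B (v - x) * fejer T x) atTop
      (𝓝 (c * ∫ x, fejer T x)) := by
    intro T hT
    have h1 := tendsto_integral_mul_fejer (hBm.sub_const c) hBE hHc hE hT
    have h2 := h1.add ((tendsto_integral_fejer_Ioi hT).const_mul c)
    rw [zero_add] at h2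
    refine h2.congr fun v => ?_
    have hf : Integrable fun u => fejer T (v - u) := (integrable_fejer hT).comp_sub_left v
    have hBf : Integrable fun u => (B u - c) * fejer T (v - u) :=
      hf.bdd_mul (c := M + |c|) (hBm.sub_const c).aestronglyMeasurable (ae_of_all _ hBE)
    rw [← integral_const_mul, ← integral_add hBf.integrableOn (hf.const_mul c).integrableOn,
      ← integral_sub_left_eq_self (fun x => B (v - x) * fejer T x) volume v,
      ← integral_indicator measurableSet_Ioi]
    congr 1; ext u
    rw [Set.indicator_apply, sub_sub_cancel]
    split_ifs with hu
    · ring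
    · rw [hBneg u (not_lt.1 hu)]; ring
  have hlim := tendsto_of_tendsto_fejer hBm hB0 hBM hBmono hfin
  have hlog := hlim.comp (Real.tendsto_log_atTop.comp tendsto_natCast_atTop_atTop)
  refine hlog.congr' ?_
  filter_upwards [eventually_ge_atTop 2] with n hn
  have hn1 : (1:ℝ) < n := by exact_mod_cast hn
  simp only [Function.comp, hB, hD, if_pos (Real.log_pos hn1)]
  rw [Real.exp_neg, Real.exp_log (by linarith), Nat.floor_natCast]
  field_simp
  rfl

open ArithmeticFunction in
lemma tendsto_sum_residueClass_div {q : ℕ} [NeZero q] {a : ZMod q} (ha : IsUnit a) :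
    Tendsto (fun n : ℕ => (∑ k ∈ Icc 1 n, vonMangoldt.residueClass a k) / n) atTop
      (𝓝 (q.totient : ℝ)⁻¹) := by
  refine wiener_ikehara (vonMangoldt.residueClass_nonneg a) (M := Real.log 4 + 4) (fun n => ?_)
    (vonMangoldt.continuousOn_LFunctionResidueClassAux a) fun s hs => ?_
  · refine le_trans ?_ (Chebyshev.psi_le_const_mul_self (Nat.cast_nonneg n))
    rw [Chebyshev.psi, Nat.floor_natCast]
    exact sum_le_sum fun k _ => vonMangoldt.residueClass_le a k
  · rw [vonMangoldt.eqOn_LFunctionResidueClassAux ha hs]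
    push_cast
    ring

/-- The prime number theorem in arithmetic progressions. -/
theorem sum_log_prime_progression {q a : ℕ} (hq : 1 ≤ q) (ha : a.Coprime q) {ε : ℝ} (hε : 0 < ε) :
    ∃ X₀ : ℕ, ∀ X : ℕ, X₀ ≤ X →
      |∑ p ∈ (Ioc 0 X).filter (fun p => p.Prime ∧ p ≡ a [MOD q]), Real.log p - X / q.totient|
        ≤ ε * X := by
  have : NeZero q := ⟨by omega⟩
  have hu : IsUnit (a : ZMod q) := (ZMod.isUnit_iff_coprime a q).2 ha
  have h1 := Metric.tendsto_nhds.1 (tendsto_sum_residueClass_div hu) (ε / 2) (by positivity)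
  have h2 : Tendsto (fun n : ℕ => Real.log n * (n:ℝ) ^ (-(1/2:ℝ))) atTop (𝓝 0) := by
    have h := (isLittleO_log_rpow_atTop (r := 1/2) (by norm_num)).tendsto_div_nhds_zero
    refine (h.comp tendsto_natCast_atTop_atTop).congr fun n => ?_
    simp only [Function.comp]
    rw [Real.rpow_neg (Nat.cast_nonneg n), div_eq_mul_inv]
  have h3 := Metric.tendsto_nhds.1 h2 (ε / 4) (by positivity)
  obtain ⟨X₀, hX₀⟩ := eventually_atTop.1 (h1.and h3)
  refine ⟨max X₀ 1, fun X hX => ?_⟩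
  have hX1 : 1 ≤ X := (le_max_right _ _).trans hX
  have hXpos : (0:ℝ) < X := by exact_mod_cast hX1
  obtain ⟨h4, h5⟩ := hX₀ X ((le_max_left _ _).trans hX)
  rw [Real.dist_eq] at h4 h5
  set S := ∑ k ∈ Icc 1 X, ArithmeticFunction.vonMangoldt.residueClass (a : ZMod q) k with hS
  set P := ∑ p ∈ (Ioc 0 X).filter (fun p => p.Prime ∧ p ≡ a [MOD q]), Real.log p with hP
  have hSX : |S - X / q.totient| ≤ ε / 2 * X := by
    have : S - X / q.totient = (S / X - (q.totient : ℝ)⁻¹) * X := by field_simp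
    rw [this, abs_mul, abs_of_pos hXpos]
    exact mul_le_mul_of_nonneg_right h4.le hXpos.le
  have hIcc : Icc 1 X = Ioc 0 X := rfl
  have hdiff : S - P = ∑ k ∈ (Ioc 0 X).filter (fun k => ¬ k.Prime),
      ArithmeticFunction.vonMangoldt.residueClass (a : ZMod q) k := by
    have h6 : ∑ x ∈ Ioc 0 X with Nat.Prime x,
        ArithmeticFunction.vonMangoldt.residueClass (a : ZMod q) x = P := by
      rw [hP, ← filter_filter, sum_filter (fun p => p ≡ a [MOD q])]
      refine sum_congr rfl fun p hp => ?_
      rw [ArithmeticFunction.vonMangoldt.residueClass, Set.indicator_apply,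
        ArithmeticFunction.vonMangoldt_apply_prime (mem_filter.1 hp).2]
      simp only [Set.mem_ofPred_eq, ZMod.natCast_eq_natCast_iff]
    rw [hS, hIcc, ← sum_filter_add_sum_filter_not (Ioc 0 X) Nat.Prime, h6, add_sub_cancel_left]
  have hd0 : 0 ≤ S - P := by
    rw [hdiff]
    exact sum_nonneg fun k _ => ArithmeticFunction.vonMangoldt.residueClass_nonneg _ k
  have hd1 : S - P ≤ ε / 2 * X := by
    have h6 : S - P ≤ Chebyshev.psi X - Chebyshev.theta X := by
      rw [hdiff, Chebyshev.psi, Chebyshev.theta, Nat.floor_natCast,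
        ← sum_filter_add_sum_filter_not (Ioc 0 X) Nat.Prime]
      have : ∑ x ∈ Ioc 0 X with Nat.Prime x, ArithmeticFunction.vonMangoldt x
          = ∑ p ∈ Ioc 0 X with Nat.Prime p, Real.log p :=
        sum_congr rfl fun p hp => ArithmeticFunction.vonMangoldt_apply_prime (mem_filter.1 hp).2
      rw [this, add_sub_cancel_left]
      exact sum_le_sum fun k _ => ArithmeticFunction.vonMangoldt.residueClass_le _ k
    refine h6.trans ((Chebyshev.psi_sub_theta_le (by exact_mod_cast hX1)).trans ?_)
    have h7 := (le_abs_self _).trans h5.le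
    rw [sub_zero, Real.rpow_neg hXpos.le, ← Real.sqrt_eq_rpow] at h7
    have h8 : Real.log X ≤ ε / 4 * √X := by
      rwa [← div_eq_mul_inv, div_le_iff₀ (Real.sqrt_pos.2 hXpos)] at h7
    have h9 := mul_le_mul_of_nonneg_left h8 (by positivity : 0 ≤ 2 * √(X:ℝ))
    have h10 := Real.mul_self_sqrt hXpos.le
    calc _ ≤ _ := h9
      _ = ε / 2 * (√X * √X) := by ring
      _ = _ := by rw [h10]
  rw [abs_le] at hSX ⊢
  constructor <;> linarith [hSX.1, hSX.2]

end

/-- The normalised weight of the primes congruent to `1` modulo `W`. -/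
noncomputable def pw (W n : ℕ) : ℝ :=
  if (W * n + 1).Prime then (W.totient : ℝ) / W * Real.log (W * n + 1 : ℕ) else 0

lemma pw_nonneg (W n : ℕ) : 0 ≤ pw W n := by
  unfold pw; split_ifs
  · have := Real.log_natCast_nonneg (W * n + 1); positivity
  · exact le_rfl

lemma pw_le_log (W n : ℕ) : pw W n ≤ Real.log (W * n + 1 : ℕ) := by
  have h0 := Real.log_natCast_nonneg (W * n + 1)
  unfold pw; split_ifs
  · refine mul_le_of_le_one_left h0 (div_le_one_of_le₀ ?_ (Nat.cast_nonneg _))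
    exact_mod_cast Nat.totient_le W
  · exact h0

/-- The sum of `pw W n * G n` as a sum over primes. -/
lemma sum_pw_mul {W : ℕ} (hW : 1 ≤ W) (N : ℕ) (G : ℕ → ℂ) :
    ∑ n ∈ Ioc 0 N, (pw W n : ℂ) * G n = (W.totient : ℂ) / W *
      ∑ p ∈ (Ioc 0 (W * N + 1)).filter (fun p => p.Prime ∧ p ≡ 1 [MOD W]),
        (Real.log p : ℂ) * G ((p - 1) / W) := by
  rw [mul_sum]
  have h1 : ∑ n ∈ Ioc 0 N, (pw W n : ℂ) * G n = ∑ n ∈ (Ioc 0 N).filter (fun n => (W * n + 1).Prime),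
      (W.totient : ℂ) / W * ((Real.log (W * n + 1 : ℕ) : ℂ) * G n) := by
    rw [sum_filter]
    refine sum_congr rfl fun n _ => ?_
    unfold pw
    split_ifs
    · push_cast; ring
    · simp
  rw [h1]
  refine sum_nbij' (fun n => W * n + 1) (fun p => (p - 1) / W) ?_ ?_ ?_ ?_ ?_
  · intro n hn
    simp only [mem_filter, mem_Ioc] at hn ⊢
    refine ⟨⟨by omega, by have := Nat.mul_le_mul_left W hn.1.2; omega⟩, hn.2, ?_⟩
    simp
  · intro p hp
    simp only [mem_filter, mem_Ioc] at hp ⊢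
    obtain ⟨⟨hp0, hpN⟩, hpp, hp1⟩ := hp
    have hd : W ∣ p - 1 := (Nat.modEq_iff_dvd' hp0).1 hp1.symm
    have hp2 := hpp.two_le
    refine ⟨⟨Nat.div_pos (Nat.le_of_dvd (by omega) hd) (by omega), ?_⟩, ?_⟩
    · exact Nat.div_le_of_le_mul (by omega)
    · rw [Nat.mul_div_cancel' hd, Nat.sub_add_cancel hp0]; exact hpp
  · intro n _
    simp [Nat.mul_div_cancel_left n (show 0 < W by omega)]
  · intro p hp
    simp only [mem_filter, mem_Ioc] at hp
    obtain ⟨⟨hp0, hpN⟩, hpp, hp1⟩ := hp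
    have hd : W ∣ p - 1 := (Nat.modEq_iff_dvd' hp0).1 hp1.symm
    rw [Nat.mul_div_cancel' hd, Nat.sub_add_cancel hp0]
  · intro n _
    simp [Nat.mul_div_cancel_left n (show 0 < W by omega)]

lemma sum_e_div {W : ℕ} (hW : 1 ≤ W) (m : ℤ) :
    ∑ c ∈ range W, e (c * m / W) = if (W : ℤ) ∣ m then (W : ℂ) else 0 := by
  have hW0 : (W : ℝ) ≠ 0 := by positivity
  have h1 : ∀ c ∈ range W, e (c * m / W) = e (m / W) ^ c := by
    intro c _; rw [← e_nat_mul]; congr 1; ring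
  rw [sum_congr rfl h1]
  split_ifs with h
  · obtain ⟨k, rfl⟩ := h
    have : ((((W : ℤ) * k : ℤ) : ℝ) / W) = (k : ℤ) := by push_cast; field_simp
    rw [this, e_int]; simp
  · have hne : e ((m : ℝ) / W) ≠ 1 := by
      intro h1
      have hδ : ∀ a : ℤ, 1 / (W : ℝ) ≤ |(m : ℝ) / W - a| := by
        intro a
        have h2 : (m : ℝ) / W - a = ((m - W * a : ℤ) : ℝ) / W := by push_cast; field_simp
        rw [h2, abs_div, Nat.abs_cast]
        refine div_le_div_of_nonneg_right ?_ (Nat.cast_nonneg _)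
        have h3 : m - W * a ≠ 0 := fun h4 => h ⟨a, by linarith⟩
        exact_mod_cast Int.one_le_abs h3
      have := le_norm_e_sub_one hδ
      rw [h1, sub_self, norm_zero] at this
      have : (0:ℝ) < 4 * (1 / W) := by positivity
      linarith
    rw [geom_sum_eq hne, ← e_nat_mul]
    have : (W : ℝ) * (m / W) = (m : ℤ) := by field_simp
    rw [this, e_int]; simp

/-- Exponential sums of the weight `pw` are small away from rationals of small denominator. -/
lemma norm_sum_pw_le_of_not_nearRational {W : ℕ} (hW : 1 ≤ W) {η : ℝ} (hη : 0 < η) :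
    ∃ Q K : ℝ, ∃ N₀ : ℕ, ∀ (N : ℕ) (α : ℝ), N₀ ≤ N → ¬ NearRational Q K N α →
      ‖∑ n ∈ Ioc 0 N, (pw W n : ℂ) * e (α * n)‖ ≤ η * N := by
  have hWpos : (0:ℝ) < W := by exact_mod_cast hW
  obtain ⟨Q, K, N₀, h⟩ := prime_exponential_sum (η := η / (2 * W)) (by positivity)
  refine ⟨Q, max K 0, max N₀ 1, fun N α hN hα => ?_⟩
  have hN1 : 1 ≤ N := (le_max_right _ _).trans hN
  have hNpos : (0:ℝ) < N := by exact_mod_cast hN1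
  set X := W * N + 1 with hX
  have hXN : N ≤ X := by nlinarith
  have hbound : ∀ c ∈ range W, ‖∑ p ∈ (Ioc 0 X).filter Nat.Prime,
      (Real.log p : ℂ) * e ((α + c) / W * p)‖ ≤ η / (2 * W) * X := by
    intro c _
    refine h X _ (((le_max_left _ _).trans hN).trans hXN) ?_
    rintro ⟨r, hr1, hrQ, a, ha⟩
    refine hα ⟨r, hr1, hrQ, a * W - r * c, ?_⟩
    have h1 : (r : ℝ) * α - ((a * W - r * c : ℤ) : ℝ) = W * (r * ((α + c) / W) - a) := by
      push_cast; field_simp; ring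
    rw [h1, abs_mul, Nat.abs_cast]
    calc (W : ℝ) * |r * ((α + c) / W) - a| ≤ W * (max K 0 / (W * N)) := by
          refine mul_le_mul_of_nonneg_left (ha.trans ?_) hWpos.le
          have hle : (W : ℝ) * N ≤ X := by rw [hX]; push_cast; linarith
          calc K / (X : ℝ) ≤ max K 0 / X :=
                div_le_div_of_nonneg_right (le_max_left _ _) (Nat.cast_nonneg _)
            _ ≤ _ := div_le_div_of_nonneg_left (le_max_right _ _) (by positivity) hle
      _ = _ := by field_simp
  rw [sum_pw_mul hW N fun n => e (α * n)]
  have hkey : ∑ p ∈ (Ioc 0 X).filter (fun p => p.Prime ∧ p ≡ 1 [MOD W]),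
        (Real.log p : ℂ) * e (α * ((p - 1) / W : ℕ))
      = (W : ℂ)⁻¹ * ∑ c ∈ range W, e (-((α + c) / W)) * ∑ p ∈ (Ioc 0 X).filter Nat.Prime,
        (Real.log p : ℂ) * e ((α + c) / W * p) := by
    simp only [mul_sum]
    rw [sum_comm, ← filter_filter, sum_filter]
    refine sum_congr rfl fun p hp => ?_
    have hp1 : 1 ≤ p := by have := (mem_Ioc.1 (mem_filter.1 hp).1).1; omega
    have hs : ∑ c ∈ range W, (W : ℂ)⁻¹ * (e (-((α + c) / W)) * ((Real.log p : ℂ)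
        * e ((α + c) / W * p))) = (W : ℂ)⁻¹ * Real.log p * e (α * ((p - 1) / W))
        * ∑ c ∈ range W, e (c * ((p - 1 : ℤ) : ℝ) / W) := by
      rw [mul_sum]
      refine sum_congr rfl fun c _ => ?_
      have : e (-((α + c) / W)) * e ((α + c) / W * p)
          = e (α * ((p - 1) / W)) * e (c * ((p - 1 : ℤ) : ℝ) / W) := by
        rw [← e_add, ← e_add]; congr 1; push_cast; ring
      linear_combination (W : ℂ)⁻¹ * Real.log p * this
    rw [hs, sum_e_div hW]
    have hiff : p ≡ 1 [MOD W] ↔ (W : ℤ) ∣ (p - 1 : ℤ) := by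
      rw [Nat.ModEq.comm, Nat.modEq_iff_dvd]; simp
    by_cases hd : p ≡ 1 [MOD W]
    · rw [if_pos hd, if_pos (hiff.1 hd)]
      have hd' : W ∣ p - 1 := (Nat.modEq_iff_dvd' hp1).1 hd.symm
      rw [Nat.cast_div hd' hWpos.ne', Nat.cast_sub hp1]
      have : (W : ℂ) ≠ 0 := by exact_mod_cast hWpos.ne'
      push_cast
      field_simp
    · rw [if_neg hd, if_neg (fun h => hd (hiff.2 h)), mul_zero]
  rw [hkey, norm_mul, norm_mul, norm_div, norm_inv, Complex.norm_natCast, Complex.norm_natCast]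
  have hφ : (W.totient : ℝ) / W ≤ 1 :=
    div_le_one_of_le₀ (by exact_mod_cast Nat.totient_le W) hWpos.le
  have hsum : ‖∑ c ∈ range W, e (-((α + c) / W)) * ∑ p ∈ (Ioc 0 X).filter Nat.Prime,
        (Real.log p : ℂ) * e ((α + c) / W * p)‖ ≤ W * (η / (2 * W) * X) := by
    refine (norm_sum_le_of_le _ (f := fun c : ℕ => e (-((α + c) / W)) *
      ∑ p ∈ (Ioc 0 X).filter Nat.Prime, (Real.log p : ℂ) * e ((α + c) / W * p))
      (fun c hc => ?_)).trans (le_of_eq (by rw [sum_const, card_range, nsmul_eq_mul]))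
    rw [norm_mul, norm_e, one_mul]; exact hbound c hc
  calc _ ≤ 1 * ((W : ℝ)⁻¹ * (W * (η / (2 * W) * X))) := by
        refine mul_le_mul hφ (mul_le_mul_of_nonneg_left hsum (by positivity)) (by positivity)
          zero_le_one
    _ = η / (2 * W) * X := by field_simp
    _ ≤ η / (2 * W) * (2 * W * N) := by
        refine mul_le_mul_of_nonneg_left ?_ (by positivity)
        have : X ≤ 2 * W * N := by rw [hX]; nlinarith
        exact_mod_cast this
    _ = η * N := by field_simp

/-- The indicator function of those `b` with `W * b + 1` coprime to `r`. -/
noncomputable def cop (W r b : ℕ) : ℝ := if (W * b + 1).Coprime r then 1 else 0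

lemma sum_range_mul_eq {M : Type*} [AddCommMonoid M] {p h : ℕ} (hh : 0 < h) (f : ℕ → M) :
    ∑ b ∈ range (p * h), f b = ∑ i ∈ range h, ∑ j ∈ range p, f (i + h * j) := by
  rw [← sum_product']
  symm
  refine sum_nbij' (fun x => x.1 + h * x.2) (fun b => (b % h, b / h)) ?_ ?_ ?_ ?_ ?_
  · rintro ⟨i, j⟩ hx
    simp only [mem_product, mem_range] at hx ⊢
    calc i + h * j < h + h * j := by omega
      _ = h * (j + 1) := by ring
      _ ≤ h * p := Nat.mul_le_mul_left _ (by omega)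
      _ = p * h := mul_comm _ _
  · intro b hb
    simp only [mem_product, mem_range] at hb ⊢
    exact ⟨Nat.mod_lt _ hh, Nat.div_lt_of_lt_mul (by rwa [mul_comm])⟩
  · rintro ⟨i, j⟩ hx
    simp only [mem_product, mem_range] at hx
    simp [Nat.add_mul_div_left _ _ hh, Nat.mod_eq_of_lt hx.1, Nat.div_eq_of_lt hx.1]
  · intro b _
    exact Nat.mod_add_div b h
  · intro x _; rfl

lemma norm_sum_cop_fibre_le {W w p h : ℕ} (hp : p.Prime) (hw : p ∣ W ∨ w < p)
    {a : ℤ} (ha : ¬ (p : ℤ) ∣ a) (i : ℕ) :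
    w * ‖∑ j ∈ range p, (cop W (p * h) (i + h * j) : ℂ) * e (j * a / p)‖
      ≤ ∑ j ∈ range p, cop W (p * h) (i + h * j) := by
  have hpos : 0 ≤ ∑ j ∈ range p, cop W (p * h) (i + h * j) :=
    sum_nonneg fun j _ => by unfold cop; split_ifs <;> norm_num
  have hexp : ∀ j, W * (i + h * j) + 1 = (W * i + 1) + h * (W * j) := fun j => by ring
  by_cases hU : ∃ l : ℕ, l.Prime ∧ l ∣ h ∧ l ∣ W * i + 1
  · have h0 : ∀ j ∈ range p, cop W (p * h) (i + h * j) = 0 := by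
      intro j _
      obtain ⟨l, hl, hlh, hli⟩ := hU
      unfold cop
      rw [if_neg]
      rw [Nat.Prime.not_coprime_iff_dvd]
      exact ⟨l, hl, by rw [hexp]; exact dvd_add hli (hlh.mul_right _), hlh.mul_left _⟩
    rw [sum_eq_zero (f := fun j => (cop W (p * h) (i + h * j) : ℂ) * e (j * a / p))
      (fun j hj => by rw [h0 j hj]; simp)]
    simpa using hpos
  · have hF : ∀ j, cop W (p * h) (i + h * j)
        = 1 - if p ∣ W * (i + h * j) + 1 then 1 else 0 := by
      intro j
      unfold cop
      have : (W * (i + h * j) + 1).Coprime (p * h) ↔ ¬ p ∣ W * (i + h * j) + 1 := by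
        constructor
        · intro hc hd
          exact Nat.Prime.not_coprime_iff_dvd.2 ⟨p, hp, hd, dvd_mul_right _ _⟩ hc
        · intro hd
          by_contra hc
          obtain ⟨l, hl, h1, h2⟩ := Nat.Prime.not_coprime_iff_dvd.1 hc
          rcases (Nat.Prime.dvd_mul hl).1 h2 with h3 | h3
          · exact hd (by rwa [← (Nat.prime_dvd_prime_iff_eq hl hp).1 h3])
          · rw [hexp] at h1
            exact hU ⟨l, hl, h3, (Nat.dvd_add_left (h3.mul_right _)).1 h1⟩
      by_cases hd : p ∣ W * (i + h * j) + 1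
      · rw [if_neg (fun hc => (this.1 hc) hd), if_pos hd]; norm_num
      · rw [if_pos (this.2 hd), if_neg hd]; norm_num
    have hsum0 : ∑ j ∈ range p, e (j * a / p) = 0 := by
      rw [sum_e_div hp.one_le, if_neg ha]
    set Z := (range p).filter (fun j => p ∣ W * (i + h * j) + 1) with hZ
    have hL : ∑ j ∈ range p, (cop W (p * h) (i + h * j) : ℂ) * e (j * a / p)
        = - ∑ j ∈ Z, e (j * a / p) := by
      have : ∀ j ∈ range p, (cop W (p * h) (i + h * j) : ℂ) * e (j * a / p)
          = e (j * a / p) - if p ∣ W * (i + h * j) + 1 then e (j * a / p) else 0 := by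
        intro j _
        rw [hF]; split_ifs <;> simp
      rw [sum_congr rfl this, sum_sub_distrib, hsum0, ← sum_filter, zero_sub]
    have hR : ∑ j ∈ range p, cop W (p * h) (i + h * j) = p - Z.card := by
      simp only [hF]
      rw [sum_sub_distrib, ← sum_filter]
      simp [hZ]
    rw [hL, hR, norm_neg]
    by_cases hWh : p ∣ W * h
    · have hiff : ∀ j, p ∣ W * (i + h * j) + 1 ↔ p ∣ W * i + 1 := by
        intro j
        have : W * (i + h * j) + 1 = (W * i + 1) + (W * h) * j := by ring
        rw [this]; exact Nat.dvd_add_left (hWh.mul_right _)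
      by_cases hi : p ∣ W * i + 1
      · have : Z = range p := by rw [hZ]; exact filter_true_of_mem fun j _ => (hiff j).2 hi
        rw [this, hsum0]; simp
      · have : Z = ∅ := by rw [hZ]; exact filter_false_of_mem fun j _ => fun h => hi ((hiff j).1 h)
        rw [this]; simp
    · have hcard : Z.card ≤ 1 := by
        rw [card_le_one]
        intro j hj j' hj'
        rw [hZ, mem_filter, mem_range] at hj hj'
        have h1 : (p : ℤ) ∣ (W * h : ℕ) * ((j : ℤ) - j') := by
          have h2 := Int.natCast_dvd_natCast.2 hj.2
          have h3 := Int.natCast_dvd_natCast.2 hj'.2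
          have h4 : ((W * h : ℕ) : ℤ) * ((j : ℤ) - j')
              = ((W * (i + h * j) + 1 : ℕ) : ℤ) - ((W * (i + h * j') + 1 : ℕ) : ℤ) := by
            push_cast; ring
          rw [h4]; exact dvd_sub h2 h3
        rcases (Nat.prime_iff_prime_int.1 hp).dvd_or_dvd h1 with h2 | h2
        · exact absurd (Int.natCast_dvd_natCast.1 h2) hWh
        · have h3 := Int.eq_zero_of_abs_lt_dvd h2 (by rw [abs_lt]; constructor <;> omega)
          omega
      have hwp : w < p := hw.resolve_left fun hd => hWh (hd.mul_right h)
      have h1 : ‖∑ j ∈ Z, e (j * a / p)‖ ≤ Z.card := by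
        refine (norm_sum_le _ _).trans ?_
        simp
      have h2 : (Z.card : ℝ) ≤ 1 := by exact_mod_cast hcard
      have h3 : (w : ℝ) + 1 ≤ p := by exact_mod_cast hwp
      have h4 := mul_le_mul_of_nonneg_left (h1.trans h2) (Nat.cast_nonneg (α := ℝ) w)
      linarith

lemma norm_sum_cop_le {W w r : ℕ} (hW : ∀ p : ℕ, p.Prime → p ≤ w → p ∣ W) (hr : 2 ≤ r) {a : ℤ}
    (ha : IsCoprime a (r : ℤ)) :
    w * ‖∑ b ∈ range r, (cop W r b : ℂ) * e (b * a / r)‖ ≤ ∑ b ∈ range r, cop W r b := by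
  obtain ⟨p, hp, h, rfl⟩ : ∃ p : ℕ, p.Prime ∧ p ∣ r :=
    ⟨r.minFac, Nat.minFac_prime (by omega), Nat.minFac_dvd r⟩
  have hh : 0 < h := Nat.pos_of_ne_zero (by rintro rfl; simp at hr)
  have hpa : ¬ (p : ℤ) ∣ a := by
    intro hd
    have h1 : IsUnit (p : ℤ) := ha.isUnit_of_dvd' hd (by push_cast; exact dvd_mul_right _ _)
    exact (Nat.prime_iff_prime_int.1 hp).not_isUnit h1
  have hp0 : (p : ℝ) ≠ 0 := by exact_mod_cast hp.ne_zero
  have hh0 : (h : ℝ) ≠ 0 := by exact_mod_cast hh.ne'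
  rw [sum_range_mul_eq hh, sum_range_mul_eq hh]
  have h1 : ∀ i ∈ range h, ‖∑ j ∈ range p, (cop W (p * h) (i + h * j) : ℂ)
      * e ((i + h * j : ℕ) * a / (p * h : ℕ))‖
      = ‖∑ j ∈ range p, (cop W (p * h) (i + h * j) : ℂ) * e (j * a / p)‖ := by
    intro i _
    have : ∑ j ∈ range p, (cop W (p * h) (i + h * j) : ℂ)
      * e ((i + h * j : ℕ) * a / (p * h : ℕ)) = e (i * a / (p * h)) *
        ∑ j ∈ range p, (cop W (p * h) (i + h * j) : ℂ) * e (j * a / p) := by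
      rw [mul_sum]
      refine sum_congr rfl fun j _ => ?_
      have : e ((i + h * j : ℕ) * a / (p * h : ℕ)) = e (i * a / (p * h)) * e (j * a / p) := by
        rw [← e_add]; congr 1; push_cast; field_simp
      rw [this]; ring
    rw [this, norm_mul, norm_e, one_mul]
  calc _ ≤ w * ∑ i ∈ range h, ‖∑ j ∈ range p, (cop W (p * h) (i + h * j) : ℂ) * e (j * a / p)‖ := by
        refine mul_le_mul_of_nonneg_left ?_ (Nat.cast_nonneg _)
        exact (norm_sum_le _ _).trans (le_of_eq (sum_congr rfl h1))
    _ ≤ _ := by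
        rw [mul_sum]
        refine sum_le_sum fun i _ => norm_sum_cop_fibre_le hp ?_ hpa i
        rcases le_or_gt p w with h | h
        · exact Or.inl (hW p hp h)
        · exact Or.inr h

lemma sum_pw_progression_eq {W : ℕ} (hW : 1 ≤ W) (r b m : ℕ) :
    ∑ n ∈ (Ioc 0 m).filter (fun n => n ≡ b [MOD r]), pw W n = (W.totient : ℝ) / W *
      ∑ p ∈ (Ioc 0 (W * m + 1)).filter (fun p => p.Prime ∧ p ≡ W * b + 1 [MOD W * r]),
        Real.log p := by
  have h := sum_pw_mul hW m fun n => if n ≡ b [MOD r] then 1 else 0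
  have h2 : ∀ p ∈ (Ioc 0 (W * m + 1)).filter Nat.Prime,
      (if p ≡ 1 [MOD W] then (Real.log p : ℂ) * (if (p - 1) / W ≡ b [MOD r] then 1 else 0) else 0)
      = if p ≡ W * b + 1 [MOD W * r] then (Real.log p : ℂ) else 0 := by
    intro p hp
    have hp1 : 1 ≤ p := by have := (mem_Ioc.1 (mem_filter.1 hp).1).1; omega
    by_cases h1 : p ≡ 1 [MOD W]
    · have hd : W ∣ p - 1 := (Nat.modEq_iff_dvd' hp1).1 h1.symm
      obtain ⟨n, hn⟩ := hd
      have hpn : p = W * n + 1 := by omega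
      rw [if_pos h1, hn, Nat.mul_div_cancel_left n (by omega)]
      have : p ≡ W * b + 1 [MOD W * r] ↔ n ≡ b [MOD r] := by
        rw [hpn]
        constructor
        · intro h3
          exact Nat.ModEq.mul_left_cancel' (by omega) (Nat.ModEq.add_right_cancel' 1 h3)
        · intro h3
          exact (Nat.ModEq.mul_left' W h3).add_right 1
      simp only [this]
      split_ifs <;> simp
    · rw [if_neg h1, if_neg]
      intro h3
      refine h1 ((Nat.ModEq.of_mul_right r h3).trans ?_)
      simp
  simp only [← filter_filter] at h ⊢
  rw [sum_filter, sum_congr rfl h2, ← sum_filter] at h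
  simp only [mul_ite, mul_one, mul_zero] at h
  rw [← sum_filter] at h
  apply Complex.ofReal_injective
  push_cast at h ⊢
  exact h

lemma sum_pw_progression {W r : ℕ} (hW : 1 ≤ W) (hr : 1 ≤ r) (b : ℕ) {ε : ℝ} (hε : 0 < ε) :
    ∃ M₀ : ℕ, ∀ m : ℕ, M₀ ≤ m →
      |∑ n ∈ (Ioc 0 m).filter (fun n => n ≡ b [MOD r]), pw W n
        - cop W r b * ((W.totient : ℝ) / (W * r).totient) * m| ≤ ε * m := by
  have hWpos : (0:ℝ) < W := by exact_mod_cast hW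
  have hφ1 : (W.totient : ℝ) ≤ W := by exact_mod_cast Nat.totient_le W
  have hφ0 : (0:ℝ) ≤ W.totient := Nat.cast_nonneg _
  by_cases hc : (W * b + 1).Coprime r
  · have hcW : (W * b + 1).Coprime (W * r) := by
      refine Nat.Coprime.mul_right ?_ hc
      simp
    have hWr : 1 ≤ W * r := Nat.mul_pos hW hr
    have hφr : (1:ℝ) ≤ (W * r).totient := by exact_mod_cast Nat.totient_pos.2 hWr
    obtain ⟨X₀, hX⟩ := sum_log_prime_progression hWr hcW (ε := ε / (4 * W)) (by positivity)
    refine ⟨max (max X₀ 1) ⌈2 / ε⌉₊, fun m hm => ?_⟩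
    have hm1 : 1 ≤ m := ((le_max_right _ _).trans (le_max_left _ _)).trans hm
    have hmε : 1 ≤ ε / 2 * m := by
      have : 2 / ε ≤ m := (Nat.le_ceil _).trans (by exact_mod_cast (le_max_right _ _).trans hm)
      rw [div_le_iff₀ hε] at this; linarith
    have hmX : X₀ ≤ W * m + 1 := by
      have := ((le_max_left _ _).trans (le_max_left _ _)).trans hm
      nlinarith
    have h1 := hX _ hmX
    have hm1' : (1:ℝ) ≤ m := by exact_mod_cast hm1
    rw [sum_pw_progression_eq hW, cop, if_pos hc, one_mul]
    set S := ∑ p ∈ (Ioc 0 (W * m + 1)).filter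
      (fun p => p.Prime ∧ p ≡ W * b + 1 [MOD W * r]), Real.log p
    set φ : ℝ := ((W * r).totient : ℝ) with hφdef
    have h2 : (W.totient : ℝ) / W * S - W.totient / φ * m
        = W.totient / W * (S - (W * m + 1 : ℕ) / φ) + W.totient / W / φ := by
      push_cast; field_simp; ring
    have hle1 : (W.totient : ℝ) / W ≤ 1 := div_le_one_of_le₀ hφ1 hWpos.le
    have hge0 : (0:ℝ) ≤ W.totient / W := by positivity
    have hq0 : 0 ≤ (W.totient : ℝ) / W / φ := by positivity
    rw [h2]
    calc _ ≤ |(W.totient : ℝ) / W * (S - (W * m + 1 : ℕ) / φ)| + |(W.totient : ℝ) / W / φ| :=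
          abs_add_le _ _
      _ ≤ 1 * (ε / (4 * W) * (W * m + 1 : ℕ)) + 1 := by
          rw [abs_mul, abs_of_nonneg hge0, abs_of_nonneg hq0]
          refine add_le_add (mul_le_mul hle1 h1 (abs_nonneg _) zero_le_one) ?_
          exact div_le_one_of_le₀ (hle1.trans hφr) (by positivity)
      _ ≤ 1 * (ε / (4 * W) * (2 * W * m)) + ε / 2 * m := by
          have : ((W * m + 1 : ℕ) : ℝ) ≤ 2 * W * m := by
            have : W * m + 1 ≤ 2 * W * m := by nlinarith
            exact_mod_cast this
          gcongr
      _ = ε * m := by field_simp; norm_num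
  · obtain ⟨l, hl, hlb, hlr⟩ := Nat.Prime.not_coprime_iff_dvd.1 hc
    set C := ∑ p ∈ Ioc 0 r, Real.log p
    refine ⟨⌈C / ε⌉₊, fun m hm => ?_⟩
    have hm' : C ≤ ε * m := by
      have : C / ε ≤ m := (Nat.le_ceil _).trans (by exact_mod_cast hm)
      rw [div_le_iff₀ hε] at this; linarith
    rw [cop, if_neg hc, zero_mul, zero_mul, sub_zero,
      abs_of_nonneg (sum_nonneg fun n _ => pw_nonneg W n), sum_pw_progression_eq hW]
    refine le_trans ?_ hm'
    have h1 : ∑ p ∈ (Ioc 0 (W * m + 1)).filter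
        (fun p => p.Prime ∧ p ≡ W * b + 1 [MOD W * r]), Real.log p ≤ C := by
      refine sum_le_sum_of_subset_of_nonneg ?_ fun p _ _ => Real.log_natCast_nonneg p
      intro p hp
      simp only [mem_filter, mem_Ioc] at hp ⊢
      have h2 : p ≡ W * b + 1 [MOD l] := hp.2.2.of_dvd (hlr.mul_left W)
      have h3 : l ∣ p := (h2.dvd_iff (dvd_refl l)).2 hlb
      rw [← (Nat.prime_dvd_prime_iff_eq hl hp.2.1).1 h3]
      exact ⟨hl.pos, Nat.le_of_dvd hr hlr⟩
    calc _ ≤ 1 * C := mul_le_mul (div_le_one_of_le₀ hφ1 hWpos.le) h1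
          (sum_nonneg fun p _ => Real.log_natCast_nonneg p) zero_le_one
      _ = C := one_mul C

/-- The mean value of `pw W n * e (a * n / r)`. -/
noncomputable def pwMean (W r : ℕ) (a : ℤ) : ℂ :=
  ((W.totient : ℝ) / (W * r).totient : ℝ) * ∑ b ∈ range r, (cop W r b : ℂ) * e (b * a / r)

lemma sum_eq_sum_progressions {r : ℕ} (hr : 1 ≤ r) (m : ℕ) (F : ℕ → ℂ) :
    ∑ n ∈ Ioc 0 m, F n = ∑ b ∈ range r, ∑ n ∈ (Ioc 0 m).filter (fun n => n ≡ b [MOD r]), F n := by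
  rw [← sum_fiberwise_of_maps_to (s := Ioc 0 m) (t := range r) (g := fun n => n % r)
    fun n _ => mem_range.2 (Nat.mod_lt _ hr)]
  refine sum_congr rfl fun b hb => sum_congr (filter_congr fun n _ => ?_) fun _ _ => rfl
  rw [Nat.ModEq, Nat.mod_eq_of_lt (mem_range.1 hb)]

lemma e_mul_div_of_modEq {r n b : ℕ} (hr : 1 ≤ r) (h : n ≡ b [MOD r]) (a : ℤ) :
    e (n * a / r) = e (b * a / r) := by
  obtain ⟨k, hk⟩ := Nat.modEq_iff_dvd.1 h.symm
  have hr0 : (r : ℝ) ≠ 0 := by positivity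
  have : (n : ℝ) * a / r = b * a / r + ((k * a : ℤ) : ℝ) := by
    have h1 : (n : ℝ) = b + r * k := by
      have : (n : ℤ) = b + r * k := by linarith
      exact_mod_cast this
    rw [h1]; push_cast; field_simp
  rw [this, e_add_int]

lemma sum_pw_mul_e_rational {W r : ℕ} (hW : 1 ≤ W) (hr : 1 ≤ r) {ε : ℝ} (hε : 0 < ε) :
    ∃ M₀ : ℕ, ∀ m : ℕ, M₀ ≤ m → ∀ a : ℤ,
      ‖∑ n ∈ Ioc 0 m, (pw W n : ℂ) * e (n * a / r) - pwMean W r a * m‖ ≤ ε * m := by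
  have hrpos : (0:ℝ) < r := by exact_mod_cast hr
  choose M hM using fun b => sum_pw_progression hW hr b (ε := ε / r) (by positivity)
  refine ⟨(range r).sup M, fun m hm a => ?_⟩
  rw [sum_eq_sum_progressions hr, pwMean, mul_sum, sum_mul, ← sum_sub_distrib]
  refine (norm_sum_le_of_le _ (f := _) (n := fun _ => ε / r * m) fun b hb => ?_).trans ?_
  · have h1 : ∑ n ∈ (Ioc 0 m).filter (fun n => n ≡ b [MOD r]), (pw W n : ℂ) * e (n * a / r)
        = ((∑ n ∈ (Ioc 0 m).filter (fun n => n ≡ b [MOD r]), pw W n : ℝ) : ℂ) * e (b * a / r) := by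
      rw [Complex.ofReal_sum, sum_mul]
      refine sum_congr rfl fun n hn => ?_
      rw [e_mul_div_of_modEq hr (mem_filter.1 hn).2]
    have h2 := hM b m ((le_sup hb).trans hm)
    rw [h1]
    set S := ∑ n ∈ (Ioc 0 m).filter (fun n => n ≡ b [MOD r]), pw W n
    have h3 : (S : ℂ) * e (b * a / r) - ((W.totient : ℝ) / (W * r).totient : ℝ)
        * ((cop W r b : ℂ) * e (b * a / r)) * m
        = ((S - cop W r b * ((W.totient : ℝ) / (W * r).totient) * m : ℝ) : ℂ) * e (b * a / r) := by
      push_cast; ring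
    rw [h3, norm_mul, norm_e, mul_one, Complex.norm_real]
    exact h2
  · rw [sum_const, card_range, nsmul_eq_mul]
    exact le_of_eq (by field_simp)

lemma pwMean_one {W : ℕ} (hW : 1 ≤ W) (a : ℤ) : pwMean W 1 a = 1 := by
  have : (W.totient : ℝ) ≠ 0 := by exact_mod_cast (Nat.totient_pos.2 hW).ne'
  have h2 : (W.totient : ℂ) ≠ 0 := by exact_mod_cast this
  simp [pwMean, cop, e_zero, h2]

lemma mul_sum_cop {W r : ℕ} (hW : 1 ≤ W) (hr : 1 ≤ r) :
    (W.totient : ℝ) / (W * r).totient * ∑ b ∈ range r, cop W r b = 1 := by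
  set s := (W.totient : ℝ) / (W * r).totient * ∑ b ∈ range r, cop W r b with hs
  have hs' : pwMean W r 0 = (s : ℂ) := by
    simp [pwMean, hs, e_zero]
  refine eq_of_forall_dist_le fun ε hε => ?_
  obtain ⟨M₁, h1⟩ := sum_pw_mul_e_rational hW hr (ε := ε / 2) (by positivity)
  obtain ⟨M₂, h2⟩ := sum_pw_mul_e_rational hW le_rfl (ε := ε / 2) (by positivity)
  set m := max (max M₁ M₂) 1 with hm
  have hmpos : (0:ℝ) < m := by exact_mod_cast (le_max_right _ _ : 1 ≤ m)
  have h3 := h1 m ((le_max_left _ _).trans (le_max_left _ _)) 0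
  have h4 := h2 m ((le_max_right _ _).trans (le_max_left _ _)) 0
  rw [hs'] at h3
  rw [pwMean_one hW] at h4
  simp only [Int.cast_zero, mul_zero, zero_div, e_zero, mul_one, one_mul] at h3 h4
  have h5 : ‖((s - 1 : ℝ) : ℂ) * m‖ ≤ ε / 2 * m + ε / 2 * m := by
    have : ((s - 1 : ℝ) : ℂ) * m = (∑ n ∈ Ioc 0 m, (pw W n : ℂ) - m)
        - (∑ n ∈ Ioc 0 m, (pw W n : ℂ) - s * m) := by push_cast; ring
    rw [this]
    exact (norm_sub_le _ _).trans (add_le_add h4 h3)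
  rw [norm_mul, Complex.norm_real, Complex.norm_natCast] at h5
  rw [Real.dist_eq]
  exact le_of_mul_le_mul_right (by rw [Real.norm_eq_abs] at h5; linarith) hmpos

lemma norm_pwMean_le {W w r : ℕ} (hW : 1 ≤ W) (hw : ∀ p : ℕ, p.Prime → p ≤ w → p ∣ W)
    (hw1 : 1 ≤ w) (hr : 2 ≤ r) {a : ℤ} (ha : IsCoprime a (r : ℤ)) :
    ‖pwMean W r a‖ ≤ 1 / w := by
  have hwpos : (0:ℝ) < w := by exact_mod_cast hw1
  rw [le_div_iff₀ hwpos, pwMean, norm_mul, Complex.norm_real, Real.norm_of_nonneg (by positivity),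
    mul_assoc, mul_comm _ (w : ℝ)]
  calc _ ≤ (W.totient : ℝ) / (W * r).totient * ∑ b ∈ range r, cop W r b :=
        mul_le_mul_of_nonneg_left (norm_sum_cop_le hw hr ha) (by positivity)
    _ = 1 := mul_sum_cop hW (by omega)

lemma sum_pw_mul_e_rational_uniform {W : ℕ} (hW : 1 ≤ W) (Q : ℕ) {ε : ℝ} (hε : 0 < ε) :
    ∃ N₀ : ℕ, ∀ N : ℕ, N₀ ≤ N → ∀ r, 1 ≤ r → r ≤ Q → ∀ a : ℤ, ∀ m ≤ N,
      ‖∑ n ∈ Ioc 0 m, (pw W n : ℂ) * e (n * a / r) - pwMean W r a * m‖ ≤ ε * N := by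
  choose M hM using fun r : ℕ => sum_pw_mul_e_rational (W := W) (r := r + 1) hW (by omega) hε
  set M₀ := (range Q).sup M with hM₀
  set C := M₀ * Real.log (W * M₀ + 1 : ℕ) + ∑ r ∈ Icc 1 Q,
    ((W.totient : ℝ) / (W * r).totient) * r * M₀ with hC
  refine ⟨max M₀ ⌈C / ε⌉₊, fun N hN r hr1 hrQ a m hmN => ?_⟩
  rcases le_or_gt M₀ m with hm | hm
  · have h1 := hM (r - 1) m ((le_sup (f := M) (mem_range.2 (by omega))).trans hm) a
    rw [Nat.sub_add_cancel hr1] at h1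
    exact h1.trans (mul_le_mul_of_nonneg_left (by exact_mod_cast hmN) hε.le)
  · have hCN : C ≤ ε * N := by
      have : C / ε ≤ N := (Nat.le_ceil _).trans (by exact_mod_cast (le_max_right _ _).trans hN)
      rw [div_le_iff₀ hε] at this; linarith
    refine le_trans ?_ hCN
    have hmM : (m : ℝ) ≤ M₀ := by exact_mod_cast hm.le
    refine (norm_sub_le _ _).trans (add_le_add ?_ ?_)
    · refine (norm_sum_le_of_le _ (f := _) (n := fun _ => Real.log (W * M₀ + 1 : ℕ))
        fun n hn => ?_).trans ?_
      · rw [norm_mul, norm_e, mul_one, Complex.norm_real, Real.norm_of_nonneg (pw_nonneg _ _)]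
        refine (pw_le_log W n).trans (Real.log_le_log (by positivity) ?_)
        have := (mem_Ioc.1 hn).2
        have : W * n + 1 ≤ W * M₀ + 1 := by gcongr; omega
        exact_mod_cast this
      · rw [sum_const, Nat.card_Ioc, nsmul_eq_mul, Nat.sub_zero]
        exact mul_le_mul_of_nonneg_right hmM (Real.log_natCast_nonneg _)
    · have h1 : ‖pwMean W r a‖ ≤ ((W.totient : ℝ) / (W * r).totient) * r := by
        rw [pwMean, norm_mul, Complex.norm_real, Real.norm_of_nonneg (by positivity)]
        refine mul_le_mul_of_nonneg_left ?_ (by positivity)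
        refine (norm_sum_le_of_le _ (f := _) (n := fun _ => (1:ℝ)) fun b _ => ?_).trans (by simp)
        rw [norm_mul, norm_e, mul_one, Complex.norm_real, cop]
        split_ifs <;> simp
      rw [norm_mul, Complex.norm_natCast]
      calc _ ≤ ((W.totient : ℝ) / (W * r).totient) * r * M₀ :=
            mul_le_mul h1 hmM (Nat.cast_nonneg _) (by positivity)
        _ ≤ _ := single_le_sum (f := fun r : ℕ => ((W.totient : ℝ) / (W * r).totient) * r * M₀)
            (fun r _ => by positivity) (mem_Icc.2 ⟨hr1, hrQ⟩)

lemma NearRational.exists_coprime {Q K : ℝ} {N : ℕ} {α : ℝ} (h : NearRational Q K N α) :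
    ∃ r : ℕ, 1 ≤ r ∧ (r : ℝ) ≤ Q ∧ ∃ a : ℤ, IsCoprime a (r : ℤ) ∧ |r * α - a| ≤ K / N := by
  obtain ⟨r, hr1, hrQ, a, ha⟩ := h
  have hg : 0 < Int.gcd a r := Int.gcd_pos_of_ne_zero_right _ (by omega)
  obtain ⟨r', hr'⟩ : Int.gcd a r ∣ r := Int.natCast_dvd_natCast.1 (Int.gcd_dvd_right a r)
  obtain ⟨a', ha'⟩ : (Int.gcd a r : ℤ) ∣ a := Int.gcd_dvd_left a r
  set g := Int.gcd a r with hgdef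
  have hr'1 : 1 ≤ r' := Nat.pos_of_ne_zero (by rintro rfl; omega)
  have hg1 : (1:ℝ) ≤ g := by exact_mod_cast hg
  have hrr : (r : ℝ) = g * r' := by exact_mod_cast hr'
  have haa : (a : ℝ) = g * a' := by exact_mod_cast ha'
  have hr0 : (0:ℝ) ≤ r' := Nat.cast_nonneg _
  refine ⟨r', hr'1, le_trans ?_ hrQ, a', ?_, ?_⟩
  · rw [hrr]; nlinarith
  · rw [Int.isCoprime_iff_gcd_eq_one]
    have h1 : Int.gcd ((g : ℤ) * a') ((g : ℤ) * r') = g := by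
      rw [← ha', show (g : ℤ) * r' = r by exact_mod_cast hr'.symm]
    rw [Int.gcd_mul_left, Int.natAbs_natCast] at h1
    exact Nat.eq_of_mul_eq_mul_left hg (by rw [h1, mul_one])
  · have h1 : (r : ℝ) * α - a = g * (r' * α - a') := by rw [hrr, haa]; ring
    rw [h1, abs_mul, Nat.abs_cast] at ha
    refine le_trans ?_ ha
    nlinarith [abs_nonneg ((r' : ℝ) * α - a')]

/-- The `W`-trick: the weight `pw W` is Fourier-pseudorandom. -/
theorem norm_sum_pw_sub_one_le {η : ℝ} (hη : 0 < η) : ∃ W : ℕ, 1 ≤ W ∧ ∃ N₀ : ℕ, ∀ N : ℕ, N₀ ≤ N →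
    ∀ α : ℝ, ‖∑ n ∈ Ioc 0 N, ((pw W n : ℂ) - 1) * e (α * n)‖ ≤ η * N := by
  set w : ℕ := ⌈4 / η⌉₊ + 1 with hw
  have hwη : 1 / (w : ℝ) ≤ η / 4 := by
    have : 4 / η ≤ w := by rw [hw]; push_cast; linarith [Nat.le_ceil (4 / η)]
    calc 1 / (w : ℝ) ≤ 1 / (4 / η) := one_div_le_one_div_of_le (by positivity) this
      _ = η / 4 := by field_simp
  set W := w.factorial
  have hW : 1 ≤ W := Nat.factorial_pos w
  have hpW : ∀ p : ℕ, p.Prime → p ≤ w → p ∣ W := fun p hp h => Nat.dvd_factorial hp.pos h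
  have hw1 : 1 ≤ w := by omega
  clear_value W w
  refine ⟨W, hW, ?_⟩
  obtain ⟨Q₀, K₀, N₁, hminor⟩ := norm_sum_pw_le_of_not_nearRational hW (η := η / 4) (by positivity)
  set Q : ℕ := max ⌈Q₀⌉₊ 1 with hQ
  set K : ℝ := max K₀ (4 / η) with hK
  have hK0 : 0 < K := lt_of_lt_of_le (by positivity) (le_max_right _ _)
  have hQQ : Q₀ ≤ Q := (Nat.le_ceil _).trans (by exact_mod_cast le_max_left _ _)
  have hQ1 : (1:ℝ) ≤ Q := by exact_mod_cast le_max_right _ _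
  have hKK : K₀ ≤ K := le_max_left _ _
  have hKη : 4 / η ≤ K := le_max_right _ _
  clear_value Q K
  have hπ := Real.pi_pos
  set ε := η / (4 * (1 + 2 * Real.pi * K)) with hε
  have hε0 : 0 < ε := by positivity
  obtain ⟨N₂, hmajor⟩ := sum_pw_mul_e_rational_uniform hW Q hε0
  refine ⟨max (max N₁ N₂) (max ⌈2 * K⌉₊ ⌈8 * Q / η⌉₊), fun N hN α => ?_⟩
  have hN1 : N₁ ≤ N := ((le_max_left _ _).trans (le_max_left _ _)).trans hN
  have hN2 : N₂ ≤ N := ((le_max_right _ _).trans (le_max_left _ _)).trans hN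
  have hN3 : 2 * K ≤ N := (Nat.le_ceil _).trans
    (by exact_mod_cast ((le_max_left _ _).trans (le_max_right _ _)).trans hN)
  have hN4 : 8 * Q / η ≤ N := (Nat.le_ceil _).trans
    (by exact_mod_cast ((le_max_right _ _).trans (le_max_right _ _)).trans hN)
  have hNpos : (0:ℝ) < N := by linarith
  have hsplit : ∑ n ∈ Ioc 0 N, ((pw W n : ℂ) - 1) * e (α * n)
      = ∑ n ∈ Ioc 0 N, (pw W n : ℂ) * e (α * n) - ∑ n ∈ Ioc 0 N, e (α * n) := by
    rw [← sum_sub_distrib]; exact sum_congr rfl fun n _ => by ring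
  by_cases hα : NearRational Q K N α
  · obtain ⟨r, hr1, hrQ, a, hcop, ha⟩ := hα.exists_coprime
    have hrpos : (0:ℝ) < r := by exact_mod_cast hr1
    have hr1' : (1:ℝ) ≤ r := by exact_mod_cast hr1
    set β := α - a / r with hβ
    have hβ1 : |β| ≤ K / N / r := by
      have : β = (r * α - a) / r := by rw [hβ]; field_simp
      rw [this, abs_div, Nat.abs_cast]
      exact div_le_div_of_nonneg_right ha hrpos.le
    have hβK : |β| * N ≤ K := by
      have h1 : |β| ≤ K / N := hβ1.trans (div_le_self (by positivity) hr1')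
      rwa [le_div_iff₀ hNpos] at h1
    have heα : ∀ n : ℕ, e (α * n) = e (n * a / r) * e (β * n) := by
      intro n; rw [← e_add]; congr 1; rw [hβ]; ring
    have h1 : ∑ n ∈ Ioc 0 N, (pw W n : ℂ) * e (α * n)
        = ∑ n ∈ Ioc 0 N, ((pw W n : ℂ) * e (n * a / r) - pwMean W r a) * e (β * n)
          + pwMean W r a * ∑ n ∈ Ioc 0 N, e (β * n) := by
      rw [mul_sum, ← sum_add_distrib]
      refine sum_congr rfl fun n _ => ?_
      rw [heα]; ring
    have h2 : ‖∑ n ∈ Ioc 0 N, ((pw W n : ℂ) * e (n * a / r) - pwMean W r a) * e (β * n)‖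
        ≤ η / 4 * N := by
      have h3 := norm_abel_le (g := fun n : ℕ => (pw W n : ℂ) * e (n * a / r) - pwMean W r a)
        (β := β) (B := ε * N) (N := N) (fun m hm => by
          have := hmajor N hN2 r hr1 (by exact_mod_cast hrQ) a m hm
          rw [sum_sub_distrib, sum_const, Nat.card_Ioc, nsmul_eq_mul, Nat.sub_zero]
          rwa [mul_comm (m : ℂ)])
      refine h3.trans ?_
      calc ε * N * (1 + 2 * Real.pi * |β| * N) ≤ ε * N * (1 + 2 * Real.pi * K) := by
            refine mul_le_mul_of_nonneg_left ?_ (by positivity)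
            have := mul_le_mul_of_nonneg_left hβK (by positivity : 0 ≤ 2 * Real.pi)
            linarith
        _ = η / 4 * N := by rw [hε]; field_simp
    rcases eq_or_lt_of_le hr1 with rfl | hr2
    · rw [pwMean_one hW] at h1 h2
      have h3 : ∑ n ∈ Ioc 0 N, e (α * n) = ∑ n ∈ Ioc 0 N, e (β * n) := by
        refine sum_congr rfl fun n _ => ?_
        rw [heα]
        have : (n : ℝ) * a / (1 : ℕ) = ((n * a : ℤ) : ℝ) := by push_cast; ring
        rw [this, e_int, one_mul]
      rw [hsplit, h1, h3, one_mul, add_sub_cancel_right]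
      exact h2.trans (by nlinarith)
    · have h3 : ‖pwMean W r a * ∑ n ∈ Ioc 0 N, e (β * n)‖ ≤ η / 4 * N := by
        rw [norm_mul]
        refine mul_le_mul ((norm_pwMean_le hW hpW hw1 hr2 hcop).trans hwη) ?_ (norm_nonneg _)
          (by positivity)
        exact (norm_sum_le _ _).trans (by simp)
      have h4 : ‖∑ n ∈ Ioc 0 N, e (α * n)‖ ≤ η / 4 * N := by
        have hδ : ∀ c : ℤ, 1 / (2 * (Q : ℝ)) ≤ |α - c| := by
          intro c
          have h5 : 1 / (r : ℝ) ≤ |(a : ℝ) / r - c| := by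
            have h6 : (a : ℝ) / r - c = ((a - r * c : ℤ) : ℝ) / r := by push_cast; field_simp
            rw [h6, abs_div, Nat.abs_cast]
            refine div_le_div_of_nonneg_right ?_ hrpos.le
            have h7 : a - r * c ≠ 0 := by
              intro h8
              have h9 : (r : ℤ) ∣ a := ⟨c, by linarith⟩
              have := Int.isUnit_iff.1 (hcop.isUnit_of_dvd' h9 (dvd_refl _))
              omega
            exact_mod_cast Int.one_le_abs h7
          have h6 : |β| ≤ 1 / (2 * r) := by
            refine hβ1.trans ?_
            rw [div_div, div_le_div_iff₀ (by positivity) (by positivity)]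
            nlinarith
          have h7 : |(a : ℝ) / r - c| ≤ |α - c| + |β| := by
            have : (a : ℝ) / r - c = (α - c) - β := by rw [hβ]; ring
            rw [this]; exact abs_sub _ _
          have h8 : 1 / (2 * (Q : ℝ)) ≤ 1 / (2 * r) :=
            one_div_le_one_div_of_le (by positivity) (by linarith)
          have h9 : 1 / (r : ℝ) = 1 / (2 * r) + 1 / (2 * r) := by field_simp; norm_num
          linarith
        have h5 := norm_geom_sum_le (by positivity) hδ 0 N
        refine h5.trans ?_
        rw [one_div_one_div]
        rw [div_le_iff₀ hη] at hN4
        linarith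
      rw [hsplit, h1]
      refine (norm_sub_le _ _).trans ?_
      have := norm_add_le (∑ n ∈ Ioc 0 N, ((pw W n : ℂ) * e (n * a / r) - pwMean W r a) * e (β * n))
        (pwMean W r a * ∑ n ∈ Ioc 0 N, e (β * n))
      nlinarith
  · have h1 := hminor N α hN1 fun h => hα (h.mono hQQ hKK)
    have hδ : ∀ c : ℤ, K / N ≤ |α - c| := by
      intro c
      by_contra hc
      push Not at hc
      exact hα ⟨1, le_rfl, by simpa using hQ1, c, by simpa using hc.le⟩
    have h2 := norm_geom_sum_le (by positivity) hδ 0 N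
    have h3 : 1 / (K / N) ≤ η / 4 * N := by
      rw [one_div_div, div_le_iff₀ hK0]
      rw [div_le_iff₀ hη] at hKη
      nlinarith
    rw [hsplit]
    refine (norm_sub_le _ _).trans ?_
    nlinarith

/-- The weight `pw W` on `(√N, N]`. -/
noncomputable def tw (W N n : ℕ) : ℝ := if N < n ^ 2 ∧ n ≤ N then pw W n else 0

lemma tw_nonneg (W N n : ℕ) : 0 ≤ tw W N n := by
  unfold tw; split_ifs; exacts [pw_nonneg _ _, le_rfl]

lemma tw_le_log (W N n : ℕ) : tw W N n ≤ Real.log (W * N + 1 : ℕ) := by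
  unfold tw
  split_ifs with h
  · refine (pw_le_log W n).trans (Real.log_le_log (by positivity) ?_)
    exact_mod_cast Nat.succ_le_succ (Nat.mul_le_mul_left W h.2)
  · exact Real.log_natCast_nonneg _

lemma tw_ne_zero {W N n : ℕ} (h : tw W N n ≠ 0) : N < n ^ 2 ∧ n ≤ N ∧ (W * n + 1).Prime := by
  unfold tw at h
  split_ifs at h with h1
  · refine ⟨h1.1, h1.2, ?_⟩
    by_contra h2
    exact h (by simp [pw, h2])
  · exact absurd rfl h

/-- Small powers of logarithms of `W N + 1` are dominated by powers of `N`. -/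
lemma eventually_log_pow_le (W j : ℕ) {s ε : ℝ} (hs : 0 < s) (hε : 0 < ε) :
    ∃ N₀ : ℕ, ∀ N : ℕ, N₀ ≤ N → Real.log (W * N + 1 : ℕ) ^ j ≤ ε * (N : ℝ) ^ s := by
  have h1 : ∀ᶠ x : ℝ in Filter.atTop, ‖Real.log x ^ j‖ ≤ ε / ((W : ℝ) + 1) ^ s * ‖x ^ s‖ := by
    have := (isLittleO_log_rpow_rpow_atTop (s := s) (r := j) hs).def
      (c := ε / ((W : ℝ) + 1) ^ s) (by positivity)
    simpa using this
  obtain ⟨X, hX⟩ := Filter.eventually_atTop.1 h1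
  refine ⟨max ⌈X⌉₊ 1, fun N hN => ?_⟩
  have hN1 : 1 ≤ N := (le_max_right _ _).trans hN
  have hNX : X ≤ N := (Nat.le_ceil _).trans (by exact_mod_cast (le_max_left _ _).trans hN)
  have h2 := hX (((W : ℝ) + 1) * N) (hNX.trans (by
    have : (0:ℝ) ≤ W * N := by positivity
    linarith))
  have h3 : Real.log (W * N + 1 : ℕ) ≤ Real.log (((W : ℝ) + 1) * N) := by
    refine Real.log_le_log (by positivity) ?_
    have : (1:ℝ) ≤ N := by exact_mod_cast hN1
    push_cast; linarith
  calc Real.log (W * N + 1 : ℕ) ^ j ≤ Real.log (((W : ℝ) + 1) * N) ^ j :=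
        pow_le_pow_left₀ (Real.log_natCast_nonneg _) h3 j
    _ ≤ ‖Real.log (((W : ℝ) + 1) * N) ^ j‖ := le_abs_self _
    _ ≤ ε / ((W : ℝ) + 1) ^ s * ‖(((W : ℝ) + 1) * N) ^ s‖ := h2
    _ = ε * (N : ℝ) ^ s := by
      rw [Real.norm_of_nonneg (by positivity), Real.mul_rpow (by positivity) (by positivity)]
      field_simp

/-- The truncated weight is Fourier-pseudorandom too. -/
theorem norm_sum_tw_sub_one_le {η : ℝ} (hη : 0 < η) : ∃ W : ℕ, 1 ≤ W ∧ ∃ N₀ : ℕ, ∀ N : ℕ, N₀ ≤ N →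
    ∀ α : ℝ, ‖∑ n ∈ Ioc 0 N, ((tw W N n : ℂ) - 1) * e (α * n)‖ ≤ η * N := by
  obtain ⟨W, hW, N₁, h1⟩ := norm_sum_pw_sub_one_le (η := η / 2) (by positivity)
  obtain ⟨N₂, h2⟩ := eventually_log_pow_le W 1 (s := 1 / 2) (ε := η / 2) (by norm_num) (by positivity)
  refine ⟨W, hW, max N₁ N₂, fun N hN α => ?_⟩
  have h3 := h1 N ((le_max_left _ _).trans hN) α
  have h4 := h2 N ((le_max_right _ _).trans hN)
  rw [pow_one] at h4
  have h5 : ∑ n ∈ Ioc 0 N, ((tw W N n : ℂ) - 1) * e (α * n)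
      = ∑ n ∈ Ioc 0 N, ((pw W n : ℂ) - 1) * e (α * n)
        - ∑ n ∈ (Ioc 0 N).filter (fun n => ¬ N < n ^ 2), (pw W n : ℂ) * e (α * n) := by
    rw [sum_filter, ← sum_sub_distrib]
    refine sum_congr rfl fun n hn => ?_
    have := (mem_Ioc.1 hn).2
    by_cases h : N < n ^ 2 <;> simp [tw, h, this]
    ring
  have h6 : ‖∑ n ∈ (Ioc 0 N).filter (fun n => ¬ N < n ^ 2), (pw W n : ℂ) * e (α * n)‖
      ≤ η / 2 * N := by
    have hsub : (Ioc 0 N).filter (fun n => ¬ N < n ^ 2) ⊆ Ioc 0 (Nat.sqrt N) := by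
      intro n hn
      rw [mem_filter, mem_Ioc] at hn
      exact mem_Ioc.2 ⟨hn.1.1, Nat.le_sqrt'.2 (not_lt.1 hn.2)⟩
    have hcard : (((Ioc 0 N).filter (fun n => ¬ N < n ^ 2)).card : ℝ) ≤ (N : ℝ) ^ (1 / 2 : ℝ) := by
      rw [← Real.sqrt_eq_rpow]
      refine le_trans ?_ (Real.nat_sqrt_le_real_sqrt)
      exact_mod_cast (card_le_card hsub).trans (by simp)
    calc _ ≤ ∑ n ∈ (Ioc 0 N).filter (fun n => ¬ N < n ^ 2), Real.log (W * N + 1 : ℕ) := by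
          refine (norm_sum_le _ _).trans (sum_le_sum fun n hn => ?_)
          rw [norm_mul, norm_e, mul_one, Complex.norm_real, Real.norm_of_nonneg (pw_nonneg _ _)]
          refine (pw_le_log W n).trans (Real.log_le_log (by positivity) ?_)
          have := (mem_Ioc.1 (mem_filter.1 hn).1).2
          exact_mod_cast Nat.succ_le_succ (Nat.mul_le_mul_left W this)
      _ ≤ (N : ℝ) ^ (1 / 2 : ℝ) * (η / 2 * (N : ℝ) ^ (1 / 2 : ℝ)) := by
          rw [sum_const, nsmul_eq_mul]
          exact mul_le_mul hcard h4 (Real.log_natCast_nonneg _) (by positivity)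
      _ = η / 2 * N := by
          rw [mul_left_comm, ← Real.sqrt_eq_rpow, Real.mul_self_sqrt (by positivity)]
  rw [h5]
  refine (norm_sub_le _ _).trans ?_
  linarith

lemma card_divisors_mul_le (a b : ℕ) :
    (a * b).divisors.card ≤ a.divisors.card * b.divisors.card := by
  rw [Nat.divisors_mul]; exact Finset.card_mul_le

lemma sum_inv_Icc_le (Q : ℕ) : ∑ q ∈ Icc 1 Q, (1 : ℝ) / q ≤ 1 + Real.log Q := by
  have := harmonic_le_one_add_log Q
  rw [harmonic_eq_sum_Icc] at this
  push_cast at this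
  simpa using this

/-- Moments of the divisor function with logarithmic weight. -/
lemma sum_card_divisors_pow_div_le (k X : ℕ) :
    ∑ l ∈ Icc 1 X, (l.divisors.card : ℝ) ^ k / l ≤ (1 + Real.log X) ^ 2 ^ k := by
  induction k with
  | zero => simpa using sum_inv_Icc_le X
  | succ k ih =>
    set T := ∑ l ∈ Icc 1 X, (l.divisors.card : ℝ) ^ k / l with hT
    have hT0 : 0 ≤ T := sum_nonneg fun l _ => by positivity
    calc ∑ l ∈ Icc 1 X, (l.divisors.card : ℝ) ^ (k + 1) / l
        = ∑ l ∈ Icc 1 X, ∑ x ∈ l.divisorsAntidiagonal,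
            ((x.1 * x.2).divisors.card : ℝ) ^ k / (x.1 * x.2 : ℕ) := by
          refine sum_congr rfl fun l _ => ?_
          rw [sum_congr rfl fun x hx => by rw [(Nat.mem_divisorsAntidiagonal.1 hx).1], sum_const,
            ← Nat.map_div_right_divisors, card_map, nsmul_eq_mul]
          ring
      _ = ∑ x ∈ (Icc 1 X).sigma fun l => l.divisorsAntidiagonal,
            ((x.2.1 * x.2.2).divisors.card : ℝ) ^ k / (x.2.1 * x.2.2 : ℕ) := by rw [sum_sigma]
      _ ≤ ∑ x ∈ Icc 1 X ×ˢ Icc 1 X, ((x.1 * x.2).divisors.card : ℝ) ^ k / (x.1 * x.2 : ℕ) := by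
          rw [← sum_image (f := fun x : ℕ × ℕ =>
            ((x.1 * x.2).divisors.card : ℝ) ^ k / (x.1 * x.2 : ℕ))
            (g := fun x : (_ : ℕ) × ℕ × ℕ => x.2)]
          · refine sum_le_sum_of_subset_of_nonneg ?_ fun _ _ _ => by positivity
            intro x hx
            obtain ⟨⟨l, y⟩, hy, rfl⟩ := mem_image.1 hx
            simp only [mem_sigma, mem_Icc, Nat.mem_divisorsAntidiagonal] at hy
            obtain ⟨⟨h1, h2⟩, h3, h4⟩ := hy
            have h5 : y.1 ≠ 0 := by rintro h; simp [h] at h3; omega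
            have h6 : y.2 ≠ 0 := by rintro h; simp [h] at h3; omega
            have h7 := Nat.le_mul_of_pos_right y.1 (Nat.pos_of_ne_zero h6)
            have h8 := Nat.le_mul_of_pos_left y.2 (Nat.pos_of_ne_zero h5)
            simp only [mem_product, mem_Icc]
            omega
          · rintro ⟨l, y⟩ hy ⟨l', y'⟩ hy' h
            simp only [coe_sigma, Set.mem_sigma_iff, mem_coe, Nat.mem_divisorsAntidiagonal] at hy hy'
            simp only at h
            subst h
            have : l = l' := by rw [← hy.2.1, hy'.2.1]
            subst this; rfl
      _ ≤ ∑ x ∈ Icc 1 X ×ˢ Icc 1 X,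
            ((x.1.divisors.card : ℝ) ^ k / x.1) * ((x.2.divisors.card : ℝ) ^ k / x.2) := by
          refine sum_le_sum fun x _ => ?_
          rw [div_mul_div_comm, ← mul_pow, Nat.cast_mul]
          gcongr
          exact_mod_cast card_divisors_mul_le _ _
      _ = T ^ 2 := by rw [sum_product, sq, hT, sum_mul_sum]
      _ ≤ (1 + Real.log X) ^ 2 ^ (k + 1) := by
          rw [pow_succ 2 k, pow_mul]
          exact pow_le_pow_left₀ hT0 ih 2

/-- The number of divisors up to `Q` of `m` that are coprime to `W`. -/
def dvc (W Q m : ℕ) : ℕ := ((Icc 1 Q).filter (fun g => g.Coprime W ∧ g ∣ m)).card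

lemma card_filter_dvd_mul_add_one_le {L W : ℕ} (hL : 1 ≤ L) (hLW : L.Coprime W) (N : ℕ) :
    (((Ioc 0 N).filter (fun n => L ∣ W * n + 1)).card : ℝ) ≤ N / L + 1 := by
  by_cases h : ∃ v, L ∣ W * v + 1
  · obtain ⟨v, hv⟩ := h
    have hsub : (Ioc 0 N).filter (fun n => L ∣ W * n + 1) ⊆ (Ioc 0 N).filter (· ≡ v [MOD L]) := by
      intro n hn
      rw [mem_filter] at hn ⊢
      refine ⟨hn.1, ?_⟩
      have h1 : W * n + 1 ≡ W * v + 1 [MOD L] :=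
        ((Nat.modEq_zero_iff_dvd.2 hn.2).trans (Nat.modEq_zero_iff_dvd.2 hv).symm)
      exact Nat.ModEq.cancel_left_of_coprime hLW (Nat.ModEq.add_right_cancel' 1 h1)
    have h1 := Nat.Ioc_filter_modEq_card 0 N (r := L) hL v
    have h2 : (((Ioc 0 N).filter (· ≡ v [MOD L])).card : ℝ) ≤ N / L + 1 := by
      have h3 : ((((Ioc 0 N).filter (· ≡ v [MOD L])).card : ℤ) : ℝ) ≤ N / L + 1 := by
        rw [h1]
        have hL0 : (0:ℝ) < L := by exact_mod_cast hL
        rw [Int.cast_max, Int.cast_zero, max_le_iff]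
        refine ⟨?_, by positivity⟩
        push_cast
        have h4 := Int.floor_le (((N : ℚ) - v) / L)
        have h5 := Int.lt_floor_add_one (((0 : ℚ) - v) / L)
        have h6 : ((⌊((N : ℚ) - v) / L⌋ : ℚ)) - ⌊((0:ℚ) - v) / L⌋ ≤ N / L + 1 := by
          have : ((N : ℚ) - v) / L - ((0:ℚ) - v) / L = N / L := by ring
          linarith
        have h7 : ((((⌊((N : ℚ) - v) / L⌋ : ℚ)) - ⌊((0:ℚ) - v) / L⌋ : ℚ) : ℝ) ≤ ((N / L + 1 : ℚ) : ℝ) := by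
          exact_mod_cast h6
        push_cast at h7
        simpa using h7
      simpa using h3
    exact le_trans (by exact_mod_cast card_le_card hsub) h2
  · push Not at h
    rw [filter_false_of_mem fun n _ => h n]
    simp; positivity

lemma sum_dvc_pow_four_le {W Q N : ℕ} (hQN : Q ^ 4 ≤ N) :
    ∑ n ∈ Ioc 0 N, (dvc W Q (W * n + 1) : ℝ) ^ 4 ≤ 2 * N * (1 + 4 * Real.log Q) ^ 16 := by
  classical
  set s := (Icc 1 Q).filter (fun g => g.Coprime W) with hs
  set t := s ×ˢ s ×ˢ s ×ˢ s with ht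
  set L : ℕ × ℕ × ℕ × ℕ → ℕ := fun g => Nat.lcm g.1 (Nat.lcm g.2.1 (Nat.lcm g.2.2.1 g.2.2.2)) with hL
  have hmem : ∀ g ∈ t, (g.1 ∈ s ∧ g.2.1 ∈ s ∧ g.2.2.1 ∈ s ∧ g.2.2.2 ∈ s) := fun g hg => by
    simpa only [ht, mem_product] using hg
  have hs1 : ∀ g ∈ s, 1 ≤ g ∧ g ≤ Q ∧ g.Coprime W := fun g hg => by
    simp only [hs, mem_filter, mem_Icc] at hg; tauto
  have hdv : ∀ m, (dvc W Q m : ℝ) ^ 4 = ∑ g ∈ t, if L g ∣ m then 1 else 0 := by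
    intro m
    have h1 : dvc W Q m ^ 4 = (t.filter (fun g => L g ∣ m)).card := by
      have h2 : t.filter (fun g => L g ∣ m) = (s.filter (· ∣ m)) ×ˢ (s.filter (· ∣ m)) ×ˢ
          (s.filter (· ∣ m)) ×ˢ (s.filter (· ∣ m)) := by
        ext g
        simp only [ht, hL, mem_filter, mem_product, Nat.lcm_dvd_iff]
        tauto
      rw [h2, card_product, card_product, card_product, dvc, ← filter_filter]
      ring
    rw [← Nat.cast_pow, h1, sum_boole]
  have hLpos : ∀ g ∈ t, 1 ≤ L g ∧ L g ≤ Q ^ 4 ∧ (L g).Coprime W := by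
    intro g hg
    obtain ⟨h1, h2, h3, h4⟩ := hmem g hg
    replace h1 := hs1 _ h1
    replace h2 := hs1 _ h2
    replace h3 := hs1 _ h3
    replace h4 := hs1 _ h4
    refine ⟨?_, ?_, ?_⟩
    · exact Nat.lcm_pos h1.1 (Nat.lcm_pos h2.1 (Nat.lcm_pos h3.1 h4.1))
    · have hl : ∀ a b : ℕ, 1 ≤ a → 1 ≤ b → Nat.lcm a b ≤ a * b := fun a b ha hb =>
        Nat.le_of_dvd (Nat.mul_pos ha hb) (Nat.lcm_dvd_mul a b)
      have p1 := Nat.lcm_pos h3.1 h4.1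
      have p2 := Nat.lcm_pos h2.1 p1
      calc L g ≤ g.1 * (g.2.1 * (g.2.2.1 * g.2.2.2)) :=
            (hl _ _ h1.1 p2).trans (Nat.mul_le_mul_left _ ((hl _ _ h2.1 p1).trans
              (Nat.mul_le_mul_left _ (hl _ _ h3.1 h4.1))))
        _ ≤ Q * (Q * (Q * Q)) := by gcongr <;> tauto
        _ = Q ^ 4 := by ring
    · have hc : ∀ a b : ℕ, a.Coprime W → b.Coprime W → (Nat.lcm a b).Coprime W := fun a b ha hb =>
        Nat.Coprime.coprime_dvd_left (Nat.lcm_dvd_mul a b) (Nat.Coprime.mul_left ha hb)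
      exact hc _ _ h1.2.2 (hc _ _ h2.2.2 (hc _ _ h3.2.2 h4.2.2))
  calc ∑ n ∈ Ioc 0 N, (dvc W Q (W * n + 1) : ℝ) ^ 4
      = ∑ g ∈ t, (((Ioc 0 N).filter (fun n => L g ∣ W * n + 1)).card : ℝ) := by
        rw [sum_congr rfl fun n _ => hdv _, sum_comm]
        exact sum_congr rfl fun g _ => by rw [sum_boole]
    _ ≤ ∑ g ∈ t, 2 * N * (1 / (L g : ℝ)) := by
        refine sum_le_sum fun g hg => ?_
        obtain ⟨h1, h2, h3⟩ := hLpos g hg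
        refine (card_filter_dvd_mul_add_one_le h1 h3 N).trans ?_
        have h4 : (1:ℝ) ≤ L g := by exact_mod_cast h1
        have h5 : (L g : ℝ) ≤ N := by exact_mod_cast h2.trans hQN
        have : (1:ℝ) ≤ N / L g := by rw [le_div_iff₀ (by linarith)]; linarith
        calc (N : ℝ) / L g + 1 ≤ N / L g + N / L g := by linarith
          _ = _ := by ring
    _ = 2 * N * ∑ g ∈ t, 1 / (L g : ℝ) := by rw [mul_sum]
    _ ≤ 2 * N * ∑ l ∈ Icc 1 (Q ^ 4), (l.divisors.card : ℝ) ^ 4 / l := by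
        refine mul_le_mul_of_nonneg_left ?_ (by positivity)
        rw [← sum_fiberwise_of_maps_to (s := t) (t := Icc 1 (Q ^ 4)) (g := L)
          fun g hg => mem_Icc.2 ⟨(hLpos g hg).1, (hLpos g hg).2.1⟩]
        refine sum_le_sum fun l hl => ?_
        rw [sum_congr rfl fun g hg => by rw [(mem_filter.1 hg).2], sum_const, nsmul_eq_mul,
          mul_one_div]
        refine div_le_div_of_nonneg_right ?_ (Nat.cast_nonneg _)
        have hsub : t.filter (fun g => L g = l) ⊆
            l.divisors ×ˢ l.divisors ×ˢ l.divisors ×ˢ l.divisors := by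
          intro g hg
          have h1 := (mem_filter.1 hg).2
          have h2 : L g ∣ l := h1 ▸ dvd_refl _
          have h3 : l ≠ 0 := by have := (mem_Icc.1 hl).1; omega
          simp only [hL, Nat.lcm_dvd_iff] at h2
          simp only [mem_product, Nat.mem_divisors]
          tauto
        have h1 := card_le_card hsub
        simp only [card_product] at h1
        have h2 : (t.filter (fun g => L g = l)).card ≤ l.divisors.card ^ 4 := h1.trans (by
          apply le_of_eq; ring)
        exact_mod_cast h2
    _ ≤ 2 * N * (1 + 4 * Real.log Q) ^ 16 := by
        refine mul_le_mul_of_nonneg_left ?_ (by positivity)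
        refine (sum_card_divisors_pow_div_le 4 (Q ^ 4)).trans ?_
        rw [Nat.cast_pow, Real.log_pow]
        norm_num

lemma sum_gcd_div_le (W Q m : ℕ) :
    ∑ q ∈ (Icc 1 Q).filter (fun q => q.Coprime W), (Nat.gcd q m : ℝ) / q ≤
      (1 + Real.log Q) * dvc W Q m := by
  classical
  have hlog : 0 ≤ 1 + Real.log Q := by have := Real.log_natCast_nonneg Q; linarith
  set s := (Icc 1 Q).filter (fun q => q.Coprime W)
  set u := (Icc 1 Q).filter (fun g => g.Coprime W ∧ g ∣ m)
  have hmaps : ∀ q ∈ s, Nat.gcd q m ∈ u := by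
    intro q hq
    simp only [s, u, mem_filter, mem_Icc] at hq ⊢
    exact ⟨⟨Nat.gcd_pos_of_pos_left _ hq.1.1, (Nat.gcd_le_left _ hq.1.1).trans hq.1.2⟩,
      Nat.Coprime.coprime_dvd_left (Nat.gcd_dvd_left _ _) hq.2, Nat.gcd_dvd_right _ _⟩
  rw [← sum_fiberwise_of_maps_to hmaps, dvc, mul_comm, ← nsmul_eq_mul]
  refine sum_le_card_nsmul _ _ _ fun g hg => ?_
  have hg1 : 1 ≤ g := by simp only [u, mem_filter, mem_Icc] at hg; exact hg.1.1
  refine le_trans ?_ (sum_inv_Icc_le Q)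
  calc ∑ q ∈ s.filter (fun q => Nat.gcd q m = g), (Nat.gcd q m : ℝ) / q
      = ∑ q ∈ s.filter (fun q => Nat.gcd q m = g), (1:ℝ) / (q / g : ℕ) := by
        refine sum_congr rfl fun q hq => ?_
        have h1 := (mem_filter.1 hq).2
        have h2 : g ∣ q := h1 ▸ Nat.gcd_dvd_left _ _
        have hg0 : (g : ℝ) ≠ 0 := by positivity
        rw [h1, Nat.cast_div h2 hg0, one_div_div]
    _ ≤ ∑ q ∈ Icc 1 Q, (1:ℝ) / q := by
        rw [← sum_image (f := fun q : ℕ => (1:ℝ) / q) (g := fun q : ℕ => q / g)]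
        · refine sum_le_sum_of_subset_of_nonneg ?_ fun _ _ _ => by positivity
          intro x hx
          obtain ⟨q, hq, rfl⟩ := mem_image.1 hx
          simp only [s, mem_filter, mem_Icc] at hq
          have h2 : g ∣ q := hq.2 ▸ Nat.gcd_dvd_left _ _
          exact mem_Icc.2 ⟨Nat.div_pos (Nat.le_of_dvd (by omega) h2) hg1,
            (Nat.div_le_self _ _).trans hq.1.1.2⟩
        · intro q hq q' hq' h
          simp only [coe_filter, Set.mem_ofPred_eq] at hq hq'
          have h2 : g ∣ q := hq.2 ▸ Nat.gcd_dvd_left _ _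
          have h3 : g ∣ q' := hq'.2 ▸ Nat.gcd_dvd_left _ _
          exact (Nat.div_left_inj h2 h3).1 h

lemma sum_mul_sq_pow_four_le {ι : Type*} (s : Finset ι) {D G : ι → ℝ} {J : ℝ}
    (hJ : ∀ i ∈ s, |G i| ≤ J) :
    (∑ i ∈ s, D i * G i ^ 2) ^ 4 ≤ (∑ i ∈ s, D i ^ 4) * J ^ 2 * (∑ i ∈ s, G i ^ 2) ^ 3 := by
  set X := ∑ i ∈ s, D i * G i ^ 2
  set Y := ∑ i ∈ s, G i ^ 2
  set Z := ∑ i ∈ s, D i ^ 2 * G i ^ 2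
  set V := ∑ i ∈ s, D i ^ 4
  have hY : 0 ≤ Y := sum_nonneg fun i _ => sq_nonneg _
  have hV : 0 ≤ V := sum_nonneg fun i _ => by positivity
  have h1 : X ^ 2 ≤ Z * Y :=
    sum_sq_le_sum_mul_sum_of_sq_le_mul s (fun i _ => by positivity) (fun i _ => by positivity)
      fun i _ => le_of_eq (by ring)
  have h2 : Z ^ 2 ≤ V * ∑ i ∈ s, G i ^ 4 :=
    sum_sq_le_sum_mul_sum_of_sq_le_mul s (fun i _ => by positivity) (fun i _ => by positivity)
      fun i _ => le_of_eq (by ring)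
  have h3 : ∑ i ∈ s, G i ^ 4 ≤ J ^ 2 * Y := by
    rw [mul_sum]
    refine sum_le_sum fun i hi => ?_
    have h4 : G i ^ 2 ≤ J ^ 2 := sq_le_sq.2 ((hJ i hi).trans (le_abs_self _))
    calc G i ^ 4 = G i ^ 2 * G i ^ 2 := by ring
      _ ≤ _ := mul_le_mul_of_nonneg_right h4 (sq_nonneg _)
  calc X ^ 4 = (X ^ 2) ^ 2 := by ring
    _ ≤ (Z * Y) ^ 2 := pow_le_pow_left₀ (sq_nonneg _) h1 2
    _ = Z ^ 2 * Y ^ 2 := by ring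
    _ ≤ V * (J ^ 2 * Y) * Y ^ 2 := by gcongr; exact h2.trans (mul_le_mul_of_nonneg_left h3 hV)
    _ = _ := by ring

lemma norm_sum_sq_eq {ι : Type*} (s : Finset ι) (g : ι → ℂ) :
    ((‖∑ i ∈ s, g i‖ ^ 2 : ℝ) : ℂ) = ∑ i ∈ s, ∑ j ∈ s, g i * starRingEnd ℂ (g j) := by
  rw [Complex.ofReal_pow, ← Complex.mul_conj', map_sum, sum_mul_sum]

lemma parseval {M : ℕ} (hM : 1 ≤ M) {s : Finset ℕ} (g : ℕ → ℂ)
    (hs : ∀ n ∈ s, ∀ n' ∈ s, (M : ℤ) ∣ n - n' → n = n') :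
    ∑ c ∈ range M, ‖∑ n ∈ s, g n * e (c * n / M)‖ ^ 2 = M * ∑ n ∈ s, ‖g n‖ ^ 2 := by
  have h : ((∑ c ∈ range M, ‖∑ n ∈ s, g n * e (c * n / M)‖ ^ 2 : ℝ) : ℂ)
      = ((M * ∑ n ∈ s, ‖g n‖ ^ 2 : ℝ) : ℂ) := by
    rw [Complex.ofReal_sum, sum_congr rfl fun c _ => norm_sum_sq_eq s _, sum_comm]
    push_cast
    rw [mul_sum]
    refine sum_congr rfl fun n hn => ?_
    rw [sum_comm]
    have h1 : ∀ n' ∈ s, ∑ c ∈ range M, g n * e (c * n / M) * starRingEnd ℂ (g n' * e (c * n' / M))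
        = if n = n' then (M : ℂ) * (g n * starRingEnd ℂ (g n)) else 0 := by
      intro n' hn'
      have h2 : ∀ c : ℕ, g n * e (c * n / M) * starRingEnd ℂ (g n' * e (c * n' / M))
          = g n * starRingEnd ℂ (g n') * e (c * ((n - n' : ℤ) : ℤ) / M) := by
        intro c
        have : (c : ℝ) * ((n - n' : ℤ) : ℤ) / M = c * n / M - c * n' / M := by push_cast; ring
        rw [this, e_sub, map_mul]; ring
      rw [sum_congr rfl fun c _ => h2 c, ← mul_sum, sum_e_div hM]
      by_cases h3 : n = n'
      · subst h3; simp; ring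
      · rw [if_neg fun h4 => h3 (hs n hn n' hn' h4), if_neg h3, mul_zero]
    rw [sum_congr rfl h1, sum_ite_eq, if_pos hn, Complex.mul_conj']
  exact_mod_cast h

lemma natCast_sub_dvd {M n n' : ℕ} (hn : n < M) (hn' : n' < M) (h : (M : ℤ) ∣ n - n') : n = n' := by
  have h1 := Int.eq_zero_of_abs_lt_dvd h (abs_lt.2 ⟨by omega, by omega⟩)
  omega

lemma tw_le_nu {W N R : ℕ} (hW : 1 ≤ W) (hN : W + 1 ≤ N) (hR : 1 ≤ R) (h1 : R ^ 20 ≤ N)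
    (h2 : N < (R + 1) ^ 20) (n : ℕ) : tw W N n ≤ 40 * nu (famW W R) (W * n + 1) := by
  have hfam := famW_sieveFamily (W := W) hR
  by_cases h0 : tw W N n = 0
  · rw [h0]; have := hfam.nu_nonneg (W * n + 1); positivity
  obtain ⟨h3, h4, h5⟩ := tw_ne_zero h0
  have hRn : R < n := by
    by_contra h
    push Not at h
    have : n ^ 2 ≤ R ^ 20 := (Nat.pow_le_pow_left h 2).trans (Nat.pow_le_pow_right hR (by norm_num))
    omega
  have hnu : nu (famW W R) (W * n + 1) = hh (famW W R) := by
    refine hfam.nu_eq_hh fun S hS p hp hdvd => ?_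
    have hpp := hfam.prime S hS p hp
    have h6 := (Nat.prime_dvd_prime_iff_eq hpp h5).1 hdvd
    have h7 : p ≤ nn S := Nat.le_of_dvd
      (Nat.pos_of_ne_zero (prod_ne_zero_iff.2 fun q hq => (hfam.prime S hS q hq).ne_zero))
      (dvd_prod_of_mem _ hp)
    have h8 := hfam.le S hS
    have h9 := Nat.le_mul_of_pos_left n hW
    omega
  have h8 : (N : ℝ) ≤ ((R : ℝ) + 1) ^ 20 := by
    have := (Nat.cast_lt (α := ℝ)).2 h2
    rw [Nat.cast_pow, Nat.cast_add R, Nat.cast_one] at this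
    exact this.le
  clear h1 h2
  have hlog : Real.log (W * n + 1 : ℕ) ≤ 40 * Real.log (R + 1) := by
    have h7 : ((W * n + 1 : ℕ) : ℝ) ≤ ((R : ℝ) + 1) ^ 40 := by
      have h9 : W * n + 1 ≤ N * N := by
        calc W * n + 1 ≤ W * N + N := by have := Nat.mul_le_mul_left W h4; omega
          _ = (W + 1) * N := by ring
          _ ≤ N * N := Nat.mul_le_mul_right _ hN
      calc ((W * n + 1 : ℕ) : ℝ) ≤ (N : ℝ) * N := by exact_mod_cast h9
        _ ≤ ((R : ℝ) + 1) ^ 20 * ((R : ℝ) + 1) ^ 20 :=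
          mul_le_mul h8 h8 (Nat.cast_nonneg _) (by positivity)
        _ = ((R : ℝ) + 1) ^ 40 := by rw [← pow_add]
    calc Real.log (W * n + 1 : ℕ) ≤ Real.log (((R : ℝ) + 1) ^ 40) :=
          Real.log_le_log (by positivity) h7
      _ = 40 * Real.log (R + 1) := by rw [Real.log_pow]; norm_num
  rw [hnu, tw, if_pos ⟨h3, h4⟩, pw, if_pos h5]
  calc (W.totient : ℝ) / W * Real.log (W * n + 1 : ℕ)
      ≤ (W.totient : ℝ) / W * (40 * Real.log (R + 1)) :=
        mul_le_mul_of_nonneg_left hlog (by positivity)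
    _ = 40 * ((W.totient : ℝ) / W * Real.log (R + 1)) := by ring
    _ ≤ _ := mul_le_mul_of_nonneg_left (le_hh_famW hW R) (by norm_num)

/-- An exponential sum weighted by the square of a trigonometric polynomial. -/
lemma sum_mul_norm_sq_le {M N : ℕ} {S : Finset ℕ} {h : ℕ → ℝ} {ψ : ℕ → ℂ} {B : ℝ}
    (hψ : ∀ r, ‖ψ r‖ ≤ 1) (hB : ∀ θ : ℝ, ‖∑ n ∈ Ioc 0 N, (h n : ℂ) * e (θ * n)‖ ≤ B) :
    ∑ n ∈ Ioc 0 N, h n * ‖∑ r ∈ S, ψ r * e (n * r / M)‖ ^ 2 ≤ S.card ^ 2 * B := by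
  have h1 : ((∑ n ∈ Ioc 0 N, h n * ‖∑ r ∈ S, ψ r * e (n * r / M)‖ ^ 2 : ℝ) : ℂ)
      = ∑ r ∈ S, ∑ r' ∈ S, ψ r * starRingEnd ℂ (ψ r') *
        ∑ n ∈ Ioc 0 N, (h n : ℂ) * e (((r : ℝ) / M - r' / M) * n) := by
    rw [Complex.ofReal_sum, sum_congr rfl fun n _ => by
      rw [Complex.ofReal_mul, norm_sum_sq_eq, mul_sum, sum_congr rfl fun r _ => mul_sum _ _ _],
      sum_comm]
    refine sum_congr rfl fun r _ => ?_
    rw [sum_comm]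
    refine sum_congr rfl fun r' _ => ?_
    rw [mul_sum]
    refine sum_congr rfl fun n _ => ?_
    have : ((r : ℝ) / M - r' / M) * n = n * r / M - n * r' / M := by ring
    rw [this, e_sub, map_mul]; ring
  calc _ ≤ ‖((∑ n ∈ Ioc 0 N, h n * ‖∑ r ∈ S, ψ r * e (n * r / M)‖ ^ 2 : ℝ) : ℂ)‖ := by
        rw [Complex.norm_real]; exact Real.le_norm_self _
    _ ≤ ∑ r ∈ S, ∑ r' ∈ S, B := by
        rw [h1]
        refine (norm_sum_le _ _).trans (sum_le_sum fun r _ => (norm_sum_le _ _).trans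
          (sum_le_sum fun r' _ => ?_))
        rw [norm_mul, norm_mul, RCLike.norm_conj]
        have hB' := hB ((r : ℝ) / M - r' / M)
        have hp : ‖ψ r‖ * ‖ψ r'‖ ≤ 1 := mul_le_one₀ (hψ r) (norm_nonneg _) (hψ r')
        exact (mul_le_of_le_one_left (norm_nonneg _) hp).trans hB'
    _ = _ := by rw [sum_const, sum_const]; simp; ring

lemma exists_log_pow_rpow_le (A : ℝ) (hA : 0 ≤ A) : ∃ C : ℝ, 1 ≤ C ∧ ∀ Q : ℕ, 1 ≤ Q →
    A * ((Q : ℝ) ^ (1 / 80 : ℝ)) ^ 4 * (1 + 4 * Real.log Q) ^ 20 ≤ C * (Q : ℝ) ^ (1 / 16 : ℝ) := by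
  refine ⟨A * 6401 ^ 20 + 1, by have : 0 ≤ A * 6401 ^ 20 := (by positivity); linarith,
    fun Q hQ => ?_⟩
  have hQ0 : (0:ℝ) < Q := by exact_mod_cast hQ
  have hQ1 : (1:ℝ) ≤ Q := by exact_mod_cast hQ
  have h1 := Real.log_natCast_le_rpow_div Q (ε := 1 / 1600) (by norm_num)
  have h2 : 1 ≤ (Q : ℝ) ^ (1 / 1600 : ℝ) := Real.one_le_rpow hQ1 (by norm_num)
  have h3 := Real.log_natCast_nonneg Q
  have h4 : (1 + 4 * Real.log Q) ^ 20 ≤ (6401 * (Q : ℝ) ^ (1 / 1600 : ℝ)) ^ 20 := by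
    refine pow_le_pow_left₀ (by linarith) ?_ 20
    rw [div_eq_mul_inv] at h1
    norm_num at h1 h2 ⊢
    linarith
  calc A * ((Q : ℝ) ^ (1 / 80 : ℝ)) ^ 4 * (1 + 4 * Real.log Q) ^ 20
      ≤ A * ((Q : ℝ) ^ (1 / 80 : ℝ)) ^ 4 * (6401 * (Q : ℝ) ^ (1 / 1600 : ℝ)) ^ 20 := by gcongr
    _ = A * 6401 ^ 20 * (((Q : ℝ) ^ (1 / 80 : ℝ)) ^ 4 * ((Q : ℝ) ^ (1 / 1600 : ℝ)) ^ 20) := by ring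
    _ = A * 6401 ^ 20 * (Q : ℝ) ^ (1 / 16 : ℝ) := by
        rw [← Real.rpow_mul_natCast hQ0.le, ← Real.rpow_mul_natCast hQ0.le, ← Real.rpow_add hQ0]
        norm_num
    _ ≤ _ := by gcongr; linarith

lemma exists_phase (z : ℂ) : ∃ ψ : ℂ, ‖ψ‖ ≤ 1 ∧ ψ * z = (‖z‖ : ℂ) := by
  by_cases hz : z = 0
  · exact ⟨0, by simp, by simp [hz]⟩
  · have h0 : (‖z‖ : ℂ) ≠ 0 := by simpa using hz
    refine ⟨starRingEnd ℂ z / ‖z‖, ?_, ?_⟩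
    · rw [norm_div, RCLike.norm_conj, Complex.norm_real, norm_norm]
      exact div_self_le_one _
    · rw [div_mul_eq_mul_div, mul_comm, Complex.mul_conj', sq, mul_div_assoc, div_self h0, mul_one]

/-- Duality: the square of the `ℓ¹`-norm of the Fourier transform of `f` over a set of frequencies. -/
lemma card_mul_sq_le_of_le_norm {M N : ℕ} {S : Finset ℕ} {f ν : ℕ → ℝ} {A B : ℝ}
    (hB : 0 ≤ B)
    (hf : ∀ n, 0 ≤ f n) (hfν : ∀ n, f n ≤ A * ν n)
    (hS : ∀ r ∈ S, B ≤ ‖∑ n ∈ Ioc 0 N, (f n : ℂ) * e (n * r / M)‖) :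
    ∃ ψ : ℕ → ℂ, (∀ r, ‖ψ r‖ ≤ 1) ∧ (B * S.card) ^ 2 ≤ A ^ 2 * (∑ n ∈ Ioc 0 N, ν n) *
      ∑ n ∈ Ioc 0 N, ν n * ‖∑ r ∈ S, ψ r * e (n * r / M)‖ ^ 2 := by
  choose ψ hψ1 hψ2 using fun r : ℕ => exists_phase (∑ n ∈ Ioc 0 N, (f n : ℂ) * e (n * r / M))
  refine ⟨ψ, hψ1, ?_⟩
  set G : ℕ → ℝ := fun n => ‖∑ r ∈ S, ψ r * e (n * r / M)‖ with hG
  have h1 : B * S.card ≤ ∑ n ∈ Ioc 0 N, f n * G n := by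
    have h2 : ((∑ r ∈ S, ‖∑ n ∈ Ioc 0 N, (f n : ℂ) * e (n * r / M)‖ : ℝ) : ℂ)
        = ∑ n ∈ Ioc 0 N, (f n : ℂ) * ∑ r ∈ S, ψ r * e (n * r / M) := by
      push_cast
      rw [sum_congr rfl fun r _ => (hψ2 r).symm, sum_congr rfl fun r _ => mul_sum _ _ _, sum_comm]
      refine sum_congr rfl fun n _ => ?_
      rw [mul_sum]
      exact sum_congr rfl fun r _ => by ring
    calc B * S.card ≤ ∑ r ∈ S, ‖∑ n ∈ Ioc 0 N, (f n : ℂ) * e (n * r / M)‖ := by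
          rw [mul_comm, ← nsmul_eq_mul]
          exact card_nsmul_le_sum _ _ _ hS
      _ ≤ ‖((∑ r ∈ S, ‖∑ n ∈ Ioc 0 N, (f n : ℂ) * e (n * r / M)‖ : ℝ) : ℂ)‖ := by
          rw [Complex.norm_real]; exact Real.le_norm_self _
      _ ≤ ∑ n ∈ Ioc 0 N, f n * G n := by
          rw [h2]
          refine (norm_sum_le _ _).trans (sum_le_sum fun n _ => ?_)
          rw [norm_mul, Complex.norm_real, Real.norm_of_nonneg (hf n)]
  have h2 : (∑ n ∈ Ioc 0 N, f n * G n) ^ 2 ≤ (∑ n ∈ Ioc 0 N, f n) * ∑ n ∈ Ioc 0 N, f n * G n ^ 2 :=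
    sum_sq_le_sum_mul_sum_of_sq_le_mul _ (fun n _ => hf n)
      (fun n _ => mul_nonneg (hf n) (sq_nonneg _)) fun n _ => le_of_eq (by ring)
  have h3 : ∑ n ∈ Ioc 0 N, f n ≤ A * ∑ n ∈ Ioc 0 N, ν n := by
    rw [mul_sum]; exact sum_le_sum fun n _ => hfν n
  have h4 : ∑ n ∈ Ioc 0 N, f n * G n ^ 2 ≤ A * ∑ n ∈ Ioc 0 N, ν n * G n ^ 2 := by
    rw [mul_sum]
    refine sum_le_sum fun n _ => ?_
    rw [← mul_assoc]
    exact mul_le_mul_of_nonneg_right (hfν n) (sq_nonneg _)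
  have h5 : 0 ≤ ∑ n ∈ Ioc 0 N, f n * G n ^ 2 :=
    sum_nonneg fun n _ => mul_nonneg (hf n) (sq_nonneg _)
  have h6 : 0 ≤ ∑ n ∈ Ioc 0 N, f n := sum_nonneg fun n _ => hf n
  calc (B * S.card) ^ 2 ≤ (∑ n ∈ Ioc 0 N, f n * G n) ^ 2 := pow_le_pow_left₀ (by positivity) h1 2
    _ ≤ _ := h2
    _ ≤ (A * ∑ n ∈ Ioc 0 N, ν n) * (A * ∑ n ∈ Ioc 0 N, ν n * G n ^ 2) :=
        mul_le_mul h3 h4 h5 (h6.trans h3)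
    _ = _ := by ring

/-- The fourth moment bound for the low frequency part of the sieve weight. -/
lemma sum_lo_pow_four_le {C₁ : ℝ} (hC₁ : 1 ≤ C₁) : ∃ C : ℝ, 1 ≤ C ∧ ∀ (W Q N : ℕ) (lo : ℕ → ℝ),
    1 ≤ Q → Q ^ 4 ≤ N →
    (∀ m, |lo m| ≤ C₁ * (Q : ℝ) ^ (1 / 80 : ℝ) *
      ∑ q ∈ (Icc 1 Q).filter (fun q => q.Coprime W), (Nat.gcd q m : ℝ) / q) →
    ∑ n ∈ Ioc 0 N, |lo (W * n + 1)| ^ 4 ≤ C * (Q : ℝ) ^ (1 / 16 : ℝ) * N := by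
  obtain ⟨C, hC, h⟩ := exists_log_pow_rpow_le (2 * C₁ ^ 4) (by positivity)
  refine ⟨C, hC, fun W Q N lo hQ hQN hlo => ?_⟩
  have hlog := Real.log_natCast_nonneg Q
  have hq : 0 ≤ (Q : ℝ) ^ (1 / 80 : ℝ) := by positivity
  set q := (Q : ℝ) ^ (1 / 80 : ℝ)
  set l := Real.log Q
  have h1 : ∀ m, |lo m| ^ 4 ≤ (C₁ * q * (1 + l)) ^ 4 * (dvc W Q m : ℝ) ^ 4 := by
    intro m
    rw [← mul_pow]
    refine pow_le_pow_left₀ (abs_nonneg _) ((hlo m).trans ?_) 4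
    rw [mul_assoc _ (1 + l)]
    exact mul_le_mul_of_nonneg_left (sum_gcd_div_le W Q m) (by positivity)
  calc ∑ n ∈ Ioc 0 N, |lo (W * n + 1)| ^ 4
      ≤ ∑ n ∈ Ioc 0 N, (C₁ * q * (1 + l)) ^ 4 * (dvc W Q (W * n + 1) : ℝ) ^ 4 :=
        sum_le_sum fun n _ => h1 _
    _ ≤ (C₁ * q * (1 + l)) ^ 4 * (2 * N * (1 + 4 * l) ^ 16) := by
        rw [← mul_sum]
        exact mul_le_mul_of_nonneg_left (sum_dvc_pow_four_le hQN) (by positivity)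
    _ ≤ (C₁ * q * (1 + 4 * l)) ^ 4 * (2 * N * (1 + 4 * l) ^ 16) := by
        gcongr; linarith
    _ = 2 * C₁ ^ 4 * q ^ 4 * (1 + 4 * l) ^ 20 * N := by ring
    _ ≤ _ := mul_le_mul_of_nonneg_right (h Q hQ) (Nat.cast_nonneg _)

lemma card_bound_of_pow_four {t J L N C K : ℝ} (ht : 0 < t) (hJ0 : 0 ≤ J) (hN : 0 < N)
    (hCK : 1 ≤ C * K) (hmain : t ^ 8 * N * J ^ 2 ≤ 6400 * L)
    (hL4 : L ^ 4 ≤ C * (2 * K / t) * N * J ^ 2 * (3 * N * J) ^ 3) :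
    J * t ^ 11 ≤ 6400 ^ 4 * 27 * (2 * C * K) := by
  have hB : 1 ≤ 6400 ^ 4 * 27 * (2 * C * K) := by linarith
  rcases hJ0.eq_or_lt with h | h
  · rw [← h]; linarith
  have hJ3 : (J * t ^ 11) ^ 3 ≤ 6400 ^ 4 * 27 * (2 * C * K) := by
    have h1 : (t ^ 8 * N * J ^ 2) ^ 4 ≤ (6400 * L) ^ 4 := pow_le_pow_left₀ (by positivity) hmain 4
    have h2 : (t ^ 8 * N * J ^ 2) ^ 4 * t ≤
        6400 ^ 4 * (C * (2 * K) * N * J ^ 2 * (3 * N * J) ^ 3) := by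
      calc (t ^ 8 * N * J ^ 2) ^ 4 * t ≤ (6400 * L) ^ 4 * t := by gcongr
        _ = 6400 ^ 4 * L ^ 4 * t := by ring
        _ ≤ 6400 ^ 4 * (C * (2 * K / t) * N * J ^ 2 * (3 * N * J) ^ 3) * t := by gcongr
        _ = _ := by field_simp
    have h3 : (N : ℝ) ^ 4 * J ^ 5 * (J * t ^ 11) ^ 3 ≤
        N ^ 4 * J ^ 5 * (6400 ^ 4 * 27 * (2 * C * K)) := by
      calc (N : ℝ) ^ 4 * J ^ 5 * (J * t ^ 11) ^ 3 = (t ^ 8 * N * J ^ 2) ^ 4 * t := by ring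
        _ ≤ _ := h2
        _ = _ := by ring
    exact le_of_mul_le_mul_left h3 (by positivity)
  by_contra hcon
  push Not at hcon
  have h1 : (1:ℝ) ≤ J * t ^ 11 := hB.trans hcon.le
  have h2 : J * t ^ 11 ≤ (J * t ^ 11) ^ 3 := le_self_pow₀ h1 (by norm_num)
  linarith

set_option maxHeartbeats 1000000 in
/-- The size of the large spectrum of a function dominated by the weight `tw W N`. -/
theorem card_large_spectrum_le : ∃ C : ℝ, 1 ≤ C ∧ ∀ W : ℕ, 1 ≤ W → ∃ N₀ : ℕ, ∀ N : ℕ, N₀ ≤ N →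
    ∀ f : ℕ → ℝ, (∀ n, 0 ≤ f n) → (∀ n, f n ≤ tw W N n) →
    ∀ t : ℝ, 0 < t → t ≤ 1 → 1 ≤ t ^ 80 * N →
    (((range (2 * N + 1)).filter (fun r : ℕ => t ^ 4 * N ≤
      ‖∑ n ∈ Ioc 0 N, (f n : ℂ) * e (n * r / (2 * N + 1 : ℕ))‖)).card : ℝ) * t ^ 11 ≤ C := by
  obtain ⟨C₀, hC₀, hsum⟩ := sum_nu_le_and_fourier
  obtain ⟨C₁, hC₁, hsplit⟩ := nu_split (ε := 1 / 80) (by norm_num)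
  obtain ⟨C₂, hC₂, hfour⟩ := sum_lo_pow_four_le hC₁
  set K : ℝ := (12800 * C₁) ^ 2 with hK
  have hK1 : 1 ≤ K := one_le_pow₀ (by linarith)
  have hCK : 1 ≤ C₂ * K := one_le_mul_of_one_le_of_one_le hC₂ hK1
  refine ⟨6400 ^ 4 * 27 * (2 * C₂ * K), by linarith, fun W hW => ?_⟩
  refine ⟨max (W + 1) (max ⌈(12800 * (C₀ + C₁)) ^ 10⌉₊ ⌈(16 * K ^ 4) ^ 5⌉₊), fun N hN f hf hftw t ht ht1 htN => ?_⟩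
  have hNW : W + 1 ≤ N := (le_max_left _ _).trans hN
  have hN1 : (12800 * (C₀ + C₁)) ^ 10 ≤ N := (Nat.le_ceil _).trans
    (by exact_mod_cast ((le_max_left _ _).trans (le_max_right _ _)).trans hN)
  have hN2 : (16 * K ^ 4) ^ 5 ≤ (N : ℝ) := (Nat.le_ceil _).trans
    (by exact_mod_cast ((le_max_right _ _).trans (le_max_right _ _)).trans hN)
  clear hN
  obtain ⟨R, hR1, hRN, hNR⟩ := exists_pow_le_lt (S := 20) (N := N) (R₀ := 1) (by norm_num)
    (by omega)
  have hfam := famW_sieveFamily (W := W) hR1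
  have hmaj := fun n => (hftw n).trans (tw_le_nu hW hNW hR1 hRN hNR n)
  have hR20 : (R : ℝ) ^ 20 ≤ N := by
    have := (Nat.cast_le (α := ℝ)).2 hRN
    rwa [Nat.cast_pow] at this
  clear hRN hNR
  have hNpos : (1 : ℝ) ≤ N := by exact_mod_cast (show 1 ≤ N by omega)
  -- the error terms from the level of the sieve
  have hR8 : 12800 * (C₀ + C₁) * R ^ 8 ≤ t ^ 8 * N := by
    refine le_of_pow_le_pow_left₀ (n := 10) (by norm_num) (by positivity) ?_
    calc (12800 * (C₀ + C₁) * R ^ 8) ^ 10 = (12800 * (C₀ + C₁)) ^ 10 * ((R : ℝ) ^ 20) ^ 4 := by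
          rw [mul_pow, ← pow_mul, ← pow_mul]
      _ ≤ N * (N : ℝ) ^ 4 := by gcongr
      _ = N ^ 5 := by ring
      _ ≤ (N : ℝ) ^ 9 := pow_le_pow_right₀ hNpos (by norm_num)
      _ ≤ (t ^ 80 * N) * (N : ℝ) ^ 9 := le_mul_of_one_le_left (by positivity) htN
      _ = (t ^ 8 * N) ^ 10 := by ring
  have ht8 : t ^ 8 * N ≤ N := mul_le_of_le_one_left (by positivity) (pow_le_one₀ ht.le ht1)
  set Q : ℕ := ⌈K / t ^ 16⌉₊ with hQ
  have hKt : 1 ≤ K / t ^ 16 := by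
    rw [le_div_iff₀ (by positivity), one_mul]
    exact (pow_le_one₀ ht.le ht1).trans hK1
  have hQlo : K / t ^ 16 ≤ Q := Nat.le_ceil _
  have hQhi : (Q : ℝ) ≤ 2 * (K / t ^ 16) := by
    have := Nat.ceil_lt_add_one (a := K / t ^ 16) (by linarith)
    linarith
  have hQ1 : (1:ℝ) ≤ Q := hKt.trans hQlo
  clear_value Q
  have hQ1' : 1 ≤ Q := by exact_mod_cast hQ1
  have hQ4 : Q ^ 4 ≤ N := by
    have h1 : 16 * K ^ 4 ≤ t ^ 64 * N := by
      refine le_of_pow_le_pow_left₀ (n := 5) (by norm_num) (by positivity) ?_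
      calc (16 * K ^ 4) ^ 5 ≤ N := hN2
        _ ≤ (t ^ 80 * N) ^ 4 * N := le_mul_of_one_le_left (by positivity) (one_le_pow₀ htN)
        _ = (t ^ 64 * N) ^ 5 := by ring
    have h2 : (Q : ℝ) ^ 4 ≤ N := by
      calc (Q : ℝ) ^ 4 ≤ (2 * (K / t ^ 16)) ^ 4 := pow_le_pow_left₀ (by positivity) hQhi 4
        _ = 16 * K ^ 4 / t ^ 64 := by rw [mul_pow, div_pow, ← pow_mul]; ring
        _ ≤ N := by rw [div_le_iff₀ (by positivity)]; linarith
    exact_mod_cast h2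
  have hQrpow : (Q : ℝ) ^ (1 / 16 : ℝ) ≤ 2 * K / t := by
    calc (Q : ℝ) ^ (1 / 16 : ℝ) ≤ ((2 * K / t) ^ 16) ^ (1 / 16 : ℝ) := by
          refine Real.rpow_le_rpow (by positivity) (hQhi.trans ?_) (by norm_num)
          rw [div_pow, ← mul_div_assoc]
          gcongr
          exact le_self_pow₀ (by linarith) (by norm_num)
      _ = 2 * K / t := by
          rw [one_div]
          exact_mod_cast Real.pow_rpow_inv_natCast (n := 16) (by positivity) (by norm_num)
  have hQsqrt : C₁ / Real.sqrt Q * 12800 ≤ t ^ 8 := by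
    have h1 : 12800 * C₁ / t ^ 8 ≤ Real.sqrt Q := by
      refine Real.le_sqrt_of_sq_le ?_
      rw [div_pow, ← pow_mul]; exact hQlo
    have h2 : 0 < Real.sqrt Q := Real.sqrt_pos.2 (by linarith)
    rw [div_mul_eq_mul_div, div_le_iff₀ h2]
    rw [div_le_iff₀ (by positivity)] at h1
    linarith
  obtain ⟨lo, hi, hlohi, hlo, hhi⟩ := hsplit hfam hR1 Q hQ1'
  have hfour' := hfour W Q N lo hQ1' hQ4 hlo
  have hnusum := (hsum hfam hR1 1 0 N).1
  clear hfour hlo hsplit hsum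
  set M := 2 * N + 1 with hM
  set S := (range M).filter (fun r : ℕ => t ^ 4 * N ≤ ‖∑ n ∈ Ioc 0 N, (f n : ℂ) * e (n * r / (M : ℕ))‖)
    with hS
  obtain ⟨ψ, hψ, hdual⟩ := card_mul_sq_le_of_le_norm (M := M) (S := S) (A := 40) (B := t ^ 4 * N)
    (by positivity) hf hmaj (fun r hr => (mem_filter.1 hr).2)
  set J : ℝ := (S.card : ℝ) with hJ
  set G : ℕ → ℝ := fun n => ‖∑ r ∈ S, ψ r * e (n * r / M)‖ with hG
  have hJ0 : 0 ≤ J := Nat.cast_nonneg _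
  have hG0 : ∀ n, 0 ≤ G n := fun n => norm_nonneg _
  have hGJ : ∀ n, |G n| ≤ J := fun n => by
    rw [abs_of_nonneg (hG0 n)]
    refine (norm_sum_le _ _).trans ?_
    calc _ ≤ ∑ r ∈ S, (1:ℝ) := sum_le_sum fun r _ => by rw [norm_mul, norm_e, mul_one]; exact hψ r
      _ = J := by simp [hJ]
  have hG2 : ∑ n ∈ Ioc 0 N, G n ^ 2 ≤ 3 * N * J := by
    calc ∑ n ∈ Ioc 0 N, G n ^ 2 ≤ ∑ n ∈ range M, G n ^ 2 := by
          refine sum_le_sum_of_subset_of_nonneg ?_ fun _ _ _ => sq_nonneg _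
          intro n hn
          rw [mem_Ioc] at hn; rw [mem_range]; omega
      _ = M * ∑ r ∈ S, ‖ψ r‖ ^ 2 := parseval (by omega) ψ fun n hn n' hn' =>
          natCast_sub_dvd (mem_range.1 (mem_filter.1 hn).1) (mem_range.1 (mem_filter.1 hn').1)
      _ ≤ M * J := by
          refine mul_le_mul_of_nonneg_left ?_ (Nat.cast_nonneg _)
          calc _ ≤ ∑ r ∈ S, (1:ℝ) := sum_le_sum fun r _ => pow_le_one₀ (norm_nonneg _) (hψ r)
            _ = J := by simp [hJ]
      _ ≤ 3 * N * J := by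
          refine mul_le_mul_of_nonneg_right ?_ hJ0
          rw [hM]; push_cast; linarith
  have hhi2 := sum_mul_norm_sq_le (M := M) (S := S) (h := fun n => hi (W * n + 1)) hψ
    (fun θ => hhi 1 0 N θ)
  have hsplit2 : ∑ n ∈ Ioc 0 N, nu (famW W R) (W * n + 1) * G n ^ 2
      = ∑ n ∈ Ioc 0 N, lo (W * n + 1) * G n ^ 2 + ∑ n ∈ Ioc 0 N, hi (W * n + 1) * G n ^ 2 := by
    rw [← sum_add_distrib]
    exact sum_congr rfl fun n _ => by rw [hlohi]; ring
  have hlo2 : ∑ n ∈ Ioc 0 N, lo (W * n + 1) * G n ^ 2 ≤ ∑ n ∈ Ioc 0 N, |lo (W * n + 1)| * G n ^ 2 :=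
    sum_le_sum fun n _ => mul_le_mul_of_nonneg_right (le_abs_self _) (sq_nonneg _)
  have hnu0 : ∀ n, 0 ≤ nu (famW W R) (W * n + 1) := fun n => hfam.nu_nonneg _
  set L := ∑ n ∈ Ioc 0 N, |lo (W * n + 1)| * G n ^ 2 with hL
  have hL0 : 0 ≤ L := sum_nonneg fun n _ => mul_nonneg (abs_nonneg _) (sq_nonneg _)
  have hL4 : L ^ 4 ≤ C₂ * (2 * K / t) * N * J ^ 2 * (3 * N * J) ^ 3 := by
    refine (sum_mul_sq_pow_four_le (J := J) (Ioc 0 N) fun n _ => hGJ n).trans ?_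
    have h0 : 0 ≤ ∑ n ∈ Ioc 0 N, G n ^ 2 := sum_nonneg fun n _ => sq_nonneg _
    gcongr
    refine hfour'.trans ?_
    gcongr
  have hH : ∑ n ∈ Ioc 0 N, hi (W * n + 1) * G n ^ 2 ≤ J ^ 2 * (t ^ 8 * N / 6400) := by
    refine hhi2.trans (mul_le_mul_of_nonneg_left ?_ (by positivity))
    rw [Nat.sub_zero]
    have h1 := mul_le_mul_of_nonneg_right hQsqrt (Nat.cast_nonneg (α := ℝ) N)
    have h2 : 0 ≤ C₀ * (R : ℝ) ^ 8 := by positivity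
    have h3 : C₁ / Real.sqrt Q * N = C₁ / Real.sqrt Q * 12800 * N / 12800 := by ring
    rw [h3]; linarith
  have hν : ∑ n ∈ Ioc 0 N, nu (famW W R) (W * n + 1) ≤ 2 * N := by
    refine hnusum.trans ?_
    have h2 : 0 ≤ C₁ * (R : ℝ) ^ 8 := by positivity
    have h3 : 0 ≤ C₀ * (R : ℝ) ^ 8 := by positivity
    rw [Nat.sub_zero]; linarith
  have hmain : t ^ 8 * N * J ^ 2 ≤ 6400 * L := by
    have h1 : (t ^ 4 * N * J) ^ 2 ≤ 40 ^ 2 * (2 * N) * (L + J ^ 2 * (t ^ 8 * N / 6400)) := by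
      refine hdual.trans ?_
      have h0 : 0 ≤ ∑ n ∈ Ioc 0 N, nu (famW W R) (W * n + 1) * G n ^ 2 :=
        sum_nonneg fun n _ => mul_nonneg (hnu0 n) (sq_nonneg _)
      refine mul_le_mul (mul_le_mul_of_nonneg_left hν (by norm_num)) ?_ h0 (by positivity)
      rw [hsplit2]; linarith
    have h2 : (N : ℝ) * (t ^ 8 * N * J ^ 2) ≤ N * (6400 * L) := by nlinarith
    exact le_of_mul_le_mul_left h2 (by linarith)
  exact card_bound_of_pow_four ht hJ0 (by linarith) hCK hmain hL4

/-- Dyadic summation of the cubes of a function with few large values. -/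
lemma sum_cube_le_of_card_le {ι : Type*} {s : Finset ι} {F : ι → ℝ} {C X η : ℝ} (hC : 0 ≤ C)
    (hX : 0 ≤ X) (hη : 0 < η) (hF : ∀ i, 0 ≤ F i)
    (hcard : ∀ t, η ≤ t → t ≤ 1 → ((s.filter (fun i => t ^ 4 * X ≤ F i)).card : ℝ) * t ^ 11 ≤ C)
    (n : ℕ) {t : ℝ} (ht0 : 0 < t) (ht1 : t ≤ 1) (ht : t ≤ 2 ^ n * η) :
    ∑ i ∈ s.filter (fun i => η ^ 4 * X ≤ F i ∧ F i < t ^ 4 * X), F i ^ 3 ≤ 2 ^ 12 * C * t * X ^ 3 := by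
  have hempty : ∀ t, 0 < t → t ≤ η →
      s.filter (fun i => η ^ 4 * X ≤ F i ∧ F i < t ^ 4 * X) = ∅ := by
    intro t ht h
    refine filter_false_of_mem fun i _ hi => ?_
    have : t ^ 4 * X ≤ η ^ 4 * X := by gcongr
    linarith [hi.1, hi.2]
  induction n generalizing t with
  | zero =>
    rw [hempty t ht0 (by simpa using ht), sum_empty]; positivity
  | succ n ih =>
    rcases le_or_gt t η with h | h
    · rw [hempty t ht0 h, sum_empty]; positivity
    set u := max (t / 2) η with hu
    have hu0 : 0 < u := lt_of_lt_of_le hη (le_max_right _ _)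
    have hut : u ≤ t := max_le (by linarith) h.le
    have htu : t / 2 ≤ u := le_max_left _ _
    have h1 : ∑ i ∈ s.filter (fun i => η ^ 4 * X ≤ F i ∧ F i < u ^ 4 * X), F i ^ 3
        ≤ 2 ^ 12 * C * (t / 2) * X ^ 3 := by
      rcases le_or_gt (t / 2) η with h2 | h2
      · rw [hempty u hu0 (max_le h2 le_rfl), sum_empty]; positivity
      · have : u = t / 2 := max_eq_left h2.le
        rw [this]
        exact ih (by linarith) (by linarith) (by rw [pow_succ] at ht; linarith)
    have h2 : ∑ i ∈ s.filter (fun i => u ^ 4 * X ≤ F i ∧ F i < t ^ 4 * X), F i ^ 3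
        ≤ 2 ^ 11 * C * t * X ^ 3 := by
      have h3 := hcard u (le_max_right _ _) (hut.trans ht1)
      set k : ℝ := ((s.filter (fun i => u ^ 4 * X ≤ F i)).card : ℝ) with hk
      have hk0 : 0 ≤ k := Nat.cast_nonneg _
      calc ∑ i ∈ s.filter (fun i => u ^ 4 * X ≤ F i ∧ F i < t ^ 4 * X), F i ^ 3
          ≤ ∑ i ∈ s.filter (fun i => u ^ 4 * X ≤ F i ∧ F i < t ^ 4 * X), (t ^ 4 * X) ^ 3 :=
            sum_le_sum fun i hi => pow_le_pow_left₀ (hF i) (mem_filter.1 hi).2.2.le 3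
        _ ≤ k * (t ^ 4 * X) ^ 3 := by
            rw [sum_const, nsmul_eq_mul]
            refine mul_le_mul_of_nonneg_right ?_ (by positivity)
            rw [hk, Nat.cast_le]
            refine card_le_card fun i hi => ?_
            exact mem_filter.2 ⟨(mem_filter.1 hi).1, (mem_filter.1 hi).2.1⟩
        _ = k * (t / 2) ^ 11 * (2 ^ 11 * t * X ^ 3) := by ring
        _ ≤ k * u ^ 11 * (2 ^ 11 * t * X ^ 3) := by gcongr
        _ ≤ C * (2 ^ 11 * t * X ^ 3) := by gcongr
        _ = _ := by ring
    calc ∑ i ∈ s.filter (fun i => η ^ 4 * X ≤ F i ∧ F i < t ^ 4 * X), F i ^ 3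
        ≤ ∑ i ∈ s.filter (fun i => η ^ 4 * X ≤ F i ∧ F i < u ^ 4 * X), F i ^ 3
          + ∑ i ∈ s.filter (fun i => u ^ 4 * X ≤ F i ∧ F i < t ^ 4 * X), F i ^ 3 := by
          rw [sum_filter, sum_filter, sum_filter, ← sum_add_distrib]
          refine sum_le_sum fun i _ => ?_
          have h4 : 0 ≤ F i ^ 3 := pow_nonneg (hF i) 3
          by_cases h5 : F i < u ^ 4 * X
          · split_ifs <;> first | linarith | (exfalso; tauto)
          · push Not at h5
            split_ifs <;> first | linarith | (exfalso; tauto)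
      _ ≤ _ := by linarith

/-- The restriction theorem for functions dominated by the weight `tw W N`: few large Fourier
coefficients, and small `ℓ³`-norm of the others, uniformly in `W`. -/
theorem restriction {τ : ℝ} (hτ : 0 < τ) : ∃ δ : ℝ, 0 < δ ∧ ∃ J : ℕ, ∀ W : ℕ, 1 ≤ W → ∃ N₀ : ℕ,
    ∀ N : ℕ, N₀ ≤ N → ∀ f : ℕ → ℝ, (∀ n, 0 ≤ f n) → (∀ n, f n ≤ tw W N n) →
    ((range (2 * N + 1)).filter (fun r : ℕ => δ * N ≤
      ‖∑ n ∈ Ioc 0 N, (f n : ℂ) * e (n * r / (2 * N + 1 : ℕ))‖)).card ≤ J ∧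
    ∑ r ∈ (range (2 * N + 1)).filter (fun r : ℕ =>
      ‖∑ n ∈ Ioc 0 N, (f n : ℂ) * e (n * r / (2 * N + 1 : ℕ))‖ < δ * N),
      ‖∑ n ∈ Ioc 0 N, (f n : ℂ) * e (n * r / (2 * N + 1 : ℕ))‖ ^ 3 ≤ τ * N ^ 3 := by
  obtain ⟨C, hC, hlarge⟩ := card_large_spectrum_le
  set t : ℝ := min 1 (τ / (2 ^ 13 * C)) with ht
  have ht0 : 0 < t := by positivity
  have ht1 : t ≤ 1 := min_le_left _ _
  have htτ : 2 ^ 12 * C * t ≤ τ / 2 := by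
    have : t ≤ τ / (2 ^ 13 * C) := min_le_right _ _
    rw [le_div_iff₀ (by positivity)] at this
    linarith
  clear_value t
  refine ⟨t ^ 4, by positivity, ⌊C / t ^ 11⌋₊, fun W hW => ?_⟩
  obtain ⟨N₁, hN₁⟩ := hlarge W hW
  obtain ⟨N₂, hN₂⟩ := eventually_log_pow_le W 2 (s := 1 / 20) (ε := τ / 6) (by norm_num)
    (by positivity)
  refine ⟨max (max N₁ N₂) (max 1 ⌈1 / t ^ 80⌉₊), fun N hN f hf hftw => ?_⟩
  have hNN₁ : N₁ ≤ N := ((le_max_left _ _).trans (le_max_left _ _)).trans hN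
  have hNN₂ : N₂ ≤ N := ((le_max_right _ _).trans (le_max_left _ _)).trans hN
  have hN1 : 1 ≤ N := ((le_max_left _ _).trans (le_max_right _ _)).trans hN
  have hNt : 1 / t ^ 80 ≤ N := (Nat.le_ceil _).trans
    (by exact_mod_cast ((le_max_right _ _).trans (le_max_right _ _)).trans hN)
  have hN1' : (1:ℝ) ≤ N := by exact_mod_cast hN1
  have hN0 : (0:ℝ) < N := by linarith
  set F : ℕ → ℝ := fun r => ‖∑ n ∈ Ioc 0 N, (f n : ℂ) * e (n * r / (2 * N + 1 : ℕ))‖ with hF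
  have hF0 : ∀ r, 0 ≤ F r := fun r => norm_nonneg _
  have hcard : ∀ u : ℝ, 0 < u → u ≤ 1 → 1 ≤ u ^ 80 * N →
      (((range (2 * N + 1)).filter (fun r => u ^ 4 * N ≤ F r)).card : ℝ) * u ^ 11 ≤ C :=
    fun u => hN₁ N hNN₁ f hf hftw u
  have htN : 1 ≤ t ^ 80 * N := by
    rw [div_le_iff₀ (by positivity)] at hNt; linarith
  refine ⟨?_, ?_⟩
  · refine Nat.le_floor ?_
    rw [le_div_iff₀ (by positivity)]
    exact hcard t ht0 ht1 htN
  set η : ℝ := (N : ℝ) ^ (-(1 / 80) : ℝ) with hη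
  have hη0 : 0 < η := by positivity
  have hη80 : η ^ 80 * N = 1 := by
    rw [hη, ← Real.rpow_mul_natCast hN0.le]
    norm_num
    rw [Real.rpow_neg_one, inv_mul_cancel₀ hN0.ne']
  have hη4 : η ^ 4 * (N : ℝ) ^ (1 / 20 : ℝ) = 1 := by
    rw [hη, ← Real.rpow_mul_natCast hN0.le, ← Real.rpow_add hN0]
    norm_num
  clear_value η
  obtain ⟨n, hn⟩ := pow_unbounded_of_one_lt (t / η) (one_lt_two (α := ℝ))
  have hdy := sum_cube_le_of_card_le (s := range (2 * N + 1)) (F := F) (C := C) (X := N) (by linarith)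
    hN0.le hη0 hF0 (fun u hu hu1 => hcard u (hη0.trans_le hu) hu1 (by rw [← hη80]; gcongr)) n
    ht0 ht1 (by rw [div_lt_iff₀ hη0] at hn; exact hn.le)
  have hpars : ∑ r ∈ range (2 * N + 1), F r ^ 2 ≤
      3 * N * (N * Real.log (W * N + 1 : ℕ) ^ 2) := by
    have h1 : ∑ r ∈ range (2 * N + 1), F r ^ 2
        = (2 * N + 1 : ℕ) * ∑ n ∈ Ioc 0 N, ‖(f n : ℂ)‖ ^ 2 := by
      rw [← parseval (by omega) (fun n => (f n : ℂ)) fun n hn n' hn' => natCast_sub_dvd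
        (by have := (mem_Ioc.1 hn).2; omega) (by have := (mem_Ioc.1 hn').2; omega)]
      simp only [hF, mul_comm]
    rw [h1]
    refine mul_le_mul (by push_cast; linarith) ?_ (sum_nonneg fun n _ => by positivity)
      (by positivity)
    calc ∑ n ∈ Ioc 0 N, ‖(f n : ℂ)‖ ^ 2 ≤ ∑ n ∈ Ioc 0 N, Real.log (W * N + 1 : ℕ) ^ 2 := by
          refine sum_le_sum fun n _ => ?_
          rw [Complex.norm_real, Real.norm_of_nonneg (hf n)]
          exact pow_le_pow_left₀ (hf n) ((hftw n).trans (tw_le_log W N n)) 2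
      _ = _ := by simp
  have hsmall : ∑ r ∈ (range (2 * N + 1)).filter (fun r => F r < η ^ 4 * N), F r ^ 3
      ≤ τ / 2 * N ^ 3 := by
    calc ∑ r ∈ (range (2 * N + 1)).filter (fun r => F r < η ^ 4 * N), F r ^ 3
        ≤ ∑ r ∈ (range (2 * N + 1)).filter (fun r => F r < η ^ 4 * N), η ^ 4 * N * F r ^ 2 := by
          refine sum_le_sum fun r hr => ?_
          rw [pow_succ' (F r) 2]
          exact mul_le_mul_of_nonneg_right (mem_filter.1 hr).2.le (sq_nonneg _)
      _ ≤ ∑ r ∈ range (2 * N + 1), η ^ 4 * N * F r ^ 2 :=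
          sum_le_sum_of_subset_of_nonneg (filter_subset _ _) fun _ _ _ => by positivity
      _ ≤ η ^ 4 * N * (3 * N * (N * (τ / 6 * (N : ℝ) ^ (1 / 20 : ℝ)))) := by
          rw [← mul_sum]
          refine mul_le_mul_of_nonneg_left (hpars.trans ?_) (by positivity)
          have := hN₂ N hNN₂
          gcongr
      _ = (η ^ 4 * (N : ℝ) ^ (1 / 20 : ℝ)) * (τ / 2 * N ^ 3) := by ring
      _ = _ := by rw [hη4, one_mul]
  calc ∑ r ∈ (range (2 * N + 1)).filter (fun r => F r < t ^ 4 * N), F r ^ 3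
      ≤ ∑ r ∈ (range (2 * N + 1)).filter (fun r => η ^ 4 * N ≤ F r ∧ F r < t ^ 4 * N), F r ^ 3
        + ∑ r ∈ (range (2 * N + 1)).filter (fun r => F r < η ^ 4 * N), F r ^ 3 := by
        rw [sum_filter, sum_filter, sum_filter, ← sum_add_distrib]
        refine sum_le_sum fun i _ => ?_
        have h4 : 0 ≤ F i ^ 3 := pow_nonneg (hF0 i) 3
        by_cases h5 : F i < η ^ 4 * N
        · split_ifs <;> linarith
        · push Not at h5
          split_ifs <;> first | linarith | (exfalso; tauto)
    _ ≤ 2 ^ 12 * C * t * N ^ 3 + τ / 2 * N ^ 3 := add_le_add hdy hsmall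
    _ ≤ τ / 2 * N ^ 3 + τ / 2 * N ^ 3 := by gcongr
    _ = τ * N ^ 3 := by ring

/-- Ramsey's theorem for triangles, in an ordered form. -/
lemma exists_mono_triangle_of_card {ι : Type*} [DecidableEq ι] (k : ℕ) : ∃ n : ℕ, ∀ C : Finset ι,
    C.card ≤ k → ∀ S : Finset ℕ, n ≤ S.card → ∀ c : ℕ → ℕ → ι,
    (∀ i ∈ S, ∀ j ∈ S, i < j → c i j ∈ C) →
    ∃ i ∈ S, ∃ j ∈ S, ∃ l ∈ S, i < j ∧ j < l ∧ c i j = c j l ∧ c i j = c i l := by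
  induction k with
  | zero =>
    refine ⟨2, fun C hC S hS c hc => ?_⟩
    obtain ⟨i, hi, j, hj, hij⟩ := one_lt_card.1 (by omega : 1 < S.card)
    have hC0 : C = ∅ := by simpa using hC
    subst hC0
    rcases lt_or_gt_of_ne hij with h | h
    · simpa using hc i hi j hj h
    · simpa using hc j hj i hi h
  | succ k ih =>
    obtain ⟨n, hn⟩ := ih
    refine ⟨(k + 1) * n + 2, fun C hC S hS c hc => ?_⟩
    have hne : S.Nonempty := card_pos.1 (by omega)
    set v := S.min' hne with hv
    have hvS : v ∈ S := min'_mem _ _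
    have hlt : ∀ j ∈ S.erase v, v < j := fun j hj =>
      lt_of_le_of_ne (min'_le _ _ (mem_of_mem_erase hj)) (ne_of_mem_erase hj).symm
    obtain ⟨a, ha, hacard⟩ := exists_lt_card_fiber_of_mul_lt_card_of_maps_to
      (s := S.erase v) (t := C) (f := fun j => c v j) (n := n)
      (fun j hj => hc v hvS j (mem_of_mem_erase hj) (hlt j hj))
      (by
        rw [card_erase_of_mem hvS]
        have := Nat.mul_le_mul_right n hC
        omega)
    set A := (S.erase v).filter (fun j => c v j = a) with hA
    have hAS : ∀ j ∈ A, j ∈ S := fun j hj => mem_of_mem_erase (mem_filter.1 hj).1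
    by_cases h : ∃ i ∈ A, ∃ j ∈ A, i < j ∧ c i j = a
    · obtain ⟨i, hi, j, hj, hij, hcij⟩ := h
      have hi' := mem_filter.1 hi
      have hj' := mem_filter.1 hj
      exact ⟨v, hvS, i, hAS i hi, j, hAS j hj, hlt i hi'.1, hij, by rw [hi'.2, hcij],
        by rw [hi'.2, hj'.2]⟩
    · push Not at h
      obtain ⟨i, hi, j, hj, l, hl, hr⟩ := hn (C.erase a) (by rw [card_erase_of_mem ha]; omega) A
        hacard.le c fun i hi j hj hij =>
          mem_erase.2 ⟨h i hi j hj hij, hc i (hAS i hi) j (hAS j hj) hij⟩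
      exact ⟨i, hAS i hi, j, hAS j hj, l, hAS l hl, hr⟩

/-- Supersaturated Schur theorem: a finite coloring has many monochromatic solutions of
`x + y = z` away from zero. -/
lemma exists_many_mono (k : ℕ) : ∃ n : ℕ, 1 ≤ n ∧ ∀ (P : ℕ) (d : ℕ → Fin k),
    P ^ 2 ≤ n ^ 3 * ((Icc P (3 * n ^ 2 * P) ×ˢ Icc P (3 * n ^ 2 * P)).filter
      (fun x => x.1 + x.2 ≤ 3 * n ^ 2 * P ∧ d x.1 = d x.2 ∧ d x.1 = d (x.1 + x.2))).card := by
  classical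
  obtain ⟨n, hn⟩ := exists_mono_triangle_of_card (ι := Fin k) k
  refine ⟨n + 1, by omega, fun P d => ?_⟩
  set X := 3 * (n + 1) ^ 2 * P with hX
  set T := (Icc P X ×ˢ Icc P X).filter
      (fun x => x.1 + x.2 ≤ X ∧ d x.1 = d x.2 ∧ d x.1 = d (x.1 + x.2)) with hT
  -- the differences of the points `j p + j² q`
  set D : ℕ → ℕ → ℕ × ℕ → ℕ := fun i j z => (j - i) * (z.1 + (j + i) * z.2) with hD
  have htri : ∀ z : ℕ × ℕ, ∃ w : ℕ × ℕ × ℕ, w.1 < w.2.1 ∧ w.2.1 < w.2.2 ∧ w.2.2 < n + 1 ∧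
      d (D w.1 w.2.1 z) = d (D w.2.1 w.2.2 z) ∧ d (D w.1 w.2.1 z) = d (D w.1 w.2.2 z) := by
    intro z
    obtain ⟨i, -, j, -, l, hl, hij, hjl, h1, h2⟩ := hn univ (by simp) (range (n + 1)) (by simp)
      (fun i j => d (D i j z)) fun _ _ _ _ _ => mem_univ _
    exact ⟨(i, j, l), hij, hjl, mem_range.1 hl, h1, h2⟩
  choose w hw1 hw2 hw3 hw4 hw5 using htri
  have hadd : ∀ i j l z, i < j → j < l → D i j z + D j l z = D i l z := by
    intro i j l z hij hjl
    obtain ⟨a, rfl⟩ := Nat.exists_eq_add_of_lt hij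
    obtain ⟨b, rfl⟩ := Nat.exists_eq_add_of_lt hjl
    simp only [hD]
    rw [show i + a + 1 - i = a + 1 by omega, show i + a + 1 + b + 1 - (i + a + 1) = b + 1 by omega,
      show i + a + 1 + b + 1 - i = a + b + 2 by omega]
    ring
  have hlow : ∀ i j z, i < j → P < z.1 → P ≤ D i j z := by
    intro i j z hij hz
    have h1 : 1 ≤ j - i := by omega
    calc P ≤ 1 * (z.1 + 0) := by omega
      _ ≤ D i j z := Nat.mul_le_mul h1 (by omega)
  have hup : ∀ i j z, i < j → j < n + 1 → z.1 ≤ 2 * P → z.2 ≤ P → D i j z ≤ X := by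
    intro i j z hij hj hz1 hz2
    have h1 : j - i ≤ j := Nat.sub_le _ _
    calc D i j z ≤ (n + 1) * (2 * P + (2 * n) * P) := by
          refine Nat.mul_le_mul (by omega) (Nat.add_le_add hz1 (Nat.mul_le_mul (by omega) hz2))
      _ = 2 * (n + 1) ^ 2 * P := by ring
      _ ≤ X := by rw [hX]; gcongr; norm_num
  set Z := Ioc P (2 * P) ×ˢ Ioc 0 P with hZ
  set U := range (n + 1) ×ˢ range (n + 1) ×ˢ range (n + 1) with hU
  have hinj : Set.InjOn (fun z => (w z, (D (w z).1 (w z).2.1 z, D (w z).2.1 (w z).2.2 z))) Z := by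
    intro z _ z' _ h
    simp only [Prod.mk.injEq] at h
    obtain ⟨h0, h1, h2⟩ := h
    rw [← h0] at h1 h2
    have hij := hw1 z
    have hjl := hw2 z
    simp only [hD] at h1 h2
    have h3 := Nat.eq_of_mul_eq_mul_left (by omega) h1
    have h4 := Nat.eq_of_mul_eq_mul_left (by omega) h2
    obtain ⟨a, ha⟩ := Nat.exists_eq_add_of_lt (hij.trans hjl)
    have h5 : ((w z).2.2 - (w z).1) * z.2 = ((w z).2.2 - (w z).1) * z'.2 := by
      rw [ha, show (w z).1 + a + 1 - (w z).1 = a + 1 by omega]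
      rw [ha] at h4
      nlinarith
    have h6 := Nat.eq_of_mul_eq_mul_left (by omega) h5
    rw [h6] at h3
    exact Prod.ext (by omega) h6
  have hmaps : ∀ z ∈ Z, (w z, (D (w z).1 (w z).2.1 z, D (w z).2.1 (w z).2.2 z)) ∈ U ×ˢ T := by
    intro z hz
    simp only [hZ, mem_product, mem_Ioc] at hz
    have h1 := hw1 z
    have h2 := hw2 z
    have h3 := hw3 z
    have hs := hadd _ _ _ z h1 h2
    have hX' := hup _ _ z (h1.trans h2) h3 hz.1.2 hz.2.2
    refine mem_product.2 ⟨?_, mem_filter.2 ⟨mem_product.2 ⟨mem_Icc.2 ⟨hlow _ _ z h1 hz.1.1, ?_⟩,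
      mem_Icc.2 ⟨hlow _ _ z h2 hz.1.1, ?_⟩⟩, ?_, hw4 z, ?_⟩⟩
    · simp only [hU, mem_product, mem_range]; omega
    · dsimp only; omega
    · dsimp only; omega
    · dsimp only; omega
    · dsimp only; rw [hs]; exact hw5 z
  have h := card_le_card_of_injOn _ hmaps hinj
  rw [hZ, hU] at h
  simp only [card_product, Nat.card_Ioc, card_range] at h
  calc P ^ 2 = (2 * P - P) * (P - 0) := by rw [show 2 * P - P = P by omega, Nat.sub_zero, sq]
    _ ≤ _ := h
    _ = _ := by ring

section ZModFourier

variable {M : ℕ} [NeZero M]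

/-- The standard character of `ZMod M`. -/
noncomputable def chi (x : ZMod M) : ℂ := ZMod.stdAddChar x

lemma chi_add (x y : ZMod M) : chi (x + y) = chi x * chi y := by
  simp [chi, AddChar.map_add_eq_mul]

@[simp] lemma norm_chi (x : ZMod M) : ‖chi x‖ = 1 := by
  simp [chi]

lemma chi_neg (x : ZMod M) : chi (-x) = starRingEnd ℂ (chi x) := by
  simp [chi, AddChar.map_neg_eq_conj]

lemma chi_natCast (j : ℕ) : chi (j : ZMod M) = e (j / M) := by
  have h := ZMod.stdAddChar_coe (N := M) (j : ℤ)
  rw [Int.cast_natCast] at h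
  rw [chi, h, e]
  congr 1
  push_cast
  ring

lemma sum_chi (x : ZMod M) : ∑ r : ZMod M, chi (r * x) = if x = 0 then (M : ℂ) else 0 := by
  have h := AddChar.sum_mulShift (R' := ℂ) x (ZMod.isPrimitive_stdAddChar M)
  rw [ZMod.card] at h
  exact_mod_cast h

/-- The Fourier transform on `ZMod M`. -/
noncomputable def ft (f : ZMod M → ℝ) (r : ZMod M) : ℂ := ∑ x, (f x : ℂ) * chi (r * x)

lemma triangle_count (f : ZMod M → ℝ) :
    (M : ℂ) * ((∑ x, ∑ y, f x * f y * f (x + y) : ℝ) : ℂ) =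
      ∑ r, ft f r ^ 2 * starRingEnd ℂ (ft f r) := by
  have h : ∀ r, ft f r ^ 2 * starRingEnd ℂ (ft f r) =
      ∑ x, ∑ y, ∑ z, (f x * f y * f z : ℂ) * chi (r * (x + y - z)) := by
    intro r
    simp only [sq, ft, map_sum, map_mul, Complex.conj_ofReal, ← chi_neg]
    rw [sum_mul_sum, sum_mul]
    refine sum_congr rfl fun x _ => ?_
    rw [sum_mul]
    refine sum_congr rfl fun y _ => ?_
    rw [mul_sum]
    refine sum_congr rfl fun z _ => ?_
    rw [show r * (x + y - z) = r * x + r * y + -(r * z) by ring, chi_add, chi_add]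
    ring
  simp only [h]
  push_cast
  rw [mul_sum]
  symm
  rw [sum_comm]
  refine sum_congr rfl fun x _ => ?_
  rw [sum_comm, mul_sum]
  refine sum_congr rfl fun y _ => ?_
  rw [sum_comm]
  have h1 : ∀ z, ∑ r, (f x * f y * f z : ℂ) * chi (r * (x + y - z)) =
      if x + y = z then (M : ℂ) * (f x * f y * f z) else 0 := by
    intro z
    rw [← mul_sum, sum_chi]
    simp only [sub_eq_zero]
    split_ifs <;> ring
  simp [h1]

/-- The Fourier transform of the uniform measure on `B`. -/
noncomputable def bt (B : Finset (ZMod M)) (r : ZMod M) : ℂ := (∑ u ∈ B, chi (r * u)) / (#B : ℂ)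

/-- The average of `f` over translates by `B + B`. -/
noncomputable def smooth (B : Finset (ZMod M)) (f : ZMod M → ℝ) (x : ZMod M) : ℝ :=
  (∑ u ∈ B, ∑ v ∈ B, f (x - u - v)) / (#B : ℝ) ^ 2

lemma ft_smooth (B : Finset (ZMod M)) (f : ZMod M → ℝ) (r : ZMod M) :
    ft (smooth B f) r = ft f r * bt B r ^ 2 := by
  have h : ∀ u v : ZMod M, ∑ x, (f (x - u - v) : ℂ) * chi (r * x) =
      ft f r * (chi (r * u) * chi (r * v)) := by
    intro u v
    rw [ft, sum_mul, ← Equiv.sum_comp (Equiv.addRight (u + v))]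
    refine sum_congr rfl fun x _ => ?_
    rw [Equiv.coe_addRight, show r * (x + (u + v)) = r * x + (r * u + r * v) by ring, chi_add,
      chi_add (r * u), show x + (u + v) - u - v = x by ring]
    ring
  have h2 : (∑ u ∈ B, chi (r * u)) ^ 2 = ∑ u ∈ B, ∑ v ∈ B, chi (r * u) * chi (r * v) := by
    rw [sq, sum_mul_sum]
  rw [bt, div_pow, h2, mul_div_assoc', ft]
  simp only [smooth]
  push_cast
  simp only [div_mul_eq_mul_div]
  rw [← sum_div]
  congr 1
  simp only [sum_mul, mul_sum]
  rw [sum_comm]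
  refine sum_congr rfl fun u _ => ?_
  rw [sum_comm]
  exact sum_congr rfl fun v _ => h u v

lemma norm_bt_le_one (B : Finset (ZMod M)) (r : ZMod M) : ‖bt B r‖ ≤ 1 := by
  rw [bt, norm_div, Complex.norm_natCast]
  refine div_le_one_of_le₀ ((norm_sum_le _ _).trans ?_) (Nat.cast_nonneg _)
  simp

lemma norm_one_sub_bt_le {B : Finset (ZMod M)} (hB : B.Nonempty) {r : ZMod M} {ε : ℝ}
    (h : ∀ u ∈ B, ‖chi (r * u) - 1‖ ≤ ε) : ‖1 - bt B r‖ ≤ ε := by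
  have hc : (0 : ℝ) < #B := by exact_mod_cast hB.card_pos
  have hc' : (#B : ℂ) ≠ 0 := by exact_mod_cast hc.ne'
  have : 1 - bt B r = (∑ u ∈ B, (1 - chi (r * u))) / (#B : ℂ) := by
    rw [bt, sum_sub_distrib, sum_const, nsmul_eq_mul, mul_one, sub_div, div_self hc']
  rw [this, norm_div, Complex.norm_natCast, div_le_iff₀ hc]
  refine (norm_sum_le _ _).trans ((sum_le_card_nsmul _ _ ε fun u hu => ?_).trans_eq ?_)
  · rw [norm_sub_rev]; exact h u hu
  · rw [nsmul_eq_mul, mul_comm]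

lemma sum_norm_bt_sq {B : Finset (ZMod M)} (hB : B.Nonempty) :
    ∑ r, ‖bt B r‖ ^ 2 = M / #B := by
  have hc : (0 : ℝ) < #B := by exact_mod_cast hB.card_pos
  have hc' : (#B : ℂ) ≠ 0 := by exact_mod_cast hc.ne'
  have h : ∀ r, ((‖∑ u ∈ B, chi (r * u)‖ ^ 2 : ℝ) : ℂ) =
      ∑ u ∈ B, ∑ v ∈ B, chi (r * (u - v)) := by
    intro r
    rw [norm_sum_sq_eq]
    refine sum_congr rfl fun u _ => sum_congr rfl fun v _ => ?_
    rw [← chi_neg, ← chi_add]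
    congr 1; ring
  have h2 : ((∑ r, ‖∑ u ∈ B, chi (r * u)‖ ^ 2 : ℝ) : ℂ) = (M * #B : ℝ) := by
    rw [Complex.ofReal_sum, sum_congr rfl fun r _ => h r, sum_comm]
    rw [sum_congr rfl fun u _ => sum_comm]
    simp only [sum_chi, sub_eq_zero]
    simp
    ring
  have h3 := Complex.ofReal_injective h2
  simp only [bt, norm_div, Complex.norm_natCast, div_pow]
  rw [← sum_div, h3]
  field_simp

lemma inversion (f : ZMod M → ℝ) (x : ZMod M) :
    (M : ℂ) * (f x : ℂ) = ∑ r, ft f r * chi (-(r * x)) := by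
  simp only [ft, sum_mul]
  rw [sum_comm]
  have h : ∀ y, ∑ r, (f y : ℂ) * chi (r * y) * chi (-(r * x)) =
      if y = x then (M : ℂ) * f y else 0 := by
    intro y
    simp only [mul_assoc, ← chi_add]
    rw [← mul_sum]
    rw [sum_congr rfl fun r _ => by rw [show r * y + -(r * x) = r * (y - x) by ring]]
    rw [sum_chi]
    simp only [sub_eq_zero]
    split_ifs <;> ring
  simp [h]

lemma abs_smooth_le {B : Finset (ZMod M)} (hB : B.Nonempty) {f : ZMod M → ℝ} {E : ℝ}
    (h : ∀ r, ‖ft f r‖ ≤ E) (x : ZMod M) : |smooth B f x| ≤ E / #B := by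
  have hM : (0 : ℝ) < M := by exact_mod_cast NeZero.pos M
  have h1 : (M : ℝ) * |smooth B f x| ≤ ∑ r, E * ‖bt B r‖ ^ 2 := by
    have := congrArg norm (inversion (smooth B f) x)
    rw [norm_mul, Complex.norm_natCast, Complex.norm_real, Real.norm_eq_abs] at this
    rw [this]
    refine (norm_sum_le _ _).trans (sum_le_sum fun r _ => ?_)
    rw [ft_smooth, norm_mul, norm_mul, norm_pow, norm_chi, mul_one]
    exact mul_le_mul_of_nonneg_right (h r) (by positivity)
  rw [← mul_sum, sum_norm_bt_sq hB] at h1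
  refine le_of_mul_le_mul_left (h1.trans_eq ?_) hM
  ring

lemma norm_one_sub_prod_le {b : ℂ} (hb : ‖b‖ ≤ 1) :
    ‖1 - b ^ 4 * starRingEnd ℂ b ^ 2‖ ≤ 6 * ‖1 - b‖ := by
  set c := starRingEnd ℂ b with hc
  have hc1 : ‖c‖ ≤ 1 := by rwa [hc, Complex.norm_conj]
  have hc2 : ‖1 - c‖ = ‖1 - b‖ := by
    rw [hc, ← Complex.norm_conj (1 - b), map_sub, map_one]
  have h : 1 - b ^ 4 * c ^ 2 = (1 - b) * (1 + b + b ^ 2 + b ^ 3) + b ^ 4 * ((1 - c) * (1 + c)) := by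
    ring
  have h1 : ‖1 + b + b ^ 2 + b ^ 3‖ ≤ 4 := by
    have h2 : ‖b ^ 2‖ ≤ 1 := by rw [norm_pow]; exact pow_le_one₀ (norm_nonneg _) hb
    have h3 : ‖b ^ 3‖ ≤ 1 := by rw [norm_pow]; exact pow_le_one₀ (norm_nonneg _) hb
    have := norm_add_le (1 + b + b ^ 2) (b ^ 3)
    have := norm_add_le (1 + b) (b ^ 2)
    have := norm_add_le 1 b
    rw [norm_one] at this
    linarith
  have h2 : ‖1 + c‖ ≤ 2 := by
    have := norm_add_le 1 c
    rw [norm_one] at this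
    linarith
  have h4 : ‖b ^ 4‖ ≤ 1 := by rw [norm_pow]; exact pow_le_one₀ (norm_nonneg _) hb
  rw [h]
  calc _ ≤ ‖(1 - b) * (1 + b + b ^ 2 + b ^ 3)‖ + ‖b ^ 4 * ((1 - c) * (1 + c))‖ := norm_add_le _ _
    _ ≤ ‖1 - b‖ * 4 + 1 * (‖1 - b‖ * 2) := by
      rw [norm_mul, norm_mul, norm_mul, hc2]; gcongr
    _ = _ := by ring

lemma triangle_smooth_le {B : Finset (ZMod M)} (hB : B.Nonempty) (f : ZMod M → ℝ)
    (S : Finset (ZMod M)) {ε : ℝ} (h : ∀ r ∈ S, ∀ u ∈ B, ‖chi (r * u) - 1‖ ≤ ε) :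
    (M : ℝ) * ∑ x, ∑ y, smooth B f x * smooth B f y * smooth B f (x + y) ≤
      (M : ℝ) * ∑ x, ∑ y, f x * f y * f (x + y) + 6 * ε * ∑ r ∈ S, ‖ft f r‖ ^ 3 +
        2 * ∑ r ∈ Sᶜ, ‖ft f r‖ ^ 3 := by
  have h1 := triangle_count f
  have h2 := triangle_count (smooth B f)
  have h3 : ((M * ∑ x, ∑ y, f x * f y * f (x + y) -
      M * ∑ x, ∑ y, smooth B f x * smooth B f y * smooth B f (x + y) : ℝ) : ℂ) =
      ∑ r, ft f r ^ 2 * starRingEnd ℂ (ft f r) *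
        (1 - bt B r ^ 4 * starRingEnd ℂ (bt B r) ^ 2) := by
    rw [Complex.ofReal_sub, Complex.ofReal_mul, Complex.ofReal_mul, Complex.ofReal_natCast, h1, h2,
      ← sum_sub_distrib]
    refine sum_congr rfl fun r _ => ?_
    rw [ft_smooth, map_mul, map_pow]
    ring
  have h4 : ∀ r, ‖ft f r ^ 2 * starRingEnd ℂ (ft f r) *
        (1 - bt B r ^ 4 * starRingEnd ℂ (bt B r) ^ 2)‖ =
      ‖1 - bt B r ^ 4 * starRingEnd ℂ (bt B r) ^ 2‖ * ‖ft f r‖ ^ 3 := by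
    intro r
    rw [norm_mul, norm_mul, norm_pow, Complex.norm_conj]
    ring
  have h5 := congrArg norm h3
  rw [Complex.norm_real, Real.norm_eq_abs] at h5
  have h6 : ‖∑ r, ft f r ^ 2 * starRingEnd ℂ (ft f r) *
        (1 - bt B r ^ 4 * starRingEnd ℂ (bt B r) ^ 2)‖ ≤
      6 * ε * ∑ r ∈ S, ‖ft f r‖ ^ 3 + 2 * ∑ r ∈ Sᶜ, ‖ft f r‖ ^ 3 := by
    refine (norm_sum_le _ _).trans ?_
    rw [← sum_add_sum_compl S, mul_sum, mul_sum]
    refine add_le_add (sum_le_sum fun r hr => ?_) (sum_le_sum fun r _ => ?_)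
    · rw [h4]
      refine mul_le_mul_of_nonneg_right ?_ (by positivity)
      exact (norm_one_sub_prod_le (norm_bt_le_one B r)).trans
        (mul_le_mul_of_nonneg_left (norm_one_sub_bt_le hB (h r hr)) (by norm_num))
    · rw [h4]
      refine mul_le_mul_of_nonneg_right ?_ (by positivity)
      refine (norm_sub_le _ _).trans ?_
      rw [norm_one, norm_mul, norm_pow, norm_pow, Complex.norm_conj]
      have := norm_bt_le_one B r
      have h7 : ‖bt B r‖ ^ 4 ≤ 1 := pow_le_one₀ (norm_nonneg _) this
      have h8 : ‖bt B r‖ ^ 2 ≤ 1 := pow_le_one₀ (norm_nonneg _) this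
      have := mul_le_one₀ h7 (by positivity) h8
      linarith
  rw [← h5] at h6
  have := neg_abs_le (M * ∑ x, ∑ y, f x * f y * f (x + y) -
      M * ∑ x, ∑ y, smooth B f x * smooth B f y * smooth B f (x + y))
  linarith

end ZModFourier

section Bohr

variable {M : ℕ} [NeZero M]

lemma chi_eq_e_val (x : ZMod M) : chi x = e (x.val / M) := by
  rw [← chi_natCast, ZMod.natCast_zmod_val]

lemma chi_eq_e_valMinAbs (x : ZMod M) : chi x = e (x.valMinAbs / M) := by
  have h := ZMod.stdAddChar_coe (N := M) x.valMinAbs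
  rw [ZMod.coe_valMinAbs] at h
  rw [chi, h, e]
  congr 1
  push_cast
  ring

lemma exists_bohr_set (S : Finset (ZMod M)) {m : ℕ} (hm : 1 ≤ m) :
    ∃ B : Finset (ZMod M), B.Nonempty ∧ (M : ℝ) ≤ #B * (m : ℝ) ^ #S ∧
      ∀ r ∈ S, ∀ u ∈ B, ‖chi (r * u) - 1‖ ≤ 2 * Real.pi / m := by
  classical
  have hM : 0 < M := NeZero.pos M
  have hM' : (0 : ℝ) < M := by exact_mod_cast hM
  have hm' : (0 : ℝ) < m := by exact_mod_cast hm
  let φ : ZMod M → (S → Fin m) := fun x r =>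
    ⟨m * ((r : ZMod M) * x).val / M, by
      rw [Nat.div_lt_iff_lt_mul hM]
      exact Nat.mul_lt_mul_of_pos_left (ZMod.val_lt _) (by omega)⟩
  have hφ : ∀ x x', φ x = φ x' → ∀ r ∈ S, ‖chi (r * x) - chi (r * x')‖ ≤ 2 * Real.pi / m := by
    intro x x' h r hr
    have h1 : m * (r * x).val / M = m * (r * x').val / M := by
      simpa [φ] using congrFun h ⟨r, hr⟩
    rw [chi_eq_e_val, chi_eq_e_val]
    generalize (r * x).val = a at h1
    generalize (r * x').val = b at h1
    have h2 := Nat.div_add_mod (m * a) M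
    have h3 := Nat.div_add_mod (m * b) M
    have h4 := Nat.mod_lt (m * a) hM
    have h5 := Nat.mod_lt (m * b) hM
    rw [h1] at h2
    have h6 : (m : ℝ) * |(a : ℝ) - b| ≤ M := by
      rw [← abs_of_pos hm', ← abs_mul, abs_le]
      have h7 : m * a ≤ m * b + M := by omega
      have h8 : m * b ≤ m * a + M := by omega
      have h7' : (m : ℝ) * a ≤ m * b + M := by exact_mod_cast h7
      have h8' : (m : ℝ) * b ≤ m * a + M := by exact_mod_cast h8
      constructor <;> linarith
    refine (norm_e_sub_le _ _).trans ?_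
    rw [← sub_div, abs_div, abs_of_pos hM']
    have h9 : |(a : ℝ) - b| / M ≤ 1 / m := by
      rw [div_le_div_iff₀ hM' hm']; linarith
    calc 2 * Real.pi * (|(a : ℝ) - b| / M) ≤ 2 * Real.pi * (1 / m) := by gcongr
      _ = 2 * Real.pi / m := by ring
  have hpos : (0 : ℝ) < (m : ℝ) ^ #S := by positivity
  obtain ⟨y, -, hy⟩ := exists_le_card_fiber_of_nsmul_le_card_of_maps_to (s := univ) (t := univ)
    (f := φ) (b := (M : ℝ) / (m : ℝ) ^ #S) (fun _ _ => mem_univ _)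
    ⟨fun _ => ⟨0, hm⟩, mem_univ _⟩ (by
      rw [nsmul_eq_mul, card_univ, card_univ, ZMod.card, Fintype.card_fun, Fintype.card_fin,
        Fintype.card_coe, Nat.cast_pow, mul_div_cancel₀ _ hpos.ne'])
  set F := univ.filter (fun x => φ x = y) with hF
  have hFne : F.Nonempty := by
    rw [← card_pos]
    have : (0 : ℝ) < #F := lt_of_lt_of_le (by positivity) hy
    exact_mod_cast this
  obtain ⟨x₀, hx₀⟩ := hFne
  refine ⟨F.image (fun x => x - x₀), ⟨_, mem_image_of_mem _ hx₀⟩, ?_, ?_⟩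
  · rw [card_image_of_injective _ (sub_left_injective)]
    rwa [div_le_iff₀ hpos] at hy
  · intro r hr u hu
    obtain ⟨x, hx, rfl⟩ := mem_image.1 hu
    have h1 := hφ x x₀ (by rw [(mem_filter.1 hx).2, (mem_filter.1 hx₀).2]) r hr
    refine le_of_eq_of_le ?_ h1
    have h2 : chi (r * (x - x₀)) * chi (r * x₀) = chi (r * x) := by
      rw [← chi_add]; congr 1; ring
    rw [← h2, ← one_mul (chi (r * x₀)), ← mul_assoc, ← sub_mul, norm_mul, norm_chi, mul_one,
      mul_one]

lemma abs_valMinAbs_le {u : ZMod M} {ε : ℝ} (h : ‖chi u - 1‖ ≤ ε) :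
    4 * |(u.valMinAbs : ℝ)| ≤ ε * M := by
  have hM' : (0 : ℝ) < M := by exact_mod_cast NeZero.pos M
  have h1 := ZMod.valMinAbs_mem_Ioc u
  have h2 : |(u.valMinAbs : ℝ) / M| ≤ 1 / 2 := by
    have h3 : (-(M : ℤ) : ℝ) < u.valMinAbs * 2 := by exact_mod_cast h1.1
    have h4 : (u.valMinAbs : ℝ) * 2 ≤ M := by exact_mod_cast h1.2
    push_cast at h3
    rw [abs_div, abs_of_pos hM', div_le_iff₀ hM', abs_le]
    constructor <;> linarith
  rw [chi_eq_e_valMinAbs] at h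
  have h5 := le_norm_e_sub_one (x := u.valMinAbs / M) (δ := |(u.valMinAbs : ℝ) / M|) (by
    intro a
    rcases eq_or_ne a 0 with rfl | ha
    · simp
    · have h6 : (1 : ℝ) ≤ |(a : ℝ)| := by exact_mod_cast Int.one_le_abs ha
      have h7 := abs_sub_abs_le_abs_sub (a : ℝ) (u.valMinAbs / M)
      rw [abs_sub_comm] at h7
      linarith)
  have h8 := h5.trans h
  rw [abs_div, abs_of_pos hM'] at h8
  rwa [← div_le_iff₀ hM', mul_div_assoc]

end Bohr

lemma sum_zmod_val {R : Type*} [AddCommMonoid R] {M : ℕ} [NeZero M] (F : ℕ → R) :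
    ∑ x : ZMod M, F x.val = ∑ n ∈ range M, F n := by
  refine sum_nbij' (fun x => x.val) (fun n => (n : ZMod M)) ?_ ?_ ?_ ?_ ?_
  · intro x _; exact mem_range.2 (ZMod.val_lt x)
  · intro n _; exact mem_univ _
  · intro x _; exact ZMod.natCast_zmod_val x
  · intro n hn; exact ZMod.val_cast_of_lt (mem_range.1 hn)
  · intro x _; rfl

lemma ft_comp_val {N : ℕ} {a : ℕ → ℝ} (ha : ∀ n, n ∉ Ioc 0 N → a n = 0)
    (r : ZMod (2 * N + 1)) :
    ft (fun x => a x.val) r =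
      ∑ n ∈ Ioc 0 N, (a n : ℂ) * e (n * r.val / (2 * N + 1 : ℕ)) := by
  have h : ∀ x : ZMod (2 * N + 1), (a x.val : ℂ) * chi (r * x) =
      (fun n : ℕ => (a n : ℂ) * e (n * r.val / (2 * N + 1 : ℕ))) x.val := by
    intro x
    have h1 : r * x = ((x.val * r.val : ℕ) : ZMod (2 * N + 1)) := by
      rw [Nat.cast_mul, ZMod.natCast_zmod_val, ZMod.natCast_zmod_val]
      exact mul_comm _ _
    rw [h1, chi_natCast]
    push_cast
    rfl
  rw [ft, sum_congr rfl fun x _ => h x]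
  refine (sum_zmod_val (fun n : ℕ => (a n : ℂ) * e (n * r.val / (2 * N + 1 : ℕ)))).trans ?_
  symm
  refine sum_subset ?_ ?_
  · intro n hn
    rw [mem_Ioc] at hn
    rw [mem_range]; omega
  · intro n _ hn
    rw [ha n hn, Complex.ofReal_zero, zero_mul]

section

variable {N : ℕ}

/-- The indicator function of the residues represented by `1, …, N`. -/
noncomputable def ind (N : ℕ) (x : ZMod (2 * N + 1)) : ℝ := if x.val ∈ Ioc 0 N then 1 else 0

lemma smooth_ind {B : Finset (ZMod (2 * N + 1))} (hB : B.Nonempty) {L : ℝ}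
    (hL : ∀ u ∈ B, 2 * |(u.valMinAbs : ℝ)| ≤ L) {a : ℕ} (ha : L < a) (haN : a + L ≤ N) :
    smooth B (ind N) a = 1 := by
  have hc : (#B : ℝ) ≠ 0 := by exact_mod_cast hB.card_ne_zero
  have h : ∀ u ∈ B, ∀ v ∈ B, ind N ((a : ZMod (2 * N + 1)) - u - v) = 1 := by
    intro u hu v hv
    have h1 := hL u hu
    have h2 := hL v hv
    have hz : (a : ZMod (2 * N + 1)) - u - v = ((a - u.valMinAbs - v.valMinAbs : ℤ) :
        ZMod (2 * N + 1)) := by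
      push_cast
      rfl
    have h3 := abs_le.1 (le_refl |(u.valMinAbs : ℝ)|)
    have h4 := abs_le.1 (le_refl |(v.valMinAbs : ℝ)|)
    have h5 : 0 < (a - u.valMinAbs - v.valMinAbs : ℤ) := by
      have : (0 : ℝ) < (a - u.valMinAbs - v.valMinAbs : ℤ) := by push_cast; linarith
      exact_mod_cast this
    have h6 : (a - u.valMinAbs - v.valMinAbs : ℤ) ≤ N := by
      have : ((a - u.valMinAbs - v.valMinAbs : ℤ) : ℝ) ≤ N := by push_cast; linarith
      exact_mod_cast this
    obtain ⟨b, hb⟩ := Int.eq_ofNat_of_zero_le h5.le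
    rw [hb] at hz h5 h6
    rw [Int.cast_natCast] at hz
    rw [ind, hz, ZMod.val_cast_of_lt (by omega), if_pos (mem_Ioc.2 ⟨by omega, by omega⟩)]
  rw [smooth, sum_congr rfl fun u hu => sum_congr rfl fun v hv => h u hu v hv]
  simp only [sum_const, nsmul_eq_mul, mul_one]
  field_simp

lemma smooth_nonneg {B : Finset (ZMod (2 * N + 1))} {f : ZMod (2 * N + 1) → ℝ}
    (hf : ∀ x, 0 ≤ f x) (x : ZMod (2 * N + 1)) : 0 ≤ smooth B f x :=
  div_nonneg (sum_nonneg fun _ _ => sum_nonneg fun _ _ => hf _) (by positivity)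

lemma smooth_sum_sub {k : ℕ} (B : Finset (ZMod (2 * N + 1)))
    (f : Fin k → ZMod (2 * N + 1) → ℝ) (g : ZMod (2 * N + 1) → ℝ) (x : ZMod (2 * N + 1)) :
    smooth B (fun x => ∑ i, f i x - g x) x = ∑ i, smooth B (f i) x - smooth B g x := by
  simp only [smooth, ← sum_div, ← sub_div]
  congr 1
  simp only [sum_sub_distrib]
  congr 1
  rw [sum_congr rfl fun u _ => sum_comm, sum_comm]

set_option maxHeartbeats 1000000 in
lemma smooth_count {k n : ℕ} (hk : 1 ≤ k) (hn : 1 ≤ n)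
    (hmono : ∀ (P : ℕ) (d : ℕ → Fin k),
      P ^ 2 ≤ n ^ 3 * ((Icc P (3 * n ^ 2 * P) ×ˢ Icc P (3 * n ^ 2 * P)).filter
        (fun x => x.1 + x.2 ≤ 3 * n ^ 2 * P ∧ d x.1 = d x.2 ∧ d x.1 = d (x.1 + x.2))).card)
    (hN : 12 * n ^ 2 ≤ N) {ε : ℝ} (hε : ε ≤ 1 / (24 * n ^ 2))
    {B : Finset (ZMod (2 * N + 1))} (hB : B.Nonempty)
    (hL : ∀ u ∈ B, 4 * |(u.valMinAbs : ℝ)| ≤ ε * (2 * N + 1 : ℕ))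
    {f : Fin k → ZMod (2 * N + 1) → ℝ} (hf : ∀ i x, 0 ≤ f i x)
    (hh : ∀ x, |smooth B (fun x => ∑ i, f i x - ind N x) x| ≤ 1 / 2) :
    1 / (1152 * k ^ 3 * n ^ 7) * (N : ℝ) ^ 2 ≤
      ∑ i, ∑ x, ∑ y, smooth B (f i) x * smooth B (f i) y * smooth B (f i) (x + y) := by
  classical
  have hk' : (0 : ℝ) < k := by exact_mod_cast hk
  have hn' : (1 : ℝ) ≤ n := by exact_mod_cast hn
  have hn2 : (0 : ℝ) < (n : ℝ) ^ 2 := by positivity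
  have hN' : (12 : ℝ) * n ^ 2 ≤ N := by exact_mod_cast hN
  have hN0 : (1 : ℝ) ≤ N := by
    have : (1 : ℝ) ≤ (n : ℝ) ^ 2 := one_le_pow₀ hn'
    linarith
  set g : Fin k → ZMod (2 * N + 1) → ℝ := fun i => smooth B (f i) with hg
  have hg0 : ∀ i x, 0 ≤ g i x := fun i x => smooth_nonneg (hf i) x
  set P := N / (6 * n ^ 2) with hP
  have hPpos : 0 < 6 * n ^ 2 := by positivity
  have hPle : P * (6 * n ^ 2) ≤ N := Nat.div_mul_le_self _ _
  have hPge : N < (P + 1) * (6 * n ^ 2) := by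
    have := Nat.div_add_mod N (6 * n ^ 2)
    have h2 := Nat.mod_lt N hPpos
    rw [← hP] at this
    calc N = 6 * n ^ 2 * P + N % (6 * n ^ 2) := this.symm
      _ < 6 * n ^ 2 * P + 6 * n ^ 2 := by omega
      _ = _ := by ring
  have hPge' : (N : ℝ) ≤ P * (12 * n ^ 2) := by
    have h1 : (N : ℝ) < (P + 1) * (6 * n ^ 2) := by exact_mod_cast hPge
    linarith
  have hPle' : (P : ℝ) * (6 * n ^ 2) ≤ N := by exact_mod_cast hPle
  clear_value P
  set X := 3 * n ^ 2 * P with hX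
  have hX2 : 2 * X ≤ N := by rw [hX]; linarith
  have hX2' : 2 * (X : ℝ) ≤ N := by exact_mod_cast hX2
  clear_value X
  set L : ℝ := N / (16 * n ^ 2) with hLdef
  have hεM : ε * (2 * N + 1 : ℕ) ≤ 2 * L := by
    calc ε * (2 * N + 1 : ℕ) ≤ 1 / (24 * n ^ 2) * (3 * N) := by
          push_cast
          exact mul_le_mul hε (by linarith) (by positivity) (by positivity)
      _ = 2 * L := by rw [hLdef]; field_simp; norm_num
  have hLP : L < P := by
    rw [hLdef, div_lt_iff₀ (by positivity)]
    have : (0 : ℝ) < P := by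
      by_contra h
      have : (P : ℝ) * (12 * n ^ 2) ≤ 0 := mul_nonpos_of_nonpos_of_nonneg (not_lt.1 h) (by positivity)
      linarith
    have : 0 < (P : ℝ) * n ^ 2 := by positivity
    linarith
  have hLN : 2 * L ≤ N := by
    rw [hLdef, ← mul_div_assoc, div_le_iff₀ (by positivity)]
    have h1 : (1 : ℝ) ≤ n ^ 2 := one_le_pow₀ hn'
    have h2 : (N : ℝ) * 1 ≤ N * n ^ 2 := by gcongr
    linarith
  clear_value L
  have hex : ∀ a : ℕ, ∃ i : Fin k, P ≤ a → a ≤ X → 1 / (2 * k) ≤ g i a := by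
    intro a
    by_cases ha : P ≤ a ∧ a ≤ X
    · by_contra! hcon
      have hlt : ∀ i, g i a < 1 / (2 * k) := fun i => (hcon i).2.2
      have h1 : smooth B (ind N) a = 1 := by
        have ha1 : (P : ℝ) ≤ a := by exact_mod_cast ha.1
        have ha2 : (a : ℝ) ≤ X := by exact_mod_cast ha.2
        refine smooth_ind hB (L := L) (fun u hu => ?_) (by linarith) (by linarith)
        have := hL u hu
        linarith
      have h2 := hh a
      rw [smooth_sum_sub, h1] at h2
      have h3 := (abs_le.1 h2).1
      have h4 : ∑ i, g i a < ∑ _i : Fin k, (1 / (2 * k) : ℝ) :=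
        sum_lt_sum_of_nonempty ⟨⟨0, hk⟩, mem_univ _⟩ fun i _ => hlt i
      rw [sum_const, card_univ, Fintype.card_fin, nsmul_eq_mul] at h4
      have h5 : (k : ℝ) * (1 / (2 * k)) = 1 / 2 := by field_simp
      rw [h5] at h4
      linarith
    · exact ⟨⟨0, hk⟩, fun h1 h2 => absurd ⟨h1, h2⟩ ha⟩
  choose d hd using hex
  have hm := hmono P d
  rw [← hX] at hm
  set Q := (Icc P X ×ˢ Icc P X).filter
    (fun x => x.1 + x.2 ≤ X ∧ d x.1 = d x.2 ∧ d x.1 = d (x.1 + x.2)) with hQ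
  set F : ZMod (2 * N + 1) × ZMod (2 * N + 1) → ℝ :=
    fun z => ∑ i, g i z.1 * g i z.2 * g i (z.1 + z.2) with hF
  have hF0 : ∀ z, 0 ≤ F z := fun z =>
    sum_nonneg fun i _ => mul_nonneg (mul_nonneg (hg0 _ _) (hg0 _ _)) (hg0 _ _)
  have hsum : ∑ i, ∑ x, ∑ y, g i x * g i y * g i (x + y) = ∑ z, F z := by
    rw [Fintype.sum_prod_type, sum_comm]
    refine sum_congr rfl fun x _ => ?_
    rw [sum_comm]
  have hinj : Set.InjOn (fun z : ℕ × ℕ => ((z.1 : ZMod (2 * N + 1)), (z.2 : ZMod (2 * N + 1)))) Q := by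
    intro z hz z' hz' h
    have h1 := (mem_filter.1 hz).1
    have h2 := (mem_filter.1 hz').1
    simp only [mem_product, mem_Icc] at h1 h2
    simp only [Prod.mk.injEq] at h
    have h3 := congrArg ZMod.val h.1
    have h4 := congrArg ZMod.val h.2
    rw [ZMod.val_cast_of_lt (by omega), ZMod.val_cast_of_lt (by omega)] at h3 h4
    exact Prod.ext h3 h4
  have hlow : ∀ z ∈ Q, (1 / (2 * k) : ℝ) ^ 3 ≤ F (z.1, z.2) := by
    intro z hz
    obtain ⟨h1, h2, h3, h4⟩ := mem_filter.1 hz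
    simp only [mem_product, mem_Icc] at h1
    have h5 := hd z.1 h1.1.1 h1.1.2
    have h6 := hd z.2 h1.2.1 h1.2.2
    have h7 := hd (z.1 + z.2) (by omega) h2
    rw [← h3] at h6
    rw [← h4, Nat.cast_add] at h7
    have h8 : (1 / (2 * k) : ℝ) ^ 3 ≤ g (d z.1) z.1 * g (d z.1) z.2 * g (d z.1) (z.1 + z.2) := by
      have h0 : (0 : ℝ) ≤ 1 / (2 * k) := by positivity
      calc (1 / (2 * k) : ℝ) ^ 3 = 1 / (2 * k) * (1 / (2 * k)) * (1 / (2 * k)) := by ring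
        _ ≤ _ := mul_le_mul (mul_le_mul h5 h6 h0 (h0.trans h5)) h7 h0
              (mul_nonneg (h0.trans h5) (h0.trans h6))
    refine h8.trans ?_
    exact single_le_sum (f := fun i => g i (z.1 : ZMod (2 * N + 1)) * g i z.2 * g i (z.1 + z.2))
      (fun i _ => mul_nonneg (mul_nonneg (hg0 _ _) (hg0 _ _)) (hg0 _ _)) (mem_univ (d z.1))
  have htotal : (#Q : ℝ) * (1 / (2 * k)) ^ 3 ≤ ∑ z, F z := by
    calc (#Q : ℝ) * (1 / (2 * k)) ^ 3 = ∑ z ∈ Q, (1 / (2 * k) : ℝ) ^ 3 := by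
          rw [sum_const, nsmul_eq_mul]
      _ ≤ ∑ z ∈ Q, F (z.1, z.2) := sum_le_sum hlow
      _ = ∑ z ∈ Q.image (fun z : ℕ × ℕ => ((z.1 : ZMod (2 * N + 1)), (z.2 : ZMod (2 * N + 1)))),
            F z := (sum_image hinj).symm
      _ ≤ ∑ z, F z := sum_le_univ_sum_of_nonneg hF0
  have hm' : (P : ℝ) ^ 2 ≤ n ^ 3 * #Q := by exact_mod_cast hm
  rw [hsum]
  refine le_trans ?_ htotal
  have h1 : (N : ℝ) ^ 2 ≤ (P * (12 * n ^ 2)) ^ 2 := by gcongr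
  calc 1 / (1152 * k ^ 3 * n ^ 7) * (N : ℝ) ^ 2
      ≤ 1 / (1152 * k ^ 3 * n ^ 7) * (P * (12 * n ^ 2)) ^ 2 := by gcongr
    _ = 1 / (8 * k ^ 3 * n ^ 3) * (P : ℝ) ^ 2 := by field_simp; ring
    _ ≤ 1 / (8 * k ^ 3 * n ^ 3) * (n ^ 3 * #Q) := by gcongr
    _ = _ := by field_simp; ring

end

section

variable {N : ℕ}

lemma norm_ft_comp_val_le {a : ℕ → ℝ} (ha : ∀ n, 0 ≤ a n) (has : ∀ n, n ∉ Ioc 0 N → a n = 0)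
    (r : ZMod (2 * N + 1)) : ‖ft (fun x => a x.val) r‖ ≤ ∑ n ∈ Ioc 0 N, a n := by
  rw [ft_comp_val has]
  refine (norm_sum_le _ _).trans (sum_le_sum fun n _ => ?_)
  rw [norm_mul, norm_e, mul_one, Complex.norm_real, Real.norm_eq_abs, abs_of_nonneg (ha n)]

/-- The large spectrum of a function on `ZMod (2 * N + 1)`. -/
noncomputable def spec (δ : ℝ) (a : ℕ → ℝ) : Finset (ZMod (2 * N + 1)) :=
  univ.filter (fun r => δ * N ≤ ‖ft (fun x => a x.val) r‖)

lemma card_spec {δ : ℝ} {a : ℕ → ℝ} (has : ∀ n, n ∉ Ioc 0 N → a n = 0) :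
    #(spec (N := N) δ a) = ((range (2 * N + 1)).filter (fun r : ℕ => δ * N ≤
      ‖∑ n ∈ Ioc 0 N, (a n : ℂ) * e (n * r / (2 * N + 1 : ℕ))‖)).card := by
  simp only [spec, card_filter, ft_comp_val has]
  exact sum_zmod_val (M := 2 * N + 1) (fun r : ℕ => if δ * N ≤
      ‖∑ n ∈ Ioc 0 N, (a n : ℂ) * e (n * r / (2 * N + 1 : ℕ))‖ then 1 else 0)

lemma sum_compl_spec {δ : ℝ} {a : ℕ → ℝ} (has : ∀ n, n ∉ Ioc 0 N → a n = 0) :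
    ∑ r ∈ (spec (N := N) δ a)ᶜ, ‖ft (fun x => a x.val) r‖ ^ 3 =
      ∑ r ∈ (range (2 * N + 1)).filter (fun r : ℕ =>
      ‖∑ n ∈ Ioc 0 N, (a n : ℂ) * e (n * r / (2 * N + 1 : ℕ))‖ < δ * N),
      ‖∑ n ∈ Ioc 0 N, (a n : ℂ) * e (n * r / (2 * N + 1 : ℕ))‖ ^ 3 := by
  simp only [spec, compl_filter, not_le, sum_filter, ft_comp_val has]
  exact sum_zmod_val (M := 2 * N + 1) (fun r : ℕ => if
      ‖∑ n ∈ Ioc 0 N, (a n : ℂ) * e (n * r / (2 * N + 1 : ℕ))‖ < δ * N then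
      ‖∑ n ∈ Ioc 0 N, (a n : ℂ) * e (n * r / (2 * N + 1 : ℕ))‖ ^ 3 else 0)

lemma card_mul_sum_spec_le {a : ℕ → ℝ} (ha : ∀ n, 0 ≤ a n)
    (has : ∀ n, n ∉ Ioc 0 N → a n = 0) {A : ℝ} (hA : ∑ n ∈ Ioc 0 N, a n ≤ A)
    (S : Finset (ZMod (2 * N + 1))) {K : ℕ} (hS : #S ≤ K) :
    ∑ r ∈ S, ‖ft (fun x => a x.val) r‖ ^ 3 ≤ K * A ^ 3 := by
  have hA0 : 0 ≤ A := (sum_nonneg fun n _ => ha n).trans hA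
  calc ∑ r ∈ S, ‖ft (fun x => a x.val) r‖ ^ 3 ≤ ∑ r ∈ S, A ^ 3 := by
        refine sum_le_sum fun r _ => ?_
        gcongr
        exact (norm_ft_comp_val_le ha has r).trans hA
    _ = #S * A ^ 3 := by rw [sum_const, nsmul_eq_mul]
    _ ≤ K * A ^ 3 := by gcongr

set_option maxHeartbeats 1000000 in
lemma transference {k n m J : ℕ} (hk : 1 ≤ k) (hn : 1 ≤ n) (hm : 1 ≤ m)
    (hmono : ∀ (P : ℕ) (d : ℕ → Fin k),
      P ^ 2 ≤ n ^ 3 * ((Icc P (3 * n ^ 2 * P) ×ˢ Icc P (3 * n ^ 2 * P)).filter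
        (fun x => x.1 + x.2 ≤ 3 * n ^ 2 * P ∧ d x.1 = d x.2 ∧ d x.1 = d (x.1 + x.2))).card)
    (hN : 12 * n ^ 2 ≤ N) {κ δ η : ℝ} (hκ : κ = 1 / (1152 * k ^ 3 * n ^ 7))
    (hm₁ : 2 * Real.pi / m ≤ 1 / (24 * n ^ 2))
    (hm₂ : 2 * Real.pi / m ≤ κ / (96 * k * (k * J + 1 : ℕ)))
    (hη : η = 1 / (2 * (m : ℝ) ^ (k * J + 1)))
    {f : Fin k → ℕ → ℝ} (hf : ∀ i n, 0 ≤ f i n) (hfs : ∀ i n, n ∉ Ioc 0 N → f i n = 0)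
    (hbias : ∀ α : ℝ, ‖∑ n ∈ Ioc 0 N, (((∑ i, f i n : ℝ) : ℂ) - 1) * e (α * n)‖ ≤ η * N)
    (hspec : ∀ i, #(spec (N := N) δ (f i)) ≤ J)
    (htail : ∀ i, ∑ r ∈ (spec (N := N) δ (f i))ᶜ, ‖ft (fun x => f i x.val) r‖ ^ 3 ≤
      κ / (4 * k) * N ^ 3) :
    κ / 3 * (N : ℝ) ^ 2 ≤ ∑ i, ∑ x : ZMod (2 * N + 1), ∑ y : ZMod (2 * N + 1),
      f i x.val * f i y.val * f i (x + y).val := by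
  classical
  have hk' : (0 : ℝ) < k := by exact_mod_cast hk
  have hn' : (1 : ℝ) ≤ n := by exact_mod_cast hn
  have hm' : (1 : ℝ) ≤ m := by exact_mod_cast hm
  have hκ0 : 0 < κ := by rw [hκ]; positivity
  have hN1 : 1 ≤ N := le_trans (Nat.mul_pos (by norm_num) (pow_pos hn 2)) hN
  have hN' : (1 : ℝ) ≤ N := by exact_mod_cast hN1
  set S : Finset (ZMod (2 * N + 1)) := insert 1 (univ.biUnion fun i => spec δ (f i)) with hS
  have hScard : #S ≤ k * J + 1 := by
    refine (card_insert_le _ _).trans (Nat.add_le_add_right ?_ 1)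
    refine (card_biUnion_le_card_mul _ _ J fun i _ => hspec i).trans_eq ?_
    rw [card_univ, Fintype.card_fin]
  have hspecS : ∀ i, spec δ (f i) ⊆ S := fun i =>
    (subset_biUnion_of_mem (fun i => spec δ (f i)) (mem_univ i)).trans (subset_insert _ _)
  obtain ⟨B, hB, hBcard, hBS⟩ := exists_bohr_set S hm
  have h1S : (1 : ZMod (2 * N + 1)) ∈ S := mem_insert_self _ _
  clear_value S
  set ε := 2 * Real.pi / m with hε
  have hε0 : 0 ≤ ε := by positivity
  clear_value ε
  have hL : ∀ u ∈ B, 4 * |(u.valMinAbs : ℝ)| ≤ ε * (2 * N + 1 : ℕ) := by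
    intro u hu
    have := hBS 1 h1S u hu
    rw [one_mul] at this
    exact abs_valMinAbs_le this
  have hη1 : η ≤ 1 := by
    rw [hη, div_le_one (by positivity)]
    have : (1 : ℝ) ≤ (m : ℝ) ^ (k * J + 1) := one_le_pow₀ hm'
    linarith
  have hsum : ∑ n ∈ Ioc 0 N, ∑ i, f i n ≤ 2 * N := by
    have h := hbias 0
    simp only [zero_mul, e_zero, mul_one, sum_sub_distrib, sum_const, Nat.card_Ioc, nsmul_eq_mul,
      ← Complex.ofReal_sum, tsub_zero] at h
    rw [← Complex.ofReal_natCast, ← Complex.ofReal_sub, Complex.norm_real, Real.norm_eq_abs] at h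
    have h2 := (abs_le.1 h).2
    have h3 : η * N ≤ 1 * N := by gcongr
    linarith
  have hsumi : ∀ i, ∑ n ∈ Ioc 0 N, f i n ≤ 2 * N := fun i =>
    (sum_le_sum fun n _ => single_le_sum (f := fun i => f i n) (fun i _ => hf i n)
      (mem_univ i)).trans hsum
  have hh : ∀ x, |smooth B (fun x => ∑ i, f i x.val - ind N x) x| ≤ 1 / 2 := by
    have h1 : (fun x : ZMod (2 * N + 1) => ∑ i, f i x.val - ind N x) =
        fun x => (fun n : ℕ => ∑ i, f i n - if n ∈ Ioc 0 N then 1 else 0) x.val := rfl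
    have h2 : ∀ n, n ∉ Ioc 0 N → (∑ i, f i n - if n ∈ Ioc 0 N then 1 else 0 : ℝ) = 0 := by
      intro n hn
      rw [if_neg hn, sum_eq_zero fun i _ => hfs i n hn, sub_zero]
    have h3 : ∀ r, ‖ft (fun x : ZMod (2 * N + 1) => ∑ i, f i x.val - ind N x) r‖ ≤ η * N := by
      intro r
      rw [h1, ft_comp_val h2]
      refine le_of_eq_of_le ?_ (hbias (r.val / (2 * N + 1 : ℕ)))
      congr 1
      refine sum_congr rfl fun n hn => ?_
      rw [if_pos hn]
      push_cast
      congr 2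
      ring
    intro x
    refine (abs_smooth_le hB h3 x).trans ?_
    have hBpos : (0 : ℝ) < #B := by exact_mod_cast hB.card_pos
    rw [div_le_iff₀ hBpos, hη]
    have h4 : (N : ℝ) ≤ #B * (m : ℝ) ^ (k * J + 1) := by
      refine le_trans ?_ (hBcard.trans (mul_le_mul_of_nonneg_left
        (pow_le_pow_right₀ hm' hScard) hBpos.le))
      push_cast
      linarith
    calc 1 / (2 * (m : ℝ) ^ (k * J + 1)) * N
        ≤ 1 / (2 * (m : ℝ) ^ (k * J + 1)) * (#B * (m : ℝ) ^ (k * J + 1)) := by gcongr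
      _ = 1 / 2 * #B := by
        have : (m : ℝ) ^ (k * J + 1) ≠ 0 := by positivity
        field_simp
  have hmain := smooth_count hk hn hmono hN hm₁ hB hL (f := fun i x => f i x.val)
    (fun i x => hf i _) hh
  rw [← hκ] at hmain
  have hcomp : ∀ i, ((2 * N + 1 : ℕ) : ℝ) * ∑ x, ∑ y, smooth B (fun x => f i x.val) x *
      smooth B (fun x => f i x.val) y * smooth B (fun x => f i x.val) (x + y) ≤
      ((2 * N + 1 : ℕ) : ℝ) * ∑ x : ZMod (2 * N + 1), ∑ y : ZMod (2 * N + 1),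
        f i x.val * f i y.val * f i (x + y).val + κ / k * N ^ 3 := by
    intro i
    refine (triangle_smooth_le hB (fun x => f i x.val) S hBS).trans ?_
    have h1 := card_mul_sum_spec_le (hf i) (hfs i) (hsumi i) S hScard
    have h2 : ∑ r ∈ Sᶜ, ‖ft (fun x => f i x.val) r‖ ^ 3 ≤ κ / (4 * k) * N ^ 3 :=
      (sum_le_sum_of_subset_of_nonneg (compl_subset_compl.2 (hspecS i))
        fun _ _ _ => by positivity).trans (htail i)
    have h3 : 6 * ε * ∑ r ∈ S, ‖ft (fun x => f i x.val) r‖ ^ 3 ≤ κ / (2 * k) * N ^ 3 := by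
      calc 6 * ε * ∑ r ∈ S, ‖ft (fun x => f i x.val) r‖ ^ 3
          ≤ 6 * (κ / (96 * k * (k * J + 1 : ℕ))) * ((k * J + 1 : ℕ) * (2 * N) ^ 3) := by gcongr
        _ = κ / (2 * k) * N ^ 3 := by
          have : ((k * J + 1 : ℕ) : ℝ) ≠ 0 := by positivity
          field_simp
          ring
    have h4 : κ / k * (N : ℝ) ^ 3 = κ / (2 * k) * N ^ 3 + 2 * (κ / (4 * k) * N ^ 3) := by
      field_simp
      ring
    rw [h4]
    linarith
  have hadd := sum_le_sum fun i (_ : i ∈ univ) => hcomp i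
  rw [sum_add_distrib, ← mul_sum, ← mul_sum, sum_const, card_univ, Fintype.card_fin,
    nsmul_eq_mul] at hadd
  have h5 : (k : ℝ) * (κ / k * N ^ 3) = κ * N ^ 3 := by field_simp
  rw [h5] at hadd
  generalize (∑ i, ∑ x : ZMod (2 * N + 1), ∑ y : ZMod (2 * N + 1),
      f i x.val * f i y.val * f i (x + y).val) = T at hadd ⊢
  have h6 : ((2 * N + 1 : ℕ) : ℝ) * (κ * N ^ 2) ≤ ((2 * N + 1 : ℕ) : ℝ) * T + κ * N ^ 3 :=
    (mul_le_mul_of_nonneg_left hmain (Nat.cast_nonneg _)).trans hadd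
  push_cast at h6
  have h7 : κ * (N : ℝ) ^ 3 ≤ (2 * N + 1) * T := by
    have : 0 ≤ κ * (N : ℝ) ^ 2 := by positivity
    have h8 : (2 * (N : ℝ) + 1) * (κ * N ^ 2) = 2 * (κ * N ^ 3) + κ * N ^ 2 := by ring
    linarith
  by_contra! hcon
  have h10 : (2 * (N : ℝ) + 1) * T < 3 * N * (κ / 3 * N ^ 2) := by
    calc (2 * (N : ℝ) + 1) * T < (2 * N + 1) * (κ / 3 * N ^ 2) := by gcongr
      _ ≤ 3 * N * (κ / 3 * N ^ 2) := by gcongr; linarith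
  have h11 : 3 * (N : ℝ) * (κ / 3 * N ^ 2) = κ * N ^ 3 := by ring
  linarith

end

lemma sum_offdiag_pos {N : ℕ} {f : ℕ → ℝ} {A : ℝ} (hf : ∀ n, 0 ≤ f n) (hA : ∀ n, f n ≤ A)
    (hfs : ∀ n, n ∉ Ioc 0 N → f n = 0)
    (h : (N : ℝ) * A ^ 3 < ∑ x : ZMod (2 * N + 1), ∑ y : ZMod (2 * N + 1),
      f x.val * f y.val * f (x + y).val) :
    ∃ x y : ℕ, x ≠ y ∧ f x ≠ 0 ∧ f y ≠ 0 ∧ f (x + y) ≠ 0 := by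
  by_contra! hcon
  have hA0 : 0 ≤ A := (hf 0).trans (hA 0)
  have hval : ∀ x y : ZMod (2 * N + 1), f x.val ≠ 0 → f y.val ≠ 0 →
      (x + y).val = x.val + y.val := by
    intro x y hx hy
    have h1 := mem_Ioc.1 (not_imp_comm.1 (hfs x.val) hx)
    have h2 := mem_Ioc.1 (not_imp_comm.1 (hfs y.val) hy)
    exact ZMod.val_add_of_lt (by omega)
  have hterm : ∀ x y : ZMod (2 * N + 1), f x.val * f y.val * f (x + y).val ≤
      if x = y then (if x.val ∈ Ioc 0 N then A ^ 3 else 0) else 0 := by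
    intro x y
    by_cases hx : f x.val = 0
    · rw [hx, zero_mul, zero_mul]; split_ifs <;> positivity
    by_cases hy : f y.val = 0
    · rw [hy, mul_zero, zero_mul]; split_ifs <;> positivity
    by_cases hxy : x = y
    · rw [if_pos hxy, if_pos (not_imp_comm.1 (hfs x.val) hx)]
      calc f x.val * f y.val * f (x + y).val ≤ A * A * A := by
            gcongr <;> first | exact hA _ | exact hf _
        _ = A ^ 3 := by ring
    · rw [if_neg hxy, hval x y hx hy,
        hcon x.val y.val (fun h => hxy (ZMod.val_injective _ h)) hx hy, mul_zero]
  have h1 := (sum_le_sum fun x (_ : x ∈ univ) => sum_le_sum fun y (_ : y ∈ univ) => hterm x y)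
  simp only [sum_ite_eq, mem_univ, if_true] at h1
  have h2 := sum_zmod_val (M := 2 * N + 1) (fun n : ℕ => if n ∈ Ioc 0 N then A ^ 3 else 0)
  have h3 : ∑ n ∈ range (2 * N + 1), (if n ∈ Ioc 0 N then A ^ 3 else 0) ≤ N * A ^ 3 := by
    rw [← sum_filter, sum_const, nsmul_eq_mul]
    have : #((range (2 * N + 1)).filter (fun n => n ∈ Ioc 0 N)) ≤ N := by
      refine (card_le_card (t := Ioc 0 N) fun n hn => (mem_filter.1 hn).2).trans_eq ?_
      rw [Nat.card_Ioc, tsub_zero]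
    gcongr
  rw [← h2] at h3
  exact absurd (h.trans_le (h1.trans h3)) (lt_irrefl _)

end SchurPrimes

open SchurPrimes Finset

/-- Strengthened Schur-type theorem for primes: the monochromatic primes
`p₁, p₂, p₃` with `p₁ + p₂ = p₃ + 1` can be taken pairwise distinct. -/
theorem schur_for_primes_distinct (k : ℕ) (c : ℕ → Fin k) :
    ∃ p₁ p₂ p₃ : ℕ, p₁.Prime ∧ p₂.Prime ∧ p₃.Prime ∧
      p₁ ≠ p₂ ∧ p₁ ≠ p₃ ∧ p₂ ≠ p₃ ∧
      c p₁ = c p₂ ∧ c p₂ = c p₃ ∧ p₁ + p₂ = p₃ + 1 := by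
  classical
  have hk : 1 ≤ k := Fin.pos (c 0)
  obtain ⟨n, hn, hmono⟩ := exists_many_mono k
  set κ : ℝ := 1 / (1152 * k ^ 3 * n ^ 7) with hκ
  have hκ0 : 0 < κ := by positivity
  obtain ⟨δ, hδ, J, hrestr⟩ := restriction (τ := κ / (4 * k)) (by positivity)
  obtain ⟨m, hm⟩ := exists_nat_gt (2 * Real.pi /
    min (1 / (24 * (n : ℝ) ^ 2)) (κ / (96 * k * (k * J + 1 : ℕ))))
  have hmin : (0 : ℝ) < min (1 / (24 * (n : ℝ) ^ 2)) (κ / (96 * k * (k * J + 1 : ℕ))) := by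
    positivity
  have hm0 : (0 : ℝ) < m := lt_trans (by positivity) hm
  have hm1 : 1 ≤ m := by exact_mod_cast hm0
  have hm2 : 2 * Real.pi / m ≤ min (1 / (24 * (n : ℝ) ^ 2)) (κ / (96 * k * (k * J + 1 : ℕ))) := by
    rw [div_lt_iff₀ hmin] at hm
    rw [div_le_iff₀ hm0]
    linarith
  obtain ⟨W, hW, N₁, hN₁⟩ := norm_sum_tw_sub_one_le
    (η := 1 / (2 * (m : ℝ) ^ (k * J + 1))) (by positivity)
  obtain ⟨N₂, hN₂⟩ := hrestr W hW
  obtain ⟨N₃, hN₃⟩ := eventually_log_pow_le W 3 (s := 1) (ε := κ / (6 * k)) one_pos (by positivity)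
  obtain ⟨N, h1, h2, h3, h4⟩ : ∃ N : ℕ, N₁ ≤ N ∧ N₂ ≤ N ∧ N₃ ≤ N ∧ 12 * n ^ 2 ≤ N :=
    ⟨N₁ + N₂ + N₃ + 12 * n ^ 2, by omega, by omega, by omega, by omega⟩
  have hN0 : (0 : ℝ) < N := by
    have : 0 < 12 * n ^ 2 := by positivity
    exact_mod_cast this.trans_le h4
  set f : Fin k → ℕ → ℝ := fun i x => if c (W * x + 1) = i then tw W N x else 0 with hf
  have hf0 : ∀ i x, 0 ≤ f i x := by
    intro i x; simp only [hf]; split_ifs; exacts [tw_nonneg _ _ _, le_rfl]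
  have hftw : ∀ i x, f i x ≤ tw W N x := by
    intro i x; simp only [hf]; split_ifs; exacts [le_rfl, tw_nonneg _ _ _]
  have hfne : ∀ i x, f i x ≠ 0 → c (W * x + 1) = i ∧ tw W N x ≠ 0 := by
    intro i x h
    simp only [hf, ne_eq, ite_eq_right_iff, Classical.not_imp] at h
    exact h
  have hpos : ∀ i x, f i x ≠ 0 → 0 < x := by
    intro i x h
    rcases Nat.eq_zero_or_pos x with rfl | h0
    · exact absurd (tw_ne_zero (hfne i 0 h).2).1 (by simp)
    · exact h0
  have hfs : ∀ i x, x ∉ Ioc 0 N → f i x = 0 := by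
    intro i x hx
    by_contra h
    exact hx (mem_Ioc.2 ⟨hpos i x h, (tw_ne_zero (hfne i x h).2).2.1⟩)
  have hsum : ∀ x, ∑ i, f i x = tw W N x := by intro x; simp [hf]
  have hT := transference hk hn hm1 hmono h4 (δ := δ) hκ (hm2.trans (min_le_left _ _))
    (hm2.trans (min_le_right _ _)) rfl hf0 hfs
    (fun α => by simp only [hsum]; exact hN₁ N h1 α)
    (fun i => by rw [card_spec (hfs i)]; exact (hN₂ N h2 (f i) (hf0 i) (hftw i)).1)
    (fun i => by rw [sum_compl_spec (hfs i)]; exact (hN₂ N h2 (f i) (hf0 i) (hftw i)).2)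
  have hlog := hN₃ N h3
  rw [Real.rpow_one] at hlog
  obtain ⟨i, hi⟩ : ∃ i, (N : ℝ) * Real.log (W * N + 1 : ℕ) ^ 3 <
      ∑ x : ZMod (2 * N + 1), ∑ y : ZMod (2 * N + 1), f i x.val * f i y.val * f i (x + y).val := by
    by_contra! hcon
    have h5 := hT.trans (sum_le_sum fun i _ => hcon i)
    rw [sum_const, card_univ, Fintype.card_fin, nsmul_eq_mul] at h5
    have h6 : (k : ℝ) * (N * Real.log (W * N + 1 : ℕ) ^ 3) ≤ k * (N * (κ / (6 * k) * N)) := by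
      gcongr
    have h7 : (k : ℝ) * (N * (κ / (6 * k) * N)) = κ / 6 * N ^ 2 := by field_simp
    have h8 : 0 < κ * (N : ℝ) ^ 2 := by positivity
    linarith
  obtain ⟨x, y, hxy, hx, hy, hz⟩ := sum_offdiag_pos (hf0 i)
    (fun n => (hftw i n).trans (tw_le_log W N n)) (hfs i) hi
  have hx0 := hpos i x hx
  have hy0 := hpos i y hy
  obtain ⟨cx, tx⟩ := hfne i x hx
  obtain ⟨cy, ty⟩ := hfne i y hy
  obtain ⟨cz, tz⟩ := hfne i (x + y) hz
  have hinj : ∀ a b : ℕ, W * a + 1 = W * b + 1 → a = b := fun a b h =>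
    Nat.eq_of_mul_eq_mul_left hW (Nat.succ_injective h)
  refine ⟨W * x + 1, W * y + 1, W * (x + y) + 1, (tw_ne_zero tx).2.2, (tw_ne_zero ty).2.2,
    (tw_ne_zero tz).2.2, fun h => hxy (hinj _ _ h), fun h => ?_, fun h => ?_, cx.trans cy.symm,
    cy.trans cz.symm, by ring⟩
  · have := hinj _ _ h; omega
  · have := hinj _ _ h; omega
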